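/- Let R > 0, 1 < s < ∞, 0 < λ < n+2, and suppose u ∈ W^{1,s}(B_R; Λ^k ℝ^n ⊗ ℝ^N) solves du = f and δu = g in B_R with ν ∧ u = 0 on ∂B_R. If f ∈ 𝓛^{2,λ}(B_R; Λ^{k+1}) and g ∈ 𝓛^{2,λ}(B_R; Λ^{k−1}), then ∇u ∈ 𝓛^{2,λ}(B_R) and there is a constant c = c(n,N,k,λ) > 0 with ‖∇u‖_{𝓛^{2,λ}(B_R)} ≤ c ( ‖f‖_{𝓛^{2,λ}(B_R)} + ‖g‖_{𝓛^{2,λ}(B_R)} ). -/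

import Mathlib

open MeasureTheory Metric Filter
open scoped ENNReal NNReal

noncomputable section

/-- Euclidean space `ℝ^n`. -/
abbrev En (n : ℕ) : Type := EuclideanSpace ℝ (Fin n)

/-- Index set for the coefficients of a `k`-form on `ℝ^n`: increasing multi-indices,
identified with `k`-element subsets of `Fin n`. -/
abbrev FormIdx (n k : ℕ) : Type := {s : Finset (Fin n) // s.card = k}

/-- An `ℝ^N`-valued `k`-covector on `ℝ^n`, described by its coefficients. -/
abbrev Form (n N k : ℕ) : Type := FormIdx n k × Fin N → ℝ

variable {n N k : ℕ}

/-- Euclidean inner product of two (vector-valued) forms. -/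
def finner (v w : Form n N k) : ℝ := ∑ q, v q * w q

/-- Euclidean norm of a (vector-valued) form. -/
def fnorm (v : Form n N k) : ℝ := Real.sqrt (∑ q, v q ^ 2)

/-- Euclidean norm of a full array of partial derivatives (a gradient). -/
def gnorm (H : Fin n → Form n N k) : ℝ := Real.sqrt (∑ i, ∑ q, H i q ^ 2)

/-- The pointwise exterior derivative of a `k`-form, assembled from the array
`G i = ∂_i u` of its partial derivatives. -/
def extD (G : Fin n → Form n N k) : Form n N (k + 1) := fun q =>
  ∑ i : Fin n,
    if h : i ∈ q.1.1 then
      (-1 : ℝ) ^ (q.1.1.filter (fun j => j < i)).card *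
        G i (⟨q.1.1.erase i, by simp [Finset.card_erase_of_mem h, q.1.2]⟩, q.2)
    else 0

/-- The pointwise codifferential of a `(k+1)`-form, assembled from the array
`G i = ∂_i u` of its partial derivatives. -/
def codiff (G : Fin n → Form n N (k + 1)) : Form n N k := fun q =>
  -∑ i : Fin n,
      if h : i ∈ q.1.1 then 0
      else
        (-1 : ℝ) ^ (q.1.1.filter (fun j => j < i)).card *
          G i (⟨insert i q.1.1, by simp [Finset.card_insert_of_notMem h, q.1.2]⟩, q.2)

/-- The nonlinearity `z ↦ t |z|^{p-2} z`. -/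
def nl (p t : ℝ) (z : Form n N k) : Form n N k := fun q => t * fnorm z ^ (p - 2) * z q

/-- The auxiliary map `V(z) = |z|^{(p-2)/2} z`. -/
def Vform (p : ℝ) (z : Form n N k) : Form n N k := fun q => fnorm z ^ ((p - 2) / 2) * z q

/-- The `i`-th standard basis vector of `ℝ^n`. -/
def basisVec (i : Fin n) : En n := EuclideanSpace.single i 1

/-- Scalar test functions: smooth and compactly supported inside `Ω`. -/
def IsTestFun (Ω : Set (En n)) (φ : En n → ℝ) : Prop :=
  ContDiff ℝ (⊤ : ℕ∞) φ ∧ HasCompactSupport φ ∧ tsupport φ ⊆ Ω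

/-- Test `k`-forms: componentwise smooth and compactly supported inside `Ω`. -/
def IsTestForm (Ω : Set (En n)) (φ : En n → Form n N k) : Prop :=
  (∀ q, ContDiff ℝ (⊤ : ℕ∞) fun x => φ x q) ∧ HasCompactSupport φ ∧ tsupport φ ⊆ Ω

/-- The (classical) array of partial derivatives of a form-valued map. -/
def smoothGrad (φ : En n → Form n N k) (x : En n) : Fin n → Form n N k := fun i q =>
  fderiv ℝ (fun y => φ y q) x (basisVec i)

/-- `g` is the weak (distributional) `i`-th partial derivative of `u` on `Ω`. -/
def HasWeakPartial (Ω : Set (En n)) (u g : En n → ℝ) (i : Fin n) : Prop :=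
  ∀ φ : En n → ℝ, IsTestFun Ω φ →
    ∫ x in Ω, u x * fderiv ℝ φ x (basisVec i) = -∫ x in Ω, g x * φ x

/-- `G` is the weak gradient (array of weak partial derivatives) of the form `u` on `Ω`. -/
def HasWeakGrad (Ω : Set (En n)) (u : En n → Form n N k)
    (G : En n → Fin n → Form n N k) : Prop :=
  ∀ i q, HasWeakPartial Ω (fun x => u x q) (fun x => G x i q) i

/-- Membership in `W^{1,p}(Ω)` for a form `u` with weak gradient `G`. -/
def MemW1p (Ω : Set (En n)) (p : ℝ) (u : En n → Form n N k)
    (G : En n → Fin n → Form n N k) : Prop :=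
  HasWeakGrad Ω u G ∧
    (∀ q, AEStronglyMeasurable (fun x => u x q) (volume.restrict Ω)) ∧
    (∀ i q, AEStronglyMeasurable (fun x => G x i q) (volume.restrict Ω)) ∧
    IntegrableOn (fun x => fnorm (u x) ^ p) Ω volume ∧
    IntegrableOn (fun x => gnorm (G x) ^ p) Ω volume

/-- Membership in `W^{1,p}_loc(Ω)` for a form `u` with weak gradient `G`. -/
def MemW1pLoc (Ω : Set (En n)) (p : ℝ) (u : En n → Form n N k)
    (G : En n → Fin n → Form n N k) : Prop :=
  HasWeakGrad Ω u G ∧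
    (∀ q, AEStronglyMeasurable (fun x => u x q) (volume.restrict Ω)) ∧
    (∀ i q, AEStronglyMeasurable (fun x => G x i q) (volume.restrict Ω)) ∧
    ∀ K, K ⊆ Ω → IsCompact K →
      IntegrableOn (fun x => fnorm (u x) ^ p) K volume ∧
      IntegrableOn (fun x => gnorm (G x) ^ p) K volume

/-- `δ f = 0` on `Ω` in the sense of distributions: `∫ ⟨f, dψ⟩ = 0` for every smooth
compactly supported form `ψ` of degree one less. (Vacuous for `0`-forms.) -/
def WeaklyCoclosed (Ω : Set (En n)) (f : En n → Form n N k) : Prop :=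
  ∀ (j : ℕ) (h : j + 1 = k) (ψ : En n → Form n N j), IsTestForm Ω ψ →
    ∫ x in Ω, finner (f x) (cast (congrArg (Form n N) h) (extD (smoothGrad ψ x))) = 0

/-- Weak formulation of the vanishing of the tangential part `ν ∧ u = 0` on `∂B`:
the integration-by-parts formula `∫_B ⟨du, ψ⟩ = ∫_B ⟨u, δψ⟩` holds without boundary
contribution for every smooth `(k+1)`-form `ψ`. -/
def TangentialZero (B : Set (En n)) (u : En n → Form n N k)
    (G : En n → Fin n → Form n N k) : Prop :=
  ∀ ψ : En n → Form n N (k + 1), (∀ q, ContDiff ℝ (⊤ : ℕ∞) fun x => ψ x q) →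
    ∫ x in B, finner (extD (G x)) (ψ x) = ∫ x in B, finner (u x) (codiff (smoothGrad ψ x))

/-- The space `W^{1,p}_{δ,T}(B)`: `W^{1,p}` forms which are weakly coclosed in `B` and
have vanishing tangential part on `∂B`. -/
def MemWdeltaT (B : Set (En n)) (p : ℝ) (u : En n → Form n N k)
    (G : En n → Fin n → Form n N k) : Prop :=
  MemW1p B p u G ∧ WeaklyCoclosed B u ∧ TangentialZero B u G

/-- `u` (with weak gradient `G`) is a local weak solution of
`δ(a(x) |du|^{p-2} du) = f` on `Ω`. -/
def IsLocalWeakSolution (Ω : Set (En n)) (p : ℝ) (a : En n → ℝ)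
    (u : En n → Form n N k) (G : En n → Fin n → Form n N k)
    (f : En n → Form n N k) : Prop :=
  ∀ φ : En n → Form n N k, IsTestForm Ω φ →
    ∫ x in Ω, finner (nl p (a x) (extD (G x))) (extD (smoothGrad φ x)) =
      ∫ x in Ω, finner (f x) (φ x)

/-- The Lorentz (quasi-)norm `‖g‖_{L^{(p,θ)}(μ)}`. -/
def lorentzNorm {α : Type*} [MeasurableSpace α] (μ : Measure α) (p : ℝ) (θ : ℝ≥0∞)
    (g : α → ℝ) : ℝ≥0∞ :=
  if θ = ⊤ then
    (⨆ t : ℝ, if 0 < t then ENNReal.ofReal (t ^ p) * μ {x | t < |g x|} else 0) ^ (1 / p)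
  else
    (∫⁻ t in Set.Ioi (0 : ℝ),
        (ENNReal.ofReal (t ^ p) * μ {x | t < |g x|}) ^ (θ.toReal / p) / ENNReal.ofReal t) ^
      (1 / θ.toReal)

/-- Membership in the Lorentz space `L^{(p,θ)}(s)`. -/
def MemLorentzOn {α : Type*} [MeasurableSpace α] (μ : Measure α) (p : ℝ) (θ : ℝ≥0∞)
    (g : α → ℝ) (s : Set α) : Prop :=
  AEStronglyMeasurable g (μ.restrict s) ∧ lorentzNorm (μ.restrict s) p θ g ≠ ⊤

/-- Local membership in the Lorentz space `L^{(p,θ)}` on the open set `Ω`. -/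
def MemLorentzLoc (p : ℝ) (θ : ℝ≥0∞) (g : En n → ℝ) (Ω : Set (En n)) : Prop :=
  ∀ K, K ⊆ Ω → IsCompact K → MemLorentzOn volume p θ g K

/-- The `L^s` norm of a scalar function on a set, valued in `ℝ≥0∞`. -/
def lpNormOn (s : ℝ) (g : En n → ℝ) (A : Set (En n)) : ℝ≥0∞ :=
  (∫⁻ x in A, ENNReal.ofReal (|g x| ^ s)) ^ (1 / s)

/-- A Dini modulus of continuity. -/
def IsDiniModulus (ω : ℝ → ℝ) : Prop :=
  (∀ t, 0 ≤ ω t) ∧ MonotoneOn ω (Set.Ici 0) ∧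
    IntegrableOn (fun t => ω t / t) (Set.Ioc 0 1) volume ∧
    Tendsto ω (nhdsWithin 0 (Set.Ioi 0)) (nhds 0)

/-- `ω` is a modulus of continuity for `a` on `Ω`. -/
def IsModulusFor (ω : ℝ → ℝ) (a : En n → ℝ) (Ω : Set (En n)) : Prop :=
  ∀ x ∈ Ω, ∀ y ∈ Ω, |a x - a y| ≤ ω ‖x - y‖

/-- Dini continuity on `Ω`. -/
def DiniContinuousOn (a : En n → ℝ) (Ω : Set (En n)) : Prop :=
  ∃ ω, IsDiniModulus ω ∧ IsModulusFor ω a Ω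

/-- `a` is `α`-Hölder with constant `C` on `s`. -/
def HolderOn (α C : ℝ) (a : En n → ℝ) (s : Set (En n)) : Prop :=
  ∀ x ∈ s, ∀ y ∈ s, |a x - a y| ≤ C * ‖x - y‖ ^ α

/-- `g` agrees a.e. on `Ω` with a function continuous on `Ω`. -/
def HasContinuousRepOn {V : Type*} [TopologicalSpace V] (Ω : Set (En n)) (g : En n → V) :
    Prop :=
  ∃ v : En n → V, ContinuousOn v Ω ∧ ∀ᵐ x ∂volume.restrict Ω, g x = v x

/-- `g` has locally vanishing mean oscillation in `Ω`. -/
def LocallyVMOOn {V : Type*} [NormedAddCommGroup V] [NormedSpace ℝ V] (Ω : Set (En n))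
    (g : En n → V) : Prop :=
  ∀ K, K ⊆ Ω → IsCompact K → ∀ ε > 0, ∃ r₀ > 0, ∀ x ∈ K, ∀ r, 0 < r → r ≤ r₀ →
    (⨍ y in ball x r, ‖g y - ⨍ z in ball x r, g z‖) ≤ ε

/-- `g` has locally bounded mean oscillation in `Ω`. -/
def LocallyBMOOn {V : Type*} [NormedAddCommGroup V] [NormedSpace ℝ V] (Ω : Set (En n))
    (g : En n → V) : Prop :=
  ∀ K, K ⊆ Ω → IsCompact K → ∃ C : ℝ, ∃ r₀ > 0, ∀ x ∈ K, ∀ r, 0 < r → r ≤ r₀ →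
    (⨍ y in ball x r, ‖g y - ⨍ z in ball x r, g z‖) ≤ C

/-- The `p`-th power of the Campanato seminorm `[u]^p_{𝓛^{p,λ}(s)}`, valued in `ℝ≥0∞`. -/
def campanatoSemi {V : Type*} [NormedAddCommGroup V] [NormedSpace ℝ V] (p lam : ℝ)
    (s : Set (En n)) (u : En n → V) : ℝ≥0∞ :=
  ⨆ (x₀ : En n) (_ : x₀ ∈ closure s) (ρ : ℝ) (_ : 0 < ρ),
    ENNReal.ofReal
      (ρ ^ (-lam) * ∫ y in ball x₀ ρ ∩ s, ‖u y - ⨍ z in ball x₀ ρ ∩ s, u z‖ ^ p)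

/-- The Campanato norm `‖u‖_{𝓛^{p,λ}(s)} = ‖u‖_{L^p(s)} + [u]_{𝓛^{p,λ}(s)}`. -/
def campanatoNorm {V : Type*} [NormedAddCommGroup V] [NormedSpace ℝ V] (p lam : ℝ)
    (s : Set (En n)) (u : En n → V) : ℝ≥0∞ :=
  (∫⁻ y in s, ENNReal.ofReal (‖u y‖ ^ p)) ^ (1 / p) + campanatoSemi p lam s u ^ (1 / p)

/-- Membership in the Campanato space `𝓛^{p,λ}(s)`. -/
def MemCampanatoOn {V : Type*} [NormedAddCommGroup V] [NormedSpace ℝ V] (p lam : ℝ)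
    (s : Set (En n)) (u : En n → V) : Prop :=
  AEStronglyMeasurable u (volume.restrict s) ∧
    IntegrableOn (fun y => ‖u y‖ ^ p) s volume ∧ campanatoSemi p lam s u ≠ ⊤

/-- Local membership in the Campanato space `𝓛^{p,λ}` on `Ω`. -/
def MemCampanatoLoc {V : Type*} [NormedAddCommGroup V] [NormedSpace ℝ V] (p lam : ℝ)
    (Ω : Set (En n)) (u : En n → V) : Prop :=
  ∀ K, K ⊆ Ω → IsCompact K → MemCampanatoOn p lam K u

/-- `v` is of class `C^{1,θ}` locally on `Ω`. -/
def C1HolderLocOn {V : Type*} [NormedAddCommGroup V] [NormedSpace ℝ V] (θ : ℝ)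
    (Ω : Set (En n)) (v : En n → V) : Prop :=
  ∃ Dv : En n → En n →L[ℝ] V, (∀ x ∈ Ω, HasFDerivAt v (Dv x) x) ∧
    ∀ K, K ⊆ Ω → IsCompact K →
      ∃ C : ℝ, 0 ≤ C ∧ ∀ x ∈ K, ∀ y ∈ K, ‖Dv x - Dv y‖ ≤ C * ‖x - y‖ ^ θ

/-- Local membership in `L^q` for a form-valued map. -/
def MemLqLoc (q : ℝ) (f : En n → Form n N k) (Ω : Set (En n)) : Prop :=
  (∀ r, AEStronglyMeasurable (fun x => f x r) (volume.restrict Ω)) ∧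
    ∀ K, K ⊆ Ω → IsCompact K → IntegrableOn (fun x => fnorm (f x) ^ q) K volume

/-- `x` is a Lebesgue point of the form-valued map `g`. -/
def IsLebesguePoint (g : En n → Form n N k) (x : En n) : Prop :=
  Tendsto (fun r => ⨍ y in ball x r, fnorm (g y - g x)) (nhdsWithin 0 (Set.Ioi 0)) (nhds 0)

/-! ### Part 1: elementary calculus -/

/-- partial derivative -/
def pd (i : Fin n) (φ : En n → ℝ) (x : En n) : ℝ := fderiv ℝ φ x (basisVec i)

/-- smooth functions -/
abbrev SM (φ : En n → ℝ) : Prop := ContDiff ℝ (⊤ : ℕ∞) φ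

/-- Laplacian -/
def lap (φ : En n → ℝ) (x : En n) : ℝ := ∑ i, pd i (pd i φ) x

/-- measure on unit ball -/
abbrev vB (n : ℕ) : Measure (En n) := volume.restrict (ball (0 : En n) 1)

lemma SM.diff {φ : En n → ℝ} (h : SM φ) : Differentiable ℝ φ := h.differentiable (by simp)

lemma SM.pd {φ : En n → ℝ} (h : SM φ) (i : Fin n) : SM (pd i φ) := by
  have h1 : ContDiff ℝ (⊤ : ℕ∞) (fderiv ℝ φ) := h.fderiv_right (m := (⊤ : ℕ∞)) (by simp)
  exact h1.clm_apply contDiff_const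

lemma SM.lap {φ : En n → ℝ} (h : SM φ) : SM (lap φ) := by
  unfold _root_.lap
  exact ContDiff.sum fun i _ => (h.pd i).pd i

lemma SM.coord (i : Fin n) : SM (fun x : En n => x i) := by
  exact (EuclideanSpace.proj i : En n →L[ℝ] ℝ).contDiff

lemma SM.normsq : SM (fun x : En n => ‖x‖ ^ 2) := contDiff_norm_sq ℝ

lemma pd_add (i : Fin n) {f g : En n → ℝ} {x : En n} (hf : DifferentiableAt ℝ f x)
    (hg : DifferentiableAt ℝ g x) : pd i (fun y => f y + g y) x = pd i f x + pd i g x := by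
  unfold pd; rw [fderiv_fun_add hf hg]; rfl

lemma pd_sub (i : Fin n) {f g : En n → ℝ} {x : En n} (hf : DifferentiableAt ℝ f x)
    (hg : DifferentiableAt ℝ g x) : pd i (fun y => f y - g y) x = pd i f x - pd i g x := by
  unfold pd; rw [fderiv_fun_sub hf hg]; rfl

lemma pd_neg (i : Fin n) {f : En n → ℝ} {x : En n} : 
    pd i (fun y => - f y) x = - pd i f x := by
  unfold pd; rw [fderiv_fun_neg]; rfl

lemma pd_const (i : Fin n) (c : ℝ) (x : En n) : pd i (fun _ => c) x = 0 := by
  unfold pd; simp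

lemma pd_mul (i : Fin n) {f g : En n → ℝ} {x : En n} (hf : DifferentiableAt ℝ f x)
    (hg : DifferentiableAt ℝ g x) :
    pd i (fun y => f y * g y) x = f x * pd i g x + pd i f x * g x := by
  unfold pd; rw [fderiv_fun_mul hf hg]
  simp; ring

lemma pd_const_mul (i : Fin n) {f : En n → ℝ} {x : En n} (c : ℝ)
    (hf : DifferentiableAt ℝ f x) : pd i (fun y => c * f y) x = c * pd i f x := by
  rw [pd_mul i (by fun_prop) hf, pd_const]; ring

lemma pd_sum {ι : Type*} (s : Finset ι) (i : Fin n) {f : ι → En n → ℝ} {x : En n}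
    (hf : ∀ j ∈ s, DifferentiableAt ℝ (f j) x) :
    pd i (fun y => ∑ j ∈ s, f j y) x = ∑ j ∈ s, pd i (f j) x := by
  unfold pd; rw [fderiv_fun_sum hf]; simp

lemma pd_coord (i j : Fin n) (x : En n) : pd i (fun y : En n => y j) x = if i = j then 1 else 0 := by
  unfold pd
  have : (fun y : En n => y j) = ⇑(EuclideanSpace.proj j : En n →L[ℝ] ℝ) := rfl
  rw [this, ContinuousLinearMap.fderiv]
  simp [basisVec, eq_comm]

lemma pd_normsq (i : Fin n) (x : En n) : pd i (fun y : En n => ‖y‖ ^ 2) x = 2 * x i := by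
  unfold pd
  rw [fderiv_norm_sq_apply]
  simp [basisVec, EuclideanSpace.inner_single_right]

lemma pd_comp (i : Fin n) {f : ℝ → ℝ} {g : En n → ℝ} {x : En n} {f' : ℝ} (hf : HasDerivAt f f' (g x))
    (hg : DifferentiableAt ℝ g x) : pd i (fun y => f (g y)) x = f' * pd i g x := by
  unfold pd
  have := hf.comp_hasFDerivAt x hg.hasFDerivAt
  have h2 : fderiv ℝ (fun y => f (g y)) x = f' • fderiv ℝ g x := this.fderiv
  rw [h2]; simp

lemma pd_comm {φ : En n → ℝ} {x : En n} (h : ContDiffAt ℝ 2 φ x) (i j : Fin n) :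
    pd i (pd j φ) x = pd j (pd i φ) x := by
  have hd : DifferentiableAt ℝ (fderiv ℝ φ) x :=
    (h.fderiv_right (m := 1) (by norm_num)).differentiableAt (by norm_num)
  have key : ∀ a b : Fin n, pd a (pd b φ) x = fderiv ℝ (fderiv ℝ φ) x (basisVec a) (basisVec b) := by
    intro a b
    unfold pd
    rw [fderiv_clm_apply hd (by fun_prop)]
    simp
  rw [key, key]
  exact (h.isSymmSndFDerivAt (by simp)).eq _ _

lemma SM.pd_comm {φ : En n → ℝ} (h : SM φ) (i j : Fin n) (x : En n) :
    _root_.pd i (_root_.pd j φ) x = _root_.pd j (_root_.pd i φ) x :=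
  _root_.pd_comm (h.contDiffAt.of_le (by norm_cast)) i j

lemma fderiv_eq_sum_pd (φ : En n → ℝ) (x v : En n) : fderiv ℝ φ x v = ∑ i, v i * pd i φ x := by
  have : v = ∑ i, v i • (basisVec i : En n) := by
    ext j
    simp [basisVec, Finset.sum_apply, Pi.single_apply]
  conv_lhs => rw [this]
  simp [pd]

lemma normsq_eq (x : En n) : ‖x‖ ^ 2 = ∑ i, x i ^ 2 := by
  rw [EuclideanSpace.norm_sq_eq]; simp

lemma abs_coord_le (x : En n) (i : Fin n) : |x i| ≤ ‖x‖ := by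
  simpa using EuclideanSpace.norm_eq x ▸ (by
    apply Real.abs_le_sqrt
    simp only [Real.norm_eq_abs, sq_abs]
    exact Finset.single_le_sum (f := fun i => x i ^ 2) (fun j _ => sq_nonneg _) (Finset.mem_univ i))

/-- smooth functions vanishing on the unit sphere -/
structure GZ (G : En n → ℝ) : Prop where
  sm : SM G
  zero : ∀ x : En n, ‖x‖ = 1 → G x = 0

lemma basisVec_norm (i : Fin n) : ‖(basisVec i : En n)‖ = 1 := by simp [basisVec]

lemma GZ.bound (i : Fin n) {G : En n → ℝ} (h : GZ G) :
    ∃ C, 0 ≤ C ∧ ∀ x : En n, ‖x‖ ≤ 1 → |G x| ≤ C * (1 - ‖x‖ ^ 2) := by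
  obtain ⟨C, hC⟩ := (isCompact_closedBall (0 : En n) 1).exists_bound_of_continuousOn
    (h.sm.continuous_fderiv (by simp)).continuousOn
  refine ⟨C, (norm_nonneg _).trans (hC 0 (by simp)), fun x hx => ?_⟩
  have hC0 : 0 ≤ C := (norm_nonneg _).trans (hC 0 (by simp))
  obtain ⟨y, hy, hxy⟩ : ∃ y : En n, ‖y‖ = 1 ∧ ‖x - y‖ = 1 - ‖x‖ := by
    by_cases h0 : x = 0
    · exact ⟨basisVec i, basisVec_norm i, by simp [h0, basisVec_norm]⟩
    · have hn : ‖x‖ ≠ 0 := by simpa using h0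
      refine ⟨(‖x‖)⁻¹ • x, by rw [norm_smul]; simp [hn], ?_⟩
      have : x - (‖x‖)⁻¹ • x = (1 - ‖x‖⁻¹) • x := by rw [sub_smul, one_smul]
      rw [this, norm_smul, Real.norm_eq_abs, abs_of_nonpos]
      · field_simp; ring
      · have : 1 ≤ ‖x‖⁻¹ := (one_le_inv₀ (by positivity)).2 hx
        linarith
  have := (convex_closedBall (0 : En n) 1).norm_image_sub_le_of_norm_fderiv_le
    (f := G) (C := C) (x := y) (y := x) (fun z _ => h.sm.diff z) (fun z hz => hC z hz)
    (by simp [hy]) (by simpa using hx)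
  rw [h.zero y hy, sub_zero, hxy] at this
  refine this.trans ?_
  have : 0 ≤ ‖x‖ := norm_nonneg _
  nlinarith [mul_nonneg hC0 (mul_nonneg this (sub_nonneg.2 hx))]

lemma trans_deriv_bound : ∃ C, 0 ≤ C ∧ (∀ t, 0 ≤ t + 1 → |(t + 1) * deriv Real.smoothTransition t| ≤ C)
    ∧ ∀ t, 1 < t → deriv Real.smoothTransition t = 0 := by
  have hc : Continuous (fun t : ℝ => (t + 1) * deriv Real.smoothTransition t) := by
    have := (Real.smoothTransition.contDiff (n := 1)).continuous_deriv (by simp)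
    fun_prop
  obtain ⟨C, hC⟩ := (isCompact_Icc (a := (-1 : ℝ)) (b := 1)).exists_bound_of_continuousOn hc.continuousOn
  have h0 : 0 ≤ C := (norm_nonneg _).trans (hC 0 (by simp))
  have h1 : ∀ t, 1 < t → deriv Real.smoothTransition t = 0 := by
    intro t ht
    have : Real.smoothTransition =ᶠ[nhds t] fun _ => 1 := by
      filter_upwards [lt_mem_nhds ht] with s hs using Real.smoothTransition.one_of_one_le hs.le
    rw [this.deriv_eq]; simp
  refine ⟨C, h0, fun t ht => ?_, h1⟩
  by_cases h : t ≤ 1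
  · exact hC t ⟨by linarith, h⟩
  · rw [h1 t (by linarith)]; simpa using h0

lemma continuous_integrableOn_ball {f : En n → ℝ} (hf : Continuous f) (x : En n) (r : ℝ) :
    IntegrableOn f (ball x r) volume :=
  (hf.continuousOn.integrableOn_compact (isCompact_closedBall x r)).mono_set ball_subset_closedBall

lemma cont_int {f : En n → ℝ} (hf : Continuous f) : Integrable f (vB n) :=
  continuous_integrableOn_ball hf 0 1

lemma int_mul_cont {u f : En n → ℝ} (hu : Integrable u (vB n)) (hf : Continuous f) :
    Integrable (fun x => u x * f x) (vB n) := by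
  obtain ⟨C, hC⟩ := (isCompact_closedBall (0 : En n) 1).exists_bound_of_continuousOn hf.continuousOn
  refine hu.mul_bdd (c := C) hf.aestronglyMeasurable ?_
  exact (ae_restrict_mem measurableSet_ball).mono fun x hx => hC x (ball_subset_closedBall hx)

/-- cutoff -/
def cutj (j : ℕ) (x : En n) : ℝ := Real.smoothTransition (j * (1 - ‖x‖ ^ 2) - 1)

lemma cutj_sm (j : ℕ) : SM (cutj j : En n → ℝ) := by
  unfold cutj
  exact Real.smoothTransition.contDiff.comp
    ((contDiff_const.mul (contDiff_const.sub SM.normsq)).sub contDiff_const)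

lemma cutj_test (j : ℕ) (hj : 0 < j) {θ : En n → ℝ} (hθ : SM θ) :
    IsTestFun (ball 0 1) (fun x => θ x * cutj j x) := by
  have hs : tsupport (fun x => θ x * cutj j x) ⊆ {x : En n | (j:ℝ)⁻¹ ≤ 1 - ‖x‖ ^ 2} := by
    apply closure_minimal
    · intro x hx
      simp only [Function.mem_support] at hx
      by_contra hcon
      simp only [Set.mem_ofPred_eq, not_le] at hcon
      apply hx
      have : cutj j x = 0 := by
        apply Real.smoothTransition.zero_of_nonpos
        have hj' : (0 : ℝ) < j := by exact_mod_cast hj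
        have := mul_lt_mul_of_pos_left hcon hj'
        rw [mul_inv_cancel₀ hj'.ne'] at this
        linarith
      rw [this, mul_zero]
    · exact isClosed_le continuous_const (by fun_prop)
  have hj' : (0 : ℝ) < j := by exact_mod_cast hj
  have hsub : tsupport (fun x => θ x * cutj j x) ⊆ ball (0 : En n) 1 := by
    refine hs.trans fun x hx => ?_
    simp only [Set.mem_ofPred_eq] at hx
    have : 0 < (j:ℝ)⁻¹ := by positivity
    have h2 : ‖x‖ ^ 2 < 1 := by linarith
    rw [mem_ball_zero_iff]
    nlinarith [norm_nonneg x]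
  refine ⟨hθ.mul (cutj_sm j), ?_, hsub⟩
  exact HasCompactSupport.of_support_subset_isCompact (isCompact_closedBall (0 : En n) 1)
    ((subset_tsupport _).trans (hsub.trans ball_subset_closedBall))

lemma pd_cutj (i : Fin n) (j : ℕ) (x : En n) : pd i (cutj j) x =
    deriv Real.smoothTransition (j * (1 - ‖x‖ ^ 2) - 1) * (-(2 * j * x i)) := by
  unfold cutj
  have h1 : DifferentiableAt ℝ (fun y : En n => ‖y‖ ^ 2) x := SM.normsq.diff x
  rw [pd_comp i (f := Real.smoothTransition) (f' := deriv Real.smoothTransition (j * (1 - ‖x‖ ^ 2) - 1))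
    (g := fun y : En n => (j : ℝ) * (1 - ‖y‖ ^ 2) - 1)
    ((Real.smoothTransition.contDiff (n := 1)).differentiable (by simp) _).hasDerivAt (by fun_prop)]
  rw [pd_sub i (by fun_prop) (by fun_prop), pd_const, pd_const_mul i _ (by fun_prop),
    pd_sub i (by fun_prop) (by fun_prop), pd_const, pd_normsq]
  ring

/-- weak partial derivatives can be tested with smooth functions vanishing on the sphere -/
theorem LB {u g : En n → ℝ} {i : Fin n} (hu : Integrable u (vB n)) (hg : Integrable g (vB n))
    (h : HasWeakPartial (ball 0 1) u g i) {θ : En n → ℝ} (hθ : GZ θ) :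
    ∫ x, u x * pd i θ x ∂(vB n) = -∫ x, g x * θ x ∂(vB n) := by
  obtain ⟨C, hC0, hC⟩ := hθ.bound i
  obtain ⟨D, hD0, hD, hD1⟩ := trans_deriv_bound
  have key : ∀ j : ℕ, 0 < j → ∫ x, u x * (θ x * pd i (cutj j) x + pd i θ x * cutj j x) ∂(vB n) =
      -∫ x, g x * (θ x * cutj j x) ∂(vB n) := by
    intro j hj
    have := h _ (cutj_test j hj hθ.sm)
    rw [← this]
    congr 1; ext x
    have := pd_mul i (hθ.sm.diff x) ((cutj_sm j).diff x)
    unfold pd at this ⊢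
    rw [this]
  have hcut : ∀ x ∈ ball (0 : En n) 1, ∀ᶠ j : ℕ in atTop, 1 < j * (1 - ‖x‖ ^ 2) - 1 := by
    intro x hx
    have hx' : 0 < 1 - ‖x‖ ^ 2 := by
      rw [mem_ball_zero_iff] at hx; nlinarith [norm_nonneg x]
    have : Tendsto (fun j : ℕ => (j:ℝ) * (1 - ‖x‖ ^ 2) - 1) atTop atTop := 
      tendsto_atTop_add_const_right _ _ (tendsto_natCast_atTop_atTop.atTop_mul_const hx')
    exact this.eventually_gt_atTop 1
  have hcb : ∀ j x, |cutj j (x : En n)| ≤ 1 := fun j x => by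
    unfold cutj; rw [abs_of_nonneg (Real.smoothTransition.nonneg _)]; exact Real.smoothTransition.le_one _
  obtain ⟨C1, hC1⟩ := (isCompact_closedBall (0 : En n) 1).exists_bound_of_continuousOn
    (hθ.sm.pd i).continuous.continuousOn
  obtain ⟨C2, hC2⟩ := (isCompact_closedBall (0 : En n) 1).exists_bound_of_continuousOn
    hθ.sm.continuous.continuousOn
  have t1 : Tendsto (fun j : ℕ => ∫ x, u x * (θ x * pd i (cutj j) x + pd i θ x * cutj j x) ∂(vB n))
      atTop (nhds (∫ x, u x * pd i θ x ∂(vB n))) := by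
    apply tendsto_integral_of_dominated_convergence (fun x => |u x| * (2 * C * D + C1))
    · intro j
      refine hu.aestronglyMeasurable.mul (Continuous.aestronglyMeasurable ?_)
      have := hθ.sm.continuous; have := ((cutj_sm j).pd i).continuous
      have := (hθ.sm.pd i).continuous; have := (cutj_sm (n := n) j).continuous
      fun_prop
    · exact hu.abs.mul_const _
    · intro j
      filter_upwards [ae_restrict_mem measurableSet_ball] with x hx
      rw [norm_mul, Real.norm_eq_abs]
      refine mul_le_mul_of_nonneg_left ?_ (abs_nonneg _)
      have hx1 := mem_ball_zero_iff.1 hx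
      have hx' : 0 < 1 - ‖x‖ ^ 2 := by nlinarith [norm_nonneg x]
      refine (norm_add_le _ _).trans (add_le_add ?_ ?_)
      · rw [pd_cutj, norm_mul, Real.norm_eq_abs, Real.norm_eq_abs, abs_mul, abs_neg, abs_mul, abs_mul]
        set t := (j:ℝ) * (1 - ‖x‖ ^ 2) - 1 with ht
        have h3 := hD t (by rw [ht]; ring_nf; have : 0 ≤ (j:ℝ) * (1 - ‖x‖ ^ 2) := by positivity
                            linarith)
        have h4 : t + 1 = j * (1 - ‖x‖ ^ 2) := by rw [ht]; ring
        rw [h4, abs_mul, abs_of_nonneg (by positivity)] at h3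
        have h5 := abs_coord_le x i
        have h6 := hC x hx1.le
        simp only [abs_two, Nat.abs_cast]
        calc |θ x| * (|deriv Real.smoothTransition t| * (2 * j * |x i|))
            ≤ (C * (1 - ‖x‖ ^ 2)) * (|deriv Real.smoothTransition t| * (2 * j * 1)) := by
              gcongr; linarith
          _ = 2 * C * ((j * (1 - ‖x‖ ^ 2)) * |deriv Real.smoothTransition t|) := by ring
          _ ≤ _ := by gcongr
      · rw [norm_mul, Real.norm_eq_abs, Real.norm_eq_abs]
        have := hC1 x (ball_subset_closedBall hx)
        rw [Real.norm_eq_abs] at this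
        calc _ ≤ C1 * 1 := mul_le_mul this (hcb j x) (abs_nonneg _) ((abs_nonneg _).trans this)
          _ = _ := mul_one _
    · filter_upwards [ae_restrict_mem measurableSet_ball] with x hx
      apply tendsto_const_nhds.congr'
      filter_upwards [hcut x hx] with j hj
      rw [pd_cutj, hD1 _ hj]
      have : cutj j x = 1 := Real.smoothTransition.one_of_one_le hj.le
      rw [this]; ring
  have t2 : Tendsto (fun j : ℕ => ∫ x, g x * (θ x * cutj j x) ∂(vB n))
      atTop (nhds (∫ x, g x * θ x ∂(vB n))) := by
    apply tendsto_integral_of_dominated_convergence (fun x => |g x| * C2)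
    · intro j
      refine hg.aestronglyMeasurable.mul (Continuous.aestronglyMeasurable ?_)
      exact hθ.sm.continuous.mul (cutj_sm j).continuous
    · exact hg.abs.mul_const _
    · intro j
      filter_upwards [ae_restrict_mem measurableSet_ball] with x hx
      rw [norm_mul, Real.norm_eq_abs]
      refine mul_le_mul_of_nonneg_left ?_ (abs_nonneg _)
      rw [norm_mul, Real.norm_eq_abs, Real.norm_eq_abs]
      have := hC2 x (ball_subset_closedBall hx)
      rw [Real.norm_eq_abs] at this
      calc _ ≤ C2 * 1 := mul_le_mul this (hcb j x) (abs_nonneg _) ((abs_nonneg _).trans this)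
        _ = _ := mul_one _
    · filter_upwards [ae_restrict_mem measurableSet_ball] with x hx
      apply tendsto_const_nhds.congr'
      filter_upwards [hcut x hx] with j hj
      have : cutj j x = 1 := Real.smoothTransition.one_of_one_le hj.le
      rw [this]; ring
  refine tendsto_nhds_unique (t1.congr' ?_) t2.neg
  filter_upwards [eventually_gt_atTop 0] with j hj using key j hj

/-- divergence theorem for fields vanishing on the sphere -/
theorem DIV0 {X : En n → ℝ} (hX : GZ X) (i : Fin n) : ∫ x, pd i X x ∂(vB n) = 0 := by
  have h : HasWeakPartial (ball (0 : En n) 1) (fun _ => 1) (fun _ => 0) i := by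
    intro φ hφ
    simp only [one_mul, zero_mul, integral_zero, neg_zero]
    rw [setIntegral_eq_integral_of_forall_compl_eq_zero]
    · have hc : HasCompactSupport (fun x => pd i φ x) := (hφ.2.1.fderiv (𝕜 := ℝ)).comp_left
        (g := fun L : En n →L[ℝ] ℝ => L (basisVec i)) (by simp)
      have := integral_mul_fderiv_eq_neg_fderiv_mul_of_integrable (μ := (volume : Measure (En n)))
        (f := fun _ => 1) (g := φ) (v := basisVec i) (by simp)
        (by simp only [one_mul]; exact ((SM.pd hφ.1 i).continuous.integrable_of_hasCompactSupport hc))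
        (by simpa using (hφ.1.continuous.integrable_of_hasCompactSupport hφ.2.1)) (by fun_prop)
        (fun x _ => SM.diff hφ.1 x)
      simpa using this
    · intro x hx
      have : x ∉ tsupport (fderiv ℝ φ) := fun h => hx (hφ.2.2 (tsupport_fderiv_subset ℝ h))
      rw [image_eq_zero_of_notMem_tsupport this]; rfl
  have := LB (cont_int continuous_const) (cont_int continuous_const) h hX
  simpa using this

/-! ### Part 2: Green identities, Poincaré, uniqueness -/

lemma GZ.mul {G H : En n → ℝ} (hG : GZ G) (hH : SM H) : GZ (fun x => G x * H x) :=
  ⟨hG.sm.mul hH, fun x hx => by rw [hG.zero x hx, zero_mul]⟩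

lemma GZ.add {G H : En n → ℝ} (hG : GZ G) (hH : GZ H) : GZ (fun x => G x + H x) :=
  ⟨hG.sm.add hH.sm, fun x hx => by rw [hG.zero x hx, hH.zero x hx, zero_add]⟩

lemma GZ.sum {ι : Type*} (s : Finset ι) {G : ι → En n → ℝ} (hG : ∀ j ∈ s, GZ (G j)) :
    GZ (fun x => ∑ j ∈ s, G j x) :=
  ⟨ContDiff.sum fun j hj => (hG j hj).sm, fun x hx => Finset.sum_eq_zero fun j hj => (hG j hj).zero x hx⟩

lemma GZ.oms {H : En n → ℝ} (hH : SM H) : GZ (fun x : En n => (1 - ‖x‖ ^ 2) * H x) :=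
  ⟨(contDiff_const.sub SM.normsq).mul hH, fun x hx => by rw [hx]; simp⟩

lemma IsTestFun.gz {φ : En n → ℝ} (h : IsTestFun (ball 0 1) φ) : GZ φ := by
  refine ⟨h.1, fun x hx => ?_⟩
  apply image_eq_zero_of_notMem_tsupport
  intro hx'
  have := mem_ball_zero_iff.1 (h.2.2 hx')
  linarith

lemma GZ.ibp {G H : En n → ℝ} (hG : GZ G) (hH : SM H) (i : Fin n) :
    ∫ x, G x * pd i H x ∂(vB n) = -∫ x, pd i G x * H x ∂(vB n) := by
  have h := DIV0 (hG.mul hH) i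
  have h1 : Integrable (fun x => G x * pd i H x) (vB n) := cont_int (hG.sm.continuous.mul (hH.pd i).continuous)
  have h2 : Integrable (fun x => pd i G x * H x) (vB n) := cont_int ((hG.sm.pd i).continuous.mul hH.continuous)
  rw [integral_congr_ae (ae_of_all _ fun x => pd_mul i (hG.sm.diff x) (hH.diff x)),
    integral_add h1 h2] at h
  linarith

lemma GZ.green {G H : En n → ℝ} (hG : GZ G) (hH : SM H) :
    ∫ x, G x * lap H x ∂(vB n) = -∑ i, ∫ x, pd i G x * pd i H x ∂(vB n) := by
  unfold lap
  simp_rw [Finset.mul_sum]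
  rw [integral_finsetSum (f := fun i x => G x * pd i (pd i H) x) _ fun i _ => cont_int (hG.sm.continuous.mul ((hH.pd i).pd i).continuous),
    ← Finset.sum_neg_distrib]
  exact Finset.sum_congr rfl fun i _ => hG.ibp (hH.pd i) i

lemma GZ.green2 {G H : En n → ℝ} (hG : GZ G) (hH : GZ H) :
    ∫ x, G x * lap H x ∂(vB n) = ∫ x, H x * lap G x ∂(vB n) := by
  rw [hG.green hH.sm, hH.green hG.sm]
  simp_rw [mul_comm]

lemma coord_sum_sq_le {x : En n} (hx : ‖x‖ ≤ 1) (v : Fin n → ℝ) :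
    (∑ i, x i * v i) ^ 2 ≤ ∑ i, v i ^ 2 := by
  refine (Finset.sum_mul_sq_le_sq_mul_sq _ _ _).trans ?_
  rw [← normsq_eq]
  have : 0 ≤ ∑ i, v i ^ 2 := Finset.sum_nonneg fun i _ => sq_nonneg _
  have h2 : ‖x‖ ^ 2 ≤ 1 := by nlinarith [norm_nonneg x]
  nlinarith

lemma GZ.poincare (hn : 0 < n) {G : En n → ℝ} (hG : GZ G) :
    ∫ x, G x ^ 2 ∂(vB n) ≤ 4 * ∑ i, ∫ x, pd i G x ^ 2 ∂(vB n) := by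
  have hGc := hG.sm.continuous
  have hpc : ∀ i, Continuous (pd i G) := fun i => (hG.sm.pd i).continuous
  have hcc : ∀ i, Continuous (fun x : En n => x i) := fun i => (SM.coord i).continuous
  have h1 : ∀ i : Fin n, ∫ x, G x ^ 2 ∂(vB n) + ∫ x, 2 * (G x * (x i * pd i G x)) ∂(vB n) = 0 := by
    intro i
    have := DIV0 ((hG.mul hG.sm).mul (SM.coord i)) i
    rw [← this, ← integral_add (cont_int (by fun_prop)) (cont_int (by have := hpc i; fun_prop))]
    congr 1; ext x
    rw [pd_mul i (f := fun y => G y * G y) ((hG.sm.diff x).mul (hG.sm.diff x)) ((SM.coord i).diff x),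
      pd_mul i (hG.sm.diff x) (hG.sm.diff x), pd_coord]
    simp; ring
  have h2 : (n:ℝ) * ∫ x, G x ^ 2 ∂(vB n) = -∫ x, 2 * (G x * ∑ i, (x i * pd i G x)) ∂(vB n) := by
    have : ∑ i : Fin n, (∫ x, G x ^ 2 ∂(vB n) + ∫ x, 2 * (G x * (x i * pd i G x)) ∂(vB n)) = 0 :=
      Finset.sum_eq_zero fun i _ => h1 i
    rw [Finset.sum_add_distrib, ← integral_finsetSum (f := fun i x => 2 * (G x * (x i * pd i G x))) _ fun i _ => cont_int (by have := hpc i; fun_prop)] at this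
    simp only [Finset.sum_const, Finset.card_univ, Fintype.card_fin, nsmul_eq_mul] at this
    simp_rw [Finset.mul_sum]
    linarith
  have h3 : -∫ x, 2 * (G x * ∑ i, (x i * pd i G x)) ∂(vB n) ≤
      ∫ x, ((1/2) * G x ^ 2 + 2 * ∑ i, pd i G x ^ 2) ∂(vB n) := by
    rw [← integral_neg]
    refine integral_mono_ae (cont_int (by fun_prop)) (cont_int (by fun_prop)) ?_
    filter_upwards [ae_restrict_mem measurableSet_ball] with x hx
    have := coord_sum_sq_le (mem_ball_zero_iff.1 hx).le (fun i => pd i G x)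
    nlinarith [sq_nonneg ((1/2) * G x + ∑ i, (x i * pd i G x)), sq_nonneg (G x + 2 * ∑ i, (x i * pd i G x))]
  rw [integral_add (cont_int (by fun_prop)) (cont_int (by fun_prop)), integral_const_mul (1/2 : ℝ), integral_const_mul (2:ℝ) (fun x => ∑ i, pd i G x ^ 2),
    integral_finsetSum (f := fun i x => pd i G x ^ 2) _ fun i _ => cont_int (by have := hpc i; fun_prop)] at h3
  have hn1 : (1:ℝ) ≤ n := by exact_mod_cast hn
  have h0 : 0 ≤ ∫ x, G x ^ 2 ∂(vB n) := integral_nonneg fun x => sq_nonneg _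
  nlinarith

/-- evaluation of a polynomial as a function on `En n` -/
def pev (P : MvPolynomial (Fin n) ℝ) (x : En n) : ℝ := MvPolynomial.eval (fun i => x i) P

lemma pev_sm (P : MvPolynomial (Fin n) ℝ) : SM (pev P) := by
  induction P using MvPolynomial.induction_on with
  | C a =>
    have : pev (MvPolynomial.C a : MvPolynomial (Fin n) ℝ) = fun _ => a := by ext x; simp [pev]
    rw [this]; exact contDiff_const
  | add p q hp hq => 
    have : pev (p + q) = fun x => pev p x + pev q x := by ext x; simp [pev]
    rw [this]; exact hp.add hq
  | mul_X p i hp => 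
    have : pev (p * MvPolynomial.X i) = fun x => pev p x * x i := by ext x; simp [pev]
    rw [this]; exact hp.mul (SM.coord i)

lemma pd_pev (i : Fin n) (P : MvPolynomial (Fin n) ℝ) : pd i (pev P) = pev (MvPolynomial.pderiv i P) := by
  induction P using MvPolynomial.induction_on with
  | C a => 
    have : pev (MvPolynomial.C a : MvPolynomial (Fin n) ℝ) = fun _ => a := by ext x; simp [pev]
    rw [this]; ext x; simp [pd_const, pev]
  | add p q hp hq => 
    have : pev (p + q) = fun x => pev p x + pev q x := by ext x; simp [pev]
    rw [this]; ext x; rw [pd_add i ((pev_sm p).diff x) ((pev_sm q).diff x), hp, hq]; simp [pev]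
  | mul_X p j hp => 
    have : pev (p * MvPolynomial.X j) = fun x => pev p x * x j := by ext x; simp [pev]
    rw [this]; ext x; rw [pd_mul i ((pev_sm p).diff x) ((SM.coord j).diff x), hp, pd_coord]
    simp only [pev, Derivation.leibniz, smul_eq_mul, MvPolynomial.pderiv_X]
    by_cases h : i = j
    · subst h; simp; ring
    · simp [h, Ne.symm h, mul_comm]

open MvPolynomial in
lemma totalDegree_pderiv_le' (i : Fin n) (P : MvPolynomial (Fin n) ℝ) (d : ℕ) (h : P.totalDegree ≤ d + 1) :
    (pderiv i P).totalDegree ≤ d := by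
  rw [P.as_sum, map_sum]
  refine totalDegree_finsetSum_le fun s hs => ?_
  rw [pderiv_monomial]
  by_cases h0 : s i = 0
  · simp [h0]
  · refine (totalDegree_monomial_le _ _).trans ?_
    have h1 : (s.sum fun _ e => e) ≤ d + 1 := (le_totalDegree hs).trans h
    have h2 : s = (s - Finsupp.single i 1) + Finsupp.single i 1 := by
      ext j; by_cases hj : i = j
      · subst hj; simp; omega
      · simp [hj]
    rw [h2, Finsupp.sum_add_index (by simp) (by simp)] at h1
    rw [Finsupp.sum_single_index rfl] at h1
    change Finsupp.sum _ (fun _ e => e) ≤ d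
    omega

open MvPolynomial in
/-- `P ↦ Δ((1-|x|²)P)` -/
def Lop (n : ℕ) : MvPolynomial (Fin n) ℝ →ₗ[ℝ] MvPolynomial (Fin n) ℝ where
  toFun P := ∑ i, pderiv i (pderiv i ((1 - ∑ j, X j ^ 2) * P))
  map_add' P Q := by simp [mul_add, Finset.sum_add_distrib]
  map_smul' c P := by simp [Finset.smul_sum]

open MvPolynomial in
lemma Lop_deg (P : MvPolynomial (Fin n) ℝ) (d : ℕ) (h : P.totalDegree ≤ d) : (Lop n P).totalDegree ≤ d := by
  refine totalDegree_finsetSum_le fun i _ => ?_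
  apply totalDegree_pderiv_le'; apply totalDegree_pderiv_le'
  refine (totalDegree_mul _ _).trans ?_
  have : (1 - ∑ j, X j ^ 2 : MvPolynomial (Fin n) ℝ).totalDegree ≤ 2 := by
    refine (totalDegree_sub _ _).trans (max_le (by simp) ?_)
    exact totalDegree_finsetSum_le fun j _ => by simp
  omega

lemma pev_Lop (P : MvPolynomial (Fin n) ℝ) (x : En n) :
    pev (Lop n P) x = lap (fun y : En n => (1 - ‖y‖ ^ 2) * pev P y) x := by
  have : (fun y : En n => (1 - ‖y‖ ^ 2) * pev P y) = pev ((1 - ∑ j, MvPolynomial.X j ^ 2) * P) := by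
    ext y; simp [pev, normsq_eq]
  rw [this]; unfold lap
  simp_rw [pd_pev]
  simp [Lop, pev]

lemma Lop_inj (hn : 0 < n) : Function.Injective (Lop n) := by
  rw [← LinearMap.ker_eq_bot, LinearMap.ker_eq_bot']
  intro P hP
  set G := fun y : En n => (1 - ‖y‖ ^ 2) * pev P y with hGdef
  have hG : GZ G := GZ.oms (pev_sm P)
  have h1 := hG.green hG.sm
  have h2 : ∀ x, lap G x = 0 := fun x => by rw [← pev_Lop, hP]; simp [pev]
  simp only [h2, mul_zero, integral_zero] at h1
  have h3 := hG.poincare hn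
  have h4 : ∑ i, ∫ x, pd i G x ^ 2 ∂(vB n) = 0 := by
    simp_rw [sq]; linarith
  rw [h4, mul_zero] at h3
  have h5 : ∫ x, G x ^ 2 ∂(vB n) = 0 := le_antisymm h3 (integral_nonneg fun x => sq_nonneg _)
  have h6 := (integral_eq_zero_iff_of_nonneg (fun x => sq_nonneg _) (cont_int (hG.sm.continuous.pow 2))).1 h5
  have h7 : Set.EqOn (fun x => G x ^ 2) 0 (ball 0 1) := by
    refine Measure.eqOn_open_of_ae_eq h6 isOpen_ball ?_ continuousOn_const
    have := hG.sm.continuous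
    fun_prop
  refine MvPolynomial.funext_set (fun _ => Set.Ioo 0 (1/(n+1:ℝ))) (fun i => Set.Ioo_infinite (by positivity)) ?_
  intro x hx
  rw [map_zero]
  have hxB : ‖(WithLp.toLp 2 x : En n)‖ < 1 := by
    have : ‖(WithLp.toLp 2 x : En n)‖ ^ 2 < 1 := by
      rw [normsq_eq]
      calc ∑ i, x i ^ 2 ≤ ∑ i : Fin n, (1/(n+1:ℝ)) := by
            refine Finset.sum_le_sum fun i _ => ?_
            have := hx i trivial
            have h1 : (1/(n+1:ℝ)) ≤ 1 := by
              rw [div_le_one (by positivity)]; linarith [Nat.cast_nonneg (α := ℝ) n]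
            nlinarith [this.1, this.2]
        _ < 1 := by
            simp only [Finset.sum_const, Finset.card_univ, Fintype.card_fin, nsmul_eq_mul]
            rw [mul_one_div, div_lt_one (by positivity)]; linarith
    nlinarith [norm_nonneg (WithLp.toLp 2 x : En n)]
  have h8 := h7 (mem_ball_zero_iff.2 hxB)
  simp only [Pi.zero_apply, hGdef, sq_eq_zero_iff, mul_eq_zero] at h8
  rcases h8 with h8 | h8
  · nlinarith [norm_nonneg (WithLp.toLp 2 x : En n)]
  · exact h8

lemma Lop_surj (hn : 0 < n) : Function.Surjective (Lop n) := by
  intro Q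
  set d := Q.totalDegree
  let L : MvPolynomial.restrictTotalDegree (Fin n) ℝ d →ₗ[ℝ] MvPolynomial.restrictTotalDegree (Fin n) ℝ d :=
    (Lop n).restrict (fun P hP => by
      rw [MvPolynomial.mem_restrictTotalDegree] at hP ⊢; exact Lop_deg P d hP)
  have hinj : Function.Injective L := fun a b hab => by
    apply Subtype.ext; apply Lop_inj hn; exact congrArg Subtype.val hab
  obtain ⟨P, hP⟩ := LinearMap.injective_iff_surjective.1 hinj
    ⟨Q, by rw [MvPolynomial.mem_restrictTotalDegree]⟩
  exact ⟨P, congrArg Subtype.val hP⟩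

lemma poly_dense {f : En n → ℝ} (hf : Continuous f) {ε : ℝ} (hε : 0 < ε) :
    ∃ P : MvPolynomial (Fin n) ℝ, ∀ x ∈ closedBall (0 : En n) 1, |pev P x - f x| < ε := by
  let Φ : MvPolynomial (Fin n) ℝ →ₐ[ℝ] C(En n, ℝ) :=
    MvPolynomial.aeval (fun i => (⟨fun x => x i, (SM.coord i).continuous⟩ : C(En n, ℝ)))
  have hΦ : ∀ P x, Φ P x = pev P x := by
    intro P x
    induction P using MvPolynomial.induction_on with
    | C a => simp [Φ, pev]
    | add p q hp hq => rw [map_add, ContinuousMap.add_apply, hp, hq]; simp [pev]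
    | mul_X p i hp => rw [map_mul, ContinuousMap.mul_apply, hp]; simp [pev, Φ]
  have hsep : Φ.range.SeparatesPoints := by
    intro x y hxy
    have : ∃ i, x i ≠ y i := by
      by_contra h; push Not at h; exact hxy (by ext i; exact h i)
    obtain ⟨i, hi⟩ := this
    refine ⟨_, ⟨Φ (MvPolynomial.X i), ⟨_, rfl⟩, rfl⟩, ?_⟩
    simpa [hΦ, pev] using hi
  obtain ⟨g, ⟨P, rfl⟩, hg⟩ := ContinuousMap.exists_mem_subalgebra_near_continuous_of_isCompact_of_separatesPoints
    hsep ⟨f, hf⟩ (isCompact_closedBall (0 : En n) 1) hε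
  exact ⟨P, fun x hx => by simpa [← hΦ] using hg x hx⟩

/-- uniqueness for very weak solutions of the Dirichlet problem -/
theorem UniqK (hn : 0 < n) {z : En n → ℝ} (hz : Integrable z (vB n))
    (h : ∀ K : En n → ℝ, SM K → ∫ x, z x * lap (fun x => (1 - ‖x‖ ^ 2) * K x) x ∂(vB n) = 0) : z =ᵐ[vB n] 0 := by
  have hP : ∀ P : MvPolynomial (Fin n) ℝ, ∫ x, z x * pev P x ∂(vB n) = 0 := by
    intro P
    obtain ⟨Q, rfl⟩ := Lop_surj hn P
    simp_rw [pev_Lop]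
    exact h _ (pev_sm Q)
  apply ae_eq_zero_of_integral_contDiff_smul_eq_zero hz.locallyIntegrable
  intro φ hφ _
  by_contra hne
  have hI : 0 ≤ ∫ x, |z x| ∂(vB n) := integral_nonneg fun x => abs_nonneg _
  set I := ∫ x, |z x| ∂(vB n)
  set a := ∫ x, φ x • z x ∂(vB n)
  have ha : 0 < |a| := abs_pos.2 hne
  obtain ⟨P, hPa⟩ := poly_dense hφ.continuous (ε := |a| / (I + 1)) (by positivity)
  have e1 : a = ∫ x, z x * (φ x - pev P x) ∂(vB n) := by
    simp_rw [mul_sub]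
    rw [integral_sub (int_mul_cont (f := φ) hz hφ.continuous) (int_mul_cont hz (pev_sm P).continuous), hP, sub_zero]
    simp [a, mul_comm]
  have e2 : |a| ≤ ∫ x, |z x| * (|a| / (I + 1)) ∂(vB n) := by
    conv_lhs => rw [e1]
    rw [← Real.norm_eq_abs]
    refine norm_integral_le_of_norm_le (hz.abs.mul_const _) ?_
    filter_upwards [ae_restrict_mem measurableSet_ball] with x hx
    rw [norm_mul, Real.norm_eq_abs, Real.norm_eq_abs, abs_sub_comm]
    exact mul_le_mul_of_nonneg_left (hPa x (ball_subset_closedBall hx)).le (abs_nonneg _)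
  rw [integral_mul_const] at e2
  change |a| ≤ I * _ at e2
  have : I * (|a| / (I + 1)) < |a| := by
    rw [mul_div_assoc', div_lt_iff₀ (by positivity)]; nlinarith
  linarith

theorem Uniq (hn : 0 < n) {z : En n → ℝ} (hz : Integrable z (vB n))
    (h : ∀ G : En n → ℝ, GZ G → ∫ x, z x * lap G x ∂(vB n) = 0) : z =ᵐ[vB n] 0 :=
  UniqK hn hz fun K hK => h _ (GZ.oms hK)

/-! ### Part 3: the Dirichlet projection -/

lemma l2_int_mul {α : Type*} [MeasurableSpace α] {μ : Measure α} {f g : α → ℝ} (hf : MemLp f 2 μ)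
    (hg : MemLp g 2 μ) : Integrable (fun x => f x * g x) μ := hf.integrable_mul hg

lemma l2_int_sq {α : Type*} [MeasurableSpace α] {μ : Measure α} {f : α → ℝ} (hf : MemLp f 2 μ) :
    Integrable (fun x => f x ^ 2) μ := hf.integrable_sq

lemma l2_cs {α : Type*} [MeasurableSpace α] {μ : Measure α} {f g : α → ℝ} (hf : MemLp f 2 μ)
    (hg : MemLp g 2 μ) : (∫ x, f x * g x ∂μ) ^ 2 ≤ (∫ x, f x ^ 2 ∂μ) * ∫ x, g x ^ 2 ∂μ := by
  have h : ∀ t : ℝ, 0 ≤ (∫ x, g x ^ 2 ∂μ) * (t * t) + (2 * ∫ x, f x * g x ∂μ) * t + ∫ x, f x ^ 2 ∂μ := by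
    intro t
    have h0 : 0 ≤ ∫ x, (f x + t * g x) ^ 2 ∂μ := integral_nonneg fun x => sq_nonneg _
    have e : ∀ x, (f x + t * g x) ^ 2 = f x ^ 2 + ((2 * t) * (f x * g x) + (t * t) * g x ^ 2) := fun x => by ring
    simp_rw [e] at h0
    have i2 : Integrable (fun x => (2 * t) * (f x * g x) + (t * t) * g x ^ 2) μ :=
      ((l2_int_mul hf hg).const_mul _).add ((l2_int_sq hg).const_mul _)
    rw [integral_add (l2_int_sq hf) i2,
      integral_add ((l2_int_mul hf hg).const_mul _) ((l2_int_sq hg).const_mul _), integral_const_mul,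
      integral_const_mul] at h0
    linarith
  have := discrim_le_zero h
  unfold discrim at this
  nlinarith

lemma l2_cs' {α : Type*} [MeasurableSpace α] {μ : Measure α} {f g : α → ℝ} (hf : MemLp f 2 μ)
    (hg : MemLp g 2 μ) : |∫ x, f x * g x ∂μ| ≤ √(∫ x, f x ^ 2 ∂μ) * √(∫ x, g x ^ 2 ∂μ) := by
  rw [← Real.sqrt_mul (integral_nonneg fun x => sq_nonneg _)]
  exact Real.abs_le_sqrt (l2_cs hf hg)

/-- L² convergence -/
def L2T {α : Type*} [MeasurableSpace α] (μ : Measure α) (fs : ℕ → α → ℝ) (f : α → ℝ) : Prop :=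
  Tendsto (fun j => ∫ x, (fs j x - f x) ^ 2 ∂μ) atTop (nhds 0)

lemma L2T.mul {α : Type*} [MeasurableSpace α] {μ : Measure α} {fs : ℕ → α → ℝ} {f g : α → ℝ}
    (h : L2T μ fs f) (hfs : ∀ j, MemLp (fs j) 2 μ) (hf : MemLp f 2 μ) (hg : MemLp g 2 μ) :
    Tendsto (fun j => ∫ x, fs j x * g x ∂μ) atTop (nhds (∫ x, f x * g x ∂μ)) := by
  rw [tendsto_iff_norm_sub_tendsto_zero]
  have h1 : Tendsto (fun j => √(∫ x, (fs j x - f x) ^ 2 ∂μ) * √(∫ x, g x ^ 2 ∂μ)) atTop (nhds 0) := by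
    have := (Real.continuous_sqrt.tendsto _ |>.comp h).mul_const (√(∫ x, g x ^ 2 ∂μ))
    simpa using this
  refine squeeze_zero (fun _ => norm_nonneg _) (fun j => ?_) h1
  rw [← integral_sub (l2_int_mul (hfs j) hg) (l2_int_mul hf hg), Real.norm_eq_abs]
  have := l2_cs' ((hfs j).sub hf) hg
  simpa [sub_mul] using this

lemma L2T.add {α : Type*} [MeasurableSpace α] {μ : Measure α} {fs gs : ℕ → α → ℝ} {f g : α → ℝ}
    (h : L2T μ fs f) (h' : L2T μ gs g) (hfs : ∀ j, MemLp (fs j) 2 μ) (hf : MemLp f 2 μ)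
    (hgs : ∀ j, MemLp (gs j) 2 μ) (hg : MemLp g 2 μ) (c : ℝ) :
    L2T μ (fun j x => fs j x + c * gs j x) (fun x => f x + c * g x) := by
  unfold L2T at *
  have h1 := (h.const_mul 2).add (h'.const_mul (2 * c ^ 2))
  simp only [mul_zero, add_zero] at h1
  refine squeeze_zero (fun _ => integral_nonneg fun x => sq_nonneg _) (fun j => ?_) h1
  have i1 := l2_int_sq ((hfs j).sub hf)
  have i2 := l2_int_sq ((hgs j).sub hg)
  simp only [Pi.sub_apply] at i1 i2
  rw [← integral_const_mul, ← integral_const_mul, ← integral_add (i1.const_mul _) (i2.const_mul _)]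
  refine integral_mono (l2_int_sq (((hfs j).add ((hgs j).const_mul c)).sub (hf.add (hg.const_mul c))))
    ((i1.const_mul _).add (i2.const_mul _)) fun x => ?_
  simp only [Pi.sub_apply, Pi.add_apply, Pi.smul_apply, smul_eq_mul]
  nlinarith [sq_nonneg ((fs j x - f x) - c * (gs j x - g x))]

lemma cont_l2 {f : En n → ℝ} (hf : Continuous f) : MemLp f 2 (vB n) := by
  rw [memLp_two_iff_integrable_sq hf.aestronglyMeasurable]
  exact cont_int (hf.pow 2)

lemma l2_l1 {f : En n → ℝ} (hf : MemLp f 2 (vB n)) : Integrable f (vB n) := by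
  haveI : IsFiniteMeasure (vB n) := ⟨by simpa using measure_ball_lt_top⟩
  exact hf.integrable (by norm_num)

lemma l2_mul_cont {u f : En n → ℝ} (hu : MemLp u 2 (vB n)) (hf : Continuous f) :
    MemLp (fun x => u x * f x) 2 (vB n) := by
  rw [memLp_two_iff_integrable_sq (f := fun x => u x * f x) (hu.aestronglyMeasurable.mul hf.aestronglyMeasurable)]
  have := int_mul_cont (l2_int_sq hu) (hf.pow 2)
  refine this.congr (ae_of_all _ fun x => ?_)
  simp; ring

/-- `D = T_D F` with potential `w` -/
structure TD (F : Fin n → En n → ℝ) (w : En n → ℝ) (D : Fin n → En n → ℝ) : Prop where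
  hF : ∀ i, MemLp (F i) 2 (vB n)
  hw : MemLp w 2 (vB n)
  hD : ∀ i, MemLp (D i) 2 (vB n)
  app : ∃ Gs : ℕ → En n → ℝ, (∀ j, GZ (Gs j)) ∧ L2T (vB n) Gs w ∧ ∀ i, L2T (vB n) (fun j => pd i (Gs j)) (D i)
  orth : ∀ G, GZ G → ∑ i, ∫ x, D i x * pd i G x ∂(vB n) = ∑ i, ∫ x, F i x * pd i G x ∂(vB n)

lemma l2_limit {fs : ℕ → En n → ℝ} (hfs : ∀ j, MemLp (fs j) 2 (vB n))
    (hc : ∀ ε > 0, ∃ K, ∀ a ≥ K, ∀ b ≥ K, ∫ x, (fs a x - fs b x) ^ 2 ∂(vB n) < ε) :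
    ∃ f, MemLp f 2 (vB n) ∧ L2T (vB n) fs f := by
  have hnorm : ∀ f g : En n → ℝ, ∀ (hf : MemLp f 2 (vB n)) (hg : MemLp g 2 (vB n)),
      ‖hf.toLp f - hg.toLp g‖ ^ 2 = ∫ x, (f x - g x) ^ 2 ∂(vB n) := by
    intro f g hf hg
    rw [← MemLp.toLp_sub, ← real_inner_self_eq_norm_sq, L2.inner_def]
    refine integral_congr_ae ?_
    filter_upwards [(hf.sub hg).coeFn_toLp] with x hx
    rw [hx]; simp [sq]
  have hcs : CauchySeq (fun j => (hfs j).toLp (fs j)) := by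
    rw [Metric.cauchySeq_iff]
    intro ε hε
    obtain ⟨K, hK⟩ := hc (ε ^ 2) (by positivity)
    refine ⟨K, fun a ha b hb => ?_⟩
    have := hK a ha b hb
    rw [← hnorm _ _ (hfs a) (hfs b)] at this
    rw [dist_eq_norm]
    exact lt_of_pow_lt_pow_left₀ 2 hε.le this
  obtain ⟨f, hf⟩ := cauchySeq_tendsto_of_complete hcs
  refine ⟨f, Lp.memLp f, ?_⟩
  unfold L2T
  have h2 : Tendsto (fun j => ‖(hfs j).toLp (fs j) - f‖ ^ 2) atTop (nhds 0) := by
    have := (tendsto_iff_norm_sub_tendsto_zero.1 hf).pow 2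
    simpa using this
  refine h2.congr fun j => ?_
  rw [← hnorm _ _ (hfs j) (Lp.memLp f), Lp.toLp_coeFn]

lemma pd_lin {f g : En n → ℝ} (hf : SM f) (hg : SM g) (c : ℝ) (i : Fin n) :
    pd i (fun x => f x + c * g x) = fun x => pd i f x + c * pd i g x := by
  ext x
  rw [pd_add i (hf.diff x) ((hg.diff x).const_mul c), pd_const_mul i c (hg.diff x)]

lemma GZ.lin {f g : En n → ℝ} (hf : GZ f) (hg : GZ g) (c : ℝ) : GZ (fun x => f x + c * g x) :=
  ⟨hf.sm.add (contDiff_const.mul hg.sm), fun x hx => by rw [hf.zero x hx, hg.zero x hx]; simp⟩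

lemma TD.lin {F F' : Fin n → En n → ℝ} {w w' : En n → ℝ} {D D' : Fin n → En n → ℝ} (h : TD F w D)
    (h' : TD F' w' D') (c : ℝ) : TD (fun i x => F i x + c * F' i x) (fun x => w x + c * w' x)
      (fun i x => D i x + c * D' i x) := by
  obtain ⟨Gs, g1, g2, g3⟩ := h.app
  obtain ⟨Gs', g1', g2', g3'⟩ := h'.app
  refine ⟨fun i => (h.hF i).add ((h'.hF i).const_mul c), h.hw.add (h'.hw.const_mul c),
    fun i => (h.hD i).add ((h'.hD i).const_mul c), ⟨fun j x => Gs j x + c * Gs' j x, fun j => (g1 j).lin (g1' j) c,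
    g2.add g2' (fun j => cont_l2 (g1 j).sm.continuous) h.hw (fun j => cont_l2 (g1' j).sm.continuous) h'.hw c, 
    fun i => ?_⟩, fun G hG => ?_⟩
  · have := (g3 i).add (g3' i) (fun j => cont_l2 ((g1 j).sm.pd i).continuous) (h.hD i) 
      (fun j => cont_l2 ((g1' j).sm.pd i).continuous) (h'.hD i) c
    simp_rw [pd_lin (g1 _).sm (g1' _).sm c i]
    exact this
  · have e : ∀ (A B : Fin n → En n → ℝ), (∀ i, MemLp (A i) 2 (vB n)) → (∀ i, MemLp (B i) 2 (vB n)) →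
      ∑ i, ∫ x, (A i x + c * B i x) * pd i G x ∂(vB n) = 
        ∑ i, ∫ x, A i x * pd i G x ∂(vB n) + c * ∑ i, ∫ x, B i x * pd i G x ∂(vB n) := by
      intro A B hA hB
      rw [Finset.mul_sum, ← Finset.sum_add_distrib]
      refine Finset.sum_congr rfl fun i _ => ?_
      have hp := cont_l2 (hG.sm.pd i).continuous
      rw [← integral_const_mul, ← integral_add (l2_int_mul (hA i) hp) ((l2_int_mul (hB i) hp).const_mul c)]
      congr 1; ext x; ring
    rw [e _ _ h.hD h'.hD, e _ _ h.hF h'.hF, h.orth G hG, h'.orth G hG]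

lemma TD.pair {F : Fin n → En n → ℝ} {w : En n → ℝ} {D : Fin n → En n → ℝ} (h : TD F w D)
    {F' : Fin n → En n → ℝ} {w' : En n → ℝ} {D' : Fin n → En n → ℝ} (h' : TD F' w' D') :
    ∑ i, ∫ x, D i x * D' i x ∂(vB n) = ∑ i, ∫ x, F i x * D' i x ∂(vB n) := by
  obtain ⟨Gs, g1, g2, g3⟩ := h'.app
  have hh : ∀ (A : Fin n → En n → ℝ), (∀ i, MemLp (A i) 2 (vB n)) →
      Tendsto (fun j => ∑ i, ∫ x, A i x * pd i (Gs j) x ∂(vB n)) atTop (nhds (∑ i, ∫ x, A i x * D' i x ∂(vB n))) := by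
    intro A hA
    refine tendsto_finsetSum _ fun i _ => ?_
    have := (g3 i).mul (fun j => cont_l2 ((g1 j).sm.pd i).continuous) (h'.hD i) (hA i)
    simpa only [mul_comm] using this
  refine tendsto_nhds_unique (hh D h.hD) ((hh F h.hF).congr fun j => (h.orth _ (g1 j)).symm)

lemma TD.symm {F : Fin n → En n → ℝ} {w : En n → ℝ} {D : Fin n → En n → ℝ} (h : TD F w D)
    {F' : Fin n → En n → ℝ} {w' : En n → ℝ} {D' : Fin n → En n → ℝ} (h' : TD F' w' D') :
    ∑ i, ∫ x, D i x * F' i x ∂(vB n) = ∑ i, ∫ x, F i x * D' i x ∂(vB n) := by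
  rw [← h.pair h']
  have := h'.pair h
  simp_rw [mul_comm (D' _ _), mul_comm (F' _ _)] at this
  exact this.symm

lemma TD.energy {F : Fin n → En n → ℝ} {w : En n → ℝ} {D : Fin n → En n → ℝ} (h : TD F w D) :
    ∑ i, ∫ x, D i x ^ 2 ∂(vB n) ≤ ∑ i, ∫ x, F i x ^ 2 ∂(vB n) := by
  have h1 := h.pair h
  have h2 : 0 ≤ ∑ i, ∫ x, (F i x - D i x) ^ 2 ∂(vB n) := 
    Finset.sum_nonneg fun i _ => integral_nonneg fun x => sq_nonneg _
  have h3 : ∑ i, ∫ x, (F i x - D i x) ^ 2 ∂(vB n) = ∑ i, ∫ x, F i x ^ 2 ∂(vB n)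
      - 2 * ∑ i, ∫ x, F i x * D i x ∂(vB n) + ∑ i, ∫ x, D i x * D i x ∂(vB n) := by
    rw [Finset.mul_sum, ← Finset.sum_sub_distrib, ← Finset.sum_add_distrib]
    refine Finset.sum_congr rfl fun i _ => ?_
    have i1 := l2_int_sq (h.hF i)
    have i2 := (l2_int_mul (h.hF i) (h.hD i)).const_mul 2
    have i3 := l2_int_mul (h.hD i) (h.hD i)
    have i12 : Integrable (fun x => F i x ^ 2 - 2 * (F i x * D i x)) (vB n) := i1.sub i2
    rw [← integral_const_mul, ← integral_sub i1 i2, ← integral_add i12 i3]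
    congr 1; ext x; ring
  simp_rw [← sq] at h1 h3
  linarith

lemma GZ.memD {G : En n → ℝ} (hG : GZ G) (i : Fin n) : MemLp (pd i G) 2 (vB n) := cont_l2 (hG.sm.pd i).continuous

lemma TD.weak {F : Fin n → En n → ℝ} {w : En n → ℝ} {D : Fin n → En n → ℝ} (h : TD F w D) (i : Fin n)
    {H : En n → ℝ} (hH : SM H) :
    ∫ x, w x * pd i H x ∂(vB n) = -∫ x, D i x * H x ∂(vB n) := by
  obtain ⟨Gs, g1, g2, g3⟩ := h.app
  have t1 := g2.mul (fun j => cont_l2 (g1 j).sm.continuous) h.hw (cont_l2 (hH.pd i).continuous)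
  have t2 := (g3 i).mul (fun j => (g1 j).memD i) (h.hD i) (cont_l2 hH.continuous)
  exact tendsto_nhds_unique t1 (t2.neg.congr fun j => ((g1 j).ibp hH i).symm)

lemma TD.weakPartial {F : Fin n → En n → ℝ} {w : En n → ℝ} {D : Fin n → En n → ℝ} (h : TD F w D) (i : Fin n) :
    HasWeakPartial (ball 0 1) w (D i) i := fun _ hφ => h.weak i hφ.1

lemma TD.vweak {F : Fin n → En n → ℝ} {w : En n → ℝ} {D : Fin n → En n → ℝ} (h : TD F w D) 
    {G : En n → ℝ} (hG : GZ G) :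
    ∫ x, w x * lap G x ∂(vB n) = -∑ i, ∫ x, F i x * pd i G x ∂(vB n) := by
  rw [← h.orth G hG]
  unfold lap
  simp_rw [Finset.mul_sum]
  rw [integral_finsetSum _ fun i _ => l2_int_mul h.hw (cont_l2 ((hG.sm.pd i).pd i).continuous),
    ← Finset.sum_neg_distrib]
  exact Finset.sum_congr rfl fun i _ => h.weak i (hG.sm.pd i)

lemma TD.const (c : Fin n → ℝ) : TD (fun i (_ : En n) => c i) (fun _ => 0) (fun _ _ => 0) := by
  have hz : GZ (fun _ : En n => (0:ℝ)) := ⟨contDiff_const, fun _ _ => rfl⟩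
  refine ⟨fun i => cont_l2 continuous_const, cont_l2 continuous_const, fun i => cont_l2 continuous_const, 
    ⟨fun _ _ => 0, fun j => hz, by simp [L2T], fun i => ?_⟩, fun G hG => ?_⟩
  · simp [L2T, pd_const]
  · refine Finset.sum_congr rfl fun i _ => ?_
    simp only [zero_mul, integral_zero]
    rw [integral_const_mul, DIV0 hG i, mul_zero]

lemma TD.ae_of_eq {F : Fin n → En n → ℝ} {w w' : En n → ℝ} {D D' : Fin n → En n → ℝ} (h : TD F w D)
    (h' : TD F w' D') (i : Fin n) : D i =ᵐ[vB n] D' i := by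
  have h1 := (h.lin h' (-1)).energy
  have h2 : ∑ i, ∫ x, (F i x + -1 * F i x) ^ 2 ∂(vB n) = 0 := by simp
  rw [h2] at h1
  have h3 : ∫ x, (D i x + -1 * D' i x) ^ 2 ∂(vB n) = 0 := by
    refine le_antisymm (le_trans ?_ h1) (integral_nonneg fun x => sq_nonneg _)
    exact Finset.single_le_sum (f := fun i => ∫ x, (D i x + -1 * D' i x) ^ 2 ∂(vB n)) 
      (fun j _ => integral_nonneg fun x => sq_nonneg _) (Finset.mem_univ i)
  have h4 := (integral_eq_zero_iff_of_nonneg (fun x => sq_nonneg _)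
    (l2_int_sq ((h.hD i).add ((h'.hD i).const_mul (-1))))).1 h3
  filter_upwards [h4] with x hx
  simp only [Pi.zero_apply, Pi.add_apply, Pi.smul_apply, smul_eq_mul] at hx
  have := pow_eq_zero_iff (two_ne_zero) |>.1 hx
  linarith

lemma GZ.smul {f : En n → ℝ} (hf : GZ f) (c : ℝ) : GZ (fun x => c * f x) :=
  ⟨contDiff_const.mul hf.sm, fun x hx => by rw [hf.zero x hx]; simp⟩

/-- gradients of functions vanishing on the sphere, as subspace of L² -/
def gradS (n : ℕ) : Submodule ℝ (PiLp 2 (fun _ : Fin n => Lp ℝ 2 (vB n))) where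
  carrier := {v | ∃ G : En n → ℝ, GZ G ∧ ∀ i, (v i : En n → ℝ) =ᵐ[vB n] pd i G}
  zero_mem' := ⟨fun _ => 0, ⟨contDiff_const, fun _ _ => rfl⟩, fun i => by
    filter_upwards [Lp.coeFn_zero ℝ 2 (vB n)] with x hx
    simpa [pd_const] using hx⟩
  add_mem' := by
    rintro a b ⟨G, hG, ha⟩ ⟨H, hH, hb⟩
    refine ⟨_, hG.lin hH 1, fun i => ?_⟩
    filter_upwards [Lp.coeFn_add (a i) (b i), ha i, hb i] with x h1 h2 h3
    rw [pd_lin hG.sm hH.sm, PiLp.add_apply, h1, Pi.add_apply, h2, h3]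
    simp
  smul_mem' := by
    rintro c a ⟨G, hG, ha⟩
    refine ⟨_, hG.smul c, fun i => ?_⟩
    filter_upwards [Lp.coeFn_smul c (a i), ha i] with x h1 h2
    rw [PiLp.smul_apply, h1, Pi.smul_apply, h2, pd_const_mul i c (hG.sm.diff x)]; rfl

theorem TD_exists (hn : 0 < n) (F : Fin n → En n → ℝ) (hF : ∀ i, MemLp (F i) 2 (vB n)) : ∃ w D, TD F w D := by
  let H := PiLp 2 (fun _ : Fin n => Lp ℝ 2 (vB n))
  let K := (gradS n).topologicalClosure
  haveI : CompleteSpace K := (gradS n).isClosed_topologicalClosure.completeSpace_coe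
  let f : H := WithLp.toLp 2 fun i => (hF i).toLp (F i)
  let p : H := K.starProjection f
  have hp : p ∈ closure ((gradS n : Submodule ℝ H) : Set H) := by
    have : p ∈ K := Submodule.starProjection_apply_mem K f
    exact this
  obtain ⟨v, hv, hvp⟩ := mem_closure_iff_seq_limit.1 hp
  choose Gs hGs hvG using hv
  have hcomp : ∀ i, Tendsto (fun j => v j i) atTop (nhds (p i)) := fun i =>
    ((PiLp.continuous_apply 2 (fun _ : Fin n => Lp ℝ 2 (vB n)) i).tendsto p).comp hvp
  have hconv : ∀ i, L2T (vB n) (fun j => pd i (Gs j)) (p i) := by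
    intro i
    have h2 : Tendsto (fun j => ‖v j i - p i‖ ^ 2) atTop (nhds 0) := by
      have := (tendsto_iff_norm_sub_tendsto_zero.1 (hcomp i)).pow 2
      simpa using this
    refine h2.congr fun j => ?_
    rw [← real_inner_self_eq_norm_sq, L2.inner_def]
    refine integral_congr_ae ?_
    filter_upwards [Lp.coeFn_sub (v j i) (p i), hvG j i] with x hx hx2
    rw [hx, Pi.sub_apply, hx2]; simp [sq]
  have hMp : ∀ i, MemLp (p i : En n → ℝ) 2 (vB n) := fun i => Lp.memLp (p i)
  obtain ⟨w, hw, hwG⟩ := l2_limit (fun j => cont_l2 (hGs j).sm.continuous) (by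
    intro ε hε
    have hs : Tendsto (fun j => ∑ i, ∫ x, (pd i (Gs j) x - p i x) ^ 2 ∂(vB n)) atTop (nhds 0) := by
      simpa using tendsto_finsetSum Finset.univ fun i _ => hconv i
    obtain ⟨K, hK⟩ := (eventually_atTop.1 (hs.eventually (gt_mem_nhds (show (0:ℝ) < ε / 16 by positivity))))
    refine ⟨K, fun a ha b hb => ?_⟩
    have h1 := ((hGs a).lin (hGs b) (-1)).poincare hn
    have h2 : ∑ i, ∫ x, pd i (fun x => Gs a x + -1 * Gs b x) x ^ 2 ∂(vB n) ≤ 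
        2 * (∑ i, ∫ x, (pd i (Gs a) x - p i x) ^ 2 ∂(vB n)) + 2 * ∑ i, ∫ x, (pd i (Gs b) x - p i x) ^ 2 ∂(vB n) := by
      rw [Finset.mul_sum, Finset.mul_sum, ← Finset.sum_add_distrib]
      refine Finset.sum_le_sum fun i _ => ?_
      rw [pd_lin (hGs a).sm (hGs b).sm]
      have i1 := (l2_int_sq (((hGs a).memD i).sub (hMp i))).const_mul 2
      have i2 := (l2_int_sq (((hGs b).memD i).sub (hMp i))).const_mul 2
      simp only [Pi.sub_apply] at i1 i2
      rw [← integral_const_mul, ← integral_const_mul, ← integral_add i1 i2]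
      refine integral_mono (l2_int_sq (((hGs a).memD i).add (((hGs b).memD i).const_mul (-1)))) (i1.add i2) fun x => ?_
      simp only [Pi.add_apply, Pi.smul_apply, smul_eq_mul]
      nlinarith [sq_nonneg ((pd i (Gs a) x - p i x) + (pd i (Gs b) x - p i x))]
    have h3 := hK a ha
    have h4 := hK b hb
    have h5 : ∫ x, (Gs a x - Gs b x) ^ 2 ∂(vB n) = ∫ x, (Gs a x + -1 * Gs b x) ^ 2 ∂(vB n) := by
      congr 1; ext x; ring
    rw [h5]
    linarith)
  refine ⟨w, fun i => p i, hF, hw, hMp, ⟨Gs, hGs, hwG, hconv⟩, fun G hG => ?_⟩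
  let g : H := WithLp.toLp 2 fun i => (hG.memD i).toLp (pd i G)
  have hg : g ∈ K := (gradS n).le_topologicalClosure ⟨G, hG, fun i => (hG.memD i).coeFn_toLp⟩
  have ho : inner ℝ (f - p) g = 0 := K.starProjection_inner_eq_zero f g hg
  rw [inner_sub_left, sub_eq_zero, PiLp.inner_apply, PiLp.inner_apply] at ho
  have e1 : ∀ i, inner ℝ (f i) (g i) = ∫ x, F i x * pd i G x ∂(vB n) := by
    intro i
    rw [L2.inner_def]
    refine integral_congr_ae ?_
    filter_upwards [(hF i).coeFn_toLp, (hG.memD i).coeFn_toLp] with x h1 h2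
    change inner ℝ (((hF i).toLp (F i) : En n → ℝ) x) (((hG.memD i).toLp (pd i G) : En n → ℝ) x) = _
    rw [h1, h2]; simp [mul_comm]
  have e2 : ∀ i, inner ℝ (p i) (g i) = ∫ x, p i x * pd i G x ∂(vB n) := by
    intro i
    rw [L2.inner_def]
    refine integral_congr_ae ?_
    filter_upwards [(hG.memD i).coeFn_toLp] with x h2
    change inner ℝ _ (((hG.memD i).toLp (pd i G) : En n → ℝ) x) = _
    rw [h2]; simp [mul_comm]
  simp_rw [e1, e2] at ho
  exact ho.symm

/-! ### Part 4: the regularised Green kernel -/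

def Ph (n : ℕ) (s : ℝ) : ℝ := if n = 2 then Real.log s else s ^ (1 - (n:ℝ) / 2) / (1 - (n:ℝ) / 2)

lemma Ph_deriv {s : ℝ} (hs : 0 < s) : HasDerivAt (Ph n) (s ^ (-(n:ℝ) / 2)) s := by
  unfold Ph
  by_cases h : n = 2
  · simp only [h, if_true]
    convert Real.hasDerivAt_log hs.ne' using 1
    norm_num [Real.rpow_neg_one]
  · simp only [h, if_false]
    have h2 : (1 - (n:ℝ) / 2) ≠ 0 := by
      intro h3
      apply h
      have : (n:ℝ) = 2 := by linarith
      exact_mod_cast this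
    have := (Real.hasDerivAt_rpow_const (p := 1 - (n:ℝ) / 2) (Or.inl hs.ne')).div_const (1 - (n:ℝ) / 2)
    have e1 : (1 - (n:ℝ) / 2) * s ^ (1 - (n:ℝ) / 2 - 1) / (1 - (n:ℝ) / 2) = s ^ (-(n:ℝ) / 2) := by
      rw [mul_comm, mul_div_assoc, div_self h2, mul_one]
      congr 1; ring
    rw [← e1]; exact this

lemma Ph_cd {s : ℝ} (hs : 0 < s) : ContDiffAt ℝ (⊤ : ℕ∞) (Ph n) s := by
  unfold Ph
  by_cases h : n = 2
  · simp only [h, if_true]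
    exact Real.contDiffAt_log.2 hs.ne'
  · simp only [h, if_false]
    exact (Real.contDiffAt_rpow_const_of_ne hs.ne').div_const _

lemma rp_deriv (p : ℝ) {s : ℝ} (hs : 0 < s) : HasDerivAt (fun t : ℝ => t ^ p) (p * s ^ (p - 1)) s :=
  Real.hasDerivAt_rpow_const (Or.inl hs.ne')

def dt (x y : En n) : ℝ := ∑ i, x i * y i

lemma dt_comm (x y : En n) : dt x y = dt y x := by unfold dt; simp_rw [mul_comm]

lemma dt_eq (x y : En n) : dt x y = inner ℝ x y := by
  unfold dt; simp [PiLp.inner_apply, mul_comm]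

lemma dt_cs (x y : En n) : |dt x y| ≤ ‖x‖ * ‖y‖ := by rw [dt_eq]; exact abs_real_inner_le_norm x y

lemma dt_sm (x : En n) : SM (dt x) := by
  unfold dt; exact ContDiff.sum fun i _ => contDiff_const.mul (SM.coord i)

lemma dt_cont : Continuous (fun p : En n × En n => dt p.1 p.2) := by
  simp_rw [dt_eq]; fun_prop

lemma pd_dt (i : Fin n) (x y : En n) : pd i (dt x) y = x i := by
  unfold dt
  rw [pd_sum _ _ fun j _ => ((SM.coord j).diff y).const_mul _]
  rw [Finset.sum_congr rfl fun j _ => pd_const_mul i (x j) ((SM.coord j).diff y)]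
  simp [pd_coord]

/-- quadratic -/
def qf (s c : ℝ) (x y : En n) : ℝ := s * ‖y‖ ^ 2 - 2 * dt x y + c

lemma qf_sm (s c : ℝ) (x : En n) : SM (qf s c x) := by
  unfold qf
  exact ((contDiff_const.mul SM.normsq).sub (contDiff_const.mul (dt_sm x))).add contDiff_const

lemma pd_qf (s c : ℝ) (x y : En n) (i : Fin n) : pd i (qf s c x) y = 2 * s * y i - 2 * x i := by
  unfold qf
  have d1 : DifferentiableAt ℝ (fun y => s * ‖y‖ ^ 2 - 2 * dt x y) y :=
    ((SM.normsq.diff y).const_mul s).sub (((dt_sm x).diff y).const_mul 2)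
  rw [pd_add i d1 (by fun_prop),
    pd_sub i ((SM.normsq.diff y).const_mul _) (((dt_sm x).diff y).const_mul _), pd_const_mul i _ (SM.normsq.diff y),
    pd_const_mul i _ ((dt_sm x).diff y), pd_normsq, pd_dt, pd_const]
  ring

lemma qf_A (x y : En n) : qf 1 (‖x‖ ^ 2) x y = ‖x - y‖ ^ 2 := by
  unfold qf; rw [norm_sub_sq_real, dt_eq]; ring

lemma qf_A_nn (x y : En n) : 0 ≤ qf 1 (‖x‖ ^ 2) x y := by rw [qf_A]; positivity

lemma qf_Q_ge (x y : En n) : (1 - ‖x‖ * ‖y‖) ^ 2 ≤ qf (‖x‖ ^ 2) 1 x y := by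
  unfold qf; nlinarith [abs_le.1 (dt_cs x y)]

lemma qf_Q_nn (x y : En n) : 0 ≤ qf (‖x‖ ^ 2) 1 x y := (sq_nonneg _).trans (qf_Q_ge x y)

lemma grad_qf {s c : ℝ} {x : En n} (h : s * c = ‖x‖ ^ 2) (y : En n) :
    ∑ i, (2 * s * y i - 2 * x i) ^ 2 = 4 * s * qf s c x y := by
  have : ∀ i, (2 * s * y i - 2 * x i) ^ 2 = 4 * s ^ 2 * y i ^ 2 - 8 * s * (x i * y i) + 4 * x i ^ 2 := fun i => by ring
  simp_rw [this]
  rw [Finset.sum_add_distrib, Finset.sum_sub_distrib, ← Finset.mul_sum, ← Finset.mul_sum, ← Finset.mul_sum,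
    ← normsq_eq, ← normsq_eq]
  unfold qf dt
  rw [← h]; ring

section
variable {s c e : ℝ} {x : En n}

lemma Pq_sm (h0 : ∀ y, 0 ≤ qf s c x y) (he : 0 < e) : SM (fun y => Ph n (qf s c x y + e)) := by
  refine contDiff_iff_contDiffAt.2 fun y => ?_
  exact (Ph_cd (n := n) (by have := h0 y; linarith : 0 < qf s c x y + e)).comp y
    ((qf_sm s c x).add contDiff_const).contDiffAt

lemma pd_qfe (y : En n) (i : Fin n) : pd i (fun y => qf s c x y + e) y = 2 * s * y i - 2 * x i := by
  rw [pd_add i ((qf_sm s c x).diff y) (by fun_prop), pd_qf, pd_const, add_zero]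

lemma pd_Pq (h0 : ∀ y, 0 ≤ qf s c x y) (he : 0 < e) (i : Fin n) (y : En n) :
    pd i (fun y => Ph n (qf s c x y + e)) y = (qf s c x y + e) ^ (-(n:ℝ) / 2) * (2 * s * y i - 2 * x i) := by
  rw [pd_comp i (f := Ph n) (g := fun y => qf s c x y + e) (Ph_deriv (by have := h0 y; linarith))
    (((qf_sm s c x).diff y).add_const _), pd_qfe]

lemma lap_Pq (h0 : ∀ y, 0 ≤ qf s c x y) (he : 0 < e) (h : s * c = ‖x‖ ^ 2) (y : En n) :
    lap (fun y => Ph n (qf s c x y + e)) y = 2 * n * s * (e * (qf s c x y + e) ^ (-(n:ℝ) / 2 - 1)) := by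
  unfold lap
  have hp : 0 < qf s c x y + e := by have := h0 y; linarith
  have h1 : ∀ i, pd i (pd i (fun y => Ph n (qf s c x y + e))) y =
      (-(n:ℝ) / 2) * (qf s c x y + e) ^ (-(n:ℝ) / 2 - 1) * (2 * s * y i - 2 * x i) ^ 2
      + (qf s c x y + e) ^ (-(n:ℝ) / 2) * (2 * s) := by
    intro i
    have e1 : pd i (fun y => Ph n (qf s c x y + e)) =
      fun y => (qf s c x y + e) ^ (-(n:ℝ) / 2) * (2 * s * y i - 2 * x i) := funext (pd_Pq h0 he i)
    have dq : DifferentiableAt ℝ (fun y => qf s c x y + e) y := ((qf_sm s c x).diff y).add_const _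
    have dl : DifferentiableAt ℝ (fun y : En n => 2 * s * y i) y := ((SM.coord i).diff y).const_mul _
    rw [e1, pd_mul i (DifferentiableAt.rpow_const dq (Or.inl hp.ne')) (dl.sub_const _),
      pd_comp i (f := fun t : ℝ => t ^ (-(n:ℝ) / 2)) (g := fun y => qf s c x y + e) (rp_deriv _ hp) dq, pd_qfe,
      pd_sub i dl (by fun_prop), pd_const_mul i _ ((SM.coord i).diff y), pd_coord, pd_const]
    simp; ring
  simp_rw [h1]
  rw [Finset.sum_add_distrib, ← Finset.mul_sum, grad_qf h]
  have h2 : (qf s c x y + e) ^ (-(n:ℝ) / 2) = (qf s c x y + e) ^ (-(n:ℝ) / 2 - 1) * (qf s c x y + e) := by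
    conv_rhs => rw [← Real.rpow_add_one hp.ne']
    congr 1; ring
  rw [h2]; simp; ring
end

/-- regularised Green function -/
def Ge (e : ℝ) (x y : En n) : ℝ := Ph n (qf (‖x‖ ^ 2) 1 x y + e) - Ph n (qf 1 (‖x‖ ^ 2) x y + e)

lemma Ge_gz {e : ℝ} (he : 0 < e) (x : En n) : GZ (Ge e x) := by
  refine ⟨(Pq_sm (qf_Q_nn x) he).sub (Pq_sm (qf_A_nn x) he), fun y hy => ?_⟩
  unfold Ge qf
  rw [hy]
  have : ‖x‖ ^ 2 * 1 ^ 2 - 2 * dt x y + 1 = 1 * 1 ^ 2 - 2 * dt x y + ‖x‖ ^ 2 := by ring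
  rw [this, sub_self]

def dG (e : ℝ) (j : Fin n) (x y : En n) : ℝ :=
  (qf (‖x‖ ^ 2) 1 x y + e) ^ (-(n:ℝ) / 2) * (2 * ‖x‖ ^ 2 * y j - 2 * x j)
    - (qf 1 (‖x‖ ^ 2) x y + e) ^ (-(n:ℝ) / 2) * (2 * y j - 2 * x j)

lemma pd_Ge {e : ℝ} (he : 0 < e) (x y : En n) (j : Fin n) : pd j (Ge e x) y = dG e j x y := by
  unfold Ge
  rw [pd_sub j ((Pq_sm (qf_Q_nn x) he).diff y) ((Pq_sm (qf_A_nn x) he).diff y), pd_Pq (qf_Q_nn x) he,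
    pd_Pq (qf_A_nn x) he]
  unfold dG; ring

def LG (e : ℝ) (x y : En n) : ℝ :=
  2 * n * (‖x‖ ^ 2 * (e * (qf (‖x‖ ^ 2) 1 x y + e) ^ (-(n:ℝ) / 2 - 1)) - e * (‖x - y‖ ^ 2 + e) ^ (-(n:ℝ) / 2 - 1))

lemma lap_sub {f g : En n → ℝ} (hf : SM f) (hg : SM g) (x : En n) : lap (fun y => f y - g y) x = lap f x - lap g x := by
  unfold lap
  rw [← Finset.sum_sub_distrib]
  refine Finset.sum_congr rfl fun i _ => ?_
  have : pd i (fun y => f y - g y) = fun y => pd i f y - pd i g y := funext fun y => pd_sub i (hf.diff y) (hg.diff y)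
  rw [this, pd_sub i ((hf.pd i).diff x) ((hg.pd i).diff x)]

lemma lap_Ge {e : ℝ} (he : 0 < e) (x y : En n) : lap (Ge e x) y = LG e x y := by
  unfold Ge
  rw [lap_sub (Pq_sm (qf_Q_nn x) he) (Pq_sm (qf_A_nn x) he), lap_Pq (qf_Q_nn x) he (mul_one _),
    lap_Pq (qf_A_nn x) he (one_mul _), qf_A]
  unfold LG; ring

def Ke (e : ℝ) (i j : Fin n) (x y : En n) : ℝ :=
  ((-(n:ℝ) / 2) * (qf (‖x‖ ^ 2) 1 x y + e) ^ (-(n:ℝ) / 2 - 1) * (2 * ‖y‖ ^ 2 * x i - 2 * y i) * (2 * ‖x‖ ^ 2 * y j - 2 * x j)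
    + (qf (‖x‖ ^ 2) 1 x y + e) ^ (-(n:ℝ) / 2) * (4 * x i * y j - 2 * (if i = j then 1 else 0)))
  - ((-(n:ℝ) / 2) * (qf 1 (‖x‖ ^ 2) x y + e) ^ (-(n:ℝ) / 2 - 1) * (2 * x i - 2 * y i) * (2 * y j - 2 * x j)
    - (qf 1 (‖x‖ ^ 2) x y + e) ^ (-(n:ℝ) / 2) * (2 * (if i = j then 1 else 0)))

lemma qf_swap_Q (x y : En n) : qf (‖x‖ ^ 2) 1 x y = qf (‖y‖ ^ 2) 1 y x := by
  unfold qf; rw [dt_comm]; ring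
lemma qf_swap_A (x y : En n) : qf 1 (‖x‖ ^ 2) x y = qf 1 (‖y‖ ^ 2) y x := by
  unfold qf; rw [dt_comm]; ring

lemma qrp_sm {s c e : ℝ} {x : En n} (h0 : ∀ y, 0 ≤ qf s c x y) (he : 0 < e) (p : ℝ) :
    SM (fun y => (qf s c x y + e) ^ p) := by
  refine contDiff_iff_contDiffAt.2 fun y => ?_
  exact ((qf_sm s c x).add contDiff_const).contDiffAt.rpow_const_of_ne (by have := h0 y; linarith)

lemma pd_qrp {s c e : ℝ} {x : En n} (h0 : ∀ y, 0 ≤ qf s c x y) (he : 0 < e) (p : ℝ) (i : Fin n) (y : En n) :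
    pd i (fun y => (qf s c x y + e) ^ p) y = p * (qf s c x y + e) ^ (p - 1) * (2 * s * y i - 2 * x i) := by
  rw [pd_comp i (f := fun t : ℝ => t ^ p) (g := fun y => qf s c x y + e) (rp_deriv _ (by have := h0 y; linarith))
    (((qf_sm s c x).diff y).add_const _), pd_qfe]

lemma dG_eq (e : ℝ) (j : Fin n) (y : En n) : (fun x => dG e j x y) = fun x =>
    (qf (‖y‖ ^ 2) 1 y x + e) ^ (-(n:ℝ) / 2) * (2 * y j * ‖x‖ ^ 2 - 2 * x j)
    - (qf 1 (‖y‖ ^ 2) y x + e) ^ (-(n:ℝ) / 2) * (2 * y j - 2 * x j) := by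
  ext x
  unfold dG
  rw [qf_swap_Q, qf_swap_A]; ring

lemma lin1_sm (y : En n) (j : Fin n) : SM (fun x : En n => 2 * y j * ‖x‖ ^ 2 - 2 * x j) :=
  (contDiff_const.mul SM.normsq).sub (contDiff_const.mul (SM.coord j))
lemma lin2_sm (y : En n) (j : Fin n) : SM (fun x : En n => 2 * y j - 2 * x j) :=
  contDiff_const.sub (contDiff_const.mul (SM.coord j))

lemma dG_sm {e : ℝ} (he : 0 < e) (j : Fin n) (y : En n) : SM (fun x => dG e j x y) := by
  rw [dG_eq]
  exact ((qrp_sm (qf_Q_nn y) he _).mul (lin1_sm y j)).sub ((qrp_sm (qf_A_nn y) he _).mul (lin2_sm y j))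

lemma pd_dG {e : ℝ} (he : 0 < e) (i j : Fin n) (x y : En n) : pd i (fun x => dG e j x y) x = Ke e i j x y := by
  rw [dG_eq]
  have s1 := qrp_sm (qf_Q_nn y) he (-(n:ℝ) / 2)
  have s2 := qrp_sm (qf_A_nn y) he (-(n:ℝ) / 2)
  have s3 : SM (fun x => (qf (‖y‖ ^ 2) 1 y x + e) ^ (-(n:ℝ) / 2) * (2 * y j * ‖x‖ ^ 2 - 2 * x j)) := s1.mul (lin1_sm y j)
  have s4 : SM (fun x => (qf 1 (‖y‖ ^ 2) y x + e) ^ (-(n:ℝ) / 2) * (2 * y j - 2 * x j)) := s2.mul (lin2_sm y j)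
  rw [pd_sub i (s3.diff x) (s4.diff x),
    pd_mul i (s1.diff x) ((lin1_sm y j).diff x), pd_mul i (s2.diff x) ((lin2_sm y j).diff x),
    pd_qrp (qf_Q_nn y) he, pd_qrp (qf_A_nn y) he,
    pd_sub i ((SM.normsq.diff x).const_mul _) (((SM.coord j).diff x).const_mul _),
    pd_sub i (by fun_prop) (((SM.coord j).diff x).const_mul _), pd_const,
    pd_const_mul i _ (SM.normsq.diff x), pd_const_mul i _ ((SM.coord j).diff x), pd_coord, pd_normsq]
  unfold Ke
  rw [qf_swap_Q x y, qf_swap_A x y]; ring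

lemma qfQ_cont : Continuous (fun p : En n × En n => qf (‖p.1‖ ^ 2) 1 p.1 p.2) := by
  unfold qf; have := dt_cont (n := n); fun_prop
lemma qfA_cont : Continuous (fun p : En n × En n => qf 1 (‖p.1‖ ^ 2) p.1 p.2) := by
  unfold qf; have := dt_cont (n := n); fun_prop

lemma qQr_cont {e : ℝ} (he : 0 < e) (p : ℝ) : Continuous (fun q : En n × En n => (qf (‖q.1‖ ^ 2) 1 q.1 q.2 + e) ^ p) :=
  (qfQ_cont.add continuous_const).rpow_const fun q => Or.inl (by have := qf_Q_nn q.1 q.2; simp; linarith)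
lemma qAr_cont {e : ℝ} (he : 0 < e) (p : ℝ) : Continuous (fun q : En n × En n => (qf 1 (‖q.1‖ ^ 2) q.1 q.2 + e) ^ p) :=
  (qfA_cont.add continuous_const).rpow_const fun q => Or.inl (by have := qf_A_nn q.1 q.2; simp; linarith)

lemma dG_cont {e : ℝ} (he : 0 < e) (j : Fin n) : Continuous (fun q : En n × En n => dG e j q.1 q.2) := by
  unfold dG
  have h1 := qQr_cont (n := n) he (-(n:ℝ) / 2)
  have h2 := qAr_cont (n := n) he (-(n:ℝ) / 2)
  fun_prop

lemma LG_cont {e : ℝ} (he : 0 < e) : Continuous (fun q : En n × En n => LG e q.1 q.2) := by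
  unfold LG
  have h1 := qQr_cont (n := n) he (-(n:ℝ) / 2 - 1)
  have h2 := qAr_cont (n := n) he (-(n:ℝ) / 2 - 1)
  simp_rw [qf_A] at h2
  fun_prop

lemma Ke_cont {e : ℝ} (he : 0 < e) (i j : Fin n) : Continuous (fun q : En n × En n => Ke e i j q.1 q.2) := by
  unfold Ke
  have h1 := qQr_cont (n := n) he (-(n:ℝ) / 2)
  have h2 := qAr_cont (n := n) he (-(n:ℝ) / 2)
  have h3 := qQr_cont (n := n) he (-(n:ℝ) / 2 - 1)
  have h4 := qAr_cont (n := n) he (-(n:ℝ) / 2 - 1)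
  fun_prop

instance vB_fin : IsFiniteMeasure (vB n) := ⟨by simpa using measure_ball_lt_top⟩

/-- Fubini -/
lemma fub {f : En n → ℝ} (hf : Integrable f (vB n)) {k : En n × En n → ℝ} (hk : Continuous k)
    {φ : En n → ℝ} (hφ : Continuous φ) :
    ∫ x, (∫ y, f y * k (x, y) ∂(vB n)) * φ x ∂(vB n) = ∫ y, f y * (∫ x, k (x, y) * φ x ∂(vB n)) ∂(vB n) := by
  simp_rw [← integral_mul_const, ← integral_const_mul]
  have hc : Continuous (fun p : En n × En n => k p * φ p.1) := by fun_prop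
  obtain ⟨C, hC⟩ := ((isCompact_closedBall (0 : En n) 1).prod (isCompact_closedBall (0 : En n) 1)).exists_bound_of_continuousOn
    hc.continuousOn
  rw [integral_integral_swap]
  · simp_rw [mul_assoc]
  have hi : Integrable (fun p : En n × En n => f p.2) ((vB n).prod (vB n)) := hf.comp_snd _
  have h2 : Integrable (fun p : En n × En n => f p.2 * (k p * φ p.1)) ((vB n).prod (vB n)) := by
    refine hi.mul_bdd (c := C) hc.aestronglyMeasurable ?_
    rw [Measure.prod_restrict]
    refine (ae_restrict_mem (measurableSet_ball.prod measurableSet_ball)).mono fun p hp => hC p ?_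
    exact ⟨ball_subset_closedBall hp.1, ball_subset_closedBall hp.2⟩
  refine h2.congr (ae_of_all _ fun p => ?_)
  simp [Function.uncurry, mul_assoc]

/-- the basic identity -/
lemma TD.kernel_id {F : Fin n → En n → ℝ} {w : En n → ℝ} {D : Fin n → En n → ℝ} (h : TD F w D) {e : ℝ} (he : 0 < e)
    {φ : En n → ℝ} (hφ : GZ φ) (i : Fin n) :
    ∑ j, ∫ y, F j y * (∫ x, Ke e i j x y * φ x ∂(vB n)) ∂(vB n) =
      ∫ y, w y * (∫ x, LG e x y * pd i φ x ∂(vB n)) ∂(vB n) := by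
  have hd := (hφ.sm.pd i).continuous
  have h1 : ∀ x, ∑ j, ∫ y, F j y * dG e j x y ∂(vB n) = - ∫ y, w y * LG e x y ∂(vB n) := by
    intro x
    have h1 := h.vweak (Ge_gz he x)
    simp_rw [lap_Ge he, pd_Ge he] at h1
    rw [h1, neg_neg]
  have h2 : ∀ j y, ∫ x, Ke e i j x y * φ x ∂(vB n) = - ∫ x, dG e j x y * pd i φ x ∂(vB n) := by
    intro j y
    have := hφ.ibp (dG_sm he j y) i
    simp_rw [pd_dG he] at this
    simp_rw [mul_comm _ (φ _), this, mul_comm]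
  simp_rw [h2, mul_neg, integral_neg]
  have h3 : ∀ j, ∫ y, F j y * (∫ x, dG e j x y * pd i φ x ∂(vB n)) ∂(vB n) =
    ∫ x, (∫ y, F j y * dG e j x y ∂(vB n)) * pd i φ x ∂(vB n) := fun j =>
    (fub (l2_l1 (h.hF j)) (dG_cont he j) hd).symm
  have h4 := fub (l2_l1 h.hw) (LG_cont he) hd
  dsimp only at h4
  rw [← h4, Finset.sum_neg_distrib]
  simp_rw [h3]
  rw [← integral_finsetSum]
  · simp_rw [← Finset.sum_mul, h1, neg_mul]
    rw [integral_neg, neg_neg]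
  · intro j _
    have hi : Integrable (fun p : En n × En n => F j p.2 * (dG e j p.1 p.2 * pd i φ p.1)) ((vB n).prod (vB n)) := by
      have hc : Continuous (fun p : En n × En n => dG e j p.1 p.2 * pd i φ p.1) := by
        have := dG_cont (n := n) he j; fun_prop
      obtain ⟨C, hC⟩ := ((isCompact_closedBall (0 : En n) 1).prod (isCompact_closedBall (0 : En n) 1)).exists_bound_of_continuousOn
        hc.continuousOn
      refine ((l2_l1 (h.hF j)).comp_snd _).mul_bdd (c := C) hc.aestronglyMeasurable ?_
      rw [Measure.prod_restrict]
      refine (ae_restrict_mem (measurableSet_ball.prod measurableSet_ball)).mono fun p hp => hC p ?_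
      exact ⟨ball_subset_closedBall hp.1, ball_subset_closedBall hp.2⟩
    refine hi.integral_prod_left.congr (ae_of_all _ fun x => ?_)
    simp only
    rw [← integral_mul_const]
    simp_rw [mul_assoc]

/-! ### Part 5: limit of the kernel -/

def kap (n : ℕ) : ℝ := ∫ z : En n, (‖z‖ ^ 2 + 1) ^ (-(n:ℝ) / 2 - 1)

lemma kap_int : Integrable (fun z : En n => (‖z‖ ^ 2 + 1) ^ (-(n:ℝ) / 2 - 1)) := by
  have := integrable_rpow_neg_one_add_norm_sq (E := En n) (μ := volume) (r := (n:ℝ) + 2) (by simp)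
  refine this.congr (ae_of_all _ fun z => ?_)
  simp only
  rw [add_comm]; congr 1; ring

lemma kap_pos : 0 < kap n := by
  unfold kap
  rw [integral_pos_iff_support_of_nonneg (fun z => by positivity) kap_int]
  have : Function.support (fun z : En n => (‖z‖ ^ 2 + 1) ^ (-(n:ℝ) / 2 - 1)) = Set.univ := by
    ext z; simp only [Function.mem_support, Set.mem_univ, iff_true]; positivity
  rw [this]; exact isOpen_univ.measure_pos volume ⟨0, trivial⟩

lemma apx_sub (ζ : En n → ℝ) (y : En n) {t : ℝ} (ht : 0 < t) :
    ∫ x, t ^ 2 * (‖x - y‖ ^ 2 + t ^ 2) ^ (-(n:ℝ) / 2 - 1) * ζ x =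
      ∫ z : En n, (‖z‖ ^ 2 + 1) ^ (-(n:ℝ) / 2 - 1) * ζ (y + t • z) := by
  rw [← integral_add_left_eq_self _ y]
  have h := Measure.integral_comp_smul (μ := (volume : Measure (En n)))
    (fun x => t ^ 2 * (‖y + x - y‖ ^ 2 + t ^ 2) ^ (-(n:ℝ) / 2 - 1) * ζ (y + x)) t
  have h2 : ∀ z : En n, t ^ 2 * (‖y + t • z - y‖ ^ 2 + t ^ 2) ^ (-(n:ℝ) / 2 - 1) * ζ (y + t • z) =
      (t ^ n)⁻¹ * ((‖z‖ ^ 2 + 1) ^ (-(n:ℝ) / 2 - 1) * ζ (y + t • z)) := by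
    intro z
    have e1 : ‖y + t • z - y‖ ^ 2 + t ^ 2 = t ^ 2 * (‖z‖ ^ 2 + 1) := by
      rw [add_sub_cancel_left, norm_smul, Real.norm_of_nonneg ht.le]; ring
    have e2 : (t ^ 2 : ℝ) ^ (-(n:ℝ) / 2 - 1) = (t ^ n)⁻¹ * (t ^ 2)⁻¹ := by
      rw [← Real.rpow_natCast t 2, ← Real.rpow_mul ht.le, ← Real.rpow_natCast t n, ← Real.rpow_neg ht.le,
        ← Real.rpow_neg ht.le, ← Real.rpow_add ht]
      congr 1; push_cast; ring
    rw [e1, Real.mul_rpow (by positivity) (by positivity), e2]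
    field_simp
  simp_rw [h2] at h
  rw [integral_const_mul] at h
  simp only [finrank_euclideanSpace, Fintype.card_fin, smul_eq_mul] at h
  rw [abs_of_pos (by positivity)] at h
  have h3 : (t ^ n)⁻¹ ≠ 0 := by positivity
  exact (mul_left_cancel₀ h3 h).symm

lemma apx_bound {ζ : En n → ℝ} {Z : ℝ} (hZ : ∀ x, |ζ x| ≤ Z) (y : En n) {t : ℝ} (ht : 0 < t) :
    |∫ x, t ^ 2 * (‖x - y‖ ^ 2 + t ^ 2) ^ (-(n:ℝ) / 2 - 1) * ζ x| ≤ kap n * Z := by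
  rw [apx_sub ζ y ht, ← Real.norm_eq_abs]
  unfold kap
  rw [← integral_mul_const]
  refine norm_integral_le_of_norm_le (kap_int.mul_const Z) (ae_of_all _ fun z => ?_)
  rw [norm_mul, Real.norm_of_nonneg (by positivity)]
  exact mul_le_mul_of_nonneg_left (hZ _) (by positivity)

lemma apx_tendsto {ζ : En n → ℝ} (hc : Continuous ζ) {Z : ℝ} (hZ : ∀ x, |ζ x| ≤ Z) (y : En n) {t : ℕ → ℝ}
    (ht : ∀ j, 0 < t j) (ht0 : Tendsto t atTop (nhds 0)) :
    Tendsto (fun j => ∫ x, t j ^ 2 * (‖x - y‖ ^ 2 + t j ^ 2) ^ (-(n:ℝ) / 2 - 1) * ζ x) atTop (nhds (kap n * ζ y)) := by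
  simp_rw [fun j => apx_sub ζ y (ht j)]
  unfold kap
  rw [← integral_mul_const]
  refine tendsto_integral_of_dominated_convergence (fun z => (‖z‖ ^ 2 + 1) ^ (-(n:ℝ) / 2 - 1) * Z) (fun j => ?_)
    (kap_int.mul_const Z) (fun j => ae_of_all _ fun z => ?_) (ae_of_all _ fun z => ?_)
  · exact kap_int.aestronglyMeasurable.mul (by fun_prop : Continuous fun z => ζ (y + t j • z)).aestronglyMeasurable
  · rw [norm_mul, Real.norm_of_nonneg (by positivity)]
    exact mul_le_mul_of_nonneg_left (hZ _) (by positivity)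
  · refine Tendsto.const_mul _ ?_
    have : Tendsto (fun j => y + t j • z) atTop (nhds (y + (0:ℝ) • z)) := 
      tendsto_const_nhds.add (ht0.smul_const z)
    rw [zero_smul, add_zero] at this
    exact (hc.tendsto y).comp this

/-- sequence of parameters -/
def tj (j : ℕ) : ℝ := 1 / ((j:ℝ) + 1)
lemma tj_pos (j : ℕ) : 0 < tj j := by unfold tj; positivity
lemma tj_le (j : ℕ) : tj j ≤ 1 := by
  unfold tj; rw [div_le_one (by positivity)]; linarith [(Nat.cast_nonneg j : (0:ℝ) ≤ j)]
lemma tj_lim : Tendsto tj atTop (nhds 0) := tendsto_one_div_add_atTop_nhds_zero_nat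
lemma tj2_lim : Tendsto (fun j => tj j ^ 2) atTop (nhds 0) := by simpa using tj_lim.pow 2

lemma test_pd_supp {φ : En n → ℝ} (hφ : IsTestFun (ball 0 1) φ) (i : Fin n) :
    ∃ r < 1, 0 < r ∧ ∀ x, pd i φ x ≠ 0 → ‖x‖ ≤ r := by
  have hc : IsCompact (tsupport φ) := hφ.2.1
  obtain ⟨r, hr, h⟩ := (exists_lt_subset_ball (isClosed_tsupport φ) hφ.2.2 : ∃ r' < 1, tsupport φ ⊆ ball 0 r')
  refine ⟨max r (1/2), max_lt hr (by norm_num), by positivity, fun x hx => ?_⟩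
  have h1 : x ∈ tsupport φ := by
    apply support_fderiv_subset ℝ
    intro h0
    apply hx
    unfold pd; rw [h0]; simp
  have := mem_ball_zero_iff.1 (h h1)
  exact this.le.trans (le_max_left _ _)

lemma cpt_bdd {ζ : En n → ℝ} (hc : Continuous ζ) {r : ℝ} (h : ∀ x, ζ x ≠ 0 → ‖x‖ ≤ r) : ∃ Z, 0 ≤ Z ∧ ∀ x, |ζ x| ≤ Z := by
  obtain ⟨C, hC⟩ := (isCompact_closedBall (0 : En n) r).exists_bound_of_continuousOn hc.continuousOn
  refine ⟨max C 0, le_max_right _ _, fun x => ?_⟩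
  by_cases hx : ζ x = 0
  · rw [hx]; simp
  · exact (hC x (by simpa using h x hx)).trans (le_max_left _ _)

lemma LG_lim {ζ : En n → ℝ} (hc : Continuous ζ) {r : ℝ} (hr : r < 1) (h : ∀ x, ζ x ≠ 0 → ‖x‖ ≤ r) :
    ∃ C, (∀ j, ∀ y ∈ ball (0 : En n) 1, |∫ x, LG (tj j ^ 2) x y * ζ x ∂(vB n)| ≤ C) ∧
    ∀ y ∈ ball (0 : En n) 1, Tendsto (fun j => ∫ x, LG (tj j ^ 2) x y * ζ x ∂(vB n)) atTop (nhds (-(2 * n * kap n) * ζ y)) := by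
  obtain ⟨Z, hZ0, hZ⟩ := cpt_bdd hc h
  set p : ℝ := -(n:ℝ) / 2 - 1 with hp
  have hpn : p ≤ 0 := by rw [hp]; have : (0:ℝ) ≤ n := Nat.cast_nonneg n; linarith
  set I1 : ℕ → En n → ℝ := fun j y => ∫ x, ‖x‖ ^ 2 * (tj j ^ 2 * (qf (‖x‖ ^ 2) 1 x y + tj j ^ 2) ^ p) * ζ x ∂(vB n) with hI1
  set I2 : ℕ → En n → ℝ := fun j y => ∫ x, tj j ^ 2 * (‖x - y‖ ^ 2 + tj j ^ 2) ^ p * ζ x with hI2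
  have hsplit : ∀ j y, ∫ x, LG (tj j ^ 2) x y * ζ x ∂(vB n) = 2 * n * (I1 j y - I2 j y) := by
    intro j y
    have h2 : I2 j y = ∫ x, tj j ^ 2 * (‖x - y‖ ^ 2 + tj j ^ 2) ^ p * ζ x ∂(vB n) := by
      rw [hI2]
      rw [setIntegral_eq_integral_of_forall_compl_eq_zero]
      intro x hx
      have : ζ x = 0 := by
        by_contra h0
        exact hx (mem_ball_zero_iff.2 ((h x h0).trans_lt hr))
      rw [this, mul_zero]
    have hpos := tj_pos j
    have c1 : Continuous fun x : En n => ‖x‖ ^ 2 * (tj j ^ 2 * (qf (‖x‖ ^ 2) 1 x y + tj j ^ 2) ^ p) * ζ x := by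
      have := (qQr_cont (n := n) (e := tj j ^ 2) (by positivity) p).comp (Continuous.prodMk continuous_id (continuous_const (y := y)))
      simp only [Function.comp_def, id] at this
      fun_prop
    have c2 : Continuous fun x : En n => tj j ^ 2 * (‖x - y‖ ^ 2 + tj j ^ 2) ^ p * ζ x := by
      have : Continuous fun x : En n => (‖x - y‖ ^ 2 + tj j ^ 2) ^ p :=
        Continuous.rpow_const (by fun_prop) fun x => Or.inl (by positivity)
      fun_prop
    rw [h2, hI1, ← integral_sub (cont_int c1) (cont_int c2), ← integral_const_mul]
    congr 1; ext x
    unfold LG; ring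
  set δ := (1 - r) ^ 2 with hδ
  have hδ0 : 0 < δ := by rw [hδ]; have : 0 < 1 - r := by linarith
                         positivity
  have hI1b : ∀ j, ∀ y ∈ ball (0 : En n) 1, |I1 j y| ≤ tj j ^ 2 * (δ ^ p * Z * (vB n).real Set.univ) := by
    intro j y hy
    rw [hI1, ← Real.norm_eq_abs]
    have := norm_integral_le_of_norm_le_const (μ := vB n) (C := tj j ^ 2 * (δ ^ p * Z)) 
      (f := fun x => ‖x‖ ^ 2 * (tj j ^ 2 * (qf (‖x‖ ^ 2) 1 x y + tj j ^ 2) ^ p) * ζ x) ?_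
    · simp only [mul_assoc] at this ⊢; exact this
    refine (ae_restrict_mem measurableSet_ball).mono fun x hx => ?_
    have hx1 := mem_ball_zero_iff.1 hx
    have hy1 := mem_ball_zero_iff.1 hy
    by_cases h0 : ζ x = 0
    · rw [h0]; simp; positivity
    have hxr := h x h0
    have hq : δ ≤ qf (‖x‖ ^ 2) 1 x y + tj j ^ 2 := by
      have := qf_Q_ge x y
      have h3 : 1 - r ≤ 1 - ‖x‖ * ‖y‖ := by nlinarith [norm_nonneg x, norm_nonneg y]
      have h4 : (1 - r) ^ 2 ≤ (1 - ‖x‖ * ‖y‖) ^ 2 := pow_le_pow_left₀ (by linarith) h3 2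
      nlinarith [sq_nonneg (tj j)]
    have hr1 : (qf (‖x‖ ^ 2) 1 x y + tj j ^ 2) ^ p ≤ δ ^ p := Real.rpow_le_rpow_of_nonpos hδ0 hq hpn
    have hq0 : 0 ≤ (qf (‖x‖ ^ 2) 1 x y + tj j ^ 2) ^ p := Real.rpow_nonneg (hδ0.le.trans hq) _
    rw [norm_mul, norm_mul, norm_mul, Real.norm_of_nonneg (sq_nonneg _), Real.norm_of_nonneg (sq_nonneg _), Real.norm_of_nonneg hq0,
      Real.norm_eq_abs]
    have hx2 : ‖x‖ ^ 2 ≤ 1 := by nlinarith [norm_nonneg x]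
    calc ‖x‖ ^ 2 * (tj j ^ 2 * (qf (‖x‖ ^ 2) 1 x y + tj j ^ 2) ^ p) * |ζ x| 
        ≤ 1 * (tj j ^ 2 * δ ^ p) * Z := by gcongr; exact hZ x
      _ = _ := by ring
  have hV : 0 ≤ (vB n).real Set.univ := measureReal_nonneg
  refine ⟨2 * n * (δ ^ p * Z * (vB n).real Set.univ + kap n * Z), fun j y hy => ?_, fun y hy => ?_⟩
  · rw [hsplit, abs_mul, abs_of_nonneg (by positivity : (0:ℝ) ≤ 2 * n)]
    gcongr
    refine (abs_sub _ _).trans (add_le_add ((hI1b j y hy).trans ?_) (apx_bound hZ y (tj_pos j)))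
    have : tj j ^ 2 ≤ 1 := by nlinarith [tj_pos j, tj_le j]
    nlinarith [show 0 ≤ δ ^ p * Z * (vB n).real Set.univ by positivity]
  · simp_rw [hsplit]
    have t1 : Tendsto (fun j => I1 j y) atTop (nhds 0) := by
      refine squeeze_zero_norm (fun j => hI1b j y hy) ?_
      simpa using tj2_lim.mul_const (δ ^ p * Z * (vB n).real Set.univ)
    have t2 := apx_tendsto hc hZ y tj_pos tj_lim
    have := (t1.sub t2).const_mul (2 * (n:ℝ))
    convert this using 2; ring

lemma TD.kernel_rhs {F : Fin n → En n → ℝ} {w : En n → ℝ} {D : Fin n → En n → ℝ} (h : TD F w D)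
    {φ : En n → ℝ} (hφ : IsTestFun (ball 0 1) φ) (i : Fin n) :
    Tendsto (fun k => ∫ y, w y * (∫ x, LG (tj k ^ 2) x y * pd i φ x ∂(vB n)) ∂(vB n)) atTop
      (nhds ((2 * n * kap n) * ∫ y, D i y * φ y ∂(vB n))) := by
  obtain ⟨r, hr, -, hs⟩ := test_pd_supp hφ i
  have hd : Continuous (pd i φ) := (hφ.gz.sm.pd i).continuous
  obtain ⟨C, hC, hl⟩ := LG_lim hd hr hs
  have e1 : (2 * n * kap n) * ∫ y, D i y * φ y ∂(vB n) = ∫ y, w y * (-(2 * n * kap n) * pd i φ y) ∂(vB n) := by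
    have := h.weak i hφ.gz.sm
    have h2 : ∫ y, w y * (-(2 * n * kap n) * pd i φ y) ∂(vB n) = -(2 * n * kap n) * ∫ y, w y * pd i φ y ∂(vB n) := by
      rw [← integral_const_mul]; congr 1; ext y; ring
    rw [h2, this]; ring
  rw [e1]
  refine tendsto_integral_of_dominated_convergence (fun y => |w y| * C) (fun k => ?_) ((l2_l1 h.hw).abs.mul_const C) (fun k => ?_) ?_
  · refine h.hw.aestronglyMeasurable.mul ?_
    have hpos := tj_pos k
    have hc : Continuous (fun q : En n × En n => LG (tj k ^ 2) q.1 q.2 * pd i φ q.1) :=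
      (LG_cont (by positivity)).mul (hd.comp continuous_fst)
    exact (hc.stronglyMeasurable.integral_prod_left').aestronglyMeasurable
  · refine (ae_restrict_mem measurableSet_ball).mono fun y hy => ?_
    rw [norm_mul]
    exact mul_le_mul_of_nonneg_left (hC k y hy) (norm_nonneg _)
  · refine (ae_restrict_mem measurableSet_ball).mono fun y hy => ?_
    exact (hl y hy).const_mul _

/-! ### Part 6: far field estimate -/

/-- size and variation at scale `1/u` -/
def Ty (u δ C : ℝ) (m : ℕ) (f f' : ℝ) : Prop :=
  |f| ≤ C * u ^ m ∧ |f'| ≤ C * u ^ m ∧ |f - f'| ≤ C * δ * u ^ (m + 1)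

lemma Ty.mul {u δ C C' f f' g g' : ℝ} {m m' : ℕ} (hu : 0 ≤ u) (hC : 0 ≤ C) (hC' : 0 ≤ C')
    (h : Ty u δ C m f f') (h' : Ty u δ C' m' g g') : Ty u δ (2 * C * C') (m + m') (f * g) (f' * g') := by
  obtain ⟨a1, a2, a3⟩ := h
  obtain ⟨b1, b2, b3⟩ := h'
  have key : ∀ a b : ℝ, |a| ≤ C * u ^ m → |b| ≤ C' * u ^ m' → |a * b| ≤ 2 * C * C' * u ^ (m + m') := by
    intro a b ha hb
    rw [abs_mul, pow_add]
    have := mul_le_mul ha hb (abs_nonneg _) (by positivity)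
    have h2 : 0 ≤ C * C' * (u ^ m * u ^ m') := by positivity
    nlinarith
  refine ⟨key _ _ a1 b1, key _ _ a2 b2, ?_⟩
  have e : f * g - f' * g' = f * (g - g') + (f - f') * g' := by ring
  rw [e]
  refine (abs_add_le _ _).trans ?_
  rw [abs_mul, abs_mul]
  have h1 := mul_le_mul a1 b3 (abs_nonneg _) (by positivity)
  have h2 := mul_le_mul a3 b2 (abs_nonneg _) ((abs_nonneg _).trans a3)
  have e1 : C * u ^ m * (C' * δ * u ^ (m' + 1)) = C * C' * δ * u ^ (m + m' + 1) := by ring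
  have e2 : C * δ * u ^ (m + 1) * (C' * u ^ m') = C * C' * δ * u ^ (m + m' + 1) := by ring
  rw [e1] at h1; rw [e2] at h2
  linarith

lemma Ty.add {u δ C C' f f' g g' : ℝ} {m : ℕ} (h : Ty u δ C m f f') (h' : Ty u δ C' m g g') :
    Ty u δ (C + C') m (f + g) (f' + g') := by
  obtain ⟨a1, a2, a3⟩ := h
  obtain ⟨b1, b2, b3⟩ := h'
  refine ⟨?_, ?_, ?_⟩
  · refine (abs_add_le _ _).trans ?_; linarith
  · refine (abs_add_le _ _).trans ?_; linarith
  · have : f + g - (f' + g') = (f - f') + (g - g') := by ring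
    rw [this]
    refine (abs_add_le _ _).trans ?_; linarith

def pcst (C : ℝ) : ℕ → ℝ
  | 0 => 1
  | k + 1 => 2 * pcst C k * C

lemma pcst_nn {C : ℝ} (hC : 0 ≤ C) (k : ℕ) : 0 ≤ pcst C k := by
  induction k with
  | zero => simp [pcst]
  | succ k ih => simp only [pcst]; positivity

lemma Ty.pow {u δ C f f' : ℝ} (hu : 0 ≤ u) (hδ : 0 ≤ δ) (hC : 0 ≤ C) (h : Ty u δ C 1 f f') (k : ℕ) :
    Ty u δ (pcst C k) k (f ^ k) (f' ^ k) := by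
  induction k with
  | zero => simp [Ty, pcst]; positivity
  | succ k ih => 
    rw [pow_succ, pow_succ]
    exact ih.mul hu (pcst_nn hC k) hC h

lemma Ty.const {u δ C c : ℝ} (hC : |c| ≤ C) (hδ : 0 ≤ δ) (hu : 0 ≤ u) : Ty u δ C 0 c c := by
  have : 0 ≤ C := (abs_nonneg _).trans hC
  refine ⟨by simpa using hC, by simpa using hC, ?_⟩
  simp; positivity

lemma Ty.inv {u δ q q' : ℝ} (hu : 0 < u) (hq : 1 ≤ 2 * u * q) (hq' : 1 ≤ 2 * u * q') (hd : |q - q'| ≤ δ) :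
    Ty u δ 4 1 q⁻¹ q'⁻¹ := by
  have p1 : 0 < q := by by_contra h; nlinarith
  have p2 : 0 < q' := by by_contra h; nlinarith
  have i1 : q⁻¹ ≤ 2 * u := by rw [inv_le_iff_one_le_mul₀ p1]; exact hq
  have i2 : q'⁻¹ ≤ 2 * u := by rw [inv_le_iff_one_le_mul₀ p2]; exact hq'
  refine ⟨?_, ?_, ?_⟩
  · rw [abs_of_pos (by positivity)]; linarith
  · rw [abs_of_pos (by positivity)]; linarith
  · have : q⁻¹ - q'⁻¹ = -(q - q') * (q⁻¹ * q'⁻¹) := by field_simp; ring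
    rw [this, abs_mul, abs_neg, abs_of_pos (by positivity : 0 < q⁻¹ * q'⁻¹)]
    have h1 := mul_le_mul i1 i2 (by positivity) (by positivity)
    have h2 := mul_le_mul hd h1 (by positivity) ((abs_nonneg _).trans hd)
    calc _ ≤ _ := h2
      _ = _ := by ring

lemma Ty.ratio {u δ q q' a a' : ℝ} (hu : 0 < u) (hq : 1 ≤ 2 * u * q) (hq' : 1 ≤ 2 * u * q') (hd : |q - q'| ≤ δ)
    (ha : |a| ≤ q) (ha' : |a'| ≤ q') (hda : |a - a'| ≤ 3 * δ) : Ty u δ 8 0 (a * q⁻¹) (a' * q'⁻¹) := by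
  have p1 : 0 < q := by by_contra h; nlinarith
  have p2 : 0 < q' := by by_contra h; nlinarith
  have i1 : q⁻¹ ≤ 2 * u := by rw [inv_le_iff_one_le_mul₀ p1]; exact hq
  have hδ : 0 ≤ δ := (abs_nonneg _).trans hd
  have b : ∀ a q : ℝ, 0 < q → |a| ≤ q → |a * q⁻¹| ≤ 1 := by
    intro a q hq h
    rw [abs_mul, abs_of_pos (inv_pos.2 hq), ← div_eq_mul_inv, div_le_one hq]; exact h
  refine ⟨?_, ?_, ?_⟩
  · have := b a q p1 ha; rw [pow_zero, mul_one]; linarith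
  · have := b a' q' p2 ha'; rw [pow_zero, mul_one]; linarith
  · have : a * q⁻¹ - a' * q'⁻¹ = (a - a') * q⁻¹ + (a' * q'⁻¹) * (q' - q) * q⁻¹ := by field_simp; ring
    rw [this]
    refine (abs_add_le _ _).trans ?_
    rw [abs_mul, abs_mul, abs_mul, abs_of_pos (inv_pos.2 p1), abs_sub_comm q' q]
    have h1 : |a - a'| * q⁻¹ ≤ 3 * δ * (2 * u) := mul_le_mul hda i1 (by positivity) (by positivity)
    have h2 : |a' * q'⁻¹| * |q - q'| ≤ 1 * δ := mul_le_mul (b a' q' p2 ha') hd (abs_nonneg _) (by norm_num)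
    have h3 : |a' * q'⁻¹| * |q - q'| * q⁻¹ ≤ 1 * δ * (2 * u) := mul_le_mul h2 i1 (by positivity) (by positivity)
    simp only [zero_add, pow_one]
    linarith

lemma rpow_sqrt_inv {Q : ℝ} (hQ : 0 < Q) (m : ℕ) : Q ^ (-(m:ℝ) / 2) = (√Q)⁻¹ ^ m := by
  rw [Real.sqrt_eq_rpow, ← Real.rpow_neg hQ.le, ← Real.rpow_natCast, ← Real.rpow_mul hQ.le]
  congr 1; ring

lemma rpow_sqrt_inv2 {Q : ℝ} (hQ : 0 < Q) (m : ℕ) : Q ^ (-(m:ℝ) / 2 - 1) = (√Q)⁻¹ ^ m * (√Q)⁻¹ * (√Q)⁻¹ := by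
  have := rpow_sqrt_inv hQ (m + 2)
  rw [show (-(m:ℝ) / 2 - 1) = -((m + 2 : ℕ):ℝ) / 2 by push_cast; ring, this]; ring

lemma Q_eq_A (x y : En n) : qf (‖x‖ ^ 2) 1 x y = ‖x - y‖ ^ 2 + (1 - ‖x‖ ^ 2) * (1 - ‖y‖ ^ 2) := by
  rw [← qf_A]; unfold qf; ring

lemma Q_ge_A {x y : En n} (hx : ‖x‖ ≤ 1) (hy : ‖y‖ ≤ 1) : ‖x - y‖ ^ 2 ≤ qf (‖x‖ ^ 2) 1 x y := by
  rw [Q_eq_A]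
  have h1 : 0 ≤ 1 - ‖x‖ ^ 2 := by nlinarith [norm_nonneg x]
  have h2 : 0 ≤ 1 - ‖y‖ ^ 2 := by nlinarith [norm_nonneg y]
  nlinarith [mul_nonneg h1 h2]

lemma sqrtQ_vec (x y : En n) : ‖(‖x‖ ^ 2) • y - x‖ = ‖x‖ * √(qf (‖x‖ ^ 2) 1 x y) := by
  have h : ‖(‖x‖ ^ 2) • y - x‖ ^ 2 = ‖x‖ ^ 2 * qf (‖x‖ ^ 2) 1 x y := by
    rw [norm_sub_sq_real, norm_smul, inner_smul_left, Real.norm_of_nonneg (sq_nonneg _), real_inner_comm, ← dt_eq]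
    unfold qf; simp; ring
  rw [← Real.sqrt_sq (norm_nonneg ((‖x‖ ^ 2) • y - x)), h, Real.sqrt_mul (sq_nonneg _), Real.sqrt_sq (norm_nonneg _)]

lemma sqrtQ_lip {x x' y : En n} (hy : ‖y‖ ≤ 1) :
    |√(qf (‖x‖ ^ 2) 1 x y) - √(qf (‖x'‖ ^ 2) 1 x' y)| ≤ ‖x - x'‖ := by
  rw [qf_swap_Q x y, qf_swap_Q x' y]
  set q := √(qf (‖y‖ ^ 2) 1 y x) with hq
  set q' := √(qf (‖y‖ ^ 2) 1 y x') with hq'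
  have h0 : 0 ≤ q := Real.sqrt_nonneg _
  have h0' : 0 ≤ q' := Real.sqrt_nonneg _
  have h1 : q ^ 2 - q' ^ 2 = inner ℝ (x - x') (((‖y‖ ^ 2) • x - y) + ((‖y‖ ^ 2) • x' - y)) := by
    rw [hq, hq', Real.sq_sqrt (qf_Q_nn _ _), Real.sq_sqrt (qf_Q_nn _ _)]
    unfold qf
    simp only [dt_eq, inner_sub_left, inner_add_right, inner_sub_right, inner_smul_right, real_inner_self_eq_norm_sq]
    rw [real_inner_comm x x', real_inner_comm y x, real_inner_comm y x']; ring
  have h2 : |q ^ 2 - q' ^ 2| ≤ ‖x - x'‖ * (q + q') := by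
    rw [h1]
    refine (abs_real_inner_le_norm _ _).trans (mul_le_mul_of_nonneg_left ?_ (norm_nonneg _))
    refine (norm_add_le _ _).trans ?_
    rw [sqrtQ_vec, sqrtQ_vec]
    nlinarith
  rcases (add_nonneg h0 h0').eq_or_lt with h | h
  · have : q = 0 := by linarith
    have h' : q' = 0 := by linarith
    rw [this, h']; simp
  · rw [show q ^ 2 - q' ^ 2 = (q - q') * (q + q') by ring, abs_mul, abs_of_pos h] at h2
    exact le_of_mul_le_mul_right h2 h

lemma Ke0_eq {x y : En n} (hxy : x ≠ y) (hx : ‖x‖ ≤ 1) (hy : ‖y‖ ≤ 1) (i j : Fin n) :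
    Ke 0 i j x y = (-2 * n) * ((√(qf (‖x‖ ^ 2) 1 x y))⁻¹ ^ n * (((‖y‖ ^ 2 * x i - y i) * (√(qf (‖x‖ ^ 2) 1 x y))⁻¹) 
        * ((‖x‖ ^ 2 * y j - x j) * (√(qf (‖x‖ ^ 2) 1 x y))⁻¹)))
      + (√(qf (‖x‖ ^ 2) 1 x y))⁻¹ ^ n * (4 * x i * y j - 2 * (if i = j then 1 else 0))
      + ((-2 * n) * (‖x - y‖⁻¹ ^ n * (((x i - y i) * ‖x - y‖⁻¹) * ((x j - y j) * ‖x - y‖⁻¹)))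
      + ‖x - y‖⁻¹ ^ n * (2 * (if i = j then 1 else 0))) := by
  have hA : 0 < ‖x - y‖ := norm_pos_iff.2 (sub_ne_zero.2 hxy)
  have hQ : 0 < qf (‖x‖ ^ 2) 1 x y := lt_of_lt_of_le (by positivity) (Q_ge_A hx hy)
  unfold Ke
  rw [qf_A, add_zero, add_zero, rpow_sqrt_inv hQ, rpow_sqrt_inv2 hQ, rpow_sqrt_inv (by positivity), rpow_sqrt_inv2 (by positivity),
    Real.sqrt_sq hA.le]
  ring

lemma Ke_lip (i j : Fin n) : ∃ C, 0 ≤ C ∧ ∀ (x1 x x' y : En n) (ρ : ℝ), ‖x1‖ ≤ 1 → 0 < ρ → ‖x - x1‖ < ρ → ‖x' - x1‖ < ρ → 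
    ‖x‖ ≤ 1 → ‖x'‖ ≤ 1 → ‖y‖ ≤ 1 → 2 * ρ ≤ ‖y - x1‖ → 
    |Ke 0 i j x y - Ke 0 i j x' y| ≤ C * ‖x - x'‖ * (‖y - x1‖⁻¹) ^ (n + 1) := by
  refine ⟨2 * (2 * n) * (2 * pcst 4 n * (2 * 8 * 8)) + 2 * pcst 4 n * 12 + (2 * (2 * n) * (2 * pcst 4 n * (2 * 8 * 8)) + 2 * pcst 4 n * 2),
    by have := pcst_nn (C := 4) (by norm_num) n; positivity, ?_⟩
  intro x1 x x' y ρ hx1 hρ hx hx' hxn hxn' hy hd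
  have hp := pcst_nn (C := 4) (by norm_num) n
  set d := ‖y - x1‖ with hdd
  have hd0 : 0 < d := by linarith
  set u := d⁻¹ with hu
  have hu0 : 0 < u := inv_pos.2 hd0
  have hud : u * d = 1 := inv_mul_cancel₀ hd0.ne'
  have hd2 : d ≤ 2 := (norm_sub_le _ _).trans (by linarith)
  have hu2 : 1 ≤ 2 * u := by nlinarith
  set δ := ‖x - x'‖ with hδ
  have hδ0 : 0 ≤ δ := norm_nonneg _
  have far : ∀ z : En n, ‖z - x1‖ < ρ → d / 2 ≤ ‖z - y‖ := by
    intro z hz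
    have h1 : ‖y - x1‖ ≤ ‖z - y‖ + ‖z - x1‖ := by
      have : y - x1 = -(z - y) + (z - x1) := by abel
      rw [this]; refine (norm_add_le _ _).trans ?_; rw [norm_neg]
    linarith
  have fA : ∀ z : En n, ‖z - x1‖ < ρ → 1 ≤ 2 * u * ‖z - y‖ := by
    intro z hz; have := far z hz; nlinarith
  have fQ : ∀ z : En n, ‖z - x1‖ < ρ → ‖z‖ ≤ 1 → 1 ≤ 2 * u * √(qf (‖z‖ ^ 2) 1 z y) := by
    intro z hz hz1
    have h1 := fA z hz
    have h2 : ‖z - y‖ ≤ √(qf (‖z‖ ^ 2) 1 z y) := Real.le_sqrt_of_sq_le (Q_ge_A hz1 hy)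
    nlinarith
  have hne : ∀ z : En n, ‖z - x1‖ < ρ → z ≠ y := by
    intro z hz h; have := far z hz; rw [h, sub_self, norm_zero] at this; linarith
  rw [Ke0_eq (hne x hx) hxn hy, Ke0_eq (hne x' hx') hxn' hy]
  have lQ := sqrtQ_lip (x := x) (x' := x') hy
  have lA : |‖x - y‖ - ‖x' - y‖| ≤ δ := by
    refine (abs_norm_sub_norm_le _ _).trans ?_
    rw [sub_sub_sub_cancel_right]
  have tQ := Ty.pow hu0.le hδ0 (by norm_num) (Ty.inv hu0 (fQ x hx hxn) (fQ x' hx' hxn') lQ) n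
  have tA := Ty.pow hu0.le hδ0 (by norm_num) (Ty.inv hu0 (fA x hx) (fA x' hx') lA) n
  have cle : ∀ l, |x l - x' l| ≤ δ := fun l => abs_coord_le (x - x') l
  have bα : ∀ z : En n, ∀ l, |‖y‖ ^ 2 * z l - y l| ≤ √(qf (‖z‖ ^ 2) 1 z y) := by
    intro z l
    have h1 := abs_coord_le ((‖y‖ ^ 2) • z - y) l
    rw [sqrtQ_vec, ← qf_swap_Q] at h1
    simp only [PiLp.sub_apply, PiLp.smul_apply, smul_eq_mul] at h1
    nlinarith [Real.sqrt_nonneg (qf (‖z‖ ^ 2) 1 z y)]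
  have bβ : ∀ z : En n, ‖z‖ ≤ 1 → ∀ l, |‖z‖ ^ 2 * y l - z l| ≤ √(qf (‖z‖ ^ 2) 1 z y) := by
    intro z hz l
    have h1 := abs_coord_le ((‖z‖ ^ 2) • y - z) l
    rw [sqrtQ_vec] at h1
    simp only [PiLp.sub_apply, PiLp.smul_apply, smul_eq_mul] at h1
    nlinarith [Real.sqrt_nonneg (qf (‖z‖ ^ 2) 1 z y)]
  have hyl : ∀ l, |y l| ≤ 1 := fun l => (abs_coord_le y l).trans hy
  have hxl : ∀ l, |x l| ≤ 1 := fun l => (abs_coord_le x l).trans hxn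
  have hxl' : ∀ l, |x' l| ≤ 1 := fun l => (abs_coord_le x' l).trans hxn'
  have tα := Ty.ratio hu0 (fQ x hx hxn) (fQ x' hx' hxn') lQ (bα x i) (bα x' i) (by
    rw [show ‖y‖ ^ 2 * x i - y i - (‖y‖ ^ 2 * x' i - y i) = ‖y‖ ^ 2 * (x i - x' i) by ring, abs_mul, abs_of_nonneg (sq_nonneg _)]
    have : ‖y‖ ^ 2 ≤ 1 := by nlinarith [norm_nonneg y]
    nlinarith [cle i, abs_nonneg (x i - x' i)])
  have tβ := Ty.ratio hu0 (fQ x hx hxn) (fQ x' hx' hxn') lQ (bβ x hxn j) (bβ x' hxn' j) (by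
    rw [show ‖x‖ ^ 2 * y j - x j - (‖x'‖ ^ 2 * y j - x' j) = (‖x‖ - ‖x'‖) * (‖x‖ + ‖x'‖) * y j - (x j - x' j) by ring]
    refine (abs_sub _ _).trans ?_
    rw [abs_mul, abs_mul, abs_of_nonneg (by positivity : 0 ≤ ‖x‖ + ‖x'‖)]
    have h1 : |‖x‖ - ‖x'‖| ≤ δ := abs_norm_sub_norm_le x x'
    have h2 : |‖x‖ - ‖x'‖| * (‖x‖ + ‖x'‖) ≤ δ * 2 := mul_le_mul h1 (by linarith) (by positivity) hδ0
    have h3 : |‖x‖ - ‖x'‖| * (‖x‖ + ‖x'‖) * |y j| ≤ δ * 2 * 1 := mul_le_mul h2 (hyl j) (abs_nonneg _) (by positivity)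
    have := cle j
    linarith)
  have tγ : ∀ l, Ty u δ 8 0 ((x l - y l) * ‖x - y‖⁻¹) ((x' l - y l) * ‖x' - y‖⁻¹) := fun l =>
    Ty.ratio hu0 (fA x hx) (fA x' hx') lA (abs_coord_le (x - y) l) (abs_coord_le (x' - y) l) (by
      rw [show x l - y l - (x' l - y l) = x l - x' l by ring]; have := cle l; linarith)
  have dij : |(if i = j then (1:ℝ) else 0)| ≤ 1 := by split_ifs <;> simp
  have tc : Ty u δ 2 0 (2 * (if i = j then (1:ℝ) else 0)) (2 * (if i = j then (1:ℝ) else 0)) :=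
    Ty.const (by rw [abs_mul]; simp; split_ifs <;> simp) hδ0 hu0.le
  have tη : Ty u δ 12 0 (4 * x i * y j - 2 * (if i = j then (1:ℝ) else 0)) (4 * x' i * y j - 2 * (if i = j then (1:ℝ) else 0)) := by
    have b : ∀ z : En n, |z i| ≤ 1 → |4 * z i * y j - 2 * (if i = j then (1:ℝ) else 0)| ≤ 12 := by
      intro z hz
      refine (abs_sub _ _).trans ?_
      rw [abs_mul, abs_mul, abs_mul, abs_of_pos (by norm_num : (0:ℝ) < 4), abs_of_pos (by norm_num : (0:ℝ) < 2)]
      have := mul_le_mul hz (hyl j) (abs_nonneg _) (by norm_num)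
      linarith
    refine ⟨by simpa using b x (hxl i), by simpa using b x' (hxl' i), ?_⟩
    rw [show 4 * x i * y j - 2 * (if i = j then (1:ℝ) else 0) - (4 * x' i * y j - 2 * (if i = j then (1:ℝ) else 0)) = 4 * ((x i - x' i) * y j) by ring,
      abs_mul, abs_mul, abs_of_pos (by norm_num : (0:ℝ) < 4)]
    have := mul_le_mul (cle i) (hyl j) (abs_nonneg _) hδ0
    have h2 : δ ≤ δ * (2 * u) := by nlinarith
    simp only [zero_add, pow_one]
    linarith [mul_nonneg hδ0 hu0.le]
  have tn : Ty u δ (2 * n) 0 (-2 * (n:ℝ)) (-2 * (n:ℝ)) := Ty.const (by rw [abs_mul]; simp) hδ0 hu0.le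
  have n0 : (0:ℝ) ≤ 2 * n := by positivity
  have T1 := tn.mul hu0.le n0 (by positivity) (tQ.mul hu0.le hp (by norm_num) (tα.mul hu0.le (by norm_num) (by norm_num) tβ))
  have T2 := tQ.mul hu0.le hp (by norm_num) tη
  have T3 := tn.mul hu0.le n0 (by positivity) (tA.mul hu0.le hp (by norm_num) ((tγ i).mul hu0.le (by norm_num) (by norm_num) (tγ j)))
  have T4 := tA.mul hu0.le hp (by norm_num) tc
  simp only [add_zero, zero_add] at T1 T2 T3 T4
  exact ((T1.add T2).add (T3.add T4)).2.2

/-! ### Part 7: far field lemma -/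

/-- regularized kernel, jointly continuous -/
def Kr (n : ℕ) (ρ : ℝ) (i j : Fin n) (p : ℝ × En n × En n) : ℝ :=
  ((-(n:ℝ) / 2) * (max (qf (‖p.2.1‖ ^ 2) 1 p.2.1 p.2.2 + p.1) (ρ ^ 2)) ^ (-(n:ℝ) / 2 - 1) * (2 * ‖p.2.2‖ ^ 2 * p.2.1 i - 2 * p.2.2 i) * (2 * ‖p.2.1‖ ^ 2 * p.2.2 j - 2 * p.2.1 j)
    + (max (qf (‖p.2.1‖ ^ 2) 1 p.2.1 p.2.2 + p.1) (ρ ^ 2)) ^ (-(n:ℝ) / 2) * (4 * p.2.1 i * p.2.2 j - 2 * (if i = j then 1 else 0)))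
  - ((-(n:ℝ) / 2) * (max (qf 1 (‖p.2.1‖ ^ 2) p.2.1 p.2.2 + p.1) (ρ ^ 2)) ^ (-(n:ℝ) / 2 - 1) * (2 * p.2.1 i - 2 * p.2.2 i) * (2 * p.2.2 j - 2 * p.2.1 j)
    - (max (qf 1 (‖p.2.1‖ ^ 2) p.2.1 p.2.2 + p.1) (ρ ^ 2)) ^ (-(n:ℝ) / 2) * (2 * (if i = j then 1 else 0)))

lemma Kr_cont {ρ : ℝ} (hρ : 0 < ρ) (i j : Fin n) : Continuous (Kr n ρ i j) := by
  have hq : 0 < ρ ^ 2 := by positivity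
  have a1 : Continuous (fun p : ℝ × En n × En n => qf (‖p.2.1‖ ^ 2) 1 p.2.1 p.2.2) := qfQ_cont.comp continuous_snd
  have a2 : Continuous (fun p : ℝ × En n × En n => qf 1 (‖p.2.1‖ ^ 2) p.2.1 p.2.2) := qfA_cont.comp continuous_snd
  have b1 : ∀ r : ℝ, Continuous (fun p : ℝ × En n × En n => (max (qf (‖p.2.1‖ ^ 2) 1 p.2.1 p.2.2 + p.1) (ρ ^ 2)) ^ r) := fun r =>
    Continuous.rpow_const (by fun_prop) fun x => Or.inl (lt_of_lt_of_le hq (le_max_right _ _)).ne'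
  have b2 : ∀ r : ℝ, Continuous (fun p : ℝ × En n × En n => (max (qf 1 (‖p.2.1‖ ^ 2) p.2.1 p.2.2 + p.1) (ρ ^ 2)) ^ r) := fun r =>
    Continuous.rpow_const (by fun_prop) fun x => Or.inl (lt_of_lt_of_le hq (le_max_right _ _)).ne'
  have h1 := b1 (-(n:ℝ) / 2)
  have h2 := b2 (-(n:ℝ) / 2)
  have h3 := b1 (-(n:ℝ) / 2 - 1)
  have h4 := b2 (-(n:ℝ) / 2 - 1)
  unfold Kr
  fun_prop

lemma Kr_eq {ρ e : ℝ} (hρ : 0 < ρ) (he : 0 ≤ e) {x y : En n} (hx : ‖x‖ ≤ 1) (hy : ‖y‖ ≤ 1) (h : ρ ≤ ‖x - y‖) (i j : Fin n) :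
    Kr n ρ i j (e, x, y) = Ke e i j x y := by
  have h2 : ρ ^ 2 ≤ ‖x - y‖ ^ 2 := pow_le_pow_left₀ hρ.le h 2
  have h1 := Q_ge_A hx hy
  have e1 : max (qf (‖x‖ ^ 2) 1 x y + e) (ρ ^ 2) = qf (‖x‖ ^ 2) 1 x y + e := max_eq_left (by linarith)
  have e2 : max (qf 1 (‖x‖ ^ 2) x y + e) (ρ ^ 2) = qf 1 (‖x‖ ^ 2) x y + e := max_eq_left (by rw [qf_A]; linarith)
  unfold Kr Ke
  simp only [e1, e2]

lemma Kr_bdd {ρ : ℝ} (hρ : 0 < ρ) (i j : Fin n) : ∃ C, 0 ≤ C ∧ ∀ e x y, 0 ≤ e → e ≤ 1 → ‖x‖ ≤ 1 → ‖y‖ ≤ 1 → |Kr n ρ i j (e, x, y)| ≤ C := by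
  obtain ⟨C, hC⟩ := ((isCompact_Icc (a := (0:ℝ)) (b := 1)).prod 
    ((isCompact_closedBall (0 : En n) 1).prod (isCompact_closedBall (0 : En n) 1))).exists_bound_of_continuousOn
    (Kr_cont hρ i j).continuousOn
  refine ⟨|C|, abs_nonneg _, fun e x y h1 h2 h3 h4 => ?_⟩
  exact (hC (e, x, y) ⟨⟨h1, h2⟩, by simpa using h3, by simpa using h4⟩).trans (le_abs_self C)

lemma kr_lim {f : En n → ℝ} (hf : Integrable f (vB n)) {ρ : ℝ} (hρ : 0 < ρ) (i j : Fin n) {φ : En n → ℝ} (hφ : Continuous φ) :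
    Tendsto (fun k => ∫ y, f y * (∫ x, Kr n ρ i j (tj k ^ 2, x, y) * φ x ∂(vB n)) ∂(vB n)) atTop
      (nhds (∫ y, f y * (∫ x, Kr n ρ i j (0, x, y) * φ x ∂(vB n)) ∂(vB n))) := by
  obtain ⟨C, hC0, hC⟩ := Kr_bdd hρ i j
  have hK := Kr_cont hρ i j
  have ht : ∀ k, 0 ≤ tj k ^ 2 ∧ tj k ^ 2 ≤ 1 := fun k => ⟨sq_nonneg _, by have := tj_le k; have := tj_pos k; nlinarith⟩
  have hin : ∀ y ∈ ball (0 : En n) 1, ∀ k, |∫ x, Kr n ρ i j (tj k ^ 2, x, y) * φ x ∂(vB n)| ≤ ∫ x, C * |φ x| ∂(vB n) := by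
    intro y hy k
    rw [← Real.norm_eq_abs]
    refine norm_integral_le_of_norm_le (cont_int (by fun_prop)) ?_
    refine (ae_restrict_mem measurableSet_ball).mono fun x hx => ?_
    rw [norm_mul, Real.norm_eq_abs, Real.norm_eq_abs]
    gcongr
    exact hC _ _ _ (ht k).1 (ht k).2 (mem_ball_zero_iff.1 hx).le (mem_ball_zero_iff.1 hy).le
  have cm : ∀ k, Continuous (fun y => ∫ x, Kr n ρ i j (tj k ^ 2, x, y) * φ x ∂(vB n)) := by
    intro k
    have : ∀ y, ∫ x, Kr n ρ i j (tj k ^ 2, x, y) * φ x ∂(vB n) = ∫ x in closedBall (0 : En n) 1, Kr n ρ i j (tj k ^ 2, x, y) * φ x := by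
      intro y
      have : (ball (0 : En n) 1) =ᵐ[volume] closedBall (0 : En n) 1 := by
        by_cases hn : n = 0
        · subst hn
          exact i.elim0
        · have : Nonempty (Fin n) := ⟨i⟩
          exact ae_eq_of_subset_of_measure_ge ball_subset_closedBall 
            (by rw [Measure.addHaar_closedBall_eq_addHaar_ball]) measurableSet_ball.nullMeasurableSet measure_closedBall_lt_top.ne
      rw [vB, setIntegral_congr_set this]
    simp_rw [this]
    refine continuous_parametric_integral_of_continuous ?_ (isCompact_closedBall _ _)
    simp only [Function.uncurry_def]
    fun_prop
  refine tendsto_integral_of_dominated_convergence (fun y => |f y| * (∫ x, C * |φ x| ∂(vB n))) ?_ ?_ ?_ ?_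
  · intro k
    exact hf.aestronglyMeasurable.mul (cm k).aestronglyMeasurable
  · exact hf.abs.mul_const _
  · intro k
    refine (ae_restrict_mem measurableSet_ball).mono fun y hy => ?_
    rw [norm_mul, Real.norm_eq_abs, Real.norm_eq_abs]
    gcongr
    exact hin y hy k
  · refine (ae_restrict_mem measurableSet_ball).mono fun y hy => ?_
    refine Tendsto.const_mul _ ?_
    refine tendsto_integral_of_dominated_convergence (fun x => C * |φ x|) ?_ (cont_int (by fun_prop)) ?_ ?_
    · intro k
      have : Continuous fun x => Kr n ρ i j (tj k ^ 2, x, y) * φ x := by fun_prop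
      exact this.aestronglyMeasurable
    · intro k
      refine (ae_restrict_mem measurableSet_ball).mono fun x hx => ?_
      rw [norm_mul, Real.norm_eq_abs, Real.norm_eq_abs]
      gcongr
      exact hC _ _ _ (ht k).1 (ht k).2 (mem_ball_zero_iff.1 hx).le (mem_ball_zero_iff.1 hy).le
    · refine ae_of_all _ fun x => ?_
      have : Continuous fun e => Kr n ρ i j (e, x, y) * φ x := by fun_prop
      exact (this.tendsto 0).comp tj2_lim

lemma kint_cont {f : En n → ℝ} (hf : Integrable f (vB n)) {k : En n × En n → ℝ} (hk : Continuous k) :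
    Continuous (fun x => ∫ y, f y * k (x, y) ∂(vB n)) := by
  refine continuous_iff_continuousAt.2 fun x0 => ?_
  obtain ⟨C, hC⟩ := ((isCompact_closedBall x0 1).prod (isCompact_closedBall (0 : En n) 1)).exists_bound_of_continuousOn
    hk.continuousOn
  refine continuousAt_of_dominated (bound := fun y => |f y| * C) ?_ ?_ (hf.abs.mul_const _) ?_
  · refine Eventually.of_forall fun x => ?_
    exact (int_mul_cont hf (by fun_prop)).aestronglyMeasurable
  · filter_upwards [closedBall_mem_nhds x0 one_pos] with x hx
    refine (ae_restrict_mem measurableSet_ball).mono fun y hy => ?_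
    rw [norm_mul, Real.norm_eq_abs]
    gcongr
    exact hC (x, y) ⟨hx, ball_subset_closedBall hy⟩
  · refine ae_of_all _ fun y => ?_
    have : Continuous fun x => f y * k (x, y) := by fun_prop
    exact this.continuousAt

lemma TD.far_eq {F : Fin n → En n → ℝ} {w : En n → ℝ} {D : Fin n → En n → ℝ} (h : TD F w D) {x1 : En n} {ρ : ℝ} (hρ : 0 < ρ)
    (h0 : ∀ j, ∀ y ∈ ball x1 (2 * ρ), F j y = 0) (i : Fin n) {φ : En n → ℝ} (hφ : IsTestFun (ball x1 ρ ∩ ball 0 1) φ) :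
    ∫ x, (∑ j, ∫ y, F j y * Kr n ρ i j (0, x, y) ∂(vB n)) * φ x ∂(vB n) = (2 * n * kap n) * ∫ y, D i y * φ y ∂(vB n) := by
  have hφ' : IsTestFun (ball 0 1) φ := ⟨hφ.1, hφ.2.1, hφ.2.2.trans Set.inter_subset_right⟩
  have hφc : Continuous φ := hφ.1.continuous
  have hs : ∀ x, φ x ≠ 0 → x ∈ ball x1 ρ := fun x hx => (hφ.2.2 (subset_tsupport _ hx)).1
  have key := h.kernel_rhs hφ' i
  have e1 : ∀ k, ∫ y, w y * (∫ x, LG (tj k ^ 2) x y * pd i φ x ∂(vB n)) ∂(vB n) = 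
      ∑ j, ∫ y, F j y * (∫ x, Kr n ρ i j (tj k ^ 2, x, y) * φ x ∂(vB n)) ∂(vB n) := by
    intro k
    rw [← h.kernel_id (by have := tj_pos k; positivity) hφ'.gz i]
    refine Finset.sum_congr rfl fun j _ => ?_
    refine integral_congr_ae ((ae_restrict_mem measurableSet_ball).mono fun y hy => ?_)
    by_cases hy2 : y ∈ ball x1 (2 * ρ)
    · simp [h0 j y hy2]
    dsimp only
    congr 1
    refine integral_congr_ae ((ae_restrict_mem measurableSet_ball).mono fun x hx => ?_)
    by_cases hx0 : φ x = 0
    · simp [hx0]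
    dsimp only
    rw [Kr_eq hρ (sq_nonneg _) (mem_ball_zero_iff.1 hx).le (mem_ball_zero_iff.1 hy).le]
    have h1 := hs x hx0
    rw [mem_ball, dist_eq_norm] at h1 hy2
    have : ‖y - x1‖ ≤ ‖x - y‖ + ‖x - x1‖ := by
      have : y - x1 = -(x - y) + (x - x1) := by abel
      rw [this]; refine (norm_add_le _ _).trans ?_; rw [norm_neg]
    linarith
  simp_rw [e1] at key
  have l2 := tendsto_finsetSum Finset.univ fun j _ => kr_lim (l2_l1 (h.hF j)) hρ i j hφc
  rw [tendsto_nhds_unique key l2]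
  have e2 : ∀ j, ∫ y, F j y * (∫ x, Kr n ρ i j (0, x, y) * φ x ∂(vB n)) ∂(vB n) = 
      ∫ x, (∫ y, F j y * Kr n ρ i j (0, x, y) ∂(vB n)) * φ x ∂(vB n) := by
    intro j
    have hk : Continuous fun p : En n × En n => Kr n ρ i j (0, p) := by have := Kr_cont hρ i j; fun_prop
    exact (fub (l2_l1 (h.hF j)) hk hφc).symm
  simp_rw [e2, Finset.sum_mul]
  rw [integral_finsetSum]
  intro j _
  have hk : Continuous fun p : En n × En n => Kr n ρ i j (0, p) := by have := Kr_cont hρ i j; fun_prop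
  exact cont_int ((kint_cont (l2_l1 (h.hF j)) hk).mul hφc)

/-- far field estimate -/
lemma TD.far (n : ℕ) : ∃ C, 0 ≤ C ∧ ∀ (F : Fin n → En n → ℝ) (w : En n → ℝ) (D : Fin n → En n → ℝ), TD F w D → ∀ (x1 : En n) (ρ : ℝ),
    ‖x1‖ ≤ 1 → 0 < ρ → (∀ j, ∀ y ∈ ball x1 (2 * ρ), F j y = 0) → ∀ i, ∃ c, ∀ᵐ x ∂(vB n), x ∈ ball x1 ρ → 
      |D i x - c| ≤ C * ρ * ∑ j, ∫ y, |F j y| * ‖y - x1‖⁻¹ ^ (n + 1) ∂(vB n) := by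
  choose Cl hCl0 hCl using fun i : Fin n => fun j : Fin n => Ke_lip i j
  have hCs : ∀ i j, Cl i j ≤ ∑ i', ∑ j', Cl i' j' := by
    intro i j
    refine (Finset.single_le_sum (f := fun j' => Cl i j') (fun j' _ => hCl0 i j') (Finset.mem_univ j)).trans ?_
    exact Finset.single_le_sum (f := fun i' => ∑ j', Cl i' j') (fun i' _ => Finset.sum_nonneg fun j' _ => hCl0 i' j') (Finset.mem_univ i)
  have hS0 : 0 ≤ ∑ i', ∑ j', Cl i' j' := Finset.sum_nonneg fun i' _ => Finset.sum_nonneg fun j' _ => hCl0 i' j'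
  set S := ∑ i', ∑ j', Cl i' j' with hS
  have hk0 : 0 < kap n := kap_pos
  refine ⟨(2 * n * kap n)⁻¹ * (S * 2), by positivity, ?_⟩
  intro F w D h x1 ρ hx1 hρ h0 i
  have hn : 0 < n := i.pos
  have hn' : (0:ℝ) < n := by exact_mod_cast hn
  set K := 2 * n * kap n with hK
  have hKp : 0 < K := by positivity
  set H : En n → ℝ := fun x => ∑ j, ∫ y, F j y * Kr n ρ i j (0, x, y) ∂(vB n) with hH
  have hHc : Continuous H := by
    refine continuous_finsetSum _ fun j _ => ?_
    have hk : Continuous fun p : En n × En n => Kr n ρ i j (0, p) := by have := Kr_cont hρ i j; fun_prop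
    exact kint_cont (l2_l1 (h.hF j)) hk
  have hU : IsOpen (ball x1 ρ ∩ ball (0 : En n) 1) := isOpen_ball.inter isOpen_ball
  have hae := hU.ae_eq_zero_of_integral_contDiff_smul_eq_zero (μ := volume) (f := fun x => K * D i x - H x) ?_ ?_
  rotate_left
  · refine IntegrableOn.locallyIntegrableOn ?_
    have i1 : IntegrableOn (fun x => K * D i x - H x) (ball 0 1) volume := by
      have a1 : Integrable (D i) (vB n) := l2_l1 (h.hD i)
      exact (a1.const_mul K).sub (cont_int hHc)
    exact i1.mono_set Set.inter_subset_right
  · intro φ p1 p2 p3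
    have hφ : IsTestFun (ball x1 ρ ∩ ball 0 1) φ := ⟨p1, p2, p3⟩
    have e := h.far_eq hρ h0 i hφ
    have a1 : Integrable (D i) (vB n) := l2_l1 (h.hD i)
    have hφc : Continuous φ := hφ.1.continuous
    have e2 : ∫ x, φ x • (K * D i x - H x) = ∫ x, φ x • (K * D i x - H x) ∂(vB n) := by
      rw [vB, setIntegral_eq_integral_of_forall_compl_eq_zero]
      intro x hx
      have : φ x = 0 := by
        by_contra hne
        exact hx (p3 (subset_tsupport _ hne)).2
      simp [this]
    rw [e2]
    have e3 : ∀ x, φ x • (K * D i x - H x) = K * (D i x * φ x) - H x * φ x := by intro x; simp only [smul_eq_mul]; ring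
    simp_rw [e3]
    have i2 : Integrable (fun x => H x * φ x) (vB n) := cont_int (hHc.mul hφc)
    rw [integral_sub ((int_mul_cont a1 hφc).const_mul K) i2, integral_const_mul]
    rw [← e]; simp [hH]
  by_cases hne : (ball x1 ρ ∩ ball (0 : En n) 1).Nonempty
  swap
  · refine ⟨0, (ae_restrict_mem measurableSet_ball).mono fun x hx hx2 => (hne ⟨x, hx2, hx⟩).elim⟩
  obtain ⟨xs, hxs1, hxs2⟩ := hne
  refine ⟨K⁻¹ * H xs, ?_⟩
  filter_upwards [ae_restrict_mem measurableSet_ball, ae_restrict_of_ae hae] with x hx hx2 hx3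
  have hD : D i x = K⁻¹ * H x := by
    have := hx2 ⟨hx3, hx⟩
    field_simp; linarith
  rw [hD, ← mul_sub, abs_mul, abs_of_pos (inv_pos.2 hKp)]
  have : |H x - H xs| ≤ S * 2 * ρ * ∑ j, ∫ y, |F j y| * ‖y - x1‖⁻¹ ^ (n + 1) ∂(vB n) := by
    rw [hH, ← Finset.sum_sub_distrib, Finset.mul_sum]
    refine (Finset.abs_sum_le_sum_abs _ _).trans (Finset.sum_le_sum fun j _ => ?_)
    have hFi := l2_l1 (h.hF j)
    have hkx : ∀ x, Integrable (fun y => F j y * Kr n ρ i j (0, x, y)) (vB n) := fun x => 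
      int_mul_cont hFi (by have := Kr_cont hρ i j; fun_prop)
    rw [← integral_sub (hkx x) (hkx xs), ← Real.norm_eq_abs, ← integral_const_mul]
    refine norm_integral_le_of_norm_le ?_ ?_
    · refine Integrable.const_mul ?_ _
      refine Integrable.mono' (hFi.abs.mul_const ((2 * ρ)⁻¹ ^ (n + 1))) ?_ (ae_of_all _ fun y => ?_)
      · refine hFi.aestronglyMeasurable.norm.mul ?_
        have : Measurable fun y : En n => ‖y - x1‖⁻¹ ^ (n + 1) := by fun_prop
        exact this.aestronglyMeasurable
      · rw [norm_mul, Real.norm_eq_abs, abs_abs, Real.norm_of_nonneg (by positivity)]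
        by_cases hy : y ∈ ball x1 (2 * ρ)
        · simp [h0 j y hy]
        rw [mem_ball, dist_eq_norm, not_lt] at hy
        gcongr
    · refine (ae_restrict_mem measurableSet_ball).mono fun y hy => ?_
      by_cases hy2 : y ∈ ball x1 (2 * ρ)
      · simp [h0 j y hy2]
      rw [mem_ball, dist_eq_norm, not_lt] at hy2
      have hyn := (mem_ball_zero_iff.1 hy).le
      have g : ∀ z ∈ ball x1 ρ, ‖z‖ ≤ 1 → Kr n ρ i j (0, z, y) = Ke 0 i j z y := by
        intro z hz hz1
        refine Kr_eq hρ le_rfl hz1 hyn ?_ i j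
        rw [mem_ball, dist_eq_norm] at hz
        have : ‖y - x1‖ ≤ ‖z - y‖ + ‖z - x1‖ := by
          have : y - x1 = -(z - y) + (z - x1) := by abel
          rw [this]; refine (norm_add_le _ _).trans ?_; rw [norm_neg]
        linarith
      have n1 := (mem_ball_zero_iff.1 hx).le
      have n2 := (mem_ball_zero_iff.1 hxs2).le
      rw [← mul_sub, norm_mul, g x hx3 n1, g xs hxs1 n2, Real.norm_eq_abs, Real.norm_eq_abs]
      rw [mem_ball, dist_eq_norm] at hx3 hxs1
      have hl := hCl i j x1 x xs y ρ hx1 hρ hx3 hxs1 n1 n2 hyn hy2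
      have hxx : ‖x - xs‖ ≤ 2 * ρ := by
        have : x - xs = (x - x1) - (xs - x1) := by abel
        rw [this]; refine (norm_sub_le _ _).trans ?_; linarith
      calc |F j y| * |Ke 0 i j x y - Ke 0 i j xs y| ≤ |F j y| * (S * (2 * ρ) * ‖y - x1‖⁻¹ ^ (n + 1)) := by
            refine mul_le_mul_of_nonneg_left (hl.trans ?_) (abs_nonneg _)
            gcongr
            exact hCs i j
        _ = _ := by ring
  calc K⁻¹ * |H x - H xs| ≤ K⁻¹ * _ := mul_le_mul_of_nonneg_left this (inv_pos.2 hKp).le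
    _ = _ := by ring

/-! ### Part 8: Campanato classes on the unit ball -/

/-- Campanato-type control of a scalar function on the unit ball -/
structure Cm (lam : ℝ) (z : En n → ℝ) (M : ℝ) : Prop where
  l2 : MemLp z 2 (vB n)
  nn : 0 ≤ M
  tot : ∫ x, z x ^ 2 ∂(vB n) ≤ M ^ 2
  osc : ∀ x1 : En n, ‖x1‖ ≤ 1 → ∀ ρ, 0 < ρ → ∃ c, ∫ x in ball x1 ρ, (z x - c) ^ 2 ∂(vB n) ≤ M ^ 2 * ρ ^ lam

def om (n : ℕ) : ℝ := volume.real (ball (0 : En n) 1)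

lemma om_pos : 0 < om n := by
  unfold om
  exact ENNReal.toReal_pos (measure_ball_pos _ _ one_pos).ne' measure_ball_lt_top.ne

lemma vol_ball (x : En n) {r : ℝ} (hr : 0 < r) : volume.real (ball x r) = om n * r ^ n := by
  unfold om Measure.real
  rw [Measure.addHaar_ball_of_pos _ _ hr, ENNReal.toReal_mul, ENNReal.toReal_ofReal (by positivity)]
  simp [mul_comm]

lemma vB_ball_le (x : En n) {r : ℝ} (hr : 0 < r) : (vB n).real (ball x r) ≤ om n * r ^ n := by
  rw [← vol_ball x hr]
  exact ENNReal.toReal_mono measure_ball_lt_top.ne (Measure.restrict_apply_le _ _)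

lemma vB_ball_ge {x : En n} (hx : ‖x‖ ≤ 1) {r : ℝ} (hr : 0 < r) (hr8 : r ≤ 8) : om n * (r / 8) ^ n ≤ (vB n).real (ball x r) := by
  rw [← vol_ball ((1 - r / 8) • x) (by positivity)]
  unfold Measure.real
  refine ENNReal.toReal_mono (measure_ne_top _ _) ?_
  rw [vB, Measure.restrict_apply measurableSet_ball]
  refine measure_mono fun y hy => ?_
  rw [mem_ball, dist_eq_norm] at hy
  have h1 : ‖(1 - r / 8) • x‖ ≤ 1 - r / 8 := by
    rw [norm_smul, Real.norm_of_nonneg (by linarith)]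
    nlinarith [norm_nonneg x]
  constructor
  · rw [mem_ball, dist_eq_norm]
    have : y - x = (y - (1 - r / 8) • x) + (-(r / 8)) • x := by module
    rw [this]
    refine (norm_add_le _ _).trans_lt ?_
    rw [norm_smul, norm_neg, Real.norm_of_nonneg (by positivity)]
    nlinarith [norm_nonneg x]
  · rw [mem_ball_zero_iff]
    have : y = (y - (1 - r / 8) • x) + (1 - r / 8) • x := by abel
    rw [this]
    refine (norm_add_le _ _).trans_lt ?_
    linarith

lemma l2_sub_const {z : En n → ℝ} (hz : MemLp z 2 (vB n)) (c : ℝ) : MemLp (fun x => z x - c) 2 (vB n) :=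
  hz.sub (memLp_const c)

lemma l2_sq_int {z : En n → ℝ} (hz : MemLp z 2 (vB n)) (c : ℝ) (s : Set (En n)) :
    Integrable (fun x => (z x - c) ^ 2) ((vB n).restrict s) :=
  (l2_sub_const hz c).integrable_sq.restrict

lemma osc_cmp {z : En n → ℝ} (hz : MemLp z 2 (vB n)) (s : Set (En n)) (a b : ℝ) :
    (a - b) ^ 2 * (vB n).real s ≤ 2 * ∫ x in s, (z x - a) ^ 2 ∂(vB n) + 2 * ∫ x in s, (z x - b) ^ 2 ∂(vB n) := by
  have h : (a - b) ^ 2 * (vB n).real s = ∫ x in s, (a - b) ^ 2 ∂(vB n) := by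
    rw [setIntegral_const, smul_eq_mul, mul_comm]
  rw [h, ← integral_const_mul, ← integral_const_mul, ← integral_add ((l2_sq_int hz a s).const_mul 2) ((l2_sq_int hz b s).const_mul 2)]
  refine integral_mono (integrable_const _) (((l2_sq_int hz a s).const_mul 2).add ((l2_sq_int hz b s).const_mul 2)) fun x => ?_
  dsimp only [Pi.add_apply]
  nlinarith [sq_nonneg ((z x - a) + (z x - b))]

lemma sq_int_mono {z : En n → ℝ} (hz : MemLp z 2 (vB n)) (c : ℝ) {s t : Set (En n)} (h : s ⊆ t) :
    ∫ x in s, (z x - c) ^ 2 ∂(vB n) ≤ ∫ x in t, (z x - c) ^ 2 ∂(vB n) :=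
  setIntegral_mono_set (l2_sq_int hz c t) (ae_of_all _ fun x => sq_nonneg _) (ae_of_all _ h)

/-- exponent -/
def th (n : ℕ) (lam : ℝ) : ℝ := (n + 2 - lam) / 2
def sg (n : ℕ) (lam : ℝ) : ℝ := min (th n lam) (1 / 2)

lemma th_pos {lam : ℝ} (h : lam < n + 2) : 0 < th n lam := by unfold th; linarith
lemma sg_pos {lam : ℝ} (h : lam < n + 2) : 0 < sg n lam := lt_min (th_pos h) (by norm_num)
lemma sg_le {lam : ℝ} : sg n lam ≤ th n lam := min_le_left _ _
lemma sg_half {lam : ℝ} : sg n lam ≤ 1 / 2 := min_le_right _ _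

lemma tel_step (n : ℕ) {lam : ℝ} (h0 : 0 ≤ lam) : ∃ C, 0 ≤ C ∧ ∀ (z : En n → ℝ) (M : ℝ), Cm lam z M → ∀ x1 : En n, ‖x1‖ ≤ 1 →
    ∀ r r', 0 < r → r ≤ 4 → r ≤ r' → r' ≤ 2 * r → ∀ a b, 
    ∫ x in ball x1 r, (z x - a) ^ 2 ∂(vB n) ≤ M ^ 2 * r ^ lam → ∫ x in ball x1 r', (z x - b) ^ 2 ∂(vB n) ≤ M ^ 2 * r' ^ lam → 
    |a - b| ≤ C * M * r ^ (1 - th n lam) := by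
  have ho := om_pos (n := n)
  set K : ℝ := 2 * (1 + 2 ^ lam) * (8 ^ n / om n) with hK
  have hKn : 0 ≤ K := by positivity
  refine ⟨√K, Real.sqrt_nonneg _, ?_⟩
  intro z M hz x1 hx1 r r' hr hr4 hrr hrr' a b ha hb
  have h1 := osc_cmp hz.l2 (ball x1 r) a b
  have h2 := (sq_int_mono hz.l2 b (ball_subset_ball (x := x1) hrr)).trans hb
  have h3 := vB_ball_ge hx1 hr (by linarith)
  have h4 : r' ^ lam ≤ 2 ^ lam * r ^ lam := by
    rw [← Real.mul_rpow (by norm_num) hr.le]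
    exact Real.rpow_le_rpow (by linarith) hrr' h0
  have hM := hz.nn
  have hrl : 0 < r ^ lam := Real.rpow_pos_of_pos hr _
  have h5 : (a - b) ^ 2 * (om n * (r / 8) ^ n) ≤ 2 * (1 + 2 ^ lam) * M ^ 2 * r ^ lam := by
    have : M ^ 2 * r' ^ lam ≤ M ^ 2 * (2 ^ lam * r ^ lam) := by gcongr
    have : (a - b) ^ 2 * (om n * (r / 8) ^ n) ≤ (a - b) ^ 2 * (vB n).real (ball x1 r) := by gcongr
    nlinarith
  have h6 : (r ^ (1 - th n lam)) ^ 2 * r ^ n = r ^ lam := by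
    rw [← Real.rpow_natCast, ← Real.rpow_natCast, ← Real.rpow_mul hr.le, ← Real.rpow_add hr]
    congr 1; unfold th; push_cast; ring
  have h7 : (a - b) ^ 2 ≤ (√K * M * r ^ (1 - th n lam)) ^ 2 := by
    have hp : 0 < om n * (r / 8) ^ n := by positivity
    refine le_of_mul_le_mul_right (h5.trans (le_of_eq ?_)) hp
    rw [mul_pow, mul_pow, Real.sq_sqrt hKn, ← h6, hK, div_pow]
    field_simp
  exact abs_le_of_sq_le_sq h7 (by positivity)

lemma tel (n : ℕ) {lam : ℝ} (h0 : 0 ≤ lam) : ∃ C, 0 ≤ C ∧ ∀ (z : En n → ℝ) (M : ℝ), Cm lam z M → ∀ x1 : En n, ‖x1‖ ≤ 1 →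
    ∀ r, 0 < r → ∀ a, ∫ x in ball x1 r, (z x - a) ^ 2 ∂(vB n) ≤ M ^ 2 * r ^ lam → 
    ∀ l : ℕ, 2 ^ l * r ≤ 4 → ∀ b, ∫ x in ball x1 (2 ^ l * r), (z x - b) ^ 2 ∂(vB n) ≤ M ^ 2 * (2 ^ l * r) ^ lam → 
    |b - a| ≤ C * M * r ^ (sg n lam - th n lam) * (2 ^ l * r) ^ (1 - sg n lam) := by
  obtain ⟨C1, hC1, hs⟩ := tel_step n h0
  refine ⟨3 * C1, by positivity, ?_⟩
  intro z M hz x1 hx1 r hr a ha l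
  have hM := hz.nn
  induction l with
  | zero =>
    intro hl b hb
    simp only [pow_zero, one_mul] at hl hb ⊢
    have := hs z M hz x1 hx1 r r hr hl le_rfl (by linarith) a b ha hb
    rw [abs_sub_comm]
    have e : r ^ (sg n lam - th n lam) * r ^ (1 - sg n lam) = r ^ (1 - th n lam) := by
      rw [← Real.rpow_add hr]; congr 1; ring
    rw [mul_assoc, e]
    refine this.trans ?_
    have : 0 ≤ C1 * M * r ^ (1 - th n lam) := by positivity
    linarith
  | succ l ih =>
    intro hl b hb
    have e2 : (2:ℝ) ^ (l + 1) * r = 2 * (2 ^ l * r) := by ring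
    rw [e2] at hl hb ⊢
    set s := (2:ℝ) ^ l * r with hs'
    have hs0 : 0 < s := by positivity
    have hrs : r ≤ s := by
      have : (1:ℝ) ≤ 2 ^ l := one_le_pow₀ (by norm_num)
      nlinarith
    obtain ⟨c, hc⟩ := hz.osc x1 hx1 s hs0
    have i1 := ih (by linarith) c hc
    have i2 := hs z M hz x1 hx1 s (2 * s) hs0 (by linarith) (by linarith) le_rfl c b hc hb
    have hσ := sg_half (n := n) (lam := lam)
    have hσt := sg_le (n := n) (lam := lam)
    have e3 : s ^ (1 - th n lam) ≤ s ^ (1 - sg n lam) * r ^ (sg n lam - th n lam) := by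
      have : s ^ (1 - th n lam) = s ^ (1 - sg n lam) * s ^ (sg n lam - th n lam) := by
        rw [← Real.rpow_add hs0]; congr 1; ring
      rw [this]
      gcongr ?_ * ?_
      exact Real.rpow_le_rpow_of_nonpos hr hrs (by linarith)
    have e4 : (4/3 : ℝ) * s ^ (1 - sg n lam) ≤ (2 * s) ^ (1 - sg n lam) := by
      rw [Real.mul_rpow (by norm_num) hs0.le]
      gcongr
      have h2 : (2:ℝ) ^ (1/2 : ℝ) ≤ 2 ^ (1 - sg n lam) := Real.rpow_le_rpow_of_exponent_le (by norm_num) (by linarith)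
      refine le_trans ?_ h2
      rw [← Real.sqrt_eq_rpow]
      exact Real.le_sqrt_of_sq_le (by norm_num)
    have hA : 0 ≤ r ^ (sg n lam - th n lam) := by positivity
    have hB : 0 ≤ s ^ (1 - sg n lam) := by positivity
    set A := r ^ (sg n lam - th n lam)
    set S := s ^ (1 - sg n lam)
    set S2 := (2 * s) ^ (1 - sg n lam)
    have t1 : |b - a| ≤ |c - a| + |c - b| := by
      have : b - a = (c - a) - (c - b) := by ring
      rw [this]; exact abs_sub _ _
    have t2 : C1 * M * s ^ (1 - th n lam) ≤ C1 * M * (S * A) := by gcongr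
    have t3 : 3 * C1 * M * A * (4 / 3 * S) ≤ 3 * C1 * M * A * S2 := by gcongr
    nlinarith

lemma tel_abs (n : ℕ) {lam : ℝ} (h0 : 0 ≤ lam) (h1 : lam < n + 2) : ∃ C, 0 ≤ C ∧ ∀ (z : En n → ℝ) (M : ℝ), Cm lam z M → ∀ x1 : En n, ‖x1‖ ≤ 1 →
    ∀ r, 0 < r → r ≤ 2 → ∀ a, ∫ x in ball x1 r, (z x - a) ^ 2 ∂(vB n) ≤ M ^ 2 * r ^ lam → 
    |a| ≤ C * M * r ^ (sg n lam - th n lam) := by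
  obtain ⟨C, hC, ht⟩ := tel n h0
  refine ⟨C * 4, by positivity, ?_⟩
  intro z M hz x1 hx1 r hr hr2 a ha
  obtain ⟨l, hl1, hl2⟩ := exists_nat_pow_near (x := 4 / r) (y := 2) (by rw [le_div_iff₀ hr]; linarith) (by norm_num)
  rw [le_div_iff₀ hr] at hl1
  rw [div_lt_iff₀ hr, pow_succ] at hl2
  have hM := hz.nn
  have h := ht z M hz x1 hx1 r hr a ha l hl1 0 ?_
  · rw [zero_sub, abs_neg] at h
    refine h.trans ?_
    have : ((2:ℝ) ^ l * r) ^ (1 - sg n lam) ≤ 4 := by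
      have g1 : ((2:ℝ) ^ l * r) ^ (1 - sg n lam) ≤ ((2:ℝ) ^ l * r) ^ (1:ℝ) := 
        Real.rpow_le_rpow_of_exponent_le (by linarith) (by linarith [sg_pos (n := n) h1])
      rw [Real.rpow_one] at g1; linarith
    calc _ ≤ C * M * r ^ (sg n lam - th n lam) * 4 := by gcongr
      _ = _ := by ring
  · have g2 : 1 ≤ ((2:ℝ) ^ l * r) ^ lam := Real.one_le_rpow (by linarith) h0
    calc _ ≤ ∫ x, (z x - 0) ^ 2 ∂(vB n) := setIntegral_le_integral (l2_sub_const hz.l2 0).integrable_sq (ae_of_all _ fun x => sq_nonneg _)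
      _ ≤ M ^ 2 := by simpa using hz.tot
      _ ≤ _ := by nlinarith [sq_nonneg M]

lemma int_abs_le {z : En n → ℝ} (hz : MemLp z 2 (vB n)) (c : ℝ) (s : Set (En n)) :
    ∫ x in s, |z x - c| ∂(vB n) ≤ √((vB n).real s) * √(∫ x in s, (z x - c) ^ 2 ∂(vB n)) := by
  have h := l2_cs' (μ := (vB n).restrict s) (f := fun _ => (1:ℝ)) (g := fun x => |z x - c|) (memLp_const _)
    ((l2_sub_const hz c).restrict s).abs
  simp only [one_mul, one_pow, sq_abs, integral_const, smul_eq_mul, mul_one, Measure.real, Measure.restrict_apply_univ] at h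
  exact (le_abs_self _).trans h

set_option maxHeartbeats 1000000 in
lemma tel_far (n : ℕ) {lam : ℝ} (h0 : 0 ≤ lam) (h1 : lam < n + 2) : ∃ C, 0 ≤ C ∧ ∀ (z : En n → ℝ) (M : ℝ), Cm lam z M → ∀ x1 : En n, ‖x1‖ ≤ 1 →
    ∀ r, 0 < r → ∀ a, ∫ x in ball x1 r, (z x - a) ^ 2 ∂(vB n) ≤ M ^ 2 * r ^ lam → 
    ∫ y in (ball x1 r)ᶜ, |z y - a| * ‖y - x1‖⁻¹ ^ (n + 1) ∂(vB n) ≤ C * M * r ^ (-th n lam) := by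
  obtain ⟨C, hC, ht⟩ := tel n h0
  have ho := om_pos (n := n)
  have hσ := sg_pos (n := n) h1
  have hσt := sg_le (n := n) (lam := lam)
  set σ := sg n lam with hσd
  set θ := th n lam with hθd
  set K : ℝ := √(om n) * 2 ^ (n / 2 + lam / 2 : ℝ) + om n * (C * 2 * 2 ^ n) with hK
  have hK0 : 0 ≤ K := by positivity
  have hq1 : (2:ℝ) ^ (-σ) < 1 := Real.rpow_lt_one_of_one_lt_of_neg (by norm_num) (by linarith)
  have hq0 : (0:ℝ) < (2:ℝ) ^ (-σ) := by positivity
  set q := (2:ℝ) ^ (-σ) with hq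
  refine ⟨K * (1 - q)⁻¹, by have : 0 < 1 - q := by linarith
                            positivity, ?_⟩
  intro z M hz x1 hx1 r hr a ha
  have hM := hz.nn
  have hintg : ∀ s : Set (En n), MeasurableSet s → IntegrableOn (fun y => |z y - a| * ‖y - x1‖⁻¹ ^ (n + 1)) (s \ ball x1 r) (vB n) := by
    intro s hs
    have i1 : IntegrableOn (fun y => |z y - a|) (s \ ball x1 r) (vB n) := (l2_l1 (l2_sub_const hz.l2 a)).abs.restrict
    refine Integrable.mono' (i1.mul_const (r⁻¹ ^ (n + 1))) ?_ ?_
    · refine i1.aestronglyMeasurable.mul ?_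
      have : Measurable fun y : En n => ‖y - x1‖⁻¹ ^ (n + 1) := by fun_prop
      exact this.aestronglyMeasurable
    · refine (ae_restrict_mem (hs.diff measurableSet_ball)).mono fun y hy => ?_
      have hy2 := hy.2
      rw [mem_ball, dist_eq_norm, not_lt] at hy2
      rw [norm_mul, Real.norm_eq_abs, abs_abs, Real.norm_of_nonneg (by positivity)]
      gcongr
  have main : ∀ l : ℕ, 2 ^ l * r ≤ 4 → ∫ y in ball x1 (2 ^ l * r) \ ball x1 r, |z y - a| * ‖y - x1‖⁻¹ ^ (n + 1) ∂(vB n) ≤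
      K * M * r ^ (-θ) * ∑ j ∈ Finset.range l, q ^ j := by
    intro l
    induction l with
    | zero => intro _; simp
    | succ l ih =>
      intro hl
      have e2 : (2:ℝ) ^ (l + 1) * r = 2 * (2 ^ l * r) := by ring
      obtain ⟨c, hc⟩ := hz.osc x1 hx1 (2 ^ (l + 1) * r) (by positivity)
      have hca := ht z M hz x1 hx1 r hr a ha (l + 1) hl c hc
      rw [e2] at hl hc hca ⊢
      set s := (2:ℝ) ^ l * r with hs'
      have hs0 : 0 < s := by positivity
      have hrs : r ≤ s := by
        have : (1:ℝ) ≤ 2 ^ l := one_le_pow₀ (by norm_num)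
        nlinarith
      have i1 := ih (by linarith)
      have hsplit : ball x1 (2 * s) \ ball x1 r = (ball x1 s \ ball x1 r) ∪ (ball x1 (2 * s) \ ball x1 s) := by
        ext y
        simp only [Set.mem_sdiff, Set.mem_union, mem_ball]
        constructor
        · rintro ⟨a1, a2⟩
          by_cases h : dist y x1 < s
          · exact Or.inl ⟨h, a2⟩
          · exact Or.inr ⟨a1, h⟩
        · rintro (⟨a1, a2⟩ | ⟨a1, a2⟩)
          · exact ⟨by linarith, a2⟩
          · exact ⟨a1, fun h => a2 (by linarith)⟩
      have hsub : ball x1 (2 * s) \ ball x1 s ⊆ ball x1 (2 * s) \ ball x1 r := 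
        Set.sdiff_subset_sdiff_right (ball_subset_ball hrs)
      rw [hsplit, setIntegral_union ?_ (measurableSet_ball.diff measurableSet_ball) (hintg _ measurableSet_ball) 
        ((hintg _ measurableSet_ball).mono_set hsub)]
      swap
      · exact Set.disjoint_left.2 fun y hy hy2 => hy2.2 hy.1
      rw [Finset.sum_range_succ, mul_add]
      refine add_le_add i1 ?_
      -- annulus estimate
      have b1 : ∫ y in ball x1 (2 * s) \ ball x1 s, |z y - a| * ‖y - x1‖⁻¹ ^ (n + 1) ∂(vB n) ≤ 
          s⁻¹ ^ (n + 1) * ∫ y in ball x1 (2 * s), |z y - a| ∂(vB n) := by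
        have j1 : Integrable (fun y => |z y - a|) (vB n) := (l2_l1 (l2_sub_const hz.l2 a)).abs
        calc _ ≤ ∫ y in ball x1 (2 * s) \ ball x1 s, s⁻¹ ^ (n + 1) * |z y - a| ∂(vB n) := by
              refine setIntegral_mono_on ((hintg _ measurableSet_ball).mono_set hsub) (j1.const_mul _).restrict 
                (measurableSet_ball.diff measurableSet_ball) fun y hy => ?_
              have hy2 := hy.2
              rw [mem_ball, dist_eq_norm, not_lt] at hy2
              rw [mul_comm]
              gcongr
          _ = s⁻¹ ^ (n + 1) * ∫ y in ball x1 (2 * s) \ ball x1 s, |z y - a| ∂(vB n) := integral_const_mul _ _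
          _ ≤ _ := by
              refine mul_le_mul_of_nonneg_left ?_ (by positivity)
              exact setIntegral_mono_set j1.restrict (ae_of_all _ fun _ => abs_nonneg _) (ae_of_all _ (fun y hy => hy.1))
      have b2 : ∫ y in ball x1 (2 * s), |z y - a| ∂(vB n) ≤ 
          ∫ y in ball x1 (2 * s), |z y - c| ∂(vB n) + (vB n).real (ball x1 (2 * s)) * |c - a| := by
        have j1 : ∀ a, Integrable (fun y => |z y - a|) ((vB n).restrict (ball x1 (2 * s))) := fun a => (l2_l1 (l2_sub_const hz.l2 a)).abs.restrict
        have : (vB n).real (ball x1 (2 * s)) * |c - a| = ∫ y in ball x1 (2 * s), |c - a| ∂(vB n) := by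
          rw [setIntegral_const, smul_eq_mul]
        rw [this, ← integral_add (j1 c) (integrable_const _)]
        refine integral_mono (j1 a) ((j1 c).add (integrable_const _)) fun y => ?_
        dsimp only [Pi.add_apply]
        have : z y - a = (z y - c) + (c - a) := by ring
        rw [this]; exact abs_add_le _ _
      have b3 := int_abs_le hz.l2 c (ball x1 (2 * s))
      have b4 := vB_ball_le x1 (show 0 < 2 * s by positivity)
      have b5 : √((vB n).real (ball x1 (2 * s))) * √(∫ x in ball x1 (2 * s), (z x - c) ^ 2 ∂(vB n)) ≤ 
          √(om n) * 2 ^ (n / 2 + lam / 2 : ℝ) * M * s ^ (n / 2 + lam / 2 : ℝ) := by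
        calc _ ≤ √(om n * (2 * s) ^ n) * √(M ^ 2 * (2 * s) ^ lam) := by gcongr
          _ = √(om n) * M * ((2 * s) ^ (n / 2 : ℝ) * (2 * s) ^ (lam / 2)) := by
            rw [Real.sqrt_mul ho.le, Real.sqrt_mul (sq_nonneg M), Real.sqrt_sq hM, Real.sqrt_eq_rpow ((2 * s) ^ n), 
              Real.sqrt_eq_rpow ((2 * s) ^ lam), ← Real.rpow_natCast, ← Real.rpow_mul (by positivity), ← Real.rpow_mul (by positivity)]
            ring_nf
          _ = _ := by
            rw [← Real.rpow_add (by positivity), Real.mul_rpow (by norm_num) hs0.le]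
            ring
      have e5 : s⁻¹ ^ (n + 1) * s ^ (n / 2 + lam / 2 : ℝ) = s ^ (-θ) := by
        rw [← Real.rpow_natCast, Real.inv_rpow hs0.le, ← Real.rpow_neg hs0.le, ← Real.rpow_add hs0]
        congr 1; rw [hθd]; unfold th; push_cast; ring
      have e6 : s ^ (-θ) ≤ r ^ (-θ) * q ^ l := by
        have g1 : s ^ (-θ) = r ^ (-θ) * ((2:ℝ) ^ l) ^ (-θ) := by rw [hs', mul_comm, Real.mul_rpow hr.le (by positivity)]
        rw [g1]
        gcongr
        rw [hq, ← Real.rpow_natCast, ← Real.rpow_natCast, ← Real.rpow_mul (by norm_num), ← Real.rpow_mul (by norm_num)]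
        refine Real.rpow_le_rpow_of_exponent_le (by norm_num) ?_
        have : (0:ℝ) ≤ l := Nat.cast_nonneg l
        nlinarith
      have e7 : s⁻¹ ^ (n + 1) * ((2 * s) ^ n * (r ^ (σ - θ) * (2 * s) ^ (1 - σ))) ≤ 2 * 2 ^ n * (r ^ (-θ) * q ^ l) := by
        have g1 : s⁻¹ ^ (n + 1) * ((2 * s) ^ n * (r ^ (σ - θ) * (2 * s) ^ (1 - σ))) = 2 ^ n * 2 ^ (1 - σ) * (r ^ (σ - θ) * s ^ (-σ)) := by
          rw [Real.mul_rpow (by norm_num) hs0.le, mul_pow, pow_succ, show s ^ (1 - σ) = s * s ^ (-σ) by 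
            rw [sub_eq_add_neg, Real.rpow_add hs0, Real.rpow_one], inv_pow]
          field_simp
        have g2 : s ^ (-σ) = r ^ (-σ) * q ^ l := by
          rw [hs', mul_comm, Real.mul_rpow hr.le (by positivity), hq, ← Real.rpow_natCast, ← Real.rpow_natCast, ← Real.rpow_mul (by norm_num), ← Real.rpow_mul (by norm_num)]
          ring_nf
        have g3 : r ^ (σ - θ) * r ^ (-σ) = r ^ (-θ) := by rw [← Real.rpow_add hr]; congr 1; ring
        have g4 : (2:ℝ) ^ (1 - σ) ≤ 2 := by
          calc (2:ℝ) ^ (1 - σ) ≤ 2 ^ (1:ℝ) := Real.rpow_le_rpow_of_exponent_le (by norm_num) (by linarith)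
            _ = 2 := Real.rpow_one 2
        rw [g1, g2, ← mul_assoc (r ^ (σ - θ)), g3]
        have : (2:ℝ) ^ n * 2 ^ (1 - σ) ≤ 2 * 2 ^ n := by rw [mul_comm]; gcongr
        exact mul_le_mul_of_nonneg_right this (by positivity)
      have b6 : (vB n).real (ball x1 (2 * s)) * |c - a| ≤ om n * (2 * s) ^ n * (C * M * r ^ (σ - θ) * (2 * s) ^ (1 - σ)) := by gcongr
      have b7 : s⁻¹ ^ (n + 1) * ∫ y in ball x1 (2 * s), |z y - a| ∂(vB n) ≤ 
          s⁻¹ ^ (n + 1) * (√(om n) * 2 ^ (n / 2 + lam / 2 : ℝ) * M * s ^ (n / 2 + lam / 2 : ℝ) + om n * (2 * s) ^ n * (C * M * r ^ (σ - θ) * (2 * s) ^ (1 - σ))) := by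
        gcongr
        linarith
      refine b1.trans (b7.trans ?_)
      have f1 : √(om n) * 2 ^ (n / 2 + lam / 2 : ℝ) * M * (s⁻¹ ^ (n + 1) * s ^ (n / 2 + lam / 2 : ℝ)) ≤ √(om n) * 2 ^ (n / 2 + lam / 2 : ℝ) * M * (r ^ (-θ) * q ^ l) := by
        rw [e5]; gcongr
      have f2 : om n * C * M * (s⁻¹ ^ (n + 1) * ((2 * s) ^ n * (r ^ (σ - θ) * (2 * s) ^ (1 - σ)))) ≤ om n * C * M * (2 * 2 ^ n * (r ^ (-θ) * q ^ l)) := by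
        gcongr
      calc _ = √(om n) * 2 ^ (n / 2 + lam / 2 : ℝ) * M * (s⁻¹ ^ (n + 1) * s ^ (n / 2 + lam / 2 : ℝ)) 
              + om n * C * M * (s⁻¹ ^ (n + 1) * ((2 * s) ^ n * (r ^ (σ - θ) * (2 * s) ^ (1 - σ)))) := by ring
        _ ≤ _ := add_le_add f1 f2
        _ = _ := by rw [hK]; ring
  have hgeo : ∀ l, ∑ j ∈ Finset.range l, q ^ j ≤ (1 - q)⁻¹ := fun l => by
    have h1q : 0 < 1 - q := by linarith
    rw [geom_sum_eq hq1.ne, ← neg_div_neg_eq, neg_sub, neg_sub, div_eq_mul_inv]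
    have : 0 < q ^ l := by positivity
    have : 0 < (1 - q)⁻¹ := by positivity
    nlinarith
  have h1q : 0 < 1 - q := by linarith
  have hres : ∀ L : ℝ, 2 ≤ L → ∫ y in (ball x1 r)ᶜ, |z y - a| * ‖y - x1‖⁻¹ ^ (n + 1) ∂(vB n) = 
      ∫ y in ball x1 L \ ball x1 r, |z y - a| * ‖y - x1‖⁻¹ ^ (n + 1) ∂(vB n) := by
    intro L hL
    rw [vB, Measure.restrict_restrict measurableSet_ball.compl, Measure.restrict_restrict (measurableSet_ball.diff measurableSet_ball)]
    congr 2
    ext y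
    simp only [Set.mem_inter_iff, Set.mem_compl_iff, Set.mem_sdiff, mem_ball_zero_iff]
    refine ⟨fun ⟨a1, a2⟩ => ⟨⟨?_, a1⟩, a2⟩, fun ⟨⟨_, a1⟩, a2⟩ => ⟨a1, a2⟩⟩
    rw [mem_ball, dist_eq_norm]
    have := norm_sub_le y x1
    linarith
  by_cases hr2 : 2 ≤ r
  · rw [hres r hr2]; simp; positivity
  obtain ⟨l, hl1, hl2⟩ := exists_nat_pow_near (x := 4 / r) (y := 2) (by rw [le_div_iff₀ hr]; linarith) (by norm_num)
  rw [le_div_iff₀ hr] at hl1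
  rw [div_lt_iff₀ hr, pow_succ] at hl2
  rw [hres (2 ^ l * r) (by linarith)]
  refine (main l hl1).trans ?_
  calc _ ≤ K * M * r ^ (-θ) * (1 - q)⁻¹ := by gcongr; exact hgeo l
    _ = _ := by ring

/-! ### Part 9: singular integral estimate and multipliers -/

lemma Cm.mono {lam M M' : ℝ} {z : En n → ℝ} (h : Cm lam z M) (hM : M ≤ M') : Cm lam z M' := by
  have h2 : M ^ 2 ≤ M' ^ 2 := pow_le_pow_left₀ h.nn hM 2
  refine ⟨h.l2, h.nn.trans hM, h.tot.trans h2, fun x1 hx1 ρ hρ => ?_⟩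
  obtain ⟨c, hc⟩ := h.osc x1 hx1 ρ hρ
  exact ⟨c, hc.trans (by gcongr)⟩

lemma Cm.congr {lam M : ℝ} {z z' : En n → ℝ} (h : Cm lam z M) (hz : z =ᵐ[vB n] z') : Cm lam z' M := by
  refine ⟨h.l2.ae_eq hz, h.nn, ?_, fun x1 hx1 ρ hρ => ?_⟩
  · refine le_trans (le_of_eq (integral_congr_ae (hz.mono fun x hx => ?_))) h.tot
    simp [hx]
  obtain ⟨c, hc⟩ := h.osc x1 hx1 ρ hρ
  refine ⟨c, le_trans (le_of_eq (integral_congr_ae (ae_restrict_of_ae (hz.mono fun x hx => ?_)))) hc⟩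
  simp [hx]

lemma Cm.smul {lam M : ℝ} {z : En n → ℝ} (h : Cm lam z M) (a : ℝ) : Cm lam (fun x => a * z x) (|a| * M) := by
  refine ⟨h.l2.const_mul a, mul_nonneg (abs_nonneg _) h.nn, ?_, fun x1 hx1 ρ hρ => ?_⟩
  · simp_rw [mul_pow, integral_const_mul, sq_abs]
    exact mul_le_mul_of_nonneg_left h.tot (sq_nonneg a)
  obtain ⟨c, hc⟩ := h.osc x1 hx1 ρ hρ
  refine ⟨a * c, ?_⟩
  simp_rw [← mul_sub, mul_pow, integral_const_mul, sq_abs, mul_assoc]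
  exact mul_le_mul_of_nonneg_left hc (sq_nonneg a)

lemma sq_add_int {z w : En n → ℝ} {μ : Measure (En n)} (hz : MemLp z 2 μ) (hw : MemLp w 2 μ) :
    ∫ x, (z x + w x) ^ 2 ∂μ ≤ 2 * ∫ x, z x ^ 2 ∂μ + 2 * ∫ x, w x ^ 2 ∂μ := by
  rw [← integral_const_mul, ← integral_const_mul, ← integral_add (hz.integrable_sq.const_mul 2) (hw.integrable_sq.const_mul 2)]
  refine integral_mono (hz.add hw).integrable_sq ((hz.integrable_sq.const_mul 2).add (hw.integrable_sq.const_mul 2)) fun x => ?_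
  dsimp only [Pi.add_apply]
  nlinarith [sq_nonneg (z x - w x)]

lemma Cm.add {lam M M' : ℝ} {z w : En n → ℝ} (h : Cm lam z M) (h' : Cm lam w M') : Cm lam (fun x => z x + w x) (2 * (M + M')) := by
  have p1 := h.nn
  have p2 := h'.nn
  refine ⟨h.l2.add h'.l2, by positivity, ?_, fun x1 hx1 ρ hρ => ?_⟩
  · refine (sq_add_int h.l2 h'.l2).trans ?_
    nlinarith [h.tot, h'.tot, mul_nonneg p1 p2]
  obtain ⟨c, hc⟩ := h.osc x1 hx1 ρ hρ
  obtain ⟨c', hc'⟩ := h'.osc x1 hx1 ρ hρ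
  refine ⟨c + c', ?_⟩
  have := sq_add_int ((l2_sub_const h.l2 c).restrict (ball x1 ρ)) ((l2_sub_const h'.l2 c').restrict (ball x1 ρ))
  simp_rw [show ∀ x, z x + w x - (c + c') = (z x - c) + (w x - c') from fun x => by ring]
  have hp : 0 < ρ ^ lam := Real.rpow_pos_of_pos hρ _
  have q : 0 ≤ M * M' * ρ ^ lam := by positivity
  have q1 : 0 ≤ M ^ 2 * ρ ^ lam := by positivity
  have q2 : 0 ≤ M' ^ 2 * ρ ^ lam := by positivity
  nlinarith

lemma Cm.zero (lam : ℝ) : Cm lam (fun _ : En n => 0) 0 := by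
  refine ⟨memLp_const 0, le_rfl, by simp, fun x1 hx1 ρ hρ => ⟨0, by simp⟩⟩

lemma Cm.sum {ι : Type*} (s : Finset ι) {lam M : ℝ} (hM : 0 ≤ M) {z : ι → En n → ℝ} (h : ∀ j ∈ s, Cm lam (z j) M) :
    Cm lam (fun x => ∑ j ∈ s, z j x) (2 ^ s.card * s.card * M) := by
  classical
  induction s using Finset.induction_on with
  | empty => simpa using Cm.zero lam
  | insert a s ha ih =>
    simp_rw [Finset.sum_insert ha]
    have i1 := (h a (Finset.mem_insert_self _ _)).add (ih fun j hj => h j (Finset.mem_insert_of_mem hj))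
    refine i1.mono ?_
    rw [Finset.card_insert_of_notMem ha]
    have : (1:ℝ) ≤ 2 ^ s.card := one_le_pow₀ (by norm_num)
    push_cast
    rw [pow_succ]
    nlinarith

lemma Cm.of_small {lam A ρ0 : ℝ} (hl : 0 ≤ lam) {z : En n → ℝ} (hz : MemLp z 2 (vB n)) (hA : 0 ≤ A) (ht : ∫ x, z x ^ 2 ∂(vB n) ≤ A ^ 2)
    (hρ0 : 0 < ρ0) (hρ1 : ρ0 ≤ 1)
    (h : ∀ x1 : En n, ‖x1‖ ≤ 1 → ∀ ρ, 0 < ρ → ρ < ρ0 → ∃ c, ∫ x in ball x1 ρ, (z x - c) ^ 2 ∂(vB n) ≤ A ^ 2 * ρ ^ lam) :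
    Cm lam z (ρ0⁻¹ ^ lam * A) := by
  have hB : 1 ≤ ρ0⁻¹ ^ lam := Real.one_le_rpow ((one_le_inv₀ hρ0).2 hρ1) hl
  set B := ρ0⁻¹ ^ lam with hBd
  have hA2 : A ^ 2 ≤ (B * A) ^ 2 := pow_le_pow_left₀ hA (by nlinarith) 2
  refine ⟨hz, by positivity, ht.trans hA2, fun x1 hx1 ρ hρ => ?_⟩
  by_cases hs : ρ < ρ0
  · obtain ⟨c, hc⟩ := h x1 hx1 ρ hρ hs
    exact ⟨c, hc.trans (by gcongr)⟩
  · refine ⟨0, ?_⟩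
    push Not at hs
    have h1 : 1 ≤ B * ρ ^ lam := by
      rw [hBd, ← Real.mul_rpow (by positivity) hρ.le]
      refine Real.one_le_rpow ?_ hl
      rw [inv_mul_eq_div, le_div_iff₀ hρ0]; linarith
    calc _ ≤ ∫ x, (z x - 0) ^ 2 ∂(vB n) := setIntegral_le_integral (l2_sub_const hz 0).integrable_sq (ae_of_all _ fun x => sq_nonneg _)
      _ ≤ A ^ 2 := by simpa using ht
      _ ≤ A ^ 2 * (B * (B * ρ ^ lam)) := by
        have : 1 ≤ B * (B * ρ ^ lam) := by nlinarith
        nlinarith [sq_nonneg A]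
      _ = _ := by ring

/-- local Morrey bound -/
lemma morrey (n : ℕ) {lam : ℝ} (h0 : 0 ≤ lam) (h1 : lam < n + 2) : ∃ C, 0 ≤ C ∧ ∀ (z : En n → ℝ) (M : ℝ), Cm lam z M → ∀ x1 : En n, ‖x1‖ ≤ 1 →
    ∀ r, 0 < r → r ≤ 1 → ∫ x in ball x1 r, z x ^ 2 ∂(vB n) ≤ C * M ^ 2 * r ^ (lam - 2) := by
  obtain ⟨C, hC, ht⟩ := tel_abs n h0 h1
  have ho := om_pos (n := n)
  refine ⟨2 + 2 * C ^ 2 * om n, by positivity, ?_⟩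
  intro z M hz x1 hx1 r hr hr1
  have hM := hz.nn
  obtain ⟨c, hc⟩ := hz.osc x1 hx1 r hr
  have hca := ht z M hz x1 hx1 r hr (by linarith) c hc
  have := sq_add_int ((l2_sub_const hz.l2 c).restrict (ball x1 r)) (memLp_const (μ := (vB n).restrict (ball x1 r)) c)
  simp only [sub_add_cancel] at this
  rw [setIntegral_const, smul_eq_mul] at this
  have hv := vB_ball_le x1 hr
  have hc2 : c ^ 2 ≤ (C * M * r ^ (sg n lam - th n lam)) ^ 2 := by rw [← sq_abs]; gcongr
  have e1 : r ^ n * (r ^ (sg n lam - th n lam)) ^ 2 ≤ r ^ (lam - 2) := by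
    rw [← Real.rpow_natCast, ← Real.rpow_natCast, ← Real.rpow_mul hr.le, ← Real.rpow_add hr]
    refine Real.rpow_le_rpow_of_exponent_ge hr hr1 ?_
    have := sg_pos (n := n) h1
    have e : th n lam = (n + 2 - lam) / 2 := rfl
    rw [e]; push_cast; linarith
  have e2 : r ^ lam ≤ r ^ (lam - 2) := Real.rpow_le_rpow_of_exponent_ge hr hr1 (by linarith)
  have e3 : (vB n).real (ball x1 r) * c ^ 2 ≤ om n * r ^ n * (C * M * r ^ (sg n lam - th n lam)) ^ 2 := by gcongr
  have e4 : C ^ 2 * M ^ 2 * om n * (r ^ n * (r ^ (sg n lam - th n lam)) ^ 2) ≤ C ^ 2 * M ^ 2 * om n * r ^ (lam - 2) := by gcongr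
  have e5 : M ^ 2 * r ^ lam ≤ M ^ 2 * r ^ (lam - 2) := by gcongr
  calc _ ≤ _ := this
    _ ≤ 2 * (M ^ 2 * r ^ (lam - 2)) + 2 * (C ^ 2 * M ^ 2 * om n * r ^ (lam - 2)) := by
        have : om n * r ^ n * (C * M * r ^ (sg n lam - th n lam)) ^ 2 = C ^ 2 * M ^ 2 * om n * (r ^ n * (r ^ (sg n lam - th n lam)) ^ 2) := by ring
        linarith
    _ = _ := by ring

/-- Lipschitz multipliers -/
lemma Cm.mult (n : ℕ) {lam : ℝ} (h0 : 0 ≤ lam) (h1 : lam < n + 2) {L : ℝ} (hL : 0 ≤ L) : ∃ C, 0 ≤ C ∧ ∀ (z ℓ : En n → ℝ) (M : ℝ), Cm lam z M → 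
    Continuous ℓ → (∀ x, ‖x‖ ≤ 1 → |ℓ x| ≤ L) → (∀ x y, ‖x‖ ≤ 1 → ‖y‖ ≤ 1 → |ℓ x - ℓ y| ≤ L * ‖x - y‖) → Cm lam (fun x => ℓ x * z x) (C * M) := by
  obtain ⟨C, hC, hm⟩ := morrey n h0 h1
  refine ⟨1⁻¹ ^ lam * (2 * L * (1 + C)), by positivity, ?_⟩
  intro z ℓ M hz hc hb hl
  have hM := hz.nn
  have hL2 : MemLp (fun x => ℓ x * z x) 2 (vB n) := by
    simp_rw [mul_comm (ℓ _)]; exact l2_mul_cont hz.l2 hc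
  rw [mul_assoc]
  refine Cm.of_small h0 hL2 (by positivity) ?_ one_pos le_rfl ?_
  · have : ∫ x, (ℓ x * z x) ^ 2 ∂(vB n) ≤ ∫ x, L ^ 2 * z x ^ 2 ∂(vB n) := by
      refine integral_mono_ae hL2.integrable_sq (hz.l2.integrable_sq.const_mul _) ?_
      refine (ae_restrict_mem measurableSet_ball).mono fun x hx => ?_
      have := hb x (mem_ball_zero_iff.1 hx).le
      dsimp only
      rw [mul_pow, ← sq_abs (ℓ x)]
      gcongr
    rw [integral_const_mul] at this
    refine this.trans ?_
    calc L ^ 2 * _ ≤ L ^ 2 * M ^ 2 := by gcongr; exact hz.tot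
      _ = (L * M) ^ 2 := by ring
      _ ≤ _ := by
        gcongr
        nlinarith [mul_nonneg hL hC]
  · intro x1 hx1 ρ hρ hρ1
    obtain ⟨c, hc'⟩ := hz.osc x1 hx1 ρ hρ
    refine ⟨ℓ x1 * c, ?_⟩
    have i1 : MemLp (fun x => (ℓ x - ℓ x1) * z x) 2 (vB n) := by
      simp_rw [mul_comm (_ - _)]; exact l2_mul_cont hz.l2 (by fun_prop)
    have i2 : MemLp (fun x => ℓ x1 * (z x - c)) 2 (vB n) := (l2_sub_const hz.l2 c).const_mul _
    have := sq_add_int (i1.restrict (ball x1 ρ)) (i2.restrict (ball x1 ρ))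
    simp_rw [show ∀ x, (ℓ x - ℓ x1) * z x + ℓ x1 * (z x - c) = ℓ x * z x - ℓ x1 * c from fun x => by ring] at this
    refine this.trans ?_
    have t1 : ∫ x in ball x1 ρ, ((ℓ x - ℓ x1) * z x) ^ 2 ∂(vB n) ≤ (L * ρ) ^ 2 * (C * M ^ 2 * ρ ^ (lam - 2)) := by
      calc _ ≤ ∫ x in ball x1 ρ, (L * ρ) ^ 2 * z x ^ 2 ∂(vB n) := by
            refine integral_mono_ae (i1.integrable_sq.restrict) (hz.l2.integrable_sq.const_mul _).restrict ?_
            filter_upwards [ae_restrict_mem measurableSet_ball, ae_restrict_of_ae (ae_restrict_mem measurableSet_ball)] with x hx hx2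
            have g := hl x x1 (mem_ball_zero_iff.1 hx2).le hx1
            rw [mem_ball, dist_eq_norm] at hx
            rw [mul_pow, ← sq_abs (ℓ x - ℓ x1)]
            gcongr
            exact g.trans (by gcongr)
        _ ≤ _ := by
            rw [integral_const_mul]
            gcongr
            exact hm z M hz x1 hx1 ρ hρ hρ1.le
    have t2 : ∫ x in ball x1 ρ, (ℓ x1 * (z x - c)) ^ 2 ∂(vB n) ≤ L ^ 2 * (M ^ 2 * ρ ^ lam) := by
      simp_rw [mul_pow]
      rw [integral_const_mul, ← sq_abs (ℓ x1)]
      gcongr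
      exact hb x1 hx1
    have e : ρ ^ lam = ρ ^ 2 * ρ ^ (lam - 2) := by
      rw [← Real.rpow_natCast, ← Real.rpow_add hρ]; congr 1; push_cast; ring
    have e' : (L * ρ) ^ 2 * (C * M ^ 2 * ρ ^ (lam - 2)) = L ^ 2 * C * M ^ 2 * ρ ^ lam := by rw [e]; ring
    rw [e'] at t1
    have hp : 0 ≤ L ^ 2 * M ^ 2 * ρ ^ lam := by positivity
    calc _ ≤ (2 * C + 2) * (L ^ 2 * M ^ 2 * ρ ^ lam) := by linarith
      _ ≤ (2 * (1 + C)) ^ 2 * (L ^ 2 * M ^ 2 * ρ ^ lam) := by gcongr; nlinarith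
      _ = _ := by ring

/-- the Dirichlet projection preserves Campanato classes -/
lemma TD.cz (n : ℕ) {lam : ℝ} (h0 : 0 ≤ lam) (h1 : lam < n + 2) : ∃ C, 0 ≤ C ∧ ∀ (F : Fin n → En n → ℝ) (w : En n → ℝ) (D : Fin n → En n → ℝ) (M : ℝ),
    TD F w D → 0 ≤ M → (∀ j, Cm lam (F j) M) → ∀ i, Cm lam (D i) (C * M) := by
  obtain ⟨C1, hC1, hfar⟩ := TD.far n
  obtain ⟨C2, hC2, htel⟩ := tel_far n h0 h1
  have ho := om_pos (n := n)
  set K : ℝ := 2 * (n * 2 ^ lam) + 2 * (om n * (C1 * (n * (C2 * 2 ^ (-th n lam)))) ^ 2) with hK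
  have hK0 : 0 ≤ K := by positivity
  refine ⟨n + 1 + K, by positivity, ?_⟩
  intro F w D M h hM hF i
  have hn : 0 < n := i.pos
  have hsing : ∀ D : Fin n → En n → ℝ, ∫ x, D i x ^ 2 ∂(vB n) ≤ ∑ i, ∫ x, D i x ^ 2 ∂(vB n) := fun D =>
    Finset.single_le_sum (f := fun i => ∫ x, D i x ^ 2 ∂(vB n)) (fun j _ => integral_nonneg fun x => sq_nonneg _) (Finset.mem_univ i)
  have hK2 : (n:ℝ) ≤ (n + 1 + K) ^ 2 := by nlinarith [(Nat.cast_nonneg n : (0:ℝ) ≤ n), mul_nonneg (Nat.cast_nonneg n : (0:ℝ) ≤ n) hK0]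
  have hK3 : K ≤ (n + 1 + K) ^ 2 := by nlinarith [(Nat.cast_nonneg n : (0:ℝ) ≤ n), mul_nonneg (Nat.cast_nonneg n : (0:ℝ) ≤ n) hK0]
  refine ⟨h.hD i, by positivity, ?_, fun x1 hx1 ρ hρ => ?_⟩
  · calc _ ≤ _ := hsing D
      _ ≤ _ := h.energy
      _ ≤ ∑ _j : Fin n, M ^ 2 := Finset.sum_le_sum fun j _ => (hF j).tot
      _ = n * M ^ 2 := by simp
      _ ≤ _ := by rw [mul_pow]; gcongr
  choose c hc using fun j => (hF j).osc x1 hx1 (2 * ρ) (by positivity)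
  set Fn : Fin n → En n → ℝ := fun j => (ball x1 (2 * ρ)).indicator (fun x => F j x - c j) with hFn
  have hFnL : ∀ j, MemLp (Fn j) 2 (vB n) := fun j => (l2_sub_const (hF j).l2 (c j)).indicator measurableSet_ball
  obtain ⟨wn, Dn, hDn⟩ := TD_exists hn Fn hFnL
  have hT := (h.lin (TD.const c) (-1)).lin hDn (-1)
  have hz : ∀ j, ∀ y ∈ ball x1 (2 * ρ), F j y + -1 * c j + -1 * Fn j y = 0 := by
    intro j y hy
    simp only [hFn, Set.indicator_of_mem hy]; ring
  obtain ⟨b, hb⟩ := hfar _ _ _ hT x1 ρ hx1 hρ hz i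
  have hI : ∀ j, ∫ y, |F j y + -1 * c j + -1 * Fn j y| * ‖y - x1‖⁻¹ ^ (n + 1) ∂(vB n) ≤ C2 * M * (2 * ρ) ^ (-th n lam) := by
    intro j
    refine le_trans (le_of_eq ?_) (htel (F j) M (hF j) x1 hx1 (2 * ρ) (by positivity) (c j) (hc j))
    rw [← integral_indicator measurableSet_ball.compl]
    congr 1; ext y
    by_cases hy : y ∈ ball x1 (2 * ρ)
    · rw [hz j y hy, Set.indicator_of_notMem (by simpa using hy)]; simp
    · rw [Set.indicator_of_mem (by simpa using hy)]
      simp only [hFn, Set.indicator_of_notMem hy]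
      ring_nf
  have hE : C1 * ρ * ∑ j, ∫ y, |F j y + -1 * c j + -1 * Fn j y| * ‖y - x1‖⁻¹ ^ (n + 1) ∂(vB n) ≤ 
      C1 * (n * (C2 * 2 ^ (-th n lam))) * M * ρ ^ (1 - th n lam) := by
    calc _ ≤ C1 * ρ * ∑ _j : Fin n, C2 * M * (2 * ρ) ^ (-th n lam) := by gcongr with j; exact hI j
      _ = C1 * ρ * (n * (C2 * M * (2 * ρ) ^ (-th n lam))) := by simp
      _ = _ := by
        rw [Real.mul_rpow (by norm_num) hρ.le, sub_eq_add_neg, Real.rpow_add hρ, Real.rpow_one]; ring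
  set E := C1 * (n * (C2 * 2 ^ (-th n lam))) * M * ρ ^ (1 - th n lam) with hEd
  refine ⟨b, ?_⟩
  have hnear : ∫ x, Dn i x ^ 2 ∂(vB n) ≤ n * (M ^ 2 * (2 * ρ) ^ lam) := by
    calc _ ≤ _ := hsing Dn
      _ ≤ _ := hDn.energy
      _ ≤ ∑ _j : Fin n, M ^ 2 * (2 * ρ) ^ lam := by
        refine Finset.sum_le_sum fun j _ => ?_
        have e : ∫ x in ball x1 (2*ρ), (F j x - c j)^2 ∂(vB n) = ∫ x, Fn j x ^ 2 ∂(vB n) := by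
          rw [← integral_indicator (μ := vB n) (s := ball x1 (2*ρ)) measurableSet_ball]
          congr 1; ext x
          by_cases hx : x ∈ ball x1 (2 * ρ)
          · simp only [hFn, Set.indicator_of_mem hx]
          · simp only [hFn, Set.indicator_of_notMem hx]; norm_num
        rw [← e]; exact hc j
      _ = _ := by simp
  have hpt : ∀ᵐ x ∂((vB n).restrict (ball x1 ρ)), (D i x - b) ^ 2 ≤ 2 * Dn i x ^ 2 + 2 * E ^ 2 := by
    filter_upwards [ae_restrict_mem measurableSet_ball, ae_restrict_of_ae hb] with x hx hx2
    have g := (hx2 hx).trans hE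
    have g2 : (D i x + -1 * 0 + -1 * Dn i x - b) ^ 2 ≤ E ^ 2 := by rw [← sq_abs]; gcongr
    nlinarith [sq_nonneg ((D i x + -1 * 0 + -1 * Dn i x - b) - Dn i x)]
  have hDi := (hDn.hD i).integrable_sq
  have hfin : ∫ x in ball x1 ρ, (D i x - b) ^ 2 ∂(vB n) ≤ 2 * ∫ x, Dn i x ^ 2 ∂(vB n) + 2 * E ^ 2 * (vB n).real (ball x1 ρ) := by
    calc _ ≤ ∫ x in ball x1 ρ, (2 * Dn i x ^ 2 + 2 * E ^ 2) ∂(vB n) := 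
          integral_mono_ae (l2_sq_int (h.hD i) b _) ((hDi.const_mul 2).restrict.add (integrable_const _)) hpt
      _ = 2 * ∫ x in ball x1 ρ, Dn i x ^ 2 ∂(vB n) + 2 * E ^ 2 * (vB n).real (ball x1 ρ) := by
          rw [integral_add (hDi.const_mul 2).restrict (integrable_const _), integral_const_mul, setIntegral_const, smul_eq_mul]; ring
      _ ≤ _ := by
          gcongr ?_ + _
          refine mul_le_mul_of_nonneg_left ?_ (by norm_num)
          exact setIntegral_le_integral hDi (ae_of_all _ fun x => sq_nonneg _)
  have hv := vB_ball_le x1 hρ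
  have e6 : (ρ ^ (1 - th n lam)) ^ 2 * ρ ^ n = ρ ^ lam := by
    rw [← Real.rpow_natCast, ← Real.rpow_natCast, ← Real.rpow_mul hρ.le, ← Real.rpow_add hρ]
    congr 1; unfold th; push_cast; ring
  calc _ ≤ _ := hfin
    _ ≤ 2 * (n * (M ^ 2 * (2 * ρ) ^ lam)) + 2 * E ^ 2 * (om n * ρ ^ n) := by gcongr
    _ = 2 * (n * 2 ^ lam) * (M ^ 2 * ρ ^ lam) + 2 * (om n * (C1 * (n * (C2 * 2 ^ (-th n lam)))) ^ 2) * (M ^ 2 * ((ρ ^ (1 - th n lam)) ^ 2 * ρ ^ n)) := by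
      rw [Real.mul_rpow (by norm_num) hρ.le, hEd]; ring
    _ = K * (M ^ 2 * ρ ^ lam) := by rw [e6, hK]; ring
    _ ≤ (n + 1 + K) ^ 2 * (M ^ 2 * ρ ^ lam) := by gcongr
    _ = _ := by ring

lemma IsTestFun.pd {φ : En n → ℝ} {Ω : Set (En n)} (h : IsTestFun Ω φ) (i : Fin n) : IsTestFun Ω (pd i φ) := by
  refine ⟨SM.pd h.1 i, ?_, ?_⟩
  · exact (h.2.1.fderiv (𝕜 := ℝ)).comp_left (g := fun L : En n →L[ℝ] ℝ => L (basisVec i)) (by simp)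
  · refine subset_trans ?_ h.2.2
    refine subset_trans ?_ (tsupport_fderiv_subset ℝ)
    refine closure_mono fun x hx => ?_
    rw [Function.mem_support] at hx ⊢
    intro h0; apply hx; unfold _root_.pd; rw [h0]; rfl

lemma IsTestFun.mul {φ ψ : En n → ℝ} {Ω : Set (En n)} (h : IsTestFun Ω φ) (hψ : SM ψ) : IsTestFun Ω (fun x => φ x * ψ x) :=
  ⟨h.1.mul hψ, h.2.1.mul_right, (tsupport_mul_subset_left).trans h.2.2⟩

lemma IsTestFun.add {φ ψ : En n → ℝ} {Ω : Set (En n)} (h : IsTestFun Ω φ) (h' : IsTestFun Ω ψ) : IsTestFun Ω (fun x => φ x + ψ x) :=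
  ⟨h.1.add h'.1, h.2.1.add h'.2.1, (tsupport_add φ ψ).trans (Set.union_subset h.2.2 h'.2.2)⟩

lemma test_uniq {z : En n → ℝ} (hz : Integrable z (vB n)) (h : ∀ ζ, IsTestFun (ball 0 1) ζ → ∫ x, z x * ζ x ∂(vB n) = 0) :
    z =ᵐ[vB n] 0 := by
  have := isOpen_ball.ae_eq_zero_of_integral_contDiff_smul_eq_zero (U := ball (0 : En n) 1) (f := z) (μ := volume)
    (IntegrableOn.locallyIntegrableOn hz) ?_
  · exact (ae_restrict_iff' measurableSet_ball).2 this
  · intro g hg hc hs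
    rw [← h g ⟨hg, hc, hs⟩, vB, setIntegral_eq_integral_of_forall_compl_eq_zero]
    · simp [mul_comm]
    · intro x hx
      rw [image_eq_zero_of_notMem_tsupport (fun h => hx (hs h)), mul_zero]

lemma weak_uniq {u g g' : En n → ℝ} {i : Fin n} (hg : Integrable g (vB n)) (hg' : Integrable g' (vB n))
    (h : HasWeakPartial (ball 0 1) u g i) (h' : HasWeakPartial (ball 0 1) u g' i) : g =ᵐ[vB n] g' := by
  have : (fun x => g x - g' x) =ᵐ[vB n] 0 := by
    apply test_uniq (hg.sub hg')
    intro ζ hζ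
    change ∫ x, (g x - g' x) * ζ x ∂(vB n) = 0
    simp only [sub_mul]
    rw [integral_sub (int_mul_cont hg hζ.1.continuous) (int_mul_cont hg' hζ.1.continuous)]
    have a := h ζ hζ
    have b := h' ζ hζ
    rw [a] at b
    linarith
  filter_upwards [this] with x hx
  simpa [sub_eq_zero] using hx

lemma cut_lim {u : En n → ℝ} {i : Fin n} (hu : Integrable u (vB n)) {θ : En n → ℝ} (hθ : GZ θ) :
    Tendsto (fun j : ℕ => ∫ x, u x * pd i (fun y => θ y * cutj j y) x ∂(vB n)) atTop (nhds (∫ x, u x * pd i θ x ∂(vB n))) := by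
  obtain ⟨C, hC0, hC⟩ := hθ.bound i
  obtain ⟨D, hD0, hD, hD1⟩ := trans_deriv_bound
  have hcut : ∀ x ∈ ball (0 : En n) 1, ∀ᶠ j : ℕ in atTop, 1 < j * (1 - ‖x‖ ^ 2) - 1 := by
    intro x hx
    have hx' : 0 < 1 - ‖x‖ ^ 2 := by
      rw [mem_ball_zero_iff] at hx; nlinarith [norm_nonneg x]
    have : Tendsto (fun j : ℕ => (j:ℝ) * (1 - ‖x‖ ^ 2) - 1) atTop atTop := 
      tendsto_atTop_add_const_right _ _ (tendsto_natCast_atTop_atTop.atTop_mul_const hx')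
    exact this.eventually_gt_atTop 1
  have hcb : ∀ j x, |cutj j (x : En n)| ≤ 1 := fun j x => by
    unfold cutj; rw [abs_of_nonneg (Real.smoothTransition.nonneg _)]; exact Real.smoothTransition.le_one _
  obtain ⟨C1, hC1⟩ := (isCompact_closedBall (0 : En n) 1).exists_bound_of_continuousOn
    (hθ.sm.pd i).continuous.continuousOn
  obtain ⟨C2, hC2⟩ := (isCompact_closedBall (0 : En n) 1).exists_bound_of_continuousOn
    hθ.sm.continuous.continuousOn
  have t1 : Tendsto (fun j : ℕ => ∫ x, u x * (θ x * pd i (cutj j) x + pd i θ x * cutj j x) ∂(vB n))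
      atTop (nhds (∫ x, u x * pd i θ x ∂(vB n))) := by
    apply tendsto_integral_of_dominated_convergence (fun x => |u x| * (2 * C * D + C1))
    · intro j
      refine hu.aestronglyMeasurable.mul (Continuous.aestronglyMeasurable ?_)
      have := hθ.sm.continuous; have := ((cutj_sm j).pd i).continuous
      have := (hθ.sm.pd i).continuous; have := (cutj_sm (n := n) j).continuous
      fun_prop
    · exact hu.abs.mul_const _
    · intro j
      filter_upwards [ae_restrict_mem measurableSet_ball] with x hx
      rw [norm_mul, Real.norm_eq_abs]
      refine mul_le_mul_of_nonneg_left ?_ (abs_nonneg _)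
      have hx1 := mem_ball_zero_iff.1 hx
      have hx' : 0 < 1 - ‖x‖ ^ 2 := by nlinarith [norm_nonneg x]
      refine (norm_add_le _ _).trans (add_le_add ?_ ?_)
      · rw [pd_cutj, norm_mul, Real.norm_eq_abs, Real.norm_eq_abs, abs_mul, abs_neg, abs_mul, abs_mul]
        set t := (j:ℝ) * (1 - ‖x‖ ^ 2) - 1 with ht
        have h3 := hD t (by rw [ht]; ring_nf; have : 0 ≤ (j:ℝ) * (1 - ‖x‖ ^ 2) := by positivity
                            linarith)
        have h4 : t + 1 = j * (1 - ‖x‖ ^ 2) := by rw [ht]; ring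
        rw [h4, abs_mul, abs_of_nonneg (by positivity)] at h3
        have h5 := abs_coord_le x i
        have h6 := hC x hx1.le
        simp only [abs_two, Nat.abs_cast]
        calc |θ x| * (|deriv Real.smoothTransition t| * (2 * j * |x i|))
            ≤ (C * (1 - ‖x‖ ^ 2)) * (|deriv Real.smoothTransition t| * (2 * j * 1)) := by
              gcongr; linarith
          _ = 2 * C * ((j * (1 - ‖x‖ ^ 2)) * |deriv Real.smoothTransition t|) := by ring
          _ ≤ _ := by gcongr
      · rw [norm_mul, Real.norm_eq_abs, Real.norm_eq_abs]
        have := hC1 x (ball_subset_closedBall hx)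
        rw [Real.norm_eq_abs] at this
        calc _ ≤ C1 * 1 := mul_le_mul this (hcb j x) (abs_nonneg _) ((abs_nonneg _).trans this)
          _ = _ := mul_one _
    · filter_upwards [ae_restrict_mem measurableSet_ball] with x hx
      apply tendsto_const_nhds.congr'
      filter_upwards [hcut x hx] with j hj
      rw [pd_cutj, hD1 _ hj]
      have : cutj j x = 1 := Real.smoothTransition.one_of_one_le hj.le
      rw [this]; ring
  refine t1.congr fun j => ?_
  congr 1; ext x
  rw [pd_mul i (hθ.sm.diff x) ((cutj_sm j).diff x)]

/-- first order identities extend from test functions to functions vanishing on the sphere -/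
lemma ext_gz {X : Fin n → En n → ℝ} (hX : ∀ i, Integrable (X i) (vB n))
    (h : ∀ ζ, IsTestFun (ball 0 1) ζ → ∑ i, ∫ x, X i x * pd i ζ x ∂(vB n) = 0) {θ : En n → ℝ} (hθ : GZ θ) :
    ∑ i, ∫ x, X i x * pd i θ x ∂(vB n) = 0 := by
  have t := tendsto_finsetSum Finset.univ fun i _ => cut_lim (hX i) hθ (i := i)
  refine tendsto_nhds_unique (t.congr' ?_) tendsto_const_nhds
  filter_upwards [eventually_gt_atTop 0] with j hj using h _ (cutj_test j hj hθ.sm)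

/-- mixed second derivatives commute weakly -/
lemma weak_swap {h : En n → ℝ} {H : Fin n → En n → ℝ} (hH : ∀ i, Integrable (H i) (vB n))
    (hw : ∀ i, HasWeakPartial (ball 0 1) h (H i) i) (i j : Fin n) {θ : En n → ℝ} (hθ : GZ θ) :
    ∫ x, H i x * pd j θ x ∂(vB n) = ∫ x, H j x * pd i θ x ∂(vB n) := by
  refine tendsto_nhds_unique ((cut_lim (hH i) hθ (i := j)).congr' ?_) (cut_lim (hH j) hθ (i := i))
  filter_upwards [eventually_gt_atTop 0] with l hl
  have ht := cutj_test l hl hθ.sm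
  have a := hw i _ (ht.pd j)
  have b := hw j _ (ht.pd i)
  have c : ∫ x, h x * fderiv ℝ (pd j fun y => θ y * cutj l y) x (basisVec i) ∂(vB n) = 
      ∫ x, h x * fderiv ℝ (pd i fun y => θ y * cutj l y) x (basisVec j) ∂(vB n) := by
    congr 1; ext x; congr 1; exact SM.pd_comm ht.1 i j x
  rw [a, b] at c
  linarith

abbrev vI : Measure ℝ := volume.restrict (Set.Ioo (0:ℝ) 1)

instance vI_prob : IsProbabilityMeasure vI := ⟨by simp⟩

lemma mink {g : ℝ × En n → ℝ} (hg : StronglyMeasurable g) {μ : Measure (En n)} [IsFiniteMeasure μ] {A : ℝ}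
    (h : ∀ t ∈ Set.Ioo (0:ℝ) 1, Integrable (fun x => g (t, x) ^ 2) μ ∧ ∫ x, g (t, x) ^ 2 ∂μ ≤ A) :
    (∀ᵐ x ∂μ, Integrable (fun t => g (t, x)) vI) ∧ MemLp (fun x => ∫ t, g (t, x) ∂vI) 2 μ ∧ 
      ∫ x, (∫ t, g (t, x) ∂vI) ^ 2 ∂μ ≤ A := by
  have hA : ∀ᵐ t ∂vI, Integrable (fun x => g (t, x) ^ 2) μ ∧ ∫ x, g (t, x) ^ 2 ∂μ ≤ A :=
    (ae_restrict_mem measurableSet_Ioo).mono h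
  have hg2 : StronglyMeasurable (fun p => g p ^ 2) := hg.pow 2
  have hp : Integrable (fun p => g p ^ 2) (vI.prod μ) := by
    rw [integrable_prod_iff hg2.aestronglyMeasurable]
    refine ⟨hA.mono fun t ht => ht.1, ?_⟩
    refine Integrable.of_bound (C := A) (hg2.norm.integral_prod_right).aestronglyMeasurable ?_
    filter_upwards [hA] with t ht
    rw [Real.norm_of_nonneg (integral_nonneg fun x => norm_nonneg _)]
    refine le_trans (le_of_eq ?_) ht.2
    congr 1; ext x; exact Real.norm_of_nonneg (sq_nonneg _)
  have hL : ∀ᵐ x ∂μ, MemLp (fun t => g (t, x)) 2 vI := by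
    filter_upwards [hp.prod_left_ae] with x hx
    exact (memLp_two_iff_integrable_sq (hg.comp_measurable measurable_prodMk_right).aestronglyMeasurable).2 hx
  have hc : ∀ᵐ x ∂μ, (∫ t, g (t, x) ∂vI) ^ 2 ≤ ∫ t, g (t, x) ^ 2 ∂vI := by
    filter_upwards [hL] with x hx
    have := l2_cs (μ := vI) (f := fun t => g (t, x)) (g := fun _ => 1) hx (memLp_const _)
    simpa using this
  have hm : StronglyMeasurable (fun x => ∫ t, g (t, x) ∂vI) := StronglyMeasurable.integral_prod_left (f := fun t x => g (t, x)) hg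
  have hi : Integrable (fun x => (∫ t, g (t, x) ∂vI) ^ 2) μ := by
    refine hp.integral_prod_right.mono' (hm.pow 2).aestronglyMeasurable ?_
    filter_upwards [hc] with x hx
    rwa [Real.norm_of_nonneg (sq_nonneg _)]
  refine ⟨hL.mono fun x hx => hx.integrable (by norm_num), (memLp_two_iff_integrable_sq hm.aestronglyMeasurable).2 hi, ?_⟩
  calc _ ≤ ∫ x, ∫ t, g (t, x) ^ 2 ∂vI ∂μ := integral_mono_ae hi hp.integral_prod_right hc
    _ = ∫ t, ∫ x, g (t, x) ^ 2 ∂μ ∂vI := (integral_integral_swap hp).symm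
    _ ≤ ∫ t, A ∂vI := integral_mono_ae hp.integral_prod_left (integrable_const _) (hA.mono fun t ht => ht.2)
    _ = A := by simp

lemma dil {F : En n → ℝ} (hF : Integrable F (vB n)) {t : ℝ} (ht : 0 < t) (ht1 : t ≤ 1) (x1 : En n) {ρ : ℝ} (hF0 : ∀ x, 0 ≤ F x) :
    Integrable (fun x => F (t • x)) (vB n) ∧ ∫ x in ball x1 ρ, F (t • x) ∂(vB n) ≤ (t ^ n)⁻¹ * ∫ y in ball (t • x1) (t * ρ), F y ∂(vB n) := by
  have hm : ∀ (x y : En n) (r : ℝ), t • x ∈ ball (t • y) (t * r) ↔ x ∈ ball y r := by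
    intro x y r
    rw [mem_ball, mem_ball, dist_eq_norm, dist_eq_norm, ← smul_sub, norm_smul, Real.norm_of_nonneg ht.le]
    exact mul_lt_mul_iff_right₀ ht
  have hm0 : ∀ (x : En n), t • x ∈ ball (0 : En n) t ↔ x ∈ ball (0 : En n) 1 := by
    intro x; have := hm x 0 1; simpa using this
  constructor
  · have h1 : IntegrableOn F (ball (0 : En n) t) volume := IntegrableOn.mono_set hF (ball_subset_ball ht1)
    have h2 := ((integrable_indicator_iff measurableSet_ball).2 h1).comp_smul ht.ne'
    refine (integrable_indicator_iff measurableSet_ball).1 (h2.congr (ae_of_all _ fun x => ?_))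
    beta_reduce
    by_cases hx : x ∈ ball (0 : En n) 1
    · rw [Set.indicator_of_mem hx, Set.indicator_of_mem ((hm0 x).2 hx)]
    · rw [Set.indicator_of_notMem hx, Set.indicator_of_notMem (fun h => hx ((hm0 x).1 h))]
  · have e : ∫ x in ball x1 ρ, F (t • x) ∂(vB n) = (t ^ n)⁻¹ * ∫ y in ball (t • x1) (t * ρ) ∩ ball 0 t, F y := by
      rw [Measure.restrict_restrict measurableSet_ball, ← integral_indicator (measurableSet_ball.inter measurableSet_ball),
        ← integral_indicator (measurableSet_ball.inter measurableSet_ball)]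
      have := Measure.integral_comp_smul (volume : Measure (En n)) ((ball (t • x1) (t * ρ) ∩ ball 0 t).indicator F) t
      rw [finrank_euclideanSpace_fin, abs_of_nonneg (by positivity), smul_eq_mul] at this
      rw [← this]
      congr 1; ext x
      by_cases hx : x ∈ ball x1 ρ ∩ ball (0 : En n) 1
      · rw [Set.indicator_of_mem hx, Set.indicator_of_mem (Set.mem_inter ((hm _ _ _).2 hx.1) ((hm0 x).2 hx.2))]
      · rw [Set.indicator_of_notMem hx, Set.indicator_of_notMem (fun h => hx ⟨(hm _ _ _).1 h.1, (hm0 x).1 h.2⟩)]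
    rw [e, Measure.restrict_restrict measurableSet_ball]
    refine mul_le_mul_of_nonneg_left ?_ (by positivity)
    refine setIntegral_mono_set ?_ (ae_of_all _ fun x => hF0 x) (ae_of_all _ (Set.inter_subset_inter_right _ (ball_subset_ball ht1)))
    exact IntegrableOn.mono_set hF Set.inter_subset_right

/-- weighted radial average -/
def Av (ω : ℝ → ℝ) (z : En n → ℝ) (x : En n) : ℝ := ∫ t, ω t * z (t • x) ∂vI

lemma dil_l2 {z : En n → ℝ} (hm : Measurable z) (hz : MemLp z 2 (vB n)) {t : ℝ} (ht : 0 < t) (ht1 : t ≤ 1) :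
    MemLp (fun x => z (t • x)) 2 (vB n) := by
  refine (memLp_two_iff_integrable_sq ?_).2 (dil hz.integrable_sq ht ht1 0 (ρ := 1) fun x => sq_nonneg _).1
  exact (hm.comp (measurable_const_smul t)).aestronglyMeasurable

lemma mean_min {f : En n → ℝ} {μ : Measure (En n)} [IsFiniteMeasure μ] (hf : MemLp f 2 μ) (c : ℝ) :
    ∫ x, (f x - ⨍ y, f y ∂μ) ^ 2 ∂μ ≤ ∫ x, (f x - c) ^ 2 ∂μ := by
  set a := ⨍ y, f y ∂μ with ha
  have hi := hf.integrable (by norm_num : (1:ℝ≥0∞) ≤ 2)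
  have h1 : ∫ x, (f x - a) ∂μ = 0 := by
    rw [ha]; exact integral_sub_average μ f
  have e : ∀ x, (f x - c) ^ 2 = (f x - a) ^ 2 + (2 * (a - c) * (f x - a) + (a - c) ^ 2) := fun x => by ring
  have i1 : Integrable (fun x => (f x - a) ^ 2) μ := (hf.sub (memLp_const a)).integrable_sq
  have i2 : Integrable (fun x => f x - a) μ := hi.sub (integrable_const a)
  have i3 : Integrable (fun x => 2 * (a - c) * (f x - a) + (a - c) ^ 2) μ := (i2.const_mul _).add (integrable_const _)
  simp_rw [e]
  rw [integral_add i1 i3, integral_add (i2.const_mul _) (integrable_const _), integral_const_mul, h1]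
  have : 0 ≤ ∫ x : En n, (a - c) ^ 2 ∂μ := integral_nonneg fun x => sq_nonneg _
  linarith

lemma av_cm {lam : ℝ} (hl : 0 ≤ lam) {z : En n → ℝ} (hm : Measurable z) {M : ℝ} (hz : Cm lam z M) {ω : ℝ → ℝ} (hω : Measurable ω) {B : ℝ} (hB : 0 ≤ B)
    (hωB : ∀ t ∈ Set.Ioo (0:ℝ) 1, ω t ^ 2 ≤ B ^ 2 * t ^ n) : 
    (∀ᵐ x ∂(vB n), Integrable (fun t => ω t * z (t • x)) vI) ∧ Cm lam (Av ω z) (B * M) := by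
  have hg : StronglyMeasurable (fun p : ℝ × En n => ω p.1 * z (p.1 • p.2)) :=
    ((hω.comp measurable_fst).mul (hm.comp (measurable_fst.smul measurable_snd))).stronglyMeasurable
  have key : ∀ t ∈ Set.Ioo (0:ℝ) 1, ω t ^ 2 * (t ^ n)⁻¹ ≤ B ^ 2 := by
    intro t ht
    have : 0 < t ^ n := pow_pos ht.1 n
    rw [← div_eq_mul_inv, div_le_iff₀ this]; exact hωB t ht
  have h1 := mink hg (μ := vB n) (A := (B * M) ^ 2) (fun t ht => by
    have d := dil_l2 hm hz.l2 ht.1 ht.2.le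
    refine ⟨(d.const_mul (ω t)).integrable_sq, ?_⟩
    simp only [mul_pow]
    rw [integral_const_mul]
    have d2 := (dil hz.l2.integrable_sq ht.1 ht.2.le 0 (ρ := 1) fun x => sq_nonneg _).2
    rw [Measure.restrict_restrict measurableSet_ball, Set.inter_self] at d2
    calc ω t ^ 2 * ∫ x, z (t • x) ^ 2 ∂(vB n) ≤ ω t ^ 2 * ((t ^ n)⁻¹ * ∫ x, z x ^ 2 ∂(vB n)) := by
          gcongr
          refine d2.trans ?_
          have : 0 < t ^ n := pow_pos ht.1 n
          refine mul_le_mul_of_nonneg_left ?_ (by positivity)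
          exact setIntegral_le_integral hz.l2.integrable_sq (ae_of_all _ fun x => sq_nonneg _)
      _ = (ω t ^ 2 * (t ^ n)⁻¹) * ∫ x, z x ^ 2 ∂(vB n) := by ring
      _ ≤ B ^ 2 * M ^ 2 := mul_le_mul (key t ht) hz.tot (integral_nonneg fun x => sq_nonneg _) (sq_nonneg _))
  refine ⟨h1.1, h1.2.1, mul_nonneg hB hz.nn, h1.2.2, ?_⟩
  intro x1 hx1 ρ hρ
  set μ := (vB n).restrict (ball x1 ρ) with hμ
  set c : ℝ → ℝ := fun t => ⨍ x, z (t • x) ∂μ with hc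
  have hcm : StronglyMeasurable c := by
    have h0 : StronglyMeasurable (fun p : ℝ × En n => z (p.1 • p.2)) := 
      (hm.comp (measurable_fst.smul measurable_snd)).stronglyMeasurable
    have : StronglyMeasurable (fun t => ∫ x, z (t • x) ∂μ) := h0.integral_prod_right
    have e : c = fun t => (μ.real Set.univ)⁻¹ * ∫ x, z (t • x) ∂μ := by
      ext t; rw [hc]; simp only [average_eq, smul_eq_mul]
    rw [e]; exact this.const_mul _
  have hg2 : StronglyMeasurable (fun p : ℝ × En n => ω p.1 * (z (p.1 • p.2) - c p.1)) :=
    ((hω.comp measurable_fst).mul ((hm.comp (measurable_fst.smul measurable_snd)).sub (hcm.measurable.comp measurable_fst))).stronglyMeasurable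
  have h2 := mink hg2 (μ := μ) (A := (B * M) ^ 2 * ρ ^ lam) (fun t ht => by
    have d := (dil_l2 hm hz.l2 ht.1 ht.2.le).restrict (ball x1 ρ)
    refine ⟨((d.sub (memLp_const (c t))).const_mul (ω t)).integrable_sq, ?_⟩
    simp only [mul_pow]
    rw [integral_const_mul]
    have htx : ‖t • x1‖ ≤ 1 := by
      rw [norm_smul, Real.norm_of_nonneg ht.1.le]; nlinarith [norm_nonneg x1, ht.2, ht.1]
    obtain ⟨c', hc'⟩ := hz.osc (t • x1) htx (t * ρ) (mul_pos ht.1 hρ)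
    have a1 := mean_min d c'
    have a2 := (dil (l2_sub_const hz.l2 c').integrable_sq ht.1 ht.2.le x1 (ρ := ρ) fun x => sq_nonneg _).2
    have h3 : ∫ x, (z (t • x) - c t) ^ 2 ∂μ ≤ (t ^ n)⁻¹ * (M ^ 2 * ρ ^ lam) := by
      refine a1.trans (a2.trans ?_)
      have : 0 < t ^ n := pow_pos ht.1 n
      refine mul_le_mul_of_nonneg_left (hc'.trans ?_) (by positivity)
      have := ht.1
      gcongr
      nlinarith [ht.2]
    calc _ ≤ ω t ^ 2 * ((t ^ n)⁻¹ * (M ^ 2 * ρ ^ lam)) := by gcongr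
      _ = (ω t ^ 2 * (t ^ n)⁻¹) * (M ^ 2 * ρ ^ lam) := by ring
      _ ≤ B ^ 2 * (M ^ 2 * ρ ^ lam) := by gcongr; exact key t ht
      _ = _ := by ring)
  refine ⟨∫ t, ω t * c t ∂vI, le_trans (le_of_eq ?_) h2.2.2⟩
  refine integral_congr_ae ?_
  by_cases hc0 : Integrable (fun t => ω t * c t) vI
  · filter_upwards [ae_restrict_of_ae h1.1] with x hx
    congr 1
    simp only [mul_sub]
    rw [integral_sub hx hc0]; rfl
  · have hae : ∀ᵐ x ∂μ, False := by
      filter_upwards [ae_restrict_of_ae h1.1, h2.1] with x hx hx2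
      apply hc0
      refine (hx.sub hx2).congr (ae_of_all _ fun t => ?_)
      simp only [Pi.sub_apply]; ring
    filter_upwards [hae] with x hx using hx.elim

lemma dil_eq (z E : En n → ℝ) {t : ℝ} (ht : 0 < t) (ht1 : t ≤ 1) :
    ∫ x, z (t • x) * E x ∂(vB n) = (t ^ n)⁻¹ * ∫ y, (ball 0 t).indicator (fun y => z y * E (t⁻¹ • y)) y ∂(vB n) := by
  have hm0 : ∀ (x : En n), t • x ∈ ball (0 : En n) t ↔ x ∈ ball (0 : En n) 1 := by
    intro x
    rw [mem_ball_zero_iff, mem_ball_zero_iff, norm_smul, Real.norm_of_nonneg ht.le]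
    constructor <;> intro h <;> nlinarith
  have e1 : ∫ y, (ball 0 t).indicator (fun y => z y * E (t⁻¹ • y)) y ∂(vB n) = 
      ∫ y, (ball (0 : En n) t).indicator (fun y => z y * E (t⁻¹ • y)) y := by
    refine setIntegral_eq_integral_of_forall_compl_eq_zero fun y hy => ?_
    exact Set.indicator_of_notMem (fun h => hy (ball_subset_ball ht1 h)) _
  have := Measure.integral_comp_smul (volume : Measure (En n)) ((ball (0 : En n) t).indicator (fun y => z y * E (t⁻¹ • y))) t
  rw [finrank_euclideanSpace_fin, abs_of_nonneg (by positivity), smul_eq_mul] at this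
  rw [e1, ← this, ← integral_indicator measurableSet_ball]
  congr 1; ext x
  by_cases hx : x ∈ ball (0 : En n) 1
  · rw [Set.indicator_of_mem hx, Set.indicator_of_mem ((hm0 x).2 hx), inv_smul_smul₀ ht.ne']
  · rw [Set.indicator_of_notMem hx, Set.indicator_of_notMem (fun h => hx ((hm0 x).1 h))]

lemma av_weak (hn : 2 ≤ n) {z : En n → ℝ} (hm : Measurable z) (hz : MemLp z 2 (vB n)) {G : En n → ℝ} (hG : GZ G) :
    ∑ i, ∫ x, (x i * Av (fun t => t ^ (n - 1)) z x) * pd i G x ∂(vB n) = - ∫ x, z x * G x ∂(vB n) := by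
  set M := √(∫ x, z x ^ 2 ∂(vB n)) with hM
  have hM2 : M ^ 2 = ∫ x, z x ^ 2 ∂(vB n) := Real.sq_sqrt (integral_nonneg fun x => sq_nonneg _)
  have hC0 : Cm 0 z M := ⟨hz, Real.sqrt_nonneg _, hM2.ge, fun x1 _ ρ _ => ⟨0, by
    simp only [sub_zero, Real.rpow_zero, mul_one]; rw [hM2]
    exact setIntegral_le_integral hz.integrable_sq (ae_of_all _ fun x => sq_nonneg _)⟩⟩
  have hψ := av_cm le_rfl hm hC0 (ω := fun t => t ^ (n - 1)) (by fun_prop) (B := 1) zero_le_one (by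
    intro t ht
    rw [← pow_mul, one_pow, one_mul]
    exact pow_le_pow_of_le_one ht.1.le ht.2.le (by omega))
  have hψ1 := l2_l1 hψ.2.l2
  set ψ := Av (fun t => t ^ (n - 1)) z with hψd
  set E : En n → ℝ := fun x => ∑ i, x i * pd i G x with hE
  have hEc : Continuous E := continuous_finsetSum _ fun i _ => (SM.coord i).continuous.mul (hG.sm.pd i).continuous
  have hEf : ∀ x, E x = fderiv ℝ G x x := fun x => (fderiv_eq_sum_pd G x x).symm
  obtain ⟨C, hC⟩ := (isCompact_closedBall (0 : En n) 1).exists_bound_of_continuousOn hEc.continuousOn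
  have hCn : 0 ≤ C := (norm_nonneg _).trans (hC 0 (by simp))
  have e1 : ∑ i, ∫ x, (x i * ψ x) * pd i G x ∂(vB n) = ∫ x, ψ x * E x ∂(vB n) := by
    rw [← integral_finsetSum]
    · congr 1; ext x; rw [hE, Finset.mul_sum]; exact Finset.sum_congr rfl fun i _ => by ring
    · intro i _
      have : Integrable (fun x => ψ x * (x i * pd i G x)) (vB n) := 
        int_mul_cont hψ1 ((SM.coord i).continuous.mul (hG.sm.pd i).continuous)
      refine this.congr (ae_of_all _ fun x => by ring)
  rw [e1]
  -- kernel
  set k : ℝ × En n → ℝ := fun p => {p : ℝ × En n | ‖p.2‖ < p.1}.indicator (fun p => p.1⁻¹ * (z p.2 * E (p.1⁻¹ • p.2))) p with hk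
  have hkm : StronglyMeasurable k := by
    refine Measurable.stronglyMeasurable (Measurable.indicator ?_ ?_)
    · exact (measurable_fst.inv).mul ((hm.comp measurable_snd).mul (hEc.measurable.comp (measurable_fst.inv.smul measurable_snd)))
    · exact measurableSet_lt (measurable_snd.norm) measurable_fst
  have hkt : ∀ t, (fun y => k (t, y)) = fun y => t⁻¹ * (ball 0 t).indicator (fun y => z y * E (t⁻¹ • y)) y := by
    intro t; ext y
    by_cases hy : ‖y‖ < t
    · rw [Set.indicator_of_mem (by simpa using hy), hk]; exact Set.indicator_of_mem (by simpa using hy) _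
    · rw [Set.indicator_of_notMem (by simpa using hy), mul_zero, hk]; exact Set.indicator_of_notMem (by simpa using hy) _
  have hkb : ∀ t ∈ Set.Ioo (0:ℝ) 1, ∀ y, |k (t, y)| ≤ t⁻¹ * C * (ball (0 : En n) t).indicator (fun y => |z y|) y := by
    intro t ht y
    have ht0 := ht.1
    have : k (t, y) = t⁻¹ * (ball 0 t).indicator (fun y => z y * E (t⁻¹ • y)) y := congrFun (hkt t) y
    rw [this, abs_mul, abs_of_pos (inv_pos.2 ht0), mul_assoc]
    gcongr
    by_cases hy : y ∈ ball 0 t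
    · rw [Set.indicator_of_mem hy, Set.indicator_of_mem hy, abs_mul, mul_comm]
      gcongr
      refine hC _ ?_
      rw [mem_closedBall_zero_iff, norm_smul, norm_inv, Real.norm_of_nonneg ht0.le]
      rw [mem_ball_zero_iff] at hy
      rw [inv_mul_le_iff₀ ht0]; linarith
    · rw [Set.indicator_of_notMem hy, Set.indicator_of_notMem hy]; simp
  have hz1 := l2_l1 hz
  have hki : ∀ t ∈ Set.Ioo (0:ℝ) 1, Integrable (fun y => k (t, y)) (vB n) ∧ ∫ y, ‖k (t, y)‖ ∂(vB n) ≤ C * (√(om n) * M) := by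
    intro t ht
    have ht0 := ht.1
    have i0 : Integrable (fun y => t⁻¹ * C * (ball (0 : En n) t).indicator (fun y => |z y|) y) (vB n) :=
      (hz1.abs.indicator measurableSet_ball).const_mul _
    have i1 : Integrable (fun y => k (t, y)) (vB n) :=
      i0.mono' (hkm.comp_measurable measurable_prodMk_left).aestronglyMeasurable (ae_of_all _ (hkb t ht))
    refine ⟨i1, ?_⟩
    calc _ ≤ ∫ y, t⁻¹ * C * (ball (0 : En n) t).indicator (fun y => |z y|) y ∂(vB n) := 
          integral_mono_ae i1.norm i0 (ae_of_all _ (hkb t ht))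
      _ = t⁻¹ * C * ∫ y in ball (0 : En n) t, |z y - 0| ∂(vB n) := by
          rw [integral_const_mul, integral_indicator measurableSet_ball]; simp
      _ ≤ t⁻¹ * C * (√(om n * t ^ n) * M) := by
          refine mul_le_mul_of_nonneg_left ((int_abs_le hz 0 _).trans ?_) (by positivity)
          refine mul_le_mul (Real.sqrt_le_sqrt (vB_ball_le 0 ht0)) (Real.sqrt_le_sqrt ?_) (Real.sqrt_nonneg _) (Real.sqrt_nonneg _)
          simp only [sub_zero]
          exact setIntegral_le_integral hz.integrable_sq (ae_of_all _ fun x => sq_nonneg _)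
      _ ≤ t⁻¹ * C * ((√(om n) * t) * M) := by
          have : √(om n * t ^ n) ≤ √(om n) * t := by
            rw [Real.sqrt_mul om_pos.le]
            gcongr
            rw [Real.sqrt_le_left ht0.le]
            exact pow_le_pow_of_le_one ht0.le ht.2.le hn
          have : 0 ≤ M := Real.sqrt_nonneg _
          gcongr
      _ = _ := by field_simp
  have hIoo := ae_restrict_mem (μ := (volume : Measure ℝ)) (measurableSet_Ioo (a := (0:ℝ)) (b := 1))
  have hkp : Integrable k (vI.prod (vB n)) := by
    rw [integrable_prod_iff hkm.aestronglyMeasurable]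
    refine ⟨hIoo.mono fun t ht => (hki t ht).1, Integrable.of_bound (C := C * (√(om n) * M)) 
      hkm.norm.integral_prod_right.aestronglyMeasurable (hIoo.mono fun t ht => ?_)⟩
    rw [Real.norm_of_nonneg (integral_nonneg fun x => norm_nonneg _)]
    exact (hki t ht).2
  -- the other side
  set q : ℝ × En n → ℝ := fun p => p.1 ^ (n - 1) * z (p.1 • p.2) * E p.2 with hq
  have hqm : StronglyMeasurable q := (((measurable_fst.pow_const _).mul (hm.comp (measurable_fst.smul measurable_snd))).mul
    (hEc.measurable.comp measurable_snd)).stronglyMeasurable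
  have hpw : ∀ t : ℝ, 0 < t → t ^ (n - 1) * (t ^ n)⁻¹ = t⁻¹ := by
    intro t ht
    have : t ^ n = t ^ (n - 1) * t := by rw [← pow_succ]; congr 1; omega
    rw [this]; field_simp
  have hqe : ∀ t ∈ Set.Ioo (0:ℝ) 1, ∫ x, q (t, x) ∂(vB n) = ∫ y, k (t, y) ∂(vB n) := by
    intro t ht
    have h1 := dil_eq z E ht.1 ht.2.le
    have h2 : ∫ x, q (t, x) ∂(vB n) = t ^ (n - 1) * ∫ x, z (t • x) * E x ∂(vB n) := by
      rw [← integral_const_mul]; congr 1; ext x; simp only [hq]; ring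
    rw [h2, h1, hkt t, integral_const_mul, ← mul_assoc, hpw t ht.1]
  have hqn : ∀ t ∈ Set.Ioo (0:ℝ) 1, ∫ x, ‖q (t, x)‖ ∂(vB n) = ∫ y, ‖k (t, y)‖ ∂(vB n) := by
    intro t ht
    have h1 := dil_eq (fun y => |z y|) (fun y => |E y|) ht.1 ht.2.le
    have h2 : ∫ x, ‖q (t, x)‖ ∂(vB n) = t ^ (n - 1) * ∫ x, |z (t • x)| * |E x| ∂(vB n) := by
      rw [← integral_const_mul]; congr 1; ext x; simp only [hq]
      rw [Real.norm_eq_abs, abs_mul, abs_mul, abs_of_nonneg (pow_nonneg ht.1.le _)]; ring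
    rw [h2, h1, ← mul_assoc, hpw t ht.1, ← integral_const_mul]
    congr 1; ext y
    have : k (t, y) = t⁻¹ * (ball 0 t).indicator (fun y => z y * E (t⁻¹ • y)) y := congrFun (hkt t) y
    rw [this, Real.norm_eq_abs, abs_mul, abs_of_pos (inv_pos.2 ht.1)]
    congr 1
    by_cases hy : y ∈ ball 0 t
    · rw [Set.indicator_of_mem hy, Set.indicator_of_mem hy, abs_mul]
    · rw [Set.indicator_of_notMem hy, Set.indicator_of_notMem hy]; simp
  have hqp : Integrable q (vI.prod (vB n)) := by
    rw [integrable_prod_iff hqm.aestronglyMeasurable]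
    refine ⟨hIoo.mono fun t ht => ?_, Integrable.of_bound (C := C * (√(om n) * M)) 
      hqm.norm.integral_prod_right.aestronglyMeasurable (hIoo.mono fun t ht => ?_)⟩
    · have i : Integrable (fun x => t ^ (n - 1) * z (t • x)) (vB n) := (l2_l1 (dil_l2 hm hz ht.1 ht.2.le)).const_mul _
      exact int_mul_cont i hEc
    · rw [Real.norm_of_nonneg (integral_nonneg fun x => norm_nonneg _), hqn t ht]
      exact (hki t ht).2
  have e2 : ∫ x, ψ x * E x ∂(vB n) = ∫ x, ∫ t, q (t, x) ∂vI ∂(vB n) := by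
    congr 1; ext x; rw [hψd, Av, ← integral_mul_const]
  have e3 : ∫ t, ∫ x, q (t, x) ∂(vB n) ∂vI = ∫ t, ∫ x, k (t, x) ∂(vB n) ∂vI :=
    integral_congr_ae (hIoo.mono fun t ht => hqe t ht)
  rw [e2, ← integral_integral_swap (f := fun t x => q (t, x)) hqp, e3, integral_integral_swap (f := fun t x => k (t, x)) hkp, ← integral_neg]
  refine integral_congr_ae ?_
  have hne : ∀ᵐ y ∂(vB n), y ≠ 0 := by
    haveI : Nonempty (Fin n) := ⟨⟨0, by omega⟩⟩
    exact ae_restrict_of_ae (Measure.ae_ne volume 0)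
  filter_upwards [ae_restrict_mem measurableSet_ball, hne] with y hy hy0
  have hy1 : ‖y‖ < 1 := mem_ball_zero_iff.1 hy
  have hyp : 0 < ‖y‖ := norm_pos_iff.2 hy0
  have e4 : ∫ t, k (t, y) ∂vI = ∫ t in Set.Ioo ‖y‖ 1, t⁻¹ * (z y * E (t⁻¹ • y)) := by
    rw [← integral_indicator measurableSet_Ioo, ← integral_indicator measurableSet_Ioo]
    congr 1; ext t
    by_cases h1 : t ∈ Set.Ioo ‖y‖ 1
    · rw [Set.indicator_of_mem h1, Set.indicator_of_mem (show t ∈ Set.Ioo (0:ℝ) 1 from ⟨hyp.trans h1.1, h1.2⟩), hk]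
      exact Set.indicator_of_mem (by simpa using h1.1) _
    · rw [Set.indicator_of_notMem h1]
      by_cases h2 : t ∈ Set.Ioo (0:ℝ) 1
      · rw [Set.indicator_of_mem h2, hk]
        have h3 : (t, y) ∉ {p : ℝ × En n | ‖p.2‖ < p.1} := fun h => h1 ⟨h, h2.2⟩
        exact Set.indicator_of_notMem h3 _
      · rw [Set.indicator_of_notMem h2]
  rw [e4, ← integral_Ioc_eq_integral_Ioo, ← intervalIntegral.integral_of_le hy1.le]
  have hd : ∀ t ∈ Set.uIcc ‖y‖ 1, HasDerivAt (fun t : ℝ => -(z y * G (t⁻¹ • y))) (t⁻¹ * (z y * E (t⁻¹ • y))) t := by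
    intro t ht
    rw [Set.uIcc_of_le hy1.le] at ht
    have ht0 : 0 < t := hyp.trans_le ht.1
    have a := (hasDerivAt_inv ht0.ne').smul_const y
    have b := (hG.sm.diff (t⁻¹ • y)).hasFDerivAt.comp_hasDerivAt t a
    have c := (b.const_mul (z y)).neg
    have e : -(z y * (fderiv ℝ G (t⁻¹ • y)) (-(t ^ 2)⁻¹ • y)) = t⁻¹ * (z y * E (t⁻¹ • y)) := by
      rw [hEf, map_smul, map_smul, smul_eq_mul, smul_eq_mul]
      field_simp
    rw [e] at c
    exact c
  rw [intervalIntegral.integral_eq_sub_of_hasDerivAt hd]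
  · have : G (‖y‖⁻¹ • y) = 0 := hG.zero _ (by rw [norm_smul, norm_inv, norm_norm, inv_mul_cancel₀ hyp.ne'])
    rw [this]; simp
  · refine ContinuousOn.intervalIntegrable ?_
    rw [Set.uIcc_of_le hy1.le]
    have hi : ContinuousOn (fun t : ℝ => t⁻¹) (Set.Icc ‖y‖ 1) := continuousOn_inv₀.mono fun t ht => (hyp.trans_le ht.1).ne'
    exact hi.mul (continuousOn_const.mul (hEc.comp_continuousOn (hi.smul continuousOn_const)))

lemma psi_exists (n : ℕ) : ∃ Ψ : En n → ℝ, GZ Ψ ∧ ∀ i v, pd i Ψ v = -(cutj 2 v * v i) := by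
  set X : ℝ → ℝ := fun s => Real.smoothTransition (2 * (1 - s) - 1) with hX
  have hXs : ContDiff ℝ (⊤ : ℕ∞) X := by
    refine Real.smoothTransition.contDiff.comp ?_
    fun_prop
  set P : ℝ → ℝ := fun s => -(∫ t in (1:ℝ)..s, X t) with hP
  have hPd : ∀ s, HasDerivAt P (-X s) s := fun s =>
    (intervalIntegral.integral_hasDerivAt_right (hXs.continuous.intervalIntegrable _ _)
      (hXs.continuous.stronglyMeasurable.stronglyMeasurableAtFilter) hXs.continuous.continuousAt).neg
  have hPs : ContDiff ℝ (⊤ : ℕ∞) P := by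
    rw [contDiff_infty_iff_deriv]
    refine ⟨fun s => (hPd s).differentiableAt, ?_⟩
    have : deriv P = fun s => -X s := funext fun s => (hPd s).deriv
    rw [this]; exact hXs.neg
  have hsm : SM (fun v : En n => P (‖v‖ ^ 2)) := hPs.comp SM.normsq
  refine ⟨fun v => (1/2) * P (‖v‖ ^ 2), ⟨contDiff_const.mul hsm, fun v hv => ?_⟩, fun i v => ?_⟩
  · rw [hv, hP]; simp
  · rw [pd_const_mul i _ (hsm.diff v), pd_comp i (f := P) (g := fun v : En n => ‖v‖ ^ 2) (hPd _) (SM.normsq.diff v), pd_normsq]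
    have : cutj 2 v = X (‖v‖ ^ 2) := by simp [cutj, hX]
    rw [this]; ring

lemma pd_aff (ζ : En n → ℝ) (hζ : Differentiable ℝ ζ) (y : En n) (σ : ℝ) (i : Fin n) :
    pd i (fun v => ζ (y - σ • v)) = fun v => -σ * pd i ζ (y - σ • v) := by
  ext v
  unfold pd
  have h1 : HasFDerivAt (fun v : En n => y - σ • v) (-(σ • ContinuousLinearMap.id ℝ (En n))) v :=
    ((hasFDerivAt_id v).const_smul σ).const_sub y
  have := ((hζ (y - σ • v)).hasFDerivAt.comp v h1).fderiv
  change (fderiv ℝ (ζ ∘ fun v => y - σ • v) v) _ = _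
  rw [this]
  simp

lemma SM.aff {ζ : En n → ℝ} (hζ : SM ζ) (y : En n) (σ : ℝ) : SM (fun v : En n => ζ (y - σ • v)) :=
  ContDiff.comp (g := ζ) hζ (contDiff_const.sub (contDiff_id.const_smul σ))

lemma lap_aff {ζ : En n → ℝ} (hζ : SM ζ) (y : En n) (σ : ℝ) (v : En n) :
    lap (fun v => ζ (y - σ • v)) v = σ ^ 2 * lap ζ (y - σ • v) := by
  unfold lap
  rw [Finset.mul_sum]
  refine Finset.sum_congr rfl fun i _ => ?_
  rw [pd_aff ζ hζ.diff, pd_const_mul i _ (((hζ.pd i).aff y σ).diff v), pd_aff _ (hζ.pd i).diff]; ring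

/-- weakly harmonic -/
structure WH (z : En n → ℝ) : Prop where
  int : Integrable z (vB n)
  har : ∀ ζ, IsTestFun (ball 0 1) ζ → ∫ x, z x * lap ζ x ∂(vB n) = 0

lemma test_trans {ζ : En n → ℝ} (hζ : IsTestFun (ball 0 (1/2)) ζ) {v : En n} (hv : ‖v‖ ≤ 1 / 2) : IsTestFun (ball 0 1) (fun y => ζ (y - v)) := by
  refine ⟨ContDiff.comp (g := ζ) hζ.1 (contDiff_id.sub contDiff_const), ?_, ?_⟩
  · exact hζ.2.1.comp_homeomorph (Homeomorph.subRight v)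
  · intro y hy
    have : y - v ∈ tsupport ζ := by
      have := tsupport_comp_subset_preimage ζ (f := fun y : En n => y - v) (by fun_prop) hy
      exact this
    have := hζ.2.2 this
    rw [mem_ball_zero_iff] at this ⊢
    calc ‖y‖ = ‖(y - v) + v‖ := by simp
      _ ≤ ‖y - v‖ + ‖v‖ := norm_add_le _ _
      _ < 1 := by linarith

lemma lap_trans {ζ : En n → ℝ} (hζ : SM ζ) (v y : En n) :
    lap (fun y => ζ (y - v)) y = lap ζ (y - v) := by
  have e : ∀ (f : En n → ℝ) (i : Fin n), pd i (fun y => f (y - v)) = fun y => pd i f (y - v) := by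
    intro f i; ext y; unfold pd; rw [fderiv_comp_sub]
  unfold lap
  refine Finset.sum_congr rfl fun i _ => ?_
  rw [e, e]

lemma wh_core {z : En n → ℝ} (hz : WH z) {ζ : En n → ℝ} (hζ : IsTestFun (ball 0 (1/2)) ζ) :
    ∫ y, z y * (∫ v, ζ (y - (1/2:ℝ) • v) * cutj 2 v ∂(vB n)) ∂(vB n) = (∫ v, cutj 2 v ∂(vB n)) * ∫ y, z y * ζ y ∂(vB n) := by
  obtain ⟨Ψ, hΨ, hΨd⟩ := psi_exists n
  have hs : SM ζ := hζ.1
  have hzi := hz.int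
  have hcc : Continuous (cutj 2 : En n → ℝ) := (cutj_sm 2).continuous
  have hcb : ∀ x : En n, |cutj 2 x| ≤ 1 := fun x => by
    unfold cutj; rw [abs_of_nonneg (Real.smoothTransition.nonneg _)]; exact Real.smoothTransition.le_one _
  set Q : ℝ → ℝ := fun σ => ∫ p, z p.2 * (ζ (p.2 - σ • p.1) * cutj 2 p.1) ∂((vB n).prod (vB n)) with hQ
  have hcf : Continuous (fderiv ℝ ζ) := hs.continuous_fderiv (by simp)
  obtain ⟨C, hC⟩ := (hζ.2.1.fderiv ℝ).exists_bound_of_continuous hcf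
  obtain ⟨C0, hC0⟩ := hζ.2.1.exists_bound_of_continuous hs.continuous
  have hi : Integrable (fun p : En n × En n => z p.2) ((vB n).prod (vB n)) := hzi.comp_snd _
  have hmem : ∀ᵐ p ∂((vB n).prod (vB n)), ‖p.1‖ ≤ 1 := by
    rw [Measure.prod_restrict]
    exact (ae_restrict_mem (measurableSet_ball.prod measurableSet_ball)).mono fun p hp => (mem_ball_zero_iff.1 hp.1).le
  have hQi : ∀ σ : ℝ, Integrable (fun p : En n × En n => z p.2 * (ζ (p.2 - σ • p.1) * cutj 2 p.1)) ((vB n).prod (vB n)) := by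
    intro σ
    have hc : Continuous (fun p : En n × En n => ζ (p.2 - σ • p.1) * cutj 2 p.1) :=
      (hs.continuous.comp (by fun_prop)).mul (hcc.comp continuous_fst)
    refine hi.mul_bdd (c := C0) hc.aestronglyMeasurable (ae_of_all _ fun p => ?_)
    rw [norm_mul]
    exact (mul_le_of_le_one_right (norm_nonneg _) (hcb _)).trans (hC0 _)
  have hQe : ∀ σ, Q σ = ∫ y, z y * (∫ v, ζ (y - σ • v) * cutj 2 v ∂(vB n)) ∂(vB n) := by
    intro σ
    rw [hQ]; beta_reduce
    rw [integral_prod_symm _ (hQi σ)]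
    simp_rw [integral_const_mul]
  have hQd : ∀ σ, HasDerivAt Q (∫ p, z p.2 * ((fderiv ℝ ζ (p.2 - σ • p.1) (-p.1)) * cutj 2 p.1) ∂((vB n).prod (vB n))) σ ∧
      Integrable (fun p : En n × En n => z p.2 * ((fderiv ℝ ζ (p.2 - σ • p.1) (-p.1)) * cutj 2 p.1)) ((vB n).prod (vB n)) := by
    intro σ
    have := hasDerivAt_integral_of_dominated_loc_of_deriv_le (μ := (vB n).prod (vB n)) (x₀ := σ) (s := Set.univ)
      (F := fun σ p => z p.2 * (ζ (p.2 - σ • p.1) * cutj 2 p.1))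
      (F' := fun σ p => z p.2 * ((fderiv ℝ ζ (p.2 - σ • p.1) (-p.1)) * cutj 2 p.1)) (bound := fun p => |z p.2| * C)
      univ_mem (Eventually.of_forall fun σ => (hQi σ).aestronglyMeasurable) (hQi σ) ?_ ?_ (hi.abs.mul_const _) ?_
    · exact ⟨this.2, this.1⟩
    · have hc : Continuous (fun p : En n × En n => (fderiv ℝ ζ (p.2 - σ • p.1) (-p.1)) * cutj 2 p.1) := by
        refine Continuous.mul ?_ (hcc.comp continuous_fst)
        exact (hcf.comp (by fun_prop)).clm_apply (by fun_prop)
      exact hi.aestronglyMeasurable.mul hc.aestronglyMeasurable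
    · filter_upwards [hmem] with p hp σ _
      rw [norm_mul, norm_mul, Real.norm_eq_abs]
      gcongr
      have h1 := (fderiv ℝ ζ (p.2 - σ • p.1)).le_opNorm (-p.1)
      rw [norm_neg] at h1
      have h2 := hC (p.2 - σ • p.1)
      have h3 : ‖cutj 2 p.1‖ ≤ 1 := hcb _
      calc _ ≤ (‖fderiv ℝ ζ (p.2 - σ • p.1)‖ * ‖p.1‖) * 1 := by gcongr
        _ ≤ (C * 1) * 1 := by gcongr; exact (norm_nonneg _).trans h2
        _ = C := by ring
    · refine ae_of_all _ fun p σ _ => ?_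
      have h1 : HasDerivAt (fun σ : ℝ => p.2 - σ • p.1) (-p.1) σ := by
        have := ((hasDerivAt_id σ).smul_const p.1).const_sub p.2
        simpa using this
      exact (((hs.diff _).hasFDerivAt.comp_hasDerivAt σ h1).mul_const _).const_mul _
  have hQ0 : ∀ σ ∈ Set.Icc (0:ℝ) (1/2), (∫ p, z p.2 * ((fderiv ℝ ζ (p.2 - σ • p.1) (-p.1)) * cutj 2 p.1) ∂((vB n).prod (vB n))) = 0 := by
    intro σ hσ
    rw [integral_prod_symm _ (hQd σ).2]
    simp_rw [integral_const_mul]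
    have key : ∀ y, ∫ v, (fderiv ℝ ζ (y - σ • v) (-v)) * cutj 2 v ∂(vB n) = ∑ i, ∫ v, pd i ζ (y - σ • v) * pd i Ψ v ∂(vB n) := by
      intro y
      rw [← integral_finsetSum]
      · congr 1; ext v
        rw [map_neg, fderiv_eq_sum_pd, ← Finset.sum_neg_distrib, Finset.sum_mul]
        refine Finset.sum_congr rfl fun i _ => ?_
        rw [hΨd]; ring
      · intro i _
        exact cont_int ((((hs.pd i).aff y σ).continuous).mul (hΨ.sm.pd i).continuous)
    simp_rw [key]
    rcases hσ.1.eq_or_lt with h0 | h0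
    · subst h0
      have : ∀ y, ∑ i, ∫ v, pd i ζ (y - (0:ℝ) • v) * pd i Ψ v ∂(vB n) = 0 := by
        intro y
        refine Finset.sum_eq_zero fun i _ => ?_
        simp only [zero_smul, sub_zero]
        rw [integral_const_mul, DIV0 hΨ i, mul_zero]
      simp_rw [this]
      simp
    · have e1 : ∀ y, ∑ i, ∫ v, pd i ζ (y - σ • v) * pd i Ψ v ∂(vB n) = ∫ v, lap ζ (y - σ • v) * (σ * Ψ v) ∂(vB n) := by
        intro y
        have g := hΨ.green (hs.aff y σ)
        simp_rw [lap_aff hs, pd_aff ζ hs.diff] at g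
        have g1 : ∫ x, Ψ x * (σ ^ 2 * lap ζ (y - σ • x)) ∂(vB n) = σ * ∫ v, lap ζ (y - σ • v) * (σ * Ψ v) ∂(vB n) := by
          rw [← integral_const_mul]; congr 1; ext v; ring
        have g2 : -∑ i, ∫ x, pd i Ψ x * (-σ * pd i ζ (y - σ • x)) ∂(vB n) = σ * ∑ i, ∫ v, pd i ζ (y - σ • v) * pd i Ψ v ∂(vB n) := by
          rw [Finset.mul_sum, ← Finset.sum_neg_distrib]
          refine Finset.sum_congr rfl fun i _ => ?_
          rw [← integral_neg, ← integral_const_mul]; congr 1; ext v; ring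
        rw [g1, g2] at g
        exact (mul_left_cancel₀ h0.ne' g).symm
      simp_rw [e1]
      have hk : Continuous (fun p : En n × En n => lap ζ (p.2 - σ • p.1)) := hs.lap.continuous.comp (by fun_prop)
      have := fub hzi hk (φ := fun v => σ * Ψ v) (continuous_const.mul hΨ.sm.continuous)
      simp only at this
      rw [← this]
      refine integral_eq_zero_of_ae ?_
      refine (ae_restrict_mem measurableSet_ball).mono fun v hv => ?_
      have hv1 : ‖σ • v‖ ≤ 1 / 2 := by
        rw [norm_smul, Real.norm_of_nonneg hσ.1]
        have := (mem_ball_zero_iff.1 hv).le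
        calc _ ≤ (1/2) * (1:ℝ) := mul_le_mul hσ.2 this (norm_nonneg _) (by norm_num)
          _ = _ := by ring
      have h2 := hz.har _ (test_trans hζ hv1)
      simp_rw [lap_trans hs] at h2
      simp [h2]
  have hconst := constant_of_has_deriv_right_zero (f := Q) (a := 0) (b := 1/2) (fun σ _ => (hQd σ).1.continuousAt.continuousWithinAt)
    (fun σ hσ => by
      have := (hQd σ).1
      rw [hQ0 σ ⟨hσ.1, hσ.2.le⟩] at this
      exact this.hasDerivWithinAt) (1/2) ⟨by norm_num, le_rfl⟩
  rw [hQe, hQe] at hconst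
  rw [hconst, ← integral_const_mul]
  congr 1; ext y
  simp only [zero_smul, sub_zero]
  rw [integral_const_mul]; ring

lemma cutj2_zero {x : En n} (hx : 1 ≤ ‖x‖) : cutj 2 x = 0 := by
  unfold cutj
  refine Real.smoothTransition.zero_of_nonpos ?_
  have : 1 ≤ ‖x‖ ^ 2 := one_le_pow₀ hx
  push_cast; linarith

lemma cutj2_supp : HasCompactSupport (cutj 2 : En n → ℝ) :=
  HasCompactSupport.intro (isCompact_closedBall (0 : En n) 1) fun x hx => cutj2_zero (by
    rw [mem_closedBall_zero_iff, not_le] at hx; exact hx.le)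

lemma cutj2_pos : 0 < ∫ v, cutj 2 v ∂(vB n) := by
  rw [setIntegral_eq_integral_of_forall_compl_eq_zero]
  · refine (cutj_sm 2).continuous.integral_pos_of_hasCompactSupport_nonneg_nonzero cutj2_supp (fun x => Real.smoothTransition.nonneg _) (x := 0) ?_
    have : cutj 2 (0 : En n) = 1 := by
      unfold cutj; exact Real.smoothTransition.one_of_one_le (by simp; norm_num)
    rw [this]; exact one_ne_zero
  · intro x hx; exact cutj2_zero (by simpa using hx)

lemma test_uniq_half {z : En n → ℝ} (hz : Integrable z (vB n)) (h : ∀ ζ, IsTestFun (ball 0 (1/2)) ζ → ∫ x, z x * ζ x ∂(vB n) = 0) :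
    ∀ᵐ x ∂(vB n), x ∈ ball (0 : En n) (1/2) → z x = 0 := by
  have hb : ball (0 : En n) (1/2) ⊆ ball 0 1 := ball_subset_ball (by norm_num)
  have := isOpen_ball.ae_eq_zero_of_integral_contDiff_smul_eq_zero (U := ball (0 : En n) (1/2)) (f := z) (μ := volume)
    ((IntegrableOn.locallyIntegrableOn hz).mono_set hb) ?_
  · exact ae_restrict_of_ae this
  · intro g hg hc hs
    rw [← h g ⟨hg, hc, hs⟩, vB, setIntegral_eq_integral_of_forall_compl_eq_zero]
    · simp [mul_comm]
    · intro x hx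
      rw [image_eq_zero_of_notMem_tsupport (fun h => hx (hb (hs h))), mul_zero]

lemma wh_rep (n : ℕ) : ∃ C, 0 ≤ C ∧ ∀ z : En n → ℝ, WH z → ∃ z' : En n → ℝ, SM z' ∧ (∀ᵐ x ∂(vB n), x ∈ ball (0 : En n) (1/2) → z x = z' x) ∧
    (∀ x, |z' x| ≤ C * ∫ y, |z y| ∂(vB n)) ∧ ∀ x y, |z' x - z' y| ≤ (C * ∫ y, |z y| ∂(vB n)) * ‖x - y‖ := by
  set κ : En n → ℝ := fun v => cutj 2 ((2:ℝ) • v) with hκ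
  have hκs : SM κ := ContDiff.comp (g := cutj 2) (cutj_sm 2) (contDiff_id.const_smul (2:ℝ))
  have hκc : HasCompactSupport κ := cutj2_supp.comp_smul (two_ne_zero)
  have hκb : ∀ x : En n, |κ x| ≤ 1 := fun x => by
    rw [hκ]; unfold cutj; rw [abs_of_nonneg (Real.smoothTransition.nonneg _)]; exact Real.smoothTransition.le_one _
  have hκe : ∀ x, κ (-x) = κ x := fun x => by simp [hκ, cutj]
  obtain ⟨K, hK⟩ := ContDiff.lipschitzWith_of_hasCompactSupport hκc hκs (by simp)
  set c : ℝ := ∫ v, cutj 2 v ∂(vB n) with hc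
  have hc0 : 0 < c := cutj2_pos
  refine ⟨2 ^ n / c * (1 + K), by positivity, fun z hz => ?_⟩
  have hzi := hz.int
  set z' : En n → ℝ := fun w => 2 ^ n / c * ∫ y, z y * κ (y - w) ∂(vB n) with hz'
  have hI : ∀ w, Integrable (fun y => z y * κ (y - w)) (vB n) := fun w => int_mul_cont hzi (hκs.continuous.comp (by fun_prop))
  refine ⟨z', ?_, ?_, ?_, ?_⟩
  · have e : z' = fun w => 2 ^ n / c * (convolution ((ball (0 : En n) 1).indicator z) κ (ContinuousLinearMap.mul ℝ ℝ) volume) w := by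
      ext w
      rw [hz']
      beta_reduce
      congr 1
      unfold convolution
      rw [← integral_indicator measurableSet_ball]
      congr 1; ext y
      rw [ContinuousLinearMap.mul_apply', ← hκe (w - y), neg_sub]
      by_cases hy : y ∈ ball (0 : En n) 1
      · rw [Set.indicator_of_mem hy, Set.indicator_of_mem hy]
      · rw [Set.indicator_of_notMem hy, Set.indicator_of_notMem hy, zero_mul]
    rw [e]
    refine contDiff_const.mul (hκc.contDiff_convolution_right _ ?_ hκs)
    exact ((integrable_indicator_iff measurableSet_ball).2 hzi).locallyIntegrable
  · have hz'c : Continuous z' := by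
      have := kint_cont hzi (k := fun p : En n × En n => κ (p.2 - p.1)) (hκs.continuous.comp (by fun_prop))
      exact continuous_const.mul this
    have := test_uniq_half (z := fun x => z x - z' x) (hzi.sub (cont_int hz'c)) ?_
    · filter_upwards [this] with x hx h; linarith [hx h]
    · intro ζ hζ
      have h1 := wh_core hz hζ
      have h2 : ∀ y, ∫ v, ζ (y - (1/2:ℝ) • v) * cutj 2 v ∂(vB n) = 2 ^ n * ∫ w, κ (y - w) * ζ w ∂(vB n) := by
        intro y
        rw [setIntegral_eq_integral_of_forall_compl_eq_zero (fun x hx => by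
          rw [cutj2_zero (by simpa using hx), mul_zero])]
        rw [setIntegral_eq_integral_of_forall_compl_eq_zero (fun x hx => by
          rw [image_eq_zero_of_notMem_tsupport (fun h => hx (ball_subset_ball (by norm_num) (hζ.2.2 h))), mul_zero])]
        have a1 := integral_sub_left_eq_self (fun u : En n => ζ (y - (1/2:ℝ) • ((2:ℝ) • u)) * cutj 2 ((2:ℝ) • u)) volume y
        have a2 := Measure.integral_comp_smul volume (fun v : En n => ζ (y - (1/2:ℝ) • v) * cutj 2 v) 2
        rw [← a1] at a2
        have a3 : ∀ w : En n, y - (1/2:ℝ) • ((2:ℝ) • (y - w)) = w := fun w => by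
          rw [smul_smul]; norm_num
        simp_rw [a3] at a2
        simp_rw [mul_comm (κ _)]
        simp only [hκ]
        rw [a2]
        simp
      simp_rw [h2] at h1
      have hk : Continuous (fun p : En n × En n => κ (p.2 - p.1)) := hκs.continuous.comp (by fun_prop)
      have h3 := fub hzi hk hζ.1.continuous
      simp only at h3
      have h4 : ∫ x, z' x * ζ x ∂(vB n) = ∫ x, z x * ζ x ∂(vB n) := by
        have : ∫ x, z' x * ζ x ∂(vB n) = 2 ^ n / c * ∫ x, (∫ y, z y * κ (y - x) ∂(vB n)) * ζ x ∂(vB n) := by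
          rw [← integral_const_mul]; congr 1; ext x; simp only [hz']; ring
        rw [this, h3]
        have h5 : ∫ y, z y * (2 ^ n * ∫ w, κ (y - w) * ζ w ∂(vB n)) ∂(vB n) = 2 ^ n * ∫ y, z y * ∫ w, κ (y - w) * ζ w ∂(vB n) ∂(vB n) := by
          rw [← integral_const_mul]; congr 1; ext y; ring
        rw [h5] at h1
        field_simp
        linarith
      simp_rw [sub_mul]
      rw [integral_sub (int_mul_cont hzi hζ.1.continuous) (int_mul_cont (cont_int hz'c) hζ.1.continuous), h4, sub_self]
  · intro x
    have : |∫ y, z y * κ (y - x) ∂(vB n)| ≤ ∫ y, |z y| ∂(vB n) := by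
      refine (abs_integral_le_integral_abs).trans (integral_mono (hI x).abs hzi.abs fun y => ?_)
      change |z y * κ (y - x)| ≤ |z y|
      rw [abs_mul]; exact mul_le_of_le_one_right (abs_nonneg _) (hκb _)
    have h0 : 0 ≤ ∫ y, |z y| ∂(vB n) := integral_nonneg fun y => abs_nonneg _
    rw [hz']; beta_reduce
    rw [abs_mul, abs_of_nonneg (by positivity : (0:ℝ) ≤ 2 ^ n / c)]
    calc _ ≤ 2 ^ n / c * ∫ y, |z y| ∂(vB n) := by gcongr
      _ ≤ _ := by
        rw [mul_assoc]
        refine mul_le_mul_of_nonneg_left ?_ (by positivity)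
        nlinarith [K.2, mul_nonneg K.2 h0]
  · intro x w
    have e : z' x - z' w = 2 ^ n / c * ∫ y, z y * (κ (y - x) - κ (y - w)) ∂(vB n) := by
      rw [hz']; beta_reduce
      rw [← mul_sub, ← integral_sub (hI x) (hI w)]
      congr 2; ext y; ring
    have : |∫ y, z y * (κ (y - x) - κ (y - w)) ∂(vB n)| ≤ ∫ y, |z y| * (K * ‖x - w‖) ∂(vB n) := by
      refine (abs_integral_le_integral_abs).trans (integral_mono ?_ (hzi.abs.mul_const _) fun y => ?_)
      · refine Integrable.abs ?_
        have := (hI x).sub (hI w)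
        refine this.congr (ae_of_all _ fun y => ?_)
        simp only [Pi.sub_apply]; ring
      change |z y * (κ (y - x) - κ (y - w))| ≤ |z y| * (K * ‖x - w‖)
      rw [abs_mul]
      refine mul_le_mul_of_nonneg_left ?_ (abs_nonneg _)
      have := hK.dist_le_mul (y - x) (y - w)
      rw [Real.dist_eq, dist_eq_norm] at this
      rwa [show y - x - (y - w) = -(x - w) by abel, norm_neg] at this
    have h0 : 0 ≤ ∫ y, |z y| ∂(vB n) := integral_nonneg fun y => abs_nonneg _
    rw [e, abs_mul, abs_of_nonneg (by positivity : (0:ℝ) ≤ 2 ^ n / c)]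
    rw [integral_mul_const] at this
    calc _ ≤ 2 ^ n / c * ((∫ y, |z y| ∂(vB n)) * (K * ‖x - w‖)) := by gcongr
      _ ≤ 2 ^ n / c * ((∫ y, |z y| ∂(vB n)) * ((1 + K) * ‖x - w‖)) := by gcongr; linarith
      _ = _ := by ring

/-- weakly harmonic function with weak gradient -/
structure HF (h : En n → ℝ) (H : Fin n → En n → ℝ) : Prop where
  hh : Integrable h (vB n)
  hH : ∀ i, Integrable (H i) (vB n)
  wp : ∀ i, HasWeakPartial (ball 0 1) h (H i) i
  div : ∀ θ, GZ θ → ∑ i, ∫ x, H i x * pd i θ x ∂(vB n) = 0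

lemma int_mul_sum {z : En n → ℝ} (hz : Integrable z (vB n)) {ι : Type*} (s : Finset ι) {f : ι → En n → ℝ} (hf : ∀ i ∈ s, Continuous (f i)) :
    ∫ x, z x * (∑ i ∈ s, f i x) ∂(vB n) = ∑ i ∈ s, ∫ x, z x * f i x ∂(vB n) := by
  simp_rw [Finset.mul_sum]
  exact integral_finsetSum _ fun i hi => int_mul_cont hz (hf i hi)

lemma HF.lapH {h : En n → ℝ} {H : Fin n → En n → ℝ} (hf : HF h H) {K : En n → ℝ} (hK : SM K) (hp : ∀ j, GZ (pd j K)) (i : Fin n) :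
    ∫ x, H i x * lap K x ∂(vB n) = 0 := by
  unfold lap
  rw [int_mul_sum (hf.hH i) _ fun j _ => ((hK.pd j).pd j).continuous]
  rw [← hf.div _ (hp i)]
  refine Finset.sum_congr rfl fun j _ => ?_
  rw [weak_swap hf.hH hf.wp i j (hp j)]
  congr 1; ext x
  rw [hK.pd_comm i j]

lemma HF.laph {h : En n → ℝ} {H : Fin n → En n → ℝ} (hf : HF h H) {K : En n → ℝ} (hK : GZ K) (hp : ∀ j, GZ (pd j K)) :
    ∫ x, h x * lap K x ∂(vB n) = 0 := by
  unfold lap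
  rw [int_mul_sum hf.hh _ fun j _ => ((hK.sm.pd j).pd j).continuous]
  have := hf.div _ hK
  rw [← neg_eq_zero, ← Finset.sum_neg_distrib] at this
  rw [← this]
  exact Finset.sum_congr rfl fun j _ => LB hf.hh (hf.hH j) (hf.wp j) (hp j)

/-- the Euler field term -/
def Eu (a : ℝ) (h : En n → ℝ) (H : Fin n → En n → ℝ) (x : En n) : ℝ := (∑ j, H j x * x j) + a * h x

lemma coord_cont (j : Fin n) : Continuous (fun x : En n => x j) := (SM.coord j).continuous

lemma HF.euInt {h : En n → ℝ} {H : Fin n → En n → ℝ} (hf : HF h H) (a : ℝ) : Integrable (Eu a h H) (vB n) := by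
  have h1 : Integrable (fun x : En n => ∑ j, H j x * x j) (vB n) := 
    integrable_finsetSum _ fun j _ => int_mul_cont (hf.hH j) (coord_cont j)
  exact h1.add (hf.hh.const_mul a)

lemma HF.eu_mul {h : En n → ℝ} {H : Fin n → En n → ℝ} (hf : HF h H) (a : ℝ) {f : En n → ℝ} (hc : Continuous f) :
    ∫ x, Eu a h H x * f x ∂(vB n) = (∑ j, ∫ x, H j x * (x j * f x) ∂(vB n)) + a * ∫ x, h x * f x ∂(vB n) := by
  have i1 : ∀ j, Integrable (fun x : En n => H j x * (x j * f x)) (vB n) := fun j => int_mul_cont (hf.hH j) ((coord_cont j).mul hc)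
  rw [← integral_finsetSum _ fun j _ => i1 j, ← integral_const_mul, ← integral_add (integrable_finsetSum _ fun j _ => i1 j) ((int_mul_cont hf.hh hc).const_mul a)]
  congr 1; ext x
  unfold Eu
  rw [add_mul, Finset.sum_mul]
  congr 1
  · exact Finset.sum_congr rfl fun j _ => by ring
  · ring

lemma HF.lapEu {h : En n → ℝ} {H : Fin n → En n → ℝ} (hf : HF h H) (a : ℝ) {K : En n → ℝ} (hK : GZ K) (hp : ∀ j, GZ (pd j K)) :
    ∫ x, Eu a h H x * lap K x ∂(vB n) = 0 := by
  rw [hf.eu_mul a hK.sm.lap.continuous, hf.laph hK hp, mul_zero, add_zero]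
  have hs := hK.sm
  have hg : ∀ i j, GZ (fun x : En n => x j * pd i K x) := fun i j => by
    have := (hp i).mul (SM.coord j)
    simpa only [mul_comm] using this
  have d1 : ∀ i j k (x : En n), pd k (fun x : En n => x j * pd i K x) x = x j * pd k (pd i K) x + (if k = j then 1 else 0) * pd i K x := by
    intro i j k x
    rw [pd_mul k ((SM.coord j).diff x) ((hs.pd i).diff x), pd_coord]
  have e1 : ∀ j, ∫ x, H j x * (x j * lap K x) ∂(vB n) = (∑ i, ∫ x, H j x * pd i (fun x : En n => x j * pd i K x) x ∂(vB n)) - ∫ x, H j x * pd j K x ∂(vB n) := by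
    intro j
    rw [← int_mul_sum (hf.hH j) _ fun i _ => ((hg i j).sm.pd i).continuous, 
      ← integral_sub (int_mul_cont (hf.hH j) (continuous_finsetSum _ fun i _ => ((hg i j).sm.pd i).continuous)) (int_mul_cont (hf.hH j) (hs.pd j).continuous)]
    congr 1; ext x
    simp_rw [d1]
    rw [Finset.sum_add_distrib, ← Finset.mul_sum]
    simp only [ite_mul, one_mul, zero_mul, Finset.sum_ite_eq', Finset.mem_univ, if_true]
    unfold lap; ring
  simp_rw [e1]
  rw [Finset.sum_sub_distrib, hf.div _ hK, sub_zero, Finset.sum_comm]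
  set θ : En n → ℝ := fun x => ((n:ℝ) - 1) * K x + ∑ j, x j * pd j K x with hθ
  have hθg : GZ θ := (hK.smul _).add (GZ.sum _ fun j _ => hg j j)
  rw [← hf.div θ hθg]
  refine Finset.sum_congr rfl fun i _ => ?_
  have e2 : ∀ j, ∫ x, H j x * pd i (fun x : En n => x j * pd i K x) x ∂(vB n) = ∫ x, H i x * pd j (fun x : En n => x j * pd i K x) x ∂(vB n) := 
    fun j => weak_swap hf.hH hf.wp j i (hg i j)
  simp_rw [e2]
  rw [← int_mul_sum (hf.hH i) _ fun j _ => ((hg i j).sm.pd j).continuous]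
  congr 1; ext x
  congr 1
  simp_rw [d1]
  rw [hθ, pd_add i ((contDiff_const.mul hs).differentiable (by simp) x) ((GZ.sum Finset.univ fun j _ => hg j j).sm.diff x), pd_const_mul i _ (hs.diff x), 
    pd_sum Finset.univ i fun j _ => (hg j j).sm.diff x]
  simp_rw [d1, if_true]
  rw [Finset.sum_add_distrib, Finset.sum_add_distrib]
  simp only [ite_mul, one_mul, zero_mul, Finset.sum_ite_eq, Finset.mem_univ, if_true, Finset.sum_const, Finset.card_univ, Fintype.card_fin, nsmul_eq_mul]
  have : ∀ j, pd j (pd i K) x = pd i (pd j K) x := fun j => hs.pd_comm j i x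
  simp_rw [this]
  ring

lemma HF.whEu {h : En n → ℝ} {H : Fin n → En n → ℝ} (hf : HF h H) (a : ℝ) : WH (Eu a h H) :=
  ⟨hf.euInt a, fun _ hζ => hf.lapEu a hζ.gz fun j => (hζ.pd j).gz⟩

lemma HF.wh {h : En n → ℝ} {H : Fin n → En n → ℝ} (hf : HF h H) : WH h :=
  ⟨hf.hh, fun _ hζ => hf.laph hζ.gz fun j => (hζ.pd j).gz⟩

lemma lip_cm (n : ℕ) {lam : ℝ} (h0 : 0 ≤ lam) (h1 : lam < n + 2) : ∃ C, 0 ≤ C ∧ ∀ (z : En n → ℝ) (A : ℝ), 0 ≤ A → Continuous z →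
    (∀ x, ‖x‖ ≤ 1 → |z x| ≤ A) → (∀ x y, ‖x‖ ≤ 1 → ‖y‖ ≤ 1 → |z x - z y| ≤ A * ‖x - y‖) → Cm lam z (C * A) := by
  obtain ⟨C, hC0, hC⟩ := Cm.mult n h0 h1 (L := 1) zero_le_one
  refine ⟨C * √(om n), by positivity, fun z A hA hc hb hl => ?_⟩
  have hcm : Cm lam (fun _ : En n => A) (√(om n) * A) := by
    refine ⟨cont_l2 continuous_const, by positivity, ?_, fun x1 _ ρ hρ => ⟨A, ?_⟩⟩
    · rw [integral_const, mul_pow, Real.sq_sqrt om_pos.le]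
      simp only [measureReal_restrict_apply_univ, smul_eq_mul]; exact le_rfl
    · simp; positivity
  have := hC _ (fun x => A⁻¹ * z x) _ hcm (continuous_const.mul hc) ?_ ?_
  · rw [mul_assoc]
    refine this.congr ?_
    refine (ae_restrict_mem measurableSet_ball).mono fun x hx => ?_
    have := hb x (mem_ball_zero_iff.1 hx).le
    rcases hA.eq_or_lt with h | h
    · rw [← h] at this ⊢
      have : z x = 0 := abs_eq_zero.1 (le_antisymm this (abs_nonneg _))
      simp [this]
    · change A⁻¹ * z x * A = z x
      field_simp
  · intro x hx
    rw [abs_mul, abs_of_nonneg (inv_nonneg.2 hA)]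
    exact (mul_le_mul_of_nonneg_left (hb x hx) (inv_nonneg.2 hA)).trans (inv_mul_le_one)
  · intro x y hx hy
    rw [← mul_sub, abs_mul, abs_of_nonneg (inv_nonneg.2 hA)]
    refine (mul_le_mul_of_nonneg_left (hl x y hx hy) (inv_nonneg.2 hA)).trans ?_
    rw [← mul_assoc]
    exact mul_le_mul_of_nonneg_right inv_mul_le_one (norm_nonneg _)

lemma HF.gradRep {h : En n → ℝ} {H : Fin n → En n → ℝ} (hf : HF h H) {h' : En n → ℝ} (hs : SM h')
    (he : ∀ᵐ x ∂(vB n), x ∈ ball (0 : En n) (1/2) → h x = h' x) (j : Fin n) : 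
    ∀ᵐ x ∂(vB n), x ∈ ball (0 : En n) (1/2) → H j x = pd j h' x := by
  have := test_uniq_half (z := fun x => H j x - pd j h' x) ((hf.hH j).sub (cont_int (hs.pd j).continuous)) ?_
  · filter_upwards [this] with x hx h; linarith [hx h]
  intro ζ hζ
  have hζ1 : IsTestFun (ball 0 1) ζ := ⟨hζ.1, hζ.2.1, hζ.2.2.trans (ball_subset_ball (by norm_num))⟩
  simp_rw [sub_mul]
  rw [integral_sub (int_mul_cont (hf.hH j) hζ.1.continuous) (int_mul_cont (cont_int (hs.pd j).continuous) hζ.1.continuous)]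
  have e1 := LB hf.hh (hf.hH j) (hf.wp j) hζ1.gz
  have e2 := hζ1.gz.ibp hs j
  have e3 : ∫ x, h x * pd j ζ x ∂(vB n) = ∫ x, pd j ζ x * h' x ∂(vB n) := by
    refine integral_congr_ae ?_
    filter_upwards [he] with x hx
    by_cases hb : x ∈ ball (0 : En n) (1/2)
    · rw [hx hb, mul_comm]
    · rw [image_eq_zero_of_notMem_tsupport (fun h => hb ((hζ.pd j).2.2 h))]; simp
  have e4 : ∫ x, ζ x * pd j h' x ∂(vB n) = ∫ x, pd j h' x * ζ x ∂(vB n) := by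
    congr 1; ext x; ring
  linarith

lemma HF.inner {h : En n → ℝ} {H : Fin n → En n → ℝ} (hf : HF h H) {a : ℕ} (ha : 1 ≤ a) {C : ℝ} (hC : 0 ≤ C)
    (hr : ∀ z : En n → ℝ, WH z → ∃ z' : En n → ℝ, SM z' ∧ (∀ᵐ x ∂(vB n), x ∈ ball (0 : En n) (1/2) → z x = z' x) ∧
    (∀ x, |z' x| ≤ C * ∫ y, |z y| ∂(vB n)) ∧ ∀ x y, |z' x - z' y| ≤ (C * ∫ y, |z y| ∂(vB n)) * ‖x - y‖) :
    ∃ h', SM h' ∧ (∀ᵐ x ∂(vB n), x ∈ ball (0 : En n) (1/2) → h x = h' x) ∧ (∀ x, ‖x‖ < 1/2 → |h' x| ≤ C * ∫ y, |Eu a h H y| ∂(vB n)) ∧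
    ∀ x y, ‖x‖ < 1/2 → ‖y‖ < 1/2 → |h' x - h' y| ≤ (C * ∫ y, |Eu a h H y| ∂(vB n)) * ‖x - y‖ := by
  obtain ⟨h', hs, he, -, -⟩ := hr h hf.wh
  obtain ⟨m', hms, hme, hmb, hml⟩ := hr _ (hf.whEu a)
  set A := C * ∫ y, |Eu a h H y| ∂(vB n) with hA
  have hA0 : 0 ≤ A := mul_nonneg hC (integral_nonneg fun y => abs_nonneg _)
  have hgr := ae_all_iff.2 (hf.gradRep hs he)
  have key : ∀ x : En n, ‖x‖ < 1/2 → (∑ j, x j * pd j h' x) + a * h' x = m' x := by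
    have : Set.EqOn (fun x => (∑ j, x j * pd j h' x) + a * h' x) m' (ball (0 : En n) (1/2)) := by
      refine Measure.eqOn_open_of_ae_eq (μ := volume) ?_ isOpen_ball ?_ hms.continuous.continuousOn
      · have hb : ball (0 : En n) (1/2) ⊆ ball 0 1 := ball_subset_ball (by norm_num)
        have h1 := ae_restrict_of_ae_restrict_of_subset hb he
        have h2 := ae_restrict_of_ae_restrict_of_subset hb hme
        have h3 := ae_restrict_of_ae_restrict_of_subset hb hgr
        filter_upwards [h1, h2, h3, ae_restrict_mem measurableSet_ball] with x a1 a2 a3 hx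
        rw [← a2 hx, ← a1 hx]
        unfold Eu
        congr 1
        exact Finset.sum_congr rfl fun j _ => by rw [a3 j hx]; ring
      · refine Continuous.continuousOn (Continuous.add ?_ (continuous_const.mul hs.continuous))
        exact continuous_finsetSum _ fun j _ => (coord_cont j).mul (hs.pd j).continuous
    exact fun x hx => this (mem_ball_zero_iff.2 hx)
  have hd : ∀ y : En n, ‖y‖ < 1/2 → ∀ t ∈ Set.Icc (0:ℝ) 1, HasDerivAt (fun t : ℝ => t ^ a * h' (t • y)) (t ^ (a - 1) * m' (t • y)) t := by
    intro y hy t ht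
    have hty : ‖t • y‖ < 1/2 := by
      rw [norm_smul, Real.norm_of_nonneg ht.1]
      exact (mul_le_of_le_one_left (norm_nonneg _) ht.2).trans_lt hy
    have h1 : HasDerivAt (fun t : ℝ => t • y) y t := by simpa using (hasDerivAt_id t).smul_const y
    have h2 := (hasDerivAt_pow a t).mul ((hs.diff (t • y)).hasFDerivAt.comp_hasDerivAt t h1)
    refine h2.congr_deriv ?_
    rw [← key _ hty, fderiv_eq_sum_pd]
    have : t ^ a = t ^ (a - 1) * t := by rw [← pow_succ]; congr 1; omega
    simp only [PiLp.smul_apply, smul_eq_mul, Function.comp]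
    rw [this, mul_add, Finset.mul_sum, Finset.mul_sum, add_comm]
    congr 1
    · exact Finset.sum_congr rfl fun j _ => by ring
    · ring
  have hcl : ∀ y : En n, ‖y‖ < 1/2 → ∀ t ∈ Set.Icc (0:ℝ) 1, HasDerivWithinAt (fun t : ℝ => t ^ a * h' (t • y)) (t ^ (a - 1) * m' (t • y)) (Set.Icc 0 1) t :=
    fun y hy t ht => (hd y hy t ht).hasDerivWithinAt
  refine ⟨h', hs, he, fun x hx => ?_, fun x y hx hy => ?_⟩
  · have := norm_image_sub_le_of_norm_deriv_le_segment_01' (hcl x hx) (C := A) ?_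
    · simpa [zero_pow (by omega : a ≠ 0)] using this
    · intro t ht
      rw [norm_mul, norm_pow, Real.norm_of_nonneg ht.1, Real.norm_eq_abs]
      exact (mul_le_of_le_one_left (abs_nonneg _) (pow_le_one₀ ht.1 ht.2.le)).trans (hmb _)
  · have := norm_image_sub_le_of_norm_deriv_le_segment_01' (f := fun t : ℝ => t ^ a * h' (t • x) - t ^ a * h' (t • y))
      (f' := fun t => t ^ (a - 1) * m' (t • x) - t ^ (a - 1) * m' (t • y)) (fun t ht => (hcl x hx t ht).sub (hcl y hy t ht)) (C := A * ‖x - y‖) ?_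
    · simpa [zero_pow (by omega : a ≠ 0)] using this
    · intro t ht
      rw [← mul_sub, norm_mul, norm_pow, Real.norm_of_nonneg ht.1, Real.norm_eq_abs]
      refine (mul_le_of_le_one_left (abs_nonneg _) (pow_le_one₀ ht.1 ht.2.le)).trans ((hml _ _).trans ?_)
      rw [← smul_sub, norm_smul, Real.norm_of_nonneg ht.1]
      refine mul_le_mul_of_nonneg_left ?_ hA0
      exact mul_le_of_le_one_left (norm_nonneg _) ht.2.le

lemma dil_deriv {z : En n → ℝ} (hz : Integrable z (vB n)) {ζ : En n → ℝ} (hζ : IsTestFun (ball 0 1) ζ) (s : ℝ) :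
    HasDerivAt (fun s : ℝ => ∫ y, z y * ζ (s • y) ∂(vB n)) (∫ y, z y * (∑ i, y i * pd i ζ (s • y)) ∂(vB n)) s := by
  have hs : SM ζ := hζ.1
  have hcf : Continuous (fderiv ℝ ζ) := hs.continuous_fderiv (by simp)
  obtain ⟨C, hC⟩ := (hζ.2.1.fderiv ℝ).exists_bound_of_continuous hcf
  simp_rw [← fderiv_eq_sum_pd]
  have hi : ∀ s : ℝ, Integrable (fun y => z y * ζ (s • y)) (vB n) := fun s => int_mul_cont hz (hs.continuous.comp (by fun_prop))
  refine (hasDerivAt_integral_of_dominated_loc_of_deriv_le (μ := vB n) (x₀ := s) (s := Set.univ) (F := fun s y => z y * ζ (s • y))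
    (F' := fun s y => z y * fderiv ℝ ζ (s • y) y) (bound := fun y => |z y| * C) univ_mem (Eventually.of_forall fun s => (hi s).aestronglyMeasurable)
    (hi s) ?_ ?_ (hz.abs.mul_const _) ?_).2
  · have hc : Continuous (fun y : En n => fderiv ℝ ζ (s • y) y) := (hcf.comp (by fun_prop)).clm_apply (by fun_prop)
    exact (int_mul_cont hz hc).aestronglyMeasurable
  · refine (ae_restrict_mem measurableSet_ball).mono fun y hy s _ => ?_
    rw [norm_mul, Real.norm_eq_abs]
    gcongr
    have h1 := (fderiv ℝ ζ (s • y)).le_opNorm y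
    have h2 := hC (s • y)
    have h3 : ‖y‖ ≤ 1 := (mem_ball_zero_iff.1 hy).le
    calc _ ≤ _ := h1
      _ ≤ C * 1 := mul_le_mul h2 h3 (norm_nonneg _) ((norm_nonneg _).trans h2)
      _ = C := mul_one _
  · refine ae_of_all _ fun y s _ => ?_
    have h1 : HasDerivAt (fun t : ℝ => t • y) y s := by simpa using (hasDerivAt_id s).smul_const y
    exact ((hs.diff _).hasFDerivAt.comp_hasDerivAt s h1).const_mul _

lemma test_dil {ζ : En n → ℝ} (hζ : IsTestFun (ball 0 1) ζ) {s : ℝ} (hs : 1 ≤ s) : IsTestFun (ball 0 1) (fun y => ζ (s • y)) := by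
  have hs0 : s ≠ 0 := by linarith
  refine ⟨ContDiff.comp (g := ζ) hζ.1 (contDiff_id.const_smul s), hζ.2.1.comp_smul hs0, ?_⟩
  intro y hy
  have : s • y ∈ tsupport ζ := tsupport_comp_subset_preimage ζ (f := fun y : En n => s • y) (by fun_prop) hy
  have := hζ.2.2 this
  rw [mem_ball_zero_iff, norm_smul, Real.norm_of_nonneg (by linarith)] at this
  rw [mem_ball_zero_iff]
  nlinarith [norm_nonneg y]

lemma pd_dil (ζ : En n → ℝ) (hζ : Differentiable ℝ ζ) (s : ℝ) (i : Fin n) :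
    pd i (fun y => ζ (s • y)) = fun y => s * pd i ζ (s • y) := by
  have := pd_aff ζ hζ 0 (-s) i
  simpa using this

lemma HF.dil_eu {h : En n → ℝ} {H : Fin n → En n → ℝ} (hf : HF h H) {a b : ℕ} (hab : a + b = n) {ζ : En n → ℝ} (hζ : IsTestFun (ball 0 1) ζ) {s : ℝ} (hs : 1 ≤ s) :
    HasDerivAt (fun s : ℝ => s ^ b * ∫ y, h y * ζ (s • y) ∂(vB n)) (-(s⁻¹ * s ^ b * ∫ y, Eu a h H y * ζ (s • y) ∂(vB n))) s := by
  have hs0 : s ≠ 0 := by linarith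
  have hsm : SM ζ := hζ.1
  have ht := test_dil hζ hs
  have hcc : ∀ i : Fin n, Continuous (fun x : En n => x i * pd i ζ (s • x)) := fun i => 
    (coord_cont i).mul ((hsm.pd i).continuous.comp (by fun_prop))
  refine ((hasDerivAt_pow b s).mul (dil_deriv hf.hh hζ s)).congr_deriv ?_
  rw [hf.eu_mul a ht.1.continuous, int_mul_sum hf.hh _ fun i _ => hcc i]
  have e : ∀ i, ∫ x, H i x * (x i * ζ (s • x)) ∂(vB n) = - (s * ∫ x, h x * (x i * pd i ζ (s • x)) ∂(vB n)) - ∫ x, h x * ζ (s • x) ∂(vB n) := by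
    intro i
    have hg : GZ (fun x : En n => x i * ζ (s • x)) := by
      have := ht.gz.mul (SM.coord i)
      simpa only [mul_comm] using this
    have h1 := LB hf.hh (hf.hH i) (hf.wp i) hg
    have h2 : ∀ x, pd i (fun x : En n => x i * ζ (s • x)) x = s * (x i * pd i ζ (s • x)) + ζ (s • x) := by
      intro x
      rw [pd_mul i ((SM.coord i).diff x) (ht.1.differentiable (by simp) x), pd_coord, pd_dil ζ hsm.diff]; simp; ring
    simp_rw [h2, mul_add] at h1
    rw [integral_add, ← integral_const_mul] at *
    · have h3 : ∫ a, h a * (s * (a i * pd i ζ (s • a))) ∂(vB n) = ∫ a, s * (h a * (a i * pd i ζ (s • a))) ∂(vB n) := by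
        congr 1; ext x; ring
      linarith
    · exact int_mul_cont hf.hh (continuous_const.mul (hcc i))
    · exact int_mul_cont hf.hh ht.1.continuous
  simp_rw [e]
  rw [Finset.sum_sub_distrib, Finset.sum_neg_distrib, ← Finset.mul_sum]
  simp only [Finset.sum_const, Finset.card_univ, Fintype.card_fin, nsmul_eq_mul]
  have hn : (n:ℝ) = a + b := by rw [← hab]; push_cast; ring
  rw [hn]
  rcases Nat.eq_zero_or_pos b with h0 | h0
  · subst h0; field_simp; simp
  · have : s ^ b = s ^ (b - 1) * s := by rw [← pow_succ]; congr 1; omega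
    rw [this]; field_simp; ring

lemma dil_eq' (z : En n → ℝ) {ζ : En n → ℝ} (hζ : IsTestFun (ball 0 1) ζ) {t : ℝ} (ht : 0 < t) (ht1 : t ≤ 1) :
    ∫ x, z (t • x) * ζ x ∂(vB n) = (t ^ n)⁻¹ * ∫ y, z y * ζ (t⁻¹ • y) ∂(vB n) := by
  rw [dil_eq z ζ ht ht1]
  congr 2; ext y
  by_cases hy : y ∈ ball (0 : En n) t
  · rw [Set.indicator_of_mem hy]
  · rw [Set.indicator_of_notMem hy, image_eq_zero_of_notMem_tsupport (f := ζ), mul_zero]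
    intro h
    have := hζ.2.2 h
    rw [mem_ball_zero_iff, norm_smul, norm_inv, Real.norm_of_nonneg ht.le, inv_mul_lt_iff₀ ht, mul_one] at this
    exact hy (mem_ball_zero_iff.2 this)

def omg (a : ℕ) : ℝ → ℝ := (Set.Ici (1/4:ℝ)).indicator (fun t => t ^ (a - 1))

lemma omg_meas (a : ℕ) : Measurable (omg a) := (measurable_id.pow_const _).indicator measurableSet_Ici

lemma omg_bd (a : ℕ) {t : ℝ} (ht : t ∈ Set.Ioo (0:ℝ) 1) : |omg a t| ≤ 1 := by
  unfold omg
  by_cases h : t ∈ Set.Ici (1/4:ℝ)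
  · rw [Set.indicator_of_mem h, abs_of_nonneg (pow_nonneg ht.1.le _)]; exact pow_le_one₀ ht.1.le ht.2.le
  · rw [Set.indicator_of_notMem h]; simp

lemma omg_bd2 (n a : ℕ) {t : ℝ} (ht : t ∈ Set.Ioo (0:ℝ) 1) : omg a t ^ 2 ≤ ((2:ℝ) ^ n) ^ 2 * t ^ n := by
  by_cases h : t ∈ Set.Ici (1/4:ℝ)
  · have h1 : omg a t ^ 2 ≤ 1 := by rw [← sq_abs]; exact pow_le_one₀ (abs_nonneg _) (omg_bd a ht)
    refine h1.trans ?_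
    rw [← pow_mul, mul_comm n 2, pow_mul, ← mul_pow]
    refine one_le_pow₀ ?_
    have : 1/4 ≤ t := h
    linarith
  · have : omg a t = 0 := Set.indicator_of_notMem h _
    rw [this]; have := ht.1; simp only [ne_eq, OfNat.ofNat_ne_zero, not_false_eq_true, zero_pow]; positivity

lemma HF.formula {h : En n → ℝ} {H : Fin n → En n → ℝ} (hf : HF h H) {a b : ℕ} (hab : a + b = n) (ha : 1 ≤ a) {h' : En n → ℝ} (hs : Continuous h')
    (he : ∀ᵐ x ∂(vB n), x ∈ ball (0 : En n) (1/2) → h x = h' x) {m : En n → ℝ} (hm : Measurable m) (hme : Eu a h H =ᵐ[vB n] m)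
    (hav : Integrable (Av (omg a) m) (vB n)) : 
    h =ᵐ[vB n] fun x => (1/4) ^ a * h' ((1/4 : ℝ) • x) + Av (omg a) m x := by
  have hmi : Integrable m (vB n) := (hf.euInt a).congr hme
  have hc4 : Continuous (fun x => (1/4) ^ a * h' ((1/4 : ℝ) • x)) := continuous_const.mul (hs.comp (by fun_prop))
  have h2i : Integrable (fun x => (1/4) ^ a * h' ((1/4 : ℝ) • x) + Av (omg a) m x) (vB n) := (cont_int hc4).add hav
  suffices (fun x => h x - ((1/4) ^ a * h' ((1/4 : ℝ) • x) + Av (omg a) m x)) =ᵐ[vB n] 0 by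
    filter_upwards [this] with x hx
    exact sub_eq_zero.1 hx
  refine test_uniq (hf.hh.sub h2i) fun ζ hζ => ?_
  have hζc := hζ.1.continuous
  obtain ⟨C, hC⟩ := hζ.2.1.exists_bound_of_continuous hζc
  have hC0 : 0 ≤ C := (norm_nonneg _).trans (hC 0)
  -- Fubini
  set q : ℝ × En n → ℝ := fun p => omg a p.1 * m (p.1 • p.2) * ζ p.2 with hq
  have hqm : StronglyMeasurable q := (((omg_meas a).comp measurable_fst).mul (hm.comp (measurable_fst.smul measurable_snd))).mul
    (hζc.measurable.comp measurable_snd) |>.stronglyMeasurable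
  have hIoo := ae_restrict_mem (μ := (volume : Measure ℝ)) (measurableSet_Ioo (a := (0:ℝ)) (b := 1))
  have hdl : ∀ t ∈ Set.Ioo (0:ℝ) 1, Integrable (fun x => m (t • x)) (vB n) := by
    intro t ht
    have h1 := (dil hmi.abs ht.1 ht.2.le 0 (ρ := 1) fun x => abs_nonneg _).1
    exact h1.mono' (hm.comp (measurable_const_smul t)).aestronglyMeasurable (ae_of_all _ fun x => le_rfl)
  have hqp : Integrable q (vI.prod (vB n)) := by
    rw [integrable_prod_iff hqm.aestronglyMeasurable]
    refine ⟨hIoo.mono fun t ht => ?_, Integrable.of_bound (C := C * (4 ^ n * ∫ y, |m y| ∂(vB n))) 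
      hqm.norm.integral_prod_right.aestronglyMeasurable (hIoo.mono fun t ht => ?_)⟩
    · have i : Integrable (fun x => omg a t * m (t • x)) (vB n) := (hdl t ht).const_mul _
      exact int_mul_cont i hζc
    · rw [Real.norm_of_nonneg (integral_nonneg fun x => norm_nonneg _)]
      have hm0 : 0 ≤ ∫ y, |m y| ∂(vB n) := integral_nonneg fun y => abs_nonneg _
      by_cases h4 : t ∈ Set.Ici (1/4:ℝ)
      · have h1 := (dil hmi.abs ht.1 ht.2.le 0 (ρ := 1) fun x => abs_nonneg _).2
        rw [Measure.restrict_restrict measurableSet_ball, Set.inter_self] at h1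
        calc _ ≤ ∫ x, C * |m (t • x)| ∂(vB n) := by
              refine integral_mono_of_nonneg (ae_of_all _ fun x => norm_nonneg _) ((hdl t ht).abs.const_mul C) (ae_of_all _ fun x => ?_)
              simp only [hq, norm_mul, Real.norm_eq_abs]
              rw [mul_comm]
              refine mul_le_mul (hC x) (mul_le_of_le_one_left (abs_nonneg _) (omg_bd a ht)) (by positivity) hC0
          _ ≤ _ := by
              rw [integral_const_mul]
              refine mul_le_mul_of_nonneg_left (h1.trans ?_) hC0
              refine mul_le_mul ?_ (setIntegral_le_integral hmi.abs (ae_of_all _ fun x => abs_nonneg _)) (integral_nonneg fun y => abs_nonneg _) (by positivity)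
              rw [← inv_pow]
              have : 1/4 ≤ t := h4
              have h3 : t⁻¹ ≤ 4 := by rw [inv_le_comm₀ ht.1 (by norm_num)]; linarith
              exact pow_le_pow_left₀ (inv_nonneg.2 ht.1.le) h3 n
      · have : ∀ x, q (t, x) = 0 := fun x => by
          have : omg a t = 0 := Set.indicator_of_notMem h4 _
          simp [hq, this]
        simp only [this, norm_zero, integral_zero]
        positivity
  have e1 : ∫ x, Av (omg a) m x * ζ x ∂(vB n) = ∫ t, ∫ x, q (t, x) ∂(vB n) ∂vI := by
    rw [integral_integral_swap (f := fun t x => q (t, x)) hqp]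
    congr 1; ext x; rw [Av, ← integral_mul_const]
  set J : ℝ → ℝ := fun t => (t⁻¹) ^ b * ∫ y, h y * ζ (t⁻¹ • y) ∂(vB n) with hJ
  have hEq : ∀ s : ℝ, ∫ y, Eu a h H y * ζ (s • y) ∂(vB n) = ∫ y, m y * ζ (s • y) ∂(vB n) := fun s =>
    integral_congr_ae (hme.mono fun y hy => by simp only [hy])
  have hJd : ∀ t ∈ Set.uIcc (1/4:ℝ) 1, HasDerivAt J (t⁻¹ * (t⁻¹) ^ b * ∫ y, m y * ζ (t⁻¹ • y) ∂(vB n)) t := by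
    intro t ht
    rw [Set.uIcc_of_le (by norm_num)] at ht
    have ht0 : 0 < t := by linarith [ht.1]
    have h1 : 1 ≤ t⁻¹ := (one_le_inv₀ ht0).2 ht.2
    refine ((hf.dil_eu hab hζ h1).comp t (hasDerivAt_inv ht0.ne')).congr_deriv ?_
    rw [hEq]
    field_simp
  have hIc : Continuous (fun s : ℝ => ∫ y, m y * ζ (s • y) ∂(vB n)) :=
    continuous_iff_continuousAt.2 fun s => (dil_deriv hmi hζ s).continuousAt
  have hintg := intervalIntegral.integral_eq_sub_of_hasDerivAt hJd (by
    refine ContinuousOn.intervalIntegrable ?_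
    rw [Set.uIcc_of_le (by norm_num)]
    have hi : ContinuousOn (fun t : ℝ => t⁻¹) (Set.Icc (1/4) 1) := continuousOn_inv₀.mono fun t ht => by
      have := ht.1; simp only [Set.mem_compl_iff, Set.mem_singleton_iff]; intro h; linarith
    exact (hi.mul (hi.pow b)).mul (hIc.comp_continuousOn hi))
  have e2 : ∫ t, ∫ x, q (t, x) ∂(vB n) ∂vI = ∫ t in (1/4:ℝ)..1, t⁻¹ * (t⁻¹) ^ b * ∫ y, m y * ζ (t⁻¹ • y) ∂(vB n) := by
    rw [intervalIntegral.integral_of_le (by norm_num), ← integral_Ico_eq_integral_Ioc]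
    rw [← integral_indicator measurableSet_Ico, ← integral_indicator measurableSet_Ioo]
    congr 1; ext t
    by_cases h1 : t ∈ Set.Ico (1/4:ℝ) 1
    · have ht : t ∈ Set.Ioo (0:ℝ) 1 := ⟨by linarith [h1.1], h1.2⟩
      rw [Set.indicator_of_mem h1, Set.indicator_of_mem ht]
      have : ∫ x, q (t, x) ∂(vB n) = t ^ (a - 1) * ∫ x, m (t • x) * ζ x ∂(vB n) := by
        rw [← integral_const_mul]; congr 1; ext x
        have : omg a t = t ^ (a - 1) := Set.indicator_of_mem (show t ∈ Set.Ici (1/4:ℝ) from h1.1) _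
        simp only [hq, this]; ring
      rw [this, dil_eq' m hζ ht.1 ht.2.le, ← mul_assoc]
      congr 1
      have ht0 := ht.1
      have e : t ^ n = t ^ (a - 1) * t * t ^ b := by rw [← pow_succ, ← pow_add]; congr 1; omega
      rw [e, inv_pow]; field_simp
    · rw [Set.indicator_of_notMem h1]
      by_cases h2 : t ∈ Set.Ioo (0:ℝ) 1
      · rw [Set.indicator_of_mem h2]
        have h4 : t ∉ Set.Ici (1/4:ℝ) := fun h => h1 ⟨h, h2.2⟩
        have : ∀ x, q (t, x) = 0 := fun x => by
          have : omg a t = 0 := Set.indicator_of_notMem h4 _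
          simp [hq, this]
        simp [this]
      · rw [Set.indicator_of_notMem h2]
  have e3 : J 1 = ∫ y, h y * ζ y ∂(vB n) := by simp [hJ]
  have e4 : J (1/4) = ∫ x, (1/4) ^ a * h' ((1/4:ℝ) • x) * ζ x ∂(vB n) := by
    have h1 := dil_eq' h' hζ (t := 1/4) (by norm_num) (by norm_num)
    have h2 : ∫ y, h' y * ζ ((1/4:ℝ)⁻¹ • y) ∂(vB n) = ∫ y, h y * ζ ((1/4:ℝ)⁻¹ • y) ∂(vB n) := by
      refine integral_congr_ae ?_
      filter_upwards [he] with y hy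
      by_cases hb : y ∈ ball (0 : En n) (1/2)
      · rw [hy hb]
      · rw [image_eq_zero_of_notMem_tsupport (f := ζ) (x := (1/4:ℝ)⁻¹ • y)]
        · simp
        · intro h
          have := hζ.2.2 h
          rw [mem_ball_zero_iff, norm_smul] at this
          rw [mem_ball_zero_iff, not_lt] at hb
          norm_num at this; linarith
    rw [h2] at h1
    have h3 : ∫ x, (1/4) ^ a * h' ((1/4:ℝ) • x) * ζ x ∂(vB n) = (1/4) ^ a * ∫ x, h' ((1/4:ℝ) • x) * ζ x ∂(vB n) := by
      rw [← integral_const_mul]; congr 1; ext x; ring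
    rw [h3, h1, ← mul_assoc, hJ]
    beta_reduce
    congr 1
    have e : ((1/4:ℝ)) ^ n = (1/4) ^ a * (1/4) ^ b := by rw [← pow_add, hab]
    rw [e, inv_pow]; field_simp
  simp_rw [sub_mul, add_mul]
  rw [integral_sub (int_mul_cont hf.hh hζc), integral_add (int_mul_cont (cont_int hc4) hζc) (int_mul_cont hav hζc), e1, e2, hintg, e3, e4]
  · ring
  · have := int_mul_cont h2i hζc
    refine this.congr (ae_of_all _ fun x => ?_)
    simp only; ring

lemma HF.cm (n : ℕ) {lam : ℝ} (h0 : 0 ≤ lam) (h1 : lam < n + 2) : ∃ C, 0 ≤ C ∧ ∀ (h : En n → ℝ) (H : Fin n → En n → ℝ) (a b : ℕ) (M : ℝ), HF h H →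
    a + b = n → 1 ≤ a → Cm lam (Eu a h H) M → Cm lam h (C * M) := by
  obtain ⟨C1, hC1, hr⟩ := wh_rep n
  obtain ⟨C2, hC2, hl⟩ := lip_cm n h0 h1
  refine ⟨2 * (C2 * (C1 * √(om n)) + 2 ^ n), by positivity, fun h H a b M hf hab ha hM => ?_⟩
  obtain ⟨h', hs, he, hb, hL⟩ := hf.inner ha hC1 hr
  set A := C1 * ∫ y, |Eu a h H y| ∂(vB n) with hA
  have hA0 : 0 ≤ A := mul_nonneg hC1 (integral_nonneg fun y => abs_nonneg _)
  have hM0 := hM.nn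
  have hAM : A ≤ C1 * √(om n) * M := by
    rw [hA, mul_assoc]
    refine mul_le_mul_of_nonneg_left ?_ hC1
    have := int_abs_le hM.l2 0 Set.univ
    simp only [sub_zero, Measure.restrict_univ] at this
    refine this.trans ?_
    refine mul_le_mul (Real.sqrt_le_sqrt ?_) ?_ (Real.sqrt_nonneg _) (Real.sqrt_nonneg _)
    · simp [om]
    · exact Real.sqrt_le_iff.2 ⟨hM0, hM.tot⟩
  obtain ⟨m, hmm, hme⟩ := hM.l2.1.aemeasurable
  have hMm := hM.congr hme
  have hav := (av_cm h0 hmm hMm (omg_meas a) (B := 2 ^ n) (by positivity) fun t ht => omg_bd2 n a ht).2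
  have hform := hf.formula hab ha hs.continuous he hmm hme (l2_l1 hav.l2)
  have h4 : ∀ x : En n, ‖x‖ ≤ 1 → ‖(1/4:ℝ) • x‖ < 1/2 := fun x hx => by
    rw [norm_smul]; norm_num; linarith
  have h4a : |((1:ℝ)/4) ^ a| ≤ 1 := by rw [abs_of_nonneg (by positivity)]; exact pow_le_one₀ (by norm_num) (by norm_num)
  have hin := hl (fun x => (1/4) ^ a * h' ((1/4:ℝ) • x)) A hA0 (continuous_const.mul (hs.continuous.comp (by fun_prop))) 
    (fun x hx => by
      rw [abs_mul]
      exact (mul_le_of_le_one_left (abs_nonneg _) h4a).trans (hb _ (h4 x hx))) 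
    (fun x y hx hy => by
      rw [← mul_sub, abs_mul]
      refine (mul_le_of_le_one_left (abs_nonneg _) h4a).trans ((hL _ _ (h4 x hx) (h4 y hy)).trans ?_)
      refine mul_le_mul_of_nonneg_left ?_ hA0
      rw [← smul_sub, norm_smul]
      refine mul_le_of_le_one_left (norm_nonneg _) (by norm_num))
  refine ((hin.add hav).congr hform.symm).mono ?_
  have := mul_le_mul_of_nonneg_left hAM hC2
  nlinarith

lemma cm_coord (n : ℕ) {lam : ℝ} (h0 : 0 ≤ lam) (h1 : lam < n + 2) : ∃ C, 0 ≤ C ∧ ∀ (i : Fin n) (z : En n → ℝ) (M : ℝ), Cm lam z M → 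
    Cm lam (fun x => x i * z x) (C * M) := by
  obtain ⟨C, hC, h⟩ := Cm.mult n h0 h1 zero_le_one
  refine ⟨C, hC, fun i z M hz => h z (fun x => x i) M hz (coord_cont i) (fun x hx => (abs_coord_le x i).trans hx) (fun x y _ _ => ?_)⟩
  rw [one_mul]; exact abs_coord_le (x - y) i

lemma solve_cm (n : ℕ) (hn : 0 < n) {lam : ℝ} (h0 : 0 ≤ lam) (h1 : lam < n + 2) : ∃ C, 0 ≤ C ∧ ∀ (z : En n → ℝ) (F : Fin n → En n → ℝ) (M : ℝ), 0 ≤ M →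
    Integrable z (vB n) → (∀ i, Cm lam (F i) M) → (∀ G, GZ G → (∃ K, SM K ∧ G = fun x => (1 - ‖x‖ ^ 2) * K x) → ∫ x, z x * lap G x ∂(vB n) = -∑ i, ∫ x, F i x * pd i G x ∂(vB n)) →
    ∃ W : Fin n → En n → ℝ, (∀ i, HasWeakPartial (ball 0 1) z (W i) i) ∧ ∀ i, Cm lam (W i) (C * M) := by
  obtain ⟨C, hC, h⟩ := TD.cz n h0 h1
  refine ⟨C, hC, fun z F M hM hz hF hG => ?_⟩
  obtain ⟨w, D, hT⟩ := TD_exists hn F (fun i => (hF i).l2)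
  refine ⟨D, fun i φ hφ => ?_, fun i => h F w D M hT hM hF i⟩
  have hu : (fun x => z x - w x) =ᵐ[vB n] 0 := by
    refine UniqK hn (hz.sub (l2_l1 hT.hw)) fun K hK => ?_
    have hGG := GZ.oms hK
    have hc := hGG.sm.lap.continuous
    simp_rw [sub_mul (z _)]
    rw [integral_sub (int_mul_cont hz hc) (int_mul_cont (l2_l1 hT.hw) hc), hG _ hGG ⟨K, hK, rfl⟩, hT.vweak hGG, sub_self]
  rw [← hT.weakPartial i φ hφ]
  refine integral_congr_ae ?_
  filter_upwards [hu] with x hx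
  have : z x = w x := sub_eq_zero.1 hx
  simp only [this]

lemma av_solve (n : ℕ) (hn : 2 ≤ n) {lam : ℝ} (h0 : 0 ≤ lam) (h1 : lam < n + 2) : ∃ C, 0 ≤ C ∧ ∀ (z : En n → ℝ) (M : ℝ), Cm lam z M → 
    ∃ F : Fin n → En n → ℝ, (∀ i, Cm lam (F i) (C * M)) ∧ ∀ G, GZ G → ∑ i, ∫ x, F i x * pd i G x ∂(vB n) = - ∫ x, z x * G x ∂(vB n) := by
  obtain ⟨C, hC, h⟩ := cm_coord n h0 h1
  refine ⟨C, hC, fun z M hz => ?_⟩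
  set z' := hz.l2.1.mk z with hz'
  have he : z =ᵐ[vB n] z' := hz.l2.1.ae_eq_mk
  have hm : Measurable z' := (hz.l2.1.stronglyMeasurable_mk).measurable
  have hc := hz.congr he
  have := (av_cm h0 hm hc (ω := fun t => t ^ (n - 1)) (by fun_prop) zero_le_one (fun t ht => by
    rw [← pow_mul, one_pow, one_mul]
    exact pow_le_pow_of_le_one ht.1.le ht.2.le (by omega))).2
  rw [one_mul] at this
  refine ⟨fun i x => x i * Av (fun t => t ^ (n - 1)) z' x, fun i => h i _ _ this, fun G hG => ?_⟩
  rw [av_weak hn hm hc.l2 hG]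
  congr 1
  refine integral_congr_ae ?_
  filter_upwards [he] with x hx
  rw [hx]

lemma oms_pd {G : En n → ℝ} (hG : SM G) (i : Fin n) : pd i (fun x => (1 - ‖x‖ ^ 2) * G x) = fun x => (1 - ‖x‖ ^ 2) * pd i G x - 2 * (x i * G x) := by
  ext x
  have hs : SM (fun x : En n => (1 : ℝ) - ‖x‖ ^ 2) := contDiff_const.sub SM.normsq
  rw [pd_mul i (hs.diff x) (hG.diff x)]
  have : pd i (fun x : En n => (1 : ℝ) - ‖x‖ ^ 2) x = - (2 * x i) := by
    rw [pd_sub i (differentiableAt_const _) (SM.normsq.diff x), pd_const, pd_normsq]; ring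
  rw [this]; ring

lemma xG_pd {G : En n → ℝ} (hG : SM G) (i j : Fin n) : pd i (fun x => x j * G x) = fun x => x j * pd i G x + (if i = j then 1 else 0) * G x := by
  ext x
  rw [pd_mul i ((SM.coord j).diff x) (hG.diff x), pd_coord]

lemma SM.oms {G : En n → ℝ} (hG : SM G) : SM (fun x => (1 - ‖x‖ ^ 2) * G x) := (contDiff_const.sub SM.normsq).mul hG

lemma SM.xm {G : En n → ℝ} (hG : SM G) (j : Fin n) : SM (fun x => x j * G x) := (SM.coord j).mul hG

lemma lap_oms {G : En n → ℝ} (hG : SM G) (x : En n) : (1 - ‖x‖ ^ 2) * lap G x = lap (fun x => (1 - ‖x‖ ^ 2) * G x) x + 4 * ∑ j, x j * pd j G x + 2 * n * G x := by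
  unfold lap
  have : ∀ i : Fin n, pd i (pd i (fun x => (1 - ‖x‖ ^ 2) * G x)) x = (1 - ‖x‖ ^ 2) * pd i (pd i G) x - 4 * (x i * pd i G x) - 2 * G x := fun i => by
    rw [oms_pd hG i, pd_sub i ((hG.pd i).oms.diff x) ((contDiff_const.mul (hG.xm i)).differentiable (by simp) x), oms_pd (hG.pd i) i, 
      pd_const_mul i 2 ((hG.xm i).diff x), xG_pd hG]
    simp; ring
  simp_rw [this]
  rw [Finset.sum_sub_distrib, Finset.sum_sub_distrib, ← Finset.mul_sum, ← Finset.mul_sum]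
  simp; ring

lemma oms_gz {G : En n → ℝ} (hG : GZ G) (j : Fin n) : GZ (pd j (fun x => (1 - ‖x‖ ^ 2) * G x)) := by
  refine ⟨hG.sm.oms.pd j, fun x hx => ?_⟩
  rw [oms_pd hG.sm]; beta_reduce; rw [hx, hG.zero x hx]; simp

lemma int_lin2 {α : Type*} [MeasurableSpace α] {μ : Measure α} {f g : α → ℝ} (a b : ℝ) (hf : Integrable f μ) (hg : Integrable g μ) :
    ∫ x, (a * f x + b * g x) ∂μ = a * ∫ x, f x ∂μ + b * ∫ x, g x ∂μ := by
  rw [integral_add (hf.const_mul a) (hg.const_mul b), integral_const_mul, integral_const_mul]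

lemma int_lin3 {α : Type*} [MeasurableSpace α] {μ : Measure α} {f g h : α → ℝ} (a b c : ℝ) (hf : Integrable f μ) (hg : Integrable g μ) (hh : Integrable h μ) :
    ∫ x, (a * f x + b * g x + c * h x) ∂μ = a * ∫ x, f x ∂μ + b * ∫ x, g x ∂μ + c * ∫ x, h x ∂μ := by
  have h1 : Integrable (fun x => a * f x + b * g x) μ := (hf.const_mul a).add (hg.const_mul b)
  rw [integral_add h1 (hh.const_mul c), integral_const_mul, int_lin2 a b hf hg]

lemma oms_int {z : En n → ℝ} (hi : Integrable z (vB n)) {G : En n → ℝ} (hG : SM G) (hK : ∫ x, z x * lap (fun x => (1 - ‖x‖ ^ 2) * G x) x ∂(vB n) = 0) : 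
    ∫ x, (1 - ‖x‖ ^ 2) * z x * lap G x ∂(vB n) = 4 * (∑ j, ∫ x, z x * (x j * pd j G x) ∂(vB n)) + 2 * n * ∫ x, z x * G x ∂(vB n) := by
  have c1 := hG.oms.lap.continuous
  have c2 : ∀ j, Continuous (fun x => x j * pd j G x) := fun j => (coord_cont j).mul (hG.pd j).continuous
  have e1 : ∫ x, (1 - ‖x‖ ^ 2) * z x * lap G x ∂(vB n) = ∫ x, (1 * (z x * lap (fun x => (1 - ‖x‖ ^ 2) * G x) x) + 4 * (z x * ∑ j, x j * pd j G x) + 2 * n * (z x * G x)) ∂(vB n) := by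
    congr 1; ext x
    rw [mul_right_comm, lap_oms hG]; ring
  have i2 := int_mul_cont hi (f := fun x => ∑ j, x j * pd j G x) (continuous_finsetSum _ fun j _ => c2 j)
  have i3 := int_mul_cont hi hG.continuous
  rw [e1, int_lin3 _ _ _ (int_mul_cont hi c1) i2 i3, hK, int_mul_sum hi _ (fun j _ => c2 j)]; ring

lemma HF.th1 (n : ℕ) (hn : 2 ≤ n) {lam : ℝ} (h0 : 0 ≤ lam) (h1 : lam < n + 2) : ∃ C, 0 ≤ C ∧ ∀ (h : En n → ℝ) (H : Fin n → En n → ℝ) (a : ℝ) (M : ℝ), HF h H →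
    Cm lam (Eu a h H) M → ∃ W : Fin n → En n → ℝ, (∀ i, HasWeakPartial (ball 0 1) (fun x => (1 - ‖x‖ ^ 2) * Eu a h H x) (W i) i) ∧ ∀ i, Cm lam (W i) (C * M) := by
  obtain ⟨C1, hC1, hco⟩ := cm_coord n h0 h1
  obtain ⟨C2, hC2, hav⟩ := av_solve n hn h0 h1
  obtain ⟨C3, hC3, hso⟩ := solve_cm n (by omega) h0 h1
  refine ⟨C3 * (2 * (2 * n * C2 + 4 * C1)), by positivity, fun h H a M hf hm => ?_⟩
  obtain ⟨F, hF, hFG⟩ := hav _ _ hm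
  have hi := hf.euInt a
  have hM := hm.nn
  rw [mul_assoc]
  refine hso _ (fun i x => 2 * n * F i x + (-4) * (x i * Eu a h H x)) _ (by positivity) ?_ (fun i => ?_) (fun G hG _ => ?_)
  · have := int_mul_cont hi (f := fun x => 1 - ‖x‖ ^ 2) (by fun_prop)
    simpa only [mul_comm] using this
  · refine (((hF i).smul (2 * n)).add ((hco i _ _ hm).smul (-4))).mono (le_of_eq ?_)
    rw [abs_of_nonneg (by positivity), abs_of_neg (by norm_num)]; ring
  · have hK := hf.lapEu a (GZ.oms hG.sm) (oms_gz hG)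
    have c2 : ∀ j, Continuous (fun x => x j * pd j G x) := fun j => (coord_cont j).mul (hG.sm.pd j).continuous
    rw [oms_int hi hG.sm hK]
    have e2 : ∀ i : Fin n, ∫ x, (2 * n * F i x + (-4) * (x i * Eu a h H x)) * pd i G x ∂(vB n) = 2 * n * ∫ x, F i x * pd i G x ∂(vB n) - 4 * ∫ x, Eu a h H x * (x i * pd i G x) ∂(vB n) := fun i => by
      rw [← integral_const_mul, ← integral_const_mul, ← integral_sub ((int_mul_cont (l2_l1 (hF i).l2) (hG.sm.pd i).continuous).const_mul _) ((int_mul_cont hi (c2 i)).const_mul _)]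
      congr 1; ext x; ring
    simp_rw [e2]
    rw [Finset.sum_sub_distrib, ← Finset.mul_sum, ← Finset.mul_sum, hFG G hG]; ring

lemma HF.eul {h : En n → ℝ} {H : Fin n → En n → ℝ} (hf : HF h H) (a : ℝ) {G : En n → ℝ} (hG : GZ G) (i : Fin n) :
    ∑ j, ∫ x, H i x * pd j (fun y => y j * G y) x ∂(vB n) = ∫ x, Eu a h H x * pd i G x ∂(vB n) + (1 + a) * ∫ x, H i x * G x ∂(vB n) := by
  have e : ∀ j : Fin n, ∫ x, H i x * pd j (fun y => y j * G y) x ∂(vB n) = ∫ x, H j x * (x j * pd i G x) ∂(vB n) + if i = j then ∫ x, H i x * G x ∂(vB n) else 0 := fun j => by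
    have hg : GZ (fun y => y j * G y) := ⟨hG.sm.xm j, fun x hx => by rw [hG.zero x hx, mul_zero]⟩
    rw [weak_swap hf.hH hf.wp i j hg, xG_pd hG.sm]
    by_cases hij : i = j
    · subst hij
      simp only [if_true]
      have c : Continuous (fun x => x i * pd i G x) := (coord_cont i).mul (hG.sm.pd i).continuous
      rw [← integral_add (int_mul_cont (hf.hH i) c) (int_mul_cont (hf.hH i) hG.sm.continuous)]
      congr 1; ext x; ring
    · simp [hij]
  simp_rw [e]
  rw [Finset.sum_add_distrib, hf.eu_mul a (hG.sm.pd i).continuous, LB hf.hh (hf.hH i) (hf.wp i) hG]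
  simp; ring

lemma HF.th2 (n : ℕ) (hn : 2 ≤ n) {lam : ℝ} (h0 : 0 ≤ lam) (h1 : lam < n + 2) : ∃ C, 0 ≤ C ∧ ∀ (h : En n → ℝ) (H : Fin n → En n → ℝ) (a b : ℕ) (M : ℝ), HF h H →
    a + b = n → 1 ≤ a → Cm lam (Eu a h H) M → ∀ i, ∃ W : Fin n → En n → ℝ, (∀ j, HasWeakPartial (ball 0 1) (fun x => (1 - ‖x‖ ^ 2) * H i x) (W j) j) ∧ ∀ j, Cm lam (W j) (C * M) := by
  obtain ⟨C1, hC1, hcm⟩ := HF.cm n h0 h1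
  obtain ⟨C3, hC3, hso⟩ := solve_cm n (by omega) h0 h1
  refine ⟨C3 * (2 * (4 + 8 * n * C1)), by positivity, fun h H a b M hf hab ha hm i => ?_⟩
  have hi := hf.hH i
  have hM := hm.nn
  have hh := hcm h H a b M hf hab ha hm
  have hb : |(4 * a + 4 - 2 * n : ℝ)| ≤ 8 * n := by
    have h2 : (2:ℝ) ≤ n := by exact_mod_cast hn
    have h3 : (a:ℝ) ≤ n := by exact_mod_cast (by omega : a ≤ n)
    have h4 : (0:ℝ) ≤ a := by positivity
    rw [abs_le]; constructor <;> linarith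
  have hc1 : Cm lam (fun x => (-4) * Eu a h H x + (4 * a + 4 - 2 * n : ℝ) * h x) ((2 * (4 + 8 * n * C1)) * M) := by
    refine ((hm.smul (-4)).add (hh.smul (4 * a + 4 - 2 * n : ℝ))).mono ?_
    rw [abs_of_neg (by norm_num : (-4:ℝ) < 0)]
    have : |(4 * a + 4 - 2 * n : ℝ)| * (C1 * M) ≤ 8 * n * (C1 * M) := mul_le_mul_of_nonneg_right hb (by positivity)
    linarith
  rw [mul_assoc]
  refine hso _ (fun j x => if j = i then (-4) * Eu a h H x + (4 * a + 4 - 2 * n : ℝ) * h x else 0) _ (by positivity) ?_ (fun j => ?_) (fun G hG _ => ?_)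
  · have := int_mul_cont hi (f := fun x => 1 - ‖x‖ ^ 2) (by fun_prop)
    simpa only [mul_comm] using this
  · by_cases hj : j = i
    · simpa only [hj, if_true] using hc1
    · simp only [hj, if_false]; exact (Cm.zero lam).mono (by positivity)
  · rw [oms_int hi hG.sm (hf.lapH hG.sm.oms (oms_gz hG) i)]
    have e1 : ∀ j : Fin n, ∫ x, H i x * (x j * pd j G x) ∂(vB n) = ∫ x, H i x * pd j (fun y => y j * G y) x ∂(vB n) - ∫ x, H i x * G x ∂(vB n) := fun j => by
      rw [← integral_sub (int_mul_cont hi ((hG.sm.xm j).pd j).continuous) (int_mul_cont hi hG.sm.continuous)]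
      congr 1; ext x
      rw [xG_pd hG.sm]; simp; ring
    simp_rw [e1]
    rw [Finset.sum_sub_distrib, hf.eul a hG i]
    have e2 : ∑ j, ∫ x, (if j = i then (-4) * Eu a h H x + (4 * a + 4 - 2 * n : ℝ) * h x else 0) * pd j G x ∂(vB n) = 
        (-4) * ∫ x, Eu a h H x * pd i G x ∂(vB n) + (4 * a + 4 - 2 * n : ℝ) * ∫ x, h x * pd i G x ∂(vB n) := by
      rw [Finset.sum_eq_single i]
      · simp only [if_true]
        rw [← int_lin2 _ _ (int_mul_cont (hf.euInt a) (hG.sm.pd i).continuous) (int_mul_cont hf.hh (hG.sm.pd i).continuous)]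
        congr 1; ext x; ring
      · intro j _ hj; simp [hj]
      · simp
    rw [e2, LB hf.hh hi (hf.wp i) hG]
    simp; ring

lemma kap_cm (n : ℕ) {lam : ℝ} (h0 : 0 ≤ lam) (h1 : lam < n + 2) : ∃ C, 0 ≤ C ∧ ∀ (z : En n → ℝ) (a : ℕ) (M : ℝ), 1 ≤ a → a ≤ n → 
    Cm lam (fun x => (2 + (a - 1) * (1 - ‖x‖ ^ 2)) * z x) M → Cm lam z (C * M) := by
  obtain ⟨C, hC, h⟩ := Cm.mult n h0 h1 (L := n + 1) (by positivity)
  refine ⟨C, hC, fun z a M ha han hz => ?_⟩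
  have ha1 : (0:ℝ) ≤ a - 1 := by have : (1:ℝ) ≤ a := by exact_mod_cast ha
                                 linarith
  have ha2 : (a:ℝ) - 1 ≤ n := by have : (a:ℝ) ≤ n := by exact_mod_cast han
                                 linarith
  set κ : En n → ℝ := fun x => 2 + (a - 1) * (1 - ‖x‖ ^ 2) with hκ
  have hk2 : ∀ x, ‖x‖ ≤ 1 → 2 ≤ κ x := fun x hx => by
    have : 0 ≤ 1 - ‖x‖ ^ 2 := by nlinarith [norm_nonneg x]
    have := mul_nonneg ha1 this
    simp only [hκ]; linarith
  have hmax : ∀ x, ‖x‖ ≤ 1 → max (κ x) 2 = κ x := fun x hx => max_eq_left (hk2 x hx)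
  have hc : Continuous (fun x => (max (κ x) 2)⁻¹) := by
    refine Continuous.inv₀ (by fun_prop) fun x => ?_
    have := le_max_right (κ x) 2
    linarith
  have := h _ (fun x => (max (κ x) 2)⁻¹) M hz hc (fun x hx => ?_) (fun x y hx hy => ?_)
  · refine this.congr ?_
    have hb : ∀ᵐ x ∂(vB n), x ∈ ball (0 : En n) 1 := ae_restrict_mem measurableSet_ball
    filter_upwards [hb] with x hx
    have hx1 : ‖x‖ ≤ 1 := (mem_ball_zero_iff.1 hx).le
    have := hk2 x hx1
    have e : (2 + ((a:ℝ) - 1) * (1 - ‖x‖ ^ 2)) = κ x := rfl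
    rw [hmax x hx1, e, inv_mul_cancel_left₀ (by linarith)]
  · rw [hmax x hx]
    have := hk2 x hx
    rw [abs_of_pos (by positivity)]
    have : (κ x)⁻¹ ≤ 1 := inv_le_one_of_one_le₀ (by linarith)
    have : (0:ℝ) ≤ n := by positivity
    linarith
  · rw [hmax x hx, hmax y hy]
    have hx2 := hk2 x hx
    have hy2 := hk2 y hy
    have e : (κ x)⁻¹ - (κ y)⁻¹ = (κ x)⁻¹ * (κ y)⁻¹ * ((a - 1) * ((‖x‖ + ‖y‖) * (‖x‖ - ‖y‖))) := by
      have e2 : ((a:ℝ) - 1) * ((‖x‖ + ‖y‖) * (‖x‖ - ‖y‖)) = κ y - κ x := by simp only [hκ]; ring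
      rw [e2]; field_simp
    rw [e, abs_mul, abs_mul, abs_mul, abs_mul, abs_of_nonneg ha1, abs_of_pos (by positivity), abs_of_pos (by positivity), abs_of_nonneg (by positivity : 0 ≤ ‖x‖ + ‖y‖)]
    have i1 : (κ x)⁻¹ ≤ 2⁻¹ := inv_anti₀ (by norm_num) hx2
    have i2 : (κ y)⁻¹ ≤ 2⁻¹ := inv_anti₀ (by norm_num) hy2
    have i3 : |‖x‖ - ‖y‖| ≤ ‖x - y‖ := abs_norm_sub_norm_le x y
    calc (κ x)⁻¹ * (κ y)⁻¹ * ((a - 1) * ((‖x‖ + ‖y‖) * |‖x‖ - ‖y‖|)) ≤ 2⁻¹ * 2⁻¹ * (n * ((1 + 1) * ‖x - y‖)) := by gcongr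
      _ ≤ (n + 1) * ‖x - y‖ := by nlinarith [norm_nonneg (x - y), mul_nonneg (Nat.cast_nonneg (α := ℝ) n) (norm_nonneg (x - y))]

lemma HF.th3 {h : En n → ℝ} {H : Fin n → En n → ℝ} (hf : HF h H) (a : ℝ) {i : Fin n} {Wm : En n → ℝ} {W : Fin n → En n → ℝ} 
    (hWm : Integrable Wm (vB n)) (hW : ∀ j, Integrable (W j) (vB n)) (h1 : HasWeakPartial (ball 0 1) (fun x => (1 - ‖x‖ ^ 2) * Eu a h H x) Wm i)
    (h2 : ∀ j, HasWeakPartial (ball 0 1) (fun x => (1 - ‖x‖ ^ 2) * H i x) (W j) j) : 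
    (fun x => Wm x + 2 * (x i * Eu a h H x) + (-1) * ∑ j, x j * W j x) =ᵐ[vB n] fun x => (2 + (a - 1) * (1 - ‖x‖ ^ 2)) * H i x := by
  have ho : Continuous (fun x : En n => 1 - ‖x‖ ^ 2) := by fun_prop
  have ie := hf.euInt a
  have icm : ∀ {z f : En n → ℝ}, Integrable z (vB n) → Continuous f → Integrable (fun x => f x * z x) (vB n) := fun hz hc => by
    have := int_mul_cont hz hc
    simpa only [mul_comm] using this
  have J1 := hWm
  have J2 : Integrable (fun x => x i * Eu a h H x) (vB n) := icm ie (coord_cont i)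
  have J3 : Integrable (fun x => ∑ j, x j * W j x) (vB n) := integrable_finsetSum _ fun j _ => icm (hW j) (coord_cont j)
  have J4 : Integrable (fun x => (2 + (a - 1) * (1 - ‖x‖ ^ 2)) * H i x) (vB n) := icm (hf.hH i) (by fun_prop)
  have J5 : Integrable (fun x => Wm x + 2 * (x i * Eu a h H x) + (-1) * ∑ j, x j * W j x) (vB n) := (J1.add (J2.const_mul 2)).add (J3.const_mul (-1))
  suffices (fun x => (Wm x + 2 * (x i * Eu a h H x) + (-1) * ∑ j, x j * W j x) - (2 + (a - 1) * (1 - ‖x‖ ^ 2)) * H i x) =ᵐ[vB n] 0 by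
    filter_upwards [this] with x hx
    exact sub_eq_zero.1 hx
  refine test_uniq (J5.sub J4) fun ζ hζ => ?_
  have hs : SM ζ := hζ.1
  have hc := hζ.1.continuous
  set η : En n → ℝ := fun x => (1 - ‖x‖ ^ 2) * ζ x with hη
  have hηg : GZ η := GZ.oms hs
  -- weak forms
  have A1 : ∫ x, Wm x * ζ x ∂(vB n) = -∫ x, (1 - ‖x‖ ^ 2) * Eu a h H x * pd i ζ x ∂(vB n) := by
    have := h1 ζ hζ
    simp only [pd]; rw [this, neg_neg]
  have A2 : ∀ j, ∫ x, W j x * (x j * ζ x) ∂(vB n) = -∫ x, (1 - ‖x‖ ^ 2) * H i x * pd j (fun y => y j * ζ y) x ∂(vB n) := fun j => by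
    have ht : IsTestFun (ball 0 1) (fun y => y j * ζ y) := by
      have := hζ.mul (SM.coord j)
      simpa only [mul_comm] using this
    have := h2 j _ ht
    simp only [pd]; rw [this, neg_neg]
  have A3 : ∀ j, ∫ x, (1 - ‖x‖ ^ 2) * H i x * pd j (fun y => y j * ζ y) x ∂(vB n) = ∫ x, H i x * pd j (fun y => y j * η y) x ∂(vB n) + 2 * ∫ x, H i x * (x j ^ 2 * ζ x) ∂(vB n) := fun j => by
    have c1 := ((hηg.sm.xm j).pd j).continuous
    have c2 : Continuous (fun x => x j ^ 2 * ζ x) := ((coord_cont j).pow 2).mul hc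
    have := int_lin2 1 2 (int_mul_cont (hf.hH i) c1) (int_mul_cont (hf.hH i) c2)
    rw [one_mul] at this
    rw [← this]
    congr 1; ext x
    rw [xG_pd hs, xG_pd hηg.sm, oms_pd hs]
    simp; ring
  have A4 := hf.eul a hηg i
  have A5 : ∫ x, Eu a h H x * pd i η x ∂(vB n) = ∫ x, (1 - ‖x‖ ^ 2) * Eu a h H x * pd i ζ x ∂(vB n) - 2 * ∫ x, (x i * Eu a h H x) * ζ x ∂(vB n) := by
    have := int_lin2 1 (-2) (int_mul_cont (icm ie ho) (hs.pd i).continuous) (int_mul_cont J2 hc)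
    rw [one_mul, neg_mul, ← sub_eq_add_neg] at this
    rw [← this]
    congr 1; ext x
    rw [oms_pd hs]; ring
  have A6 : ∫ x, (∑ j, x j * W j x) * ζ x ∂(vB n) = ∑ j, ∫ x, W j x * (x j * ζ x) ∂(vB n) := by
    rw [← integral_finsetSum]
    · congr 1; ext x; rw [Finset.sum_mul]; refine Finset.sum_congr rfl fun j _ => by ring
    · intro j _
      have c : Continuous (fun x => x j * ζ x) := (coord_cont j).mul hc
      exact int_mul_cont (hW j) c
  have A7 : ∫ x, ((2 + (a - 1) * (1 - ‖x‖ ^ 2)) * H i x) * ζ x ∂(vB n) = 2 * (∑ j, ∫ x, H i x * (x j ^ 2 * ζ x) ∂(vB n)) + (1 + a) * ∫ x, H i x * η x ∂(vB n) := by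
    have c2 : ∀ j, Continuous (fun x => x j ^ 2 * ζ x) := fun j => ((coord_cont j).pow 2).mul hc
    rw [← int_mul_sum (hf.hH i) _ (fun j _ => c2 j), ← int_lin2 _ _ (int_mul_cont (hf.hH i) (continuous_finsetSum _ fun j _ => c2 j)) (int_mul_cont (hf.hH i) hηg.sm.continuous)]
    congr 1; ext x
    rw [← Finset.sum_mul, ← normsq_eq]; simp only [hη]; ring
  have E : ∫ x, ((Wm x + 2 * (x i * Eu a h H x) + (-1) * ∑ j, x j * W j x) - (2 + (a - 1) * (1 - ‖x‖ ^ 2)) * H i x) * ζ x ∂(vB n) = 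
      (1 * ∫ x, Wm x * ζ x ∂(vB n) + 2 * ∫ x, (x i * Eu a h H x) * ζ x ∂(vB n) + (-1) * ∫ x, (∑ j, x j * W j x) * ζ x ∂(vB n)) - ∫ x, ((2 + (a - 1) * (1 - ‖x‖ ^ 2)) * H i x) * ζ x ∂(vB n) := by
    rw [← int_lin3 _ _ _ (int_mul_cont J1 hc) (int_mul_cont J2 hc) (int_mul_cont J3 hc)]
    have := int_mul_cont J5 hc
    rw [← integral_sub (by refine this.congr (.of_forall fun x => ?_); ring) (int_mul_cont J4 hc)]
    congr 1; ext x; ring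
  rw [E, A6]
  simp_rw [A2, A3]
  rw [Finset.sum_neg_distrib, Finset.sum_add_distrib, A4, A7, ← Finset.mul_sum, A1, A5]
  ring

theorem HF.th (n : ℕ) (hn : 2 ≤ n) {lam : ℝ} (h0 : 0 ≤ lam) (h1 : lam < n + 2) : ∃ C, 0 ≤ C ∧ ∀ (h : En n → ℝ) (H : Fin n → En n → ℝ) (a b : ℕ) (M : ℝ), HF h H →
    a + b = n → 1 ≤ a → Cm lam (Eu a h H) M → ∀ i, Cm lam (H i) (C * M) := by
  obtain ⟨C1, hC1, hcm⟩ := HF.th1 n hn h0 h1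
  obtain ⟨C2, hC2, hco⟩ := cm_coord n h0 h1
  obtain ⟨C3, hC3, hcw⟩ := HF.th2 n hn h0 h1
  obtain ⟨C4, hC4, hk⟩ := kap_cm n h0 h1
  refine ⟨C4 * (2 * (2 * (C1 + 2 * C2) + 2 ^ n * n * (C2 * C3))), by positivity, fun h H a b M hf hab ha hm i => ?_⟩
  obtain ⟨Wm, hw1, hw2⟩ := hcm h H a M hf hm
  obtain ⟨W, hW1, hW2⟩ := hcw h H a b M hf hab ha hm i
  have hM := hm.nn
  rw [mul_assoc]
  refine hk _ a _ ha (by omega) ?_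
  refine Cm.congr ?_ (hf.th3 a (l2_l1 (hw2 i).l2) (fun j => l2_l1 (hW2 j).l2) (hw1 i) hW1)
  refine (((hw2 i).add ((hco i _ _ hm).smul 2)).add ((Cm.sum Finset.univ (by positivity) (fun j _ => hco j _ _ (hW2 j))).smul (-1))).mono (le_of_eq ?_)
  simp; ring

def sgn (i : Fin n) (S : Finset (Fin n)) : ℝ := (-1) ^ (S.filter (fun j => j < i)).card

lemma sgn_mul (i : Fin n) (S : Finset (Fin n)) : sgn i S * sgn i S = 1 := by
  unfold sgn; rw [← mul_pow]; simp

lemma sgn_insert {i j : Fin n} {S : Finset (Fin n)} (hi : i ∉ S) : sgn j (insert i S) = (if i < j then -1 else 1) * sgn j S := by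
  unfold sgn
  rw [Finset.filter_insert]
  by_cases h : i < j
  · rw [if_pos h, if_pos h, Finset.card_insert_of_notMem (by simp [hi]), pow_succ]; ring
  · rw [if_neg h, if_neg h, one_mul]

lemma sgn_erase {i j : Fin n} {S : Finset (Fin n)} (hj : j ∈ S) : sgn i (S.erase j) = (if j < i then -1 else 1) * sgn i S := by
  have := sgn_insert (i := j) (j := i) (S := S.erase j) (by simp)
  rw [Finset.insert_erase hj] at this
  rw [this]
  split_ifs <;> ring

def we (i : Fin n) : (Finset (Fin n) → ℝ) →ₗ[ℝ] (Finset (Fin n) → ℝ) where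
  toFun v S := if i ∈ S then sgn i S * v (S.erase i) else 0
  map_add' v w := by ext S; simp only [Pi.add_apply]; split_ifs <;> ring
  map_smul' c v := by ext S; simp only [Pi.smul_apply, smul_eq_mul, RingHom.id_apply]; split_ifs <;> ring

def co (i : Fin n) : (Finset (Fin n) → ℝ) →ₗ[ℝ] (Finset (Fin n) → ℝ) where
  toFun v S := if i ∈ S then 0 else sgn i S * v (insert i S)
  map_add' v w := by ext S; simp only [Pi.add_apply]; split_ifs <;> ring
  map_smul' c v := by ext S; simp only [Pi.smul_apply, smul_eq_mul, RingHom.id_apply]; split_ifs <;> ring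

lemma we_apply (i : Fin n) (v : Finset (Fin n) → ℝ) (S : Finset (Fin n)) : we i v S = if i ∈ S then sgn i S * v (S.erase i) else 0 := rfl
lemma co_apply (i : Fin n) (v : Finset (Fin n) → ℝ) (S : Finset (Fin n)) : co i v S = if i ∈ S then 0 else sgn i S * v (insert i S) := rfl

lemma co_we_self (i : Fin n) (v : Finset (Fin n) → ℝ) (S : Finset (Fin n)) : co i (we i v) S = if i ∈ S then 0 else v S := by
  rw [co_apply, we_apply]
  by_cases h : i ∈ S
  · simp [h]
  · rw [if_neg h, if_neg h, if_pos (Finset.mem_insert_self i S), sgn_insert h, Finset.erase_insert h, if_neg (lt_irrefl i), one_mul, ← mul_assoc, sgn_mul, one_mul]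

lemma we_co_self (i : Fin n) (v : Finset (Fin n) → ℝ) (S : Finset (Fin n)) : we i (co i v) S = if i ∈ S then v S else 0 := by
  rw [we_apply, co_apply]
  by_cases h : i ∈ S
  · rw [if_pos h, if_pos h, if_neg (by simp), sgn_erase h, Finset.insert_erase h, if_neg (lt_irrefl i), one_mul, ← mul_assoc, sgn_mul, one_mul]
  · simp [h]

lemma car (i j : Fin n) (v : Finset (Fin n) → ℝ) : co i (we j v) = (if i = j then v else 0) - we j (co i v) := by
  rw [eq_sub_iff_add_eq]
  ext S
  rw [Pi.add_apply]
  by_cases hij : i = j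
  · subst hij
    rw [co_we_self, we_co_self, if_pos rfl]
    split_ifs <;> simp
  · rw [if_neg hij, co_apply, we_apply, we_apply, co_apply]
    have hji : j ≠ i := Ne.symm hij
    by_cases hi : i ∈ S
    · simp [hi, hij]
    · by_cases hj : j ∈ S
      · rw [if_neg hi, if_pos (Finset.mem_insert_of_mem hj), if_pos hj, if_neg (by simp [hi]), sgn_insert hi, sgn_erase hj, Finset.erase_insert_of_ne hij]
        rcases lt_or_gt_of_ne hij with h | h
        · rw [if_pos h, if_neg h.not_gt]; simp; ring
        · rw [if_pos h, if_neg h.not_gt]; simp; ring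
      · simp [hi, hj, hji]

lemma we_anti (i j : Fin n) (v : Finset (Fin n) → ℝ) : we i (we j v) = - we j (we i v) := by
  ext S
  rw [Pi.neg_apply, we_apply, we_apply, we_apply, we_apply]
  by_cases hij : i = j
  · subst hij; simp
  · have hji : j ≠ i := Ne.symm hij
    by_cases hi : i ∈ S
    · by_cases hj : j ∈ S
      · rw [if_pos hi, if_pos hj, if_pos (by simp [hji, hj]), if_pos (by simp [hij, hi]), sgn_erase hi, sgn_erase hj, Finset.erase_right_comm]
        rcases lt_or_gt_of_ne hij with h | h
        · rw [if_pos h, if_neg h.not_gt]; ring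
        · rw [if_pos h, if_neg h.not_gt]; ring
      · simp [hi, hj]
    · simp [hi]

lemma co_we_sum (v : Finset (Fin n) → ℝ) (S : Finset (Fin n)) : ∑ i, co i (we i v) S = ((n - S.card : ℕ) : ℝ) * v S := by
  simp_rw [co_we_self]
  have : ∀ i, (if i ∈ S then 0 else v S) = if i ∈ Sᶜ then v S else 0 := fun i => by by_cases h : i ∈ S <;> simp [h]
  simp_rw [this]
  rw [Finset.sum_ite_mem, Finset.univ_inter, Finset.sum_const, Finset.card_compl, Fintype.card_fin, nsmul_eq_mul]

/-- antisymmetrisation -/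
lemma we_we_anti (X : Fin n → Fin n → Finset (Fin n) → ℝ) : ∑ j, ∑ l, we j (we l (X j l)) = (1/2 : ℝ) • ∑ j, ∑ l, we j (we l (X j l - X l j)) := by
  have e : ∑ j, ∑ l, we j (we l (X l j)) = - ∑ j, ∑ l, we j (we l (X j l)) := by
    rw [Finset.sum_comm, ← Finset.sum_neg_distrib]
    refine Finset.sum_congr rfl fun j _ => ?_
    rw [← Finset.sum_neg_distrib]
    exact Finset.sum_congr rfl fun l _ => we_anti _ _ _
  simp only [map_sub, Finset.sum_sub_distrib]
  rw [e, sub_neg_eq_add, ← two_smul ℝ, smul_smul]; norm_num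

/-- pairing of a family with a function -/
def pr (z : Finset (Fin n) → En n → ℝ) (η : En n → ℝ) : Finset (Fin n) → ℝ := fun S => ∫ x, z S x * η x ∂(vB n)

lemma pr_we (i : Fin n) (z : Finset (Fin n) → En n → ℝ) (η : En n → ℝ) : pr (fun S x => we i (fun T => z T x) S) η = we i (pr z η) := by
  ext S
  simp only [pr, we_apply]
  by_cases h : i ∈ S
  · simp only [h, if_true, mul_assoc]; rw [integral_const_mul]
  · simp [h]

lemma pr_co (i : Fin n) (z : Finset (Fin n) → En n → ℝ) (η : En n → ℝ) : pr (fun S x => co i (fun T => z T x) S) η = co i (pr z η) := by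
  ext S
  simp only [pr, co_apply]
  by_cases h : i ∈ S
  · simp [h]
  · simp only [h, if_false, mul_assoc]; rw [integral_const_mul]

lemma we_int {i : Fin n} {z : Finset (Fin n) → En n → ℝ} {μ : Measure (En n)} (hz : ∀ S, Integrable (z S) μ) (S : Finset (Fin n)) : Integrable (fun x => we i (fun T => z T x) S) μ := by
  simp only [we_apply]
  by_cases h : i ∈ S
  · simp only [h, if_true]; exact (hz _).const_mul _
  · simp [h]

lemma co_int {i : Fin n} {z : Finset (Fin n) → En n → ℝ} {μ : Measure (En n)} (hz : ∀ S, Integrable (z S) μ) (S : Finset (Fin n)) : Integrable (fun x => co i (fun T => z T x) S) μ := by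
  simp only [co_apply]
  by_cases h : i ∈ S
  · simp [h]
  · simp only [h, if_false]; exact (hz _).const_mul _

lemma sgn_abs (i : Fin n) (S : Finset (Fin n)) : |sgn i S| = 1 := by unfold sgn; simp

lemma we_cm {i : Fin n} {z : Finset (Fin n) → En n → ℝ} {lam M : ℝ} (hM : 0 ≤ M) (hz : ∀ S, Cm lam (z S) M) (S : Finset (Fin n)) : Cm lam (fun x => we i (fun T => z T x) S) M := by
  simp only [we_apply]
  by_cases h : i ∈ S
  · simp only [h, if_true]; have := (hz (S.erase i)).smul (sgn i S); rwa [sgn_abs, one_mul] at this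
  · simp only [h, if_false]; exact (Cm.zero lam).mono hM

lemma co_cm {i : Fin n} {z : Finset (Fin n) → En n → ℝ} {lam M : ℝ} (hM : 0 ≤ M) (hz : ∀ S, Cm lam (z S) M) (S : Finset (Fin n)) : Cm lam (fun x => co i (fun T => z T x) S) M := by
  simp only [co_apply]
  by_cases h : i ∈ S
  · simp only [h, if_true]; exact (Cm.zero lam).mono hM
  · simp only [h, if_false]; have := (hz (insert i S)).smul (sgn i S); rwa [sgn_abs, one_mul] at this

lemma pr_congr {z z' : Finset (Fin n) → En n → ℝ} (h : ∀ S, z S =ᵐ[vB n] z' S) (η : En n → ℝ) : pr z η = pr z' η := by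
  ext S
  refine integral_congr_ae ?_
  filter_upwards [h S] with x hx
  rw [hx]

lemma pr_sum {ι : Type*} (s : Finset ι) {z : ι → Finset (Fin n) → En n → ℝ} (hz : ∀ i S, Integrable (z i S) (vB n)) {η : En n → ℝ} (hη : Continuous η) : 
    pr (fun S x => ∑ i ∈ s, z i S x) η = ∑ i ∈ s, pr (z i) η := by
  ext S
  simp only [pr, Finset.sum_apply, Finset.sum_mul]
  rw [integral_finsetSum]
  exact fun i _ => int_mul_cont (hz i S) hη

lemma pr_lin {z z' : Finset (Fin n) → En n → ℝ} (hz : ∀ S, Integrable (z S) (vB n)) (hz' : ∀ S, Integrable (z' S) (vB n)) (c : ℝ) {η : En n → ℝ} (hη : Continuous η) : 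
    pr (fun S x => z S x + c * z' S x) η = pr z η + c • pr z' η := by
  ext S
  simp only [pr, Pi.add_apply, Pi.smul_apply, smul_eq_mul]
  have := int_lin2 1 c (int_mul_cont (hz S) hη) (int_mul_cont (hz' S) hη)
  rw [one_mul] at this; rw [← this]
  congr 1; ext x; ring

lemma pr_neg (z : Finset (Fin n) → En n → ℝ) (η : En n → ℝ) : pr (fun S x => - z S x) η = - pr z η := by
  ext S
  simp only [pr, Pi.neg_apply, neg_mul, integral_neg]

lemma pr_rlin {z : Finset (Fin n) → En n → ℝ} (hz : ∀ S, Integrable (z S) (vB n)) (c : ℝ) {η η' : En n → ℝ} (hη : Continuous η) (hη' : Continuous η') : 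
    pr z (fun x => η x + c * η' x) = pr z η + c • pr z η' := by
  ext S
  simp only [pr, Pi.add_apply, Pi.smul_apply, smul_eq_mul]
  have := int_lin2 1 c (int_mul_cont (hz S) hη) (int_mul_cont (hz S) hη')
  rw [one_mul] at this; rw [← this]
  congr 1; ext x; ring

lemma pr_rsum {ι : Type*} (s : Finset ι) {z : Finset (Fin n) → En n → ℝ} (hz : ∀ S, Integrable (z S) (vB n)) {η : ι → En n → ℝ} (hη : ∀ i, Continuous (η i)) : 
    pr z (fun x => ∑ i ∈ s, η i x) = ∑ i ∈ s, pr z (η i) := by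
  ext S
  simp only [pr, Finset.sum_apply]
  exact int_mul_sum (hz S) s fun i _ => hη i

structure Sys (u : Finset (Fin n) → En n → ℝ) (G : Fin n → Finset (Fin n) → En n → ℝ) (f g : Finset (Fin n) → En n → ℝ) : Prop where
  hu : ∀ S, Integrable (u S) (vB n)
  hG : ∀ i S, Integrable (G i S) (vB n)
  wp : ∀ i S, HasWeakPartial (ball 0 1) (u S) (G i S) i
  tz : ∀ η, SM η → pr f η = -∑ i, we i (pr u (pd i η))
  hf : ∀ S, f S =ᵐ[vB n] fun x => ∑ i, we i (fun T => G i T x) S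
  hg : ∀ S, g S =ᵐ[vB n] fun x => -∑ i, co i (fun T => G i T x) S

section
variable {u : Finset (Fin n) → En n → ℝ} {G : Fin n → Finset (Fin n) → En n → ℝ} {f g : Finset (Fin n) → En n → ℝ}

lemma Sys.fi (h : Sys u G f g) (S : Finset (Fin n)) : Integrable (f S) (vB n) := by
  refine Integrable.congr ?_ (h.hf S).symm
  exact integrable_finsetSum _ fun i _ => we_int (h.hG i) S

lemma Sys.gi (h : Sys u G f g) (S : Finset (Fin n)) : Integrable (g S) (vB n) := by
  refine Integrable.congr ?_ (h.hg S).symm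
  exact (integrable_finsetSum _ fun i _ => co_int (h.hG i) S).neg

lemma Sys.prf (h : Sys u G f g) {η : En n → ℝ} (hη : Continuous η) : pr f η = ∑ i, we i (pr (G i) η) := by
  rw [pr_congr h.hf, pr_sum _ (fun i => we_int (h.hG i)) hη]
  exact Finset.sum_congr rfl fun i _ => pr_we i _ _

lemma Sys.prg (h : Sys u G f g) {η : En n → ℝ} (hη : Continuous η) : pr g η = -∑ i, co i (pr (G i) η) := by
  rw [pr_congr h.hg, pr_neg, pr_sum _ (fun i => co_int (h.hG i)) hη]
  exact congrArg _ (Finset.sum_congr rfl fun i _ => pr_co i _ _)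

lemma Sys.swap (h : Sys u G f g) {η : En n → ℝ} (hη : GZ η) (i j : Fin n) : pr (G i) (pd j η) = pr (G j) (pd i η) := by
  ext S
  exact weak_swap (fun i => h.hG i S) (fun i => h.wp i S) i j hη

lemma Sys.lb (h : Sys u G f g) {η : En n → ℝ} (hη : GZ η) (i : Fin n) : pr u (pd i η) = -pr (G i) η := by
  ext S
  exact LB (h.hu S) (h.hG i S) (h.wp i S) hη

lemma Sys.box (h : Sys u G f g) {η : En n → ℝ} (hη : GZ η) : 
    ∑ i, (co i (pr f (pd i η)) - we i (pr g (pd i η))) = ∑ i, pr (G i) (pd i η) := by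
  have e1 : ∀ i, co i (pr f (pd i η)) = ∑ j, co i (we j (pr (G j) (pd i η))) := fun i => by
    rw [h.prf (hη.sm.pd i).continuous, map_sum]
  have e2 : ∀ i, we i (pr g (pd i η)) = -∑ j, we i (co j (pr (G j) (pd i η))) := fun i => by
    rw [h.prg (hη.sm.pd i).continuous, map_neg, map_sum]
  have e3 : ∑ i, ∑ j, we i (co j (pr (G j) (pd i η))) = ∑ i, ∑ j, we j (co i (pr (G j) (pd i η))) := by
    rw [Finset.sum_comm]
    exact Finset.sum_congr rfl fun i _ => Finset.sum_congr rfl fun j _ => by rw [h.swap hη]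
  simp_rw [e1, e2]
  rw [Finset.sum_sub_distrib, Finset.sum_neg_distrib, sub_neg_eq_add, e3, ← Finset.sum_add_distrib]
  refine Finset.sum_congr rfl fun i _ => ?_
  rw [← Finset.sum_add_distrib]
  simp_rw [car, sub_add_cancel]
  simp

lemma lap_xm {θ : En n → ℝ} (h : SM θ) (j : Fin n) (x : En n) : lap (fun y => y j * θ y) x = x j * lap θ x + 2 * pd j θ x := by
  unfold lap
  have : ∀ i : Fin n, pd i (pd i (fun y => y j * θ y)) x = x j * pd i (pd i θ) x + (if i = j then 2 * pd i θ x else 0) := fun i => by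
    have hs : SM (fun x : En n => (if i = j then (1:ℝ) else 0) * θ x) := contDiff_const.mul h
    rw [xG_pd h, pd_add i (((h.pd i).xm j).diff x) (hs.diff x), xG_pd (h.pd i), pd_const_mul i _ (h.diff x)]
    split_ifs <;> ring
  simp_rw [this]
  rw [Finset.sum_add_distrib, ← Finset.mul_sum]
  simp

lemma pr_lap {z : Finset (Fin n) → En n → ℝ} (hz : ∀ S, Integrable (z S) (vB n)) {η : En n → ℝ} (h : SM η) : pr z (lap η) = ∑ i, pr z (pd i (pd i η)) :=
  pr_rsum Finset.univ hz fun i => ((h.pd i).pd i).continuous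

lemma pr_lap_xm {z : Finset (Fin n) → En n → ℝ} (hz : ∀ S, Integrable (z S) (vB n)) {θ : En n → ℝ} (h : SM θ) (j : Fin n) : 
    pr z (lap (fun y => y j * θ y)) = pr z (fun x => x j * lap θ x) + (2:ℝ) • pr z (pd j θ) := by
  have c : Continuous (fun x : En n => x j * lap θ x) := (coord_cont j).mul h.lap.continuous
  rw [← pr_rlin hz 2 c (h.pd j).continuous]
  congr 1; ext x; exact lap_xm h j x

lemma Sys.key (h : Sys u G f g) {θ : En n → ℝ} (hθ : GZ θ) (hA : ∀ l j, GZ (fun x => x j * pd l θ x - x l * pd j θ x)) : 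
    ∑ j, we j (pr u (fun x => x j * lap θ x)) = (2:ℝ) • pr f θ + ∑ j, ∑ l, we j (we l (pr g (pd l (fun y => y j * θ y)))) - 
      ∑ j, ∑ i, we j (co i (pr f (pd i (fun y => y j * θ y)))) := by
  have hs := hθ.sm
  have hx : ∀ j, SM (fun y => y j * θ y) := fun j => hs.xm j
  -- the f-term
  have e1 : ∑ j, ∑ i, we j (co i (pr f (pd i (fun y => y j * θ y)))) = -∑ j, we j (pr u (lap (fun y => y j * θ y))) 
      + ∑ j, ∑ l, we j (we l (∑ i, co i (pr u (pd i (pd l (fun y => y j * θ y)))))) := by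
    rw [← Finset.sum_neg_distrib, ← Finset.sum_add_distrib]
    refine Finset.sum_congr rfl fun j _ => ?_
    have e : ∀ i, co i (pr f (pd i (fun y => y j * θ y))) = -pr u (pd i (pd i (fun y => y j * θ y))) + ∑ l, we l (co i (pr u (pd i (pd l (fun y => y j * θ y))))) := fun i => by
      rw [h.tz _ ((hx j).pd i), map_neg, map_sum]
      simp_rw [car]
      rw [Finset.sum_sub_distrib, neg_sub, sub_eq_neg_add]
      congr 1
      · simp
      · refine Finset.sum_congr rfl fun l _ => ?_
        congr 2; 
        have : pd l (pd i (fun y => y j * θ y)) = pd i (pd l (fun y => y j * θ y)) := by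
          ext x; exact (hx j).pd_comm _ _ x
        rw [this]
    rw [← map_sum (we j)]
    simp_rw [e]
    rw [Finset.sum_add_distrib, Finset.sum_neg_distrib, map_add, map_neg, pr_lap h.hu (hx j), Finset.sum_comm, map_sum]
    congr 1
    rw [map_sum]
    exact Finset.sum_congr rfl fun l _ => by rw [map_sum (we l)]
  have e2 : ∑ j, ∑ l, we j (we l (∑ i, co i (pr u (pd i (pd l (fun y => y j * θ y)))))) = ∑ j, ∑ l, we j (we l (pr g (pd l (fun y => y j * θ y)))) := by
    rw [we_we_anti, we_we_anti (fun j l => pr g (pd l (fun y => y j * θ y)))]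
    congr 1
    refine Finset.sum_congr rfl fun j _ => Finset.sum_congr rfl fun l _ => ?_
    congr 2
    have ea : ∀ x, pd l (fun y => y j * θ y) x + (-1) * pd j (fun y => y l * θ y) x = x j * pd l θ x - x l * pd j θ x := fun x => by
      rw [xG_pd hs, xG_pd hs]
      by_cases hlj : l = j
      · subst hlj; ring
      · rw [if_neg hlj, if_neg (Ne.symm hlj)]; ring
    have eA : (fun x => pd l (fun y => y j * θ y) x + (-1) * pd j (fun y => y l * θ y) x) = fun x => x j * pd l θ x - x l * pd j θ x := funext ea
    have hAz := hA l j
    rw [← eA] at hAz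
    have r1 := pr_rlin h.gi (-1) ((hx j).pd l).continuous ((hx l).pd j).continuous
    rw [neg_one_smul, ← sub_eq_add_neg] at r1
    rw [← r1, h.prg hAz.sm.continuous, ← Finset.sum_sub_distrib, ← Finset.sum_neg_distrib]
    refine Finset.sum_congr rfl fun i _ => ?_
    rw [← map_sub, ← map_neg, ← h.lb hAz i]
    congr 1
    have r2 := pr_rlin h.hu (-1) (((hx j).pd l).pd i).continuous (((hx l).pd j).pd i).continuous
    rw [neg_one_smul, ← sub_eq_add_neg] at r2
    rw [← r2, pd_lin ((hx j).pd l) ((hx l).pd j)]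
  have e3 : ∑ j, we j (pr u (lap (fun y => y j * θ y))) = ∑ j, we j (pr u (fun x => x j * lap θ x)) - (2:ℝ) • pr f θ := by
    rw [h.tz θ hs, smul_neg, sub_neg_eq_add, Finset.smul_sum, ← Finset.sum_add_distrib]
    refine Finset.sum_congr rfl fun j _ => ?_
    rw [pr_lap_xm h.hu hs, map_add, map_smul]
  rw [e1, e2, e3]; abel

def Tds (f g u0 : Finset (Fin n) → En n → ℝ) (D : Fin n → Finset (Fin n) → En n → ℝ) : Prop :=
  ∀ S, TD (fun i x => co i (fun T => f T x) S - we i (fun T => g T x) S) (u0 S) (fun i => D i S)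

variable {u0 : Finset (Fin n) → En n → ℝ} {D : Fin n → Finset (Fin n) → En n → ℝ}

lemma pr_F (hf : ∀ S, Integrable (f S) (vB n)) (hg : ∀ S, Integrable (g S) (vB n)) (i : Fin n) {η : En n → ℝ} (hη : Continuous η) (S : Finset (Fin n)) : 
    ∫ x, (co i (fun T => f T x) S - we i (fun T => g T x) S) * η x ∂(vB n) = (co i (pr f η) - we i (pr g η)) S := by
  rw [← pr_co, ← pr_we]
  simp only [Pi.sub_apply, pr]
  rw [← integral_sub (int_mul_cont (co_int hf S) hη) (int_mul_cont (we_int hg S) hη)]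
  congr 1; ext x; ring

lemma Tds.vw (h : Tds f g u0 D) (hf : ∀ S, Integrable (f S) (vB n)) (hg : ∀ S, Integrable (g S) (vB n)) {η : En n → ℝ} (hη : GZ η) : 
    pr u0 (lap η) = -∑ i, (co i (pr f (pd i η)) - we i (pr g (pd i η))) := by
  ext S
  have := (h S).vweak hη
  simp only [pr_F hf hg _ (hη.sm.pd _).continuous] at this
  rw [Pi.neg_apply, Finset.sum_apply]; exact this

lemma Tds.orth (h : Tds f g u0 D) (hf : ∀ S, Integrable (f S) (vB n)) (hg : ∀ S, Integrable (g S) (vB n)) {η : En n → ℝ} (hη : GZ η) : 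
    ∑ i, pr (D i) (pd i η) = ∑ i, (co i (pr f (pd i η)) - we i (pr g (pd i η))) := by
  ext S
  have := (h S).orth η hη
  simp only [pr_F hf hg _ (hη.sm.pd _).continuous] at this
  rw [Finset.sum_apply, Finset.sum_apply]; exact this

lemma Tds.key (h : Tds f g u0 D) (hf : ∀ S, Integrable (f S) (vB n)) (hg : ∀ S, Integrable (g S) (vB n)) {θ : En n → ℝ} (hθ : GZ θ) : 
    ∑ j, we j (pr u0 (fun x => x j * lap θ x)) = (2:ℝ) • ∑ j, we j (pr (D j) θ) + ∑ j, ∑ l, we j (we l (pr g (pd l (fun y => y j * θ y)))) - 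
      ∑ j, ∑ i, we j (co i (pr f (pd i (fun y => y j * θ y)))) := by
  have hi : ∀ S, Integrable (u0 S) (vB n) := fun S => l2_l1 (h S).hw
  rw [Finset.smul_sum, ← Finset.sum_add_distrib, ← Finset.sum_sub_distrib]
  refine Finset.sum_congr rfl fun j _ => ?_
  have hx : GZ (fun y => y j * θ y) := ⟨hθ.sm.xm j, fun x hx => by rw [hθ.zero x hx, mul_zero]⟩
  have e : pr u0 (pd j θ) = - pr (D j) θ := by
    ext S; exact (h S).weak j hθ.sm
  have e1 := pr_lap_xm hi hθ.sm j
  rw [e, smul_neg, ← sub_eq_add_neg, h.vw hf hg hx, eq_sub_iff_add_eq] at e1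
  rw [← e1, map_add, map_neg, map_sum, map_smul, Finset.sum_congr rfl (fun i _ => map_sub (we j) _ _), Finset.sum_sub_distrib]
  abel

/-- the key identity for `x ∧ h` -/
lemma Sys.w2 (h : Sys u G f g) (h' : Tds f g u0 D) {θ : En n → ℝ} (hθ : GZ θ) (hA : ∀ l j, GZ (fun x => x j * pd l θ x - x l * pd j θ x)) : 
    ∑ j, we j (pr (fun S x => u S x + (-1) * u0 S x) (fun x => x j * lap θ x)) = (2:ℝ) • pr (fun S x => f S x + (-1) * ∑ i, we i (fun T => D i T x) S) θ := by
  have hi : ∀ S, Integrable (u0 S) (vB n) := fun S => l2_l1 (h' S).hw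
  have hD : ∀ i S, Integrable (D i S) (vB n) := fun i S => l2_l1 ((h' S).hD i)
  have c := hθ.sm.continuous
  rw [pr_lin h.fi (fun S => integrable_finsetSum _ fun i _ => we_int (hD i) S) (-1) c, pr_sum _ (fun i => we_int (hD i)) c]
  simp_rw [pr_we]
  have e : ∀ j : Fin n, we j (pr (fun S x => u S x + (-1) * u0 S x) (fun x => x j * lap θ x)) = we j (pr u (fun x => x j * lap θ x)) - we j (pr u0 (fun x => x j * lap θ x)) := fun j => by
    have cj : Continuous (fun x : En n => x j * lap θ x) := (coord_cont j).mul hθ.sm.lap.continuous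
    rw [pr_lin h.hu hi (-1) cj, neg_one_smul, ← sub_eq_add_neg, map_sub]
  simp_rw [e]
  rw [Finset.sum_sub_distrib, h.key hθ hA, h'.key h.fi h.gi hθ, neg_one_smul, smul_add, smul_neg]
  abel

end

lemma Cm.sumF {lam M : ℝ} (hM : 0 ≤ M) {z : Fin n → En n → ℝ} (h : ∀ j, Cm lam (z j) M) :
    Cm lam (fun x => ∑ j, z j x) (2 ^ n * n * M) := by
  have := Cm.sum Finset.univ hM (fun j _ => h j)
  rwa [Finset.card_univ, Fintype.card_fin] at this

lemma Tds_exists (n : ℕ) (hn : 0 < n) {lam : ℝ} (h0 : 0 ≤ lam) (h1 : lam < n + 2) : ∃ C, 0 ≤ C ∧ ∀ (f g : Finset (Fin n) → En n → ℝ) (M : ℝ), 0 ≤ M →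
    (∀ S, Cm lam (f S) M) → (∀ S, Cm lam (g S) M) → ∃ u0 D, Tds f g u0 D ∧ ∀ i S, Cm lam (D i S) (C * M) := by
  obtain ⟨C, hC, h⟩ := TD.cz n h0 h1
  refine ⟨C * 4, by positivity, fun f g M hM hf hg => ?_⟩
  have hF : ∀ S i, Cm lam (fun x => co i (fun T => f T x) S - we i (fun T => g T x) S) (4 * M) := fun S i => by
    have := (co_cm (i := i) hM hf S).add ((we_cm (i := i) hM hg S).smul (-1))
    have e : ∀ a b : ℝ, a + -1 * b = a - b := fun a b => by ring
    simp only [e, abs_neg, abs_one, one_mul] at this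
    exact this.mono (by linarith)
  choose w D hD using fun S => TD_exists hn _ (fun i => (hF S i).l2)
  refine ⟨w, fun i S => D S i, fun S => hD S, fun i S => ?_⟩
  rw [mul_assoc]
  exact h _ _ _ _ (hD S) (by positivity) (hF S) i

section
variable {u : Finset (Fin n) → En n → ℝ} {G : Fin n → Finset (Fin n) → En n → ℝ} {f g : Finset (Fin n) → En n → ℝ}
variable {u0 : Finset (Fin n) → En n → ℝ} {D : Fin n → Finset (Fin n) → En n → ℝ}

lemma Sys.HF (h : Sys u G f g) (h' : Tds f g u0 D) (S : Finset (Fin n)) : 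
    HF (fun x => u S x + (-1) * u0 S x) (fun i x => G i S x + (-1) * D i S x) := by
  have hi : ∀ S, Integrable (u0 S) (vB n) := fun S => l2_l1 (h' S).hw
  have hD : ∀ i S, Integrable (D i S) (vB n) := fun i S => l2_l1 ((h' S).hD i)
  refine ⟨(h.hu S).add ((hi S).const_mul _), fun i => (h.hG i S).add ((hD i S).const_mul _), fun i φ hφ => ?_, fun θ hθ => ?_⟩
  · have c1 := hφ.gz.sm.continuous
    have c2 := (hφ.gz.sm.pd i).continuous
    have e1 := congrFun (pr_lin h.hu hi (-1) c2) S
    have e2 := congrFun (pr_lin (h.hG i) (hD i) (-1) c1) S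
    have e3 := congrFun (h.lb hφ.gz i) S
    have e4 := (h' S).weak i hφ.gz.sm
    change pr (fun S x => u S x + (-1) * u0 S x) (pd i φ) S = -pr (fun S x => G i S x + (-1) * D i S x) φ S
    change pr u0 (pd i φ) S = -pr (D i) φ S at e4
    rw [e1, e2]
    simp only [Pi.add_apply, Pi.smul_apply, smul_eq_mul, Pi.neg_apply] at e3 ⊢
    rw [e3, e4]; ring
  · have e1 := congrFun ((h.box hθ).symm.trans (h'.orth h.fi h.gi hθ).symm) S
    have e2 : ∀ i, ∫ x, (G i S x + (-1) * D i S x) * pd i θ x ∂(vB n) = pr (G i) (pd i θ) S - pr (D i) (pd i θ) S := fun i => by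
      have := congrFun (pr_lin (h.hG i) (hD i) (-1) (hθ.sm.pd i).continuous) S
      simp only [Pi.add_apply, Pi.smul_apply, smul_eq_mul, neg_one_mul, ← sub_eq_add_neg] at this
      rw [← this]
      simp only [pr, neg_one_mul, ← sub_eq_add_neg]
    simp only [e2, Finset.sum_sub_distrib]
    rw [Finset.sum_apply, Finset.sum_apply] at e1
    rw [e1, sub_self]

end

lemma pr_p {z : Finset (Fin n) → En n → ℝ} (hz : ∀ S, Integrable (z S) (vB n)) (T : Finset (Fin n)) {η : En n → ℝ} (hη : Continuous η) : 
    ∫ x, (∑ j, x j * we j (fun S => z S x) T) * η x ∂(vB n) = ∑ j, we j (pr z (fun x => x j * η x)) T := by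
  simp_rw [Finset.sum_mul]
  have e : ∀ (j : Fin n) (x : En n), x j * we j (fun S => z S x) T * η x = we j (fun S => z S x) T * (x j * η x) := fun j x => by ring
  simp_rw [e]
  have c : ∀ j : Fin n, Continuous (fun x : En n => x j * η x) := fun j => (coord_cont j).mul hη
  rw [integral_finsetSum _ fun j _ => int_mul_cont (we_int hz T) (c j)]
  refine Finset.sum_congr rfl fun j _ => ?_
  rw [← pr_we]; rfl

lemma xwe_int {z : Finset (Fin n) → En n → ℝ} (hz : ∀ S, Integrable (z S) (vB n)) (T : Finset (Fin n)) : 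
    Integrable (fun x => ∑ j, x j * we j (fun S => z S x) T) (vB n) := by
  refine integrable_finsetSum _ fun j _ => ?_
  have := int_mul_cont (we_int (i := j) hz T) (coord_cont j)
  simpa only [mul_comm] using this

/-- weak gradient of `x ∧ h` -/
lemma wedge_weak {h : Finset (Fin n) → En n → ℝ} {H : Fin n → Finset (Fin n) → En n → ℝ} (hh : ∀ S, Integrable (h S) (vB n)) 
    (hH : ∀ i S, Integrable (H i S) (vB n)) (wp : ∀ i S, HasWeakPartial (ball 0 1) (h S) (H i S) i) (i : Fin n) (T : Finset (Fin n)) : 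
    HasWeakPartial (ball 0 1) (fun x => ∑ j, x j * we j (fun S => h S x) T) 
      (fun x => we i (fun S => h S x) T + ∑ j, x j * we j (fun S => H i S x) T) i := by
  intro φ hφ
  have hs := hφ.gz.sm
  have c1 := hs.continuous
  have c2 := (hs.pd i).continuous
  change ∫ x, (∑ j, x j * we j (fun S => h S x) T) * pd i φ x ∂(vB n) = -∫ x, (we i (fun S => h S x) T + ∑ j, x j * we j (fun S => H i S x) T) * φ x ∂(vB n)
  simp_rw [add_mul (we i _ T)]
  rw [pr_p hh T c2, integral_add (int_mul_cont (we_int hh T) c1) (int_mul_cont (xwe_int (hH i) T) c1), pr_p (hH i) T c1]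
  have e : ∫ x, we i (fun S => h S x) T * φ x ∂(vB n) = we i (pr h φ) T := by rw [← pr_we]; rfl
  have e2 : ∀ j, pr h (fun x => x j * pd i φ x) = -pr (H i) (fun x => x j * φ x) - (if i = j then (1:ℝ) else 0) • pr h φ := fun j => by
    have hg : GZ (fun x => x j * φ x) := ⟨hs.xm j, fun x hx => by rw [hφ.gz.zero x hx, mul_zero]⟩
    have : pr h (pd i (fun x => x j * φ x)) = -pr (H i) (fun x => x j * φ x) := by
      ext S; exact LB (hh S) (hH i S) (wp i S) hg
    have c3 : Continuous (fun x : En n => x j * pd i φ x) := (coord_cont j).mul c2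
    rw [xG_pd hs, pr_rlin hh _ c3 c1] at this
    rw [eq_sub_iff_add_eq, this]
  rw [e]
  simp_rw [e2, map_sub, map_neg, map_smul]
  simp only [Pi.sub_apply, Pi.neg_apply, Pi.smul_apply, Finset.sum_sub_distrib, Finset.sum_neg_distrib, smul_eq_mul, ite_mul, one_mul, zero_mul, Finset.sum_ite_eq, Finset.mem_univ, if_true]
  ring

lemma wedge_alg (x : Fin n → ℝ) (h : Finset (Fin n) → ℝ) (H : Fin n → Finset (Fin n) → ℝ) (S : Finset (Fin n)) : 
    ∑ i, co i (fun T => we i h T + ∑ j, x j * we j (H i) T) S - ∑ j, x j * we j (fun T => -∑ i, co i (H i) T) S = 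
      ∑ j, H j S * x j + ((n - S.card : ℕ) : ℝ) * h S := by
  have e1 : ∀ i, (fun T => we i h T + ∑ j, x j * we j (H i) T) = we i h + ∑ j, x j • we j (H i) := fun i => by
    ext T; simp [Finset.sum_apply]
  have e2 : (fun T => -∑ i, co i (H i) T) = -∑ i, co i (H i) := by ext T; simp [Finset.sum_apply]
  have e3 : ∀ i, co i (we i h + ∑ j, x j • we j (H i)) S = co i (we i h) S + ∑ j, x j * ((if i = j then H i else 0) S - we j (co i (H i)) S) := fun i => by
    rw [map_add, map_sum, Pi.add_apply, Finset.sum_apply]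
    congr 1
    refine Finset.sum_congr rfl fun j _ => ?_
    rw [map_smul, car]; rfl
  simp_rw [e1, e2, e3]
  rw [Finset.sum_add_distrib, co_we_sum]
  simp only [map_neg, map_sum, Pi.neg_apply, Finset.sum_apply, mul_sub, Finset.sum_sub_distrib, mul_neg, Finset.sum_neg_distrib, Finset.mul_sum]
  have e4 : ∑ i, ∑ j, x j * (if i = j then H i else 0) S = ∑ j, H j S * x j := by
    refine Finset.sum_congr rfl fun i _ => ?_
    have : ∀ j, x j * (if i = j then H i else 0) S = if i = j then H i S * x j else 0 := fun j => by split_ifs <;> simp [mul_comm]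
    simp [this]
  rw [e4, Finset.sum_comm (f := fun i j => x i * we i (co j (H j)) S)]
  ring

lemma Cm.linc {lam M M' : ℝ} {z w : En n → ℝ} (h : Cm lam z M) (h' : Cm lam w M') : Cm lam (fun x => z x + (-1) * w x) (2 * (M + M')) := by
  have := h.add (h'.smul (-1))
  simpa only [abs_neg, abs_one, one_mul] using this

lemma Q_cm (n : ℕ) (hn : 2 ≤ n) {lam : ℝ} (h0 : 0 ≤ lam) (h1 : lam < n + 2) : ∃ C, 0 ≤ C ∧ ∀ (u : Finset (Fin n) → En n → ℝ) (G : Fin n → Finset (Fin n) → En n → ℝ) (f g : Finset (Fin n) → En n → ℝ) 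
    (u0 : Finset (Fin n) → En n → ℝ) (D : Fin n → Finset (Fin n) → En n → ℝ) (M : ℝ), 0 ≤ M → Sys u G f g → Tds f g u0 D → (∀ S, Cm lam (f S) M) → (∀ i S, Cm lam (D i S) M) → 
    ∀ i T, Cm lam (fun x => we i (fun S => u S x + (-1) * u0 S x) T + ∑ j, x j * we j (fun S => G i S x + (-1) * D i S x) T) (C * M) := by
  obtain ⟨C1, hC1, hs⟩ := solve_cm n (by omega) h0 h1
  obtain ⟨C2, hC2, ha⟩ := av_solve n hn h0 h1
  refine ⟨C1 * (C2 * (2 * (2 * (1 + 2 ^ n * n)))), by positivity, fun u G f g u0 D M hM h h' hf hD i T => ?_⟩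
  have hHF := h.HF h'
  have hc : Cm lam (fun x => 2 * (f T x + (-1) * ∑ i, we i (fun T => D i T x) T)) (2 * (2 * (1 + 2 ^ n * n) * M)) := by
    have := ((hf T).linc (Cm.sumF hM fun i => we_cm (i := i) hM (hD i) T)).smul 2
    refine this.mono (le_of_eq ?_)
    rw [abs_of_pos (by norm_num)]; ring
  obtain ⟨F, hF, hF'⟩ := ha _ _ hc
  have ip := xwe_int (fun S => (hHF S).hh) T
  obtain ⟨W, hW, hWc⟩ := hs (fun x => ∑ j, x j * we j (fun S => u S x + (-1) * u0 S x) T) F _ (by positivity) ip hF (fun θ hθ hK => by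
    obtain ⟨K, hK, rfl⟩ := hK
    have hA : ∀ l j, GZ (fun x => x j * pd l (fun x => (1 - ‖x‖ ^ 2) * K x) x - x l * pd j (fun x => (1 - ‖x‖ ^ 2) * K x) x) := fun l j => by
      have e : (fun x => x j * pd l (fun x => (1 - ‖x‖ ^ 2) * K x) x - x l * pd j (fun x => (1 - ‖x‖ ^ 2) * K x) x) = fun x => (1 - ‖x‖ ^ 2) * (x j * pd l K x - x l * pd j K x) := by
        ext x
        rw [oms_pd hK, oms_pd hK]; ring
      rw [e]
      exact GZ.oms (((hK.pd l).xm j).sub ((hK.pd j).xm l))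
    rw [pr_p (fun S => (hHF S).hh) T hθ.sm.lap.continuous, hF' _ hθ, neg_neg]
    have := congrFun (h.w2 h' hθ hA) T
    rw [Finset.sum_apply] at this
    rw [this, Pi.smul_apply, smul_eq_mul]
    simp_rw [mul_assoc (2:ℝ)]
    rw [integral_const_mul]; rfl)
  have iq := (we_int (i := i) (fun S => (hHF S).hh) T).add (xwe_int (fun S => (hHF S).hH i) T)
  have := weak_uniq (l2_l1 (hWc i).l2) iq (hW i) (wedge_weak (fun S => (hHF S).hh) (fun i S => (hHF S).hH i) (fun i S => (hHF S).wp i) i T)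
  refine ((hWc i).congr this).mono (le_of_eq ?_)
  ring

theorem core (n : ℕ) (hn : 2 ≤ n) {lam : ℝ} (h0 : 0 ≤ lam) (h1 : lam < n + 2) : ∃ C, 0 ≤ C ∧ ∀ (u : Finset (Fin n) → En n → ℝ) (G : Fin n → Finset (Fin n) → En n → ℝ) (f g : Finset (Fin n) → En n → ℝ) 
    (M : ℝ), 0 ≤ M → Sys u G f g → (∀ S, Cm lam (f S) M) → (∀ S, Cm lam (g S) M) → ∀ i S, S ≠ Finset.univ → Cm lam (G i S) (C * M) := by
  obtain ⟨C1, hC1, hT⟩ := Tds_exists n (by omega) h0 h1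
  obtain ⟨C2, hC2, hQ⟩ := Q_cm n hn h0 h1
  obtain ⟨C3, hC3, hx⟩ := cm_coord n h0 h1
  obtain ⟨C4, hC4, hE⟩ := HF.th n hn h0 h1
  set P : ℝ := 2 ^ n * n with hP
  have hP0 : 0 ≤ P := by positivity
  refine ⟨2 * (C1 + C4 * (2 * (P * (C2 * (1 + C1)) + P * (C3 * (2 * (1 + P * C1)))))), by positivity, fun u G f g M hM h hf hg i S hS => ?_⟩
  obtain ⟨u0, D, h', hD⟩ := hT f g M hM hf hg
  have hHF := h.HF h'
  have q1 := hQ u G f g u0 D ((1 + C1) * M) (by positivity) h h' (fun S => (hf S).mono (by nlinarith)) (fun i S => (hD i S).mono (by nlinarith))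
  have hM1 : 0 ≤ C2 * ((1 + C1) * M) := by positivity
  have q2 := Cm.sumF (z := fun i x => co i (fun T => we i (fun S => u S x + (-1) * u0 S x) T + ∑ j, x j * we j (fun S => G i S x + (-1) * D i S x) T) S) hM1 fun i => co_cm hM1 (q1 i) S
  have hM2 : 0 ≤ C1 * M := by positivity
  have hg' : ∀ T, Cm lam (fun x => -∑ i, co i (fun S => G i S x + (-1) * D i S x) T) (2 * (M + P * (C1 * M))) := fun T => by
    refine ((hg T).add (Cm.sumF hM2 fun i => co_cm (i := i) hM2 (hD i) T)).congr ?_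
    filter_upwards [h.hg T] with x hx
    rw [hx, ← Finset.sum_neg_distrib, ← Finset.sum_neg_distrib, ← Finset.sum_add_distrib]
    refine Finset.sum_congr rfl fun i _ => ?_
    have : (fun S => G i S x + (-1) * D i S x) = (fun S => G i S x) - fun S => D i S x := by ext S; simp; ring
    rw [this, map_sub, Pi.sub_apply]; ring
  have hM3 : 0 ≤ 2 * (M + P * (C1 * M)) := by positivity
  have q3 := Cm.sumF (by positivity) fun j => hx j _ _ (we_cm (i := j) hM3 hg' S)
  have q4 := q2.linc q3
  have e : ∀ x : En n, (∑ i, co i (fun T => we i (fun S => u S x + (-1) * u0 S x) T + ∑ j, x j * we j (fun S => G i S x + (-1) * D i S x) T) S) + 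
      (-1) * ∑ j, x j * we j (fun T => -∑ i, co i (fun S => G i S x + (-1) * D i S x) T) S = 
      Eu ((n - S.card : ℕ) : ℝ) (fun x => u S x + (-1) * u0 S x) (fun i x => G i S x + (-1) * D i S x) x := fun x => by
    rw [neg_one_mul, ← sub_eq_add_neg]
    exact wedge_alg (fun j => x j) _ _ S
  simp_rw [e] at q4
  have hcard : S.card < n := by
    have := Finset.card_lt_card (Finset.ssubset_univ_iff.2 hS)
    rwa [Finset.card_univ, Fintype.card_fin] at this
  have q5 := hE _ _ (n - S.card) S.card _ (hHF S) (by omega) (by omega) q4 i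
  have q6 := ((hD i S).add q5)
  refine (q6.congr (.of_forall fun x => ?_)).mono (le_of_eq ?_)
  · simp only; ring
  · ring

/-- oscillation control on the unit ball -/
def Os (lam : ℝ) (z : En n → ℝ) (M : ℝ) : Prop := 
  ∀ x1 : En n, ‖x1‖ ≤ 1 → ∀ ρ, 0 < ρ → ∃ c, ∫ x in ball x1 ρ, (z x - c) ^ 2 ∂(vB n) ≤ M ^ 2 * ρ ^ lam

lemma Os.tot {lam M : ℝ} {z : En n → ℝ} (h : Os lam z M) (hz : MemLp z 2 (vB n)) : ∫ x, (z x - ⨍ y, z y ∂(vB n)) ^ 2 ∂(vB n) ≤ M ^ 2 := by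
  obtain ⟨c, hc⟩ := h 0 (by simp) 1 one_pos
  have : (vB n).restrict (ball 0 1) = vB n := by
    unfold vB; rw [Measure.restrict_restrict measurableSet_ball, Set.inter_self]
  rw [this, Real.one_rpow, mul_one] at hc
  exact (mean_min hz c).trans hc

lemma Os.cm {lam M : ℝ} {z : En n → ℝ} (hM : 0 ≤ M) (h : Os lam z M) (hz : MemLp z 2 (vB n)) : Cm lam (fun x => z x - ⨍ y, z y ∂(vB n)) M := by
  refine ⟨l2_sub_const hz _, hM, h.tot hz, fun x1 h1 ρ hρ => ?_⟩
  obtain ⟨c, hc⟩ := h x1 h1 ρ hρ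
  refine ⟨c - ⨍ y, z y ∂(vB n), le_of_eq_of_le ?_ hc⟩
  congr 1; ext x; ring

lemma cm_zero {M : ℝ} {z : En n → ℝ} (hM : 0 ≤ M) (hz : MemLp z 2 (vB n)) (h : ∫ x, z x ^ 2 ∂(vB n) ≤ M ^ 2) : Cm 0 z M := by
  refine ⟨hz, hM, h, fun x1 h1 ρ hρ => ⟨0, ?_⟩⟩
  simp only [sub_zero, Real.rpow_zero, mul_one]
  exact (setIntegral_le_integral hz.integrable_sq (.of_forall fun x => sq_nonneg _)).trans h

section
variable {u : Finset (Fin n) → En n → ℝ} {G : Fin n → Finset (Fin n) → En n → ℝ} {f g : Finset (Fin n) → En n → ℝ}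

lemma Sys.mean (h : Sys u G f g) (S : Finset (Fin n)) : ⨍ y, f S y ∂(vB n) = 0 := by
  have := congrFun (h.tz (fun _ => 1) contDiff_const) S
  have e : ∀ i : Fin n, pr u (pd i fun _ => 1) = 0 := fun i => by
    ext S; simp [pr, pd_const]
  simp only [e, map_zero, Finset.sum_const_zero, neg_zero, Pi.zero_apply] at this
  simp only [pr, mul_one] at this
  rw [average_eq, this, smul_zero]

lemma Sys.top (h : Sys u G f g) (i : Fin n) : G i Finset.univ =ᵐ[vB n] fun x => -sgn i (Finset.univ.erase i) * g (Finset.univ.erase i) x := by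
  filter_upwards [h.hg (Finset.univ.erase i)] with x hx
  rw [hx]
  have e : ∀ j, co j (fun T => G j T x) (Finset.univ.erase i) = if j = i then sgn i (Finset.univ.erase i) * G i Finset.univ x else 0 := fun j => by
    rw [co_apply]
    by_cases hj : j = i
    · subst hj; simp
    · simp [hj]
  simp only [e, Finset.sum_ite_eq', Finset.mem_univ, if_true]
  rw [neg_mul_neg, ← mul_assoc, sgn_mul, one_mul]

lemma sym_int {η : En n → ℝ} (hη : SM η) (i j : Fin n) : ∫ x, x j * pd i η x ∂(vB n) = ∫ x, x i * pd j η x ∂(vB n) := by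
  have h1 := DIV0 (GZ.oms (hη.pd j)) i
  have h2 := DIV0 (GZ.oms (hη.pd i)) j
  have c : ∀ k l : Fin n, Continuous fun x : En n => x k * pd l η x := fun k l => (coord_cont k).mul (hη.pd l).continuous
  have c' : ∀ k l : Fin n, Continuous fun x : En n => (1 - ‖x‖ ^ 2) * pd k (pd l η) x := fun k l => ((hη.pd l).pd k).oms.continuous
  rw [oms_pd (hη.pd _), integral_sub (cont_int (c' _ _)) ((cont_int (c _ _)).const_mul _), integral_const_mul] at h1 h2
  rw [show pd j (pd i η) = pd i (pd j η) from funext fun x => hη.pd_comm j i x] at h2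
  linarith

lemma sys_b (b : Finset (Fin n) → ℝ) : Sys (fun S x => ∑ j, x j * we j b S) (fun i S _ => we i b S) (fun _ _ => 0) (fun S _ => -(((n - S.card : ℕ) : ℝ) * b S)) := by
  refine ⟨fun S => xwe_int (fun S => integrable_const (b S)) S, fun i S => integrable_const _, fun i S => ?_, fun η hη => ?_, fun S => ?_, fun S => ?_⟩
  · have := wedge_weak (h := fun S _ => b S) (H := fun i S _ => 0) (fun S => integrable_const (b S)) (fun i S => integrable_const _) (fun i S φ hφ => by
      have e : ∫ x in ball 0 1, fderiv ℝ φ x (basisVec i) = 0 := DIV0 hφ.gz i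
      simp [integral_const_mul, e]) i S
    have e : ∀ j : Fin n, we j (fun _ => (0:ℝ)) = 0 := fun j => map_zero (we j)
    simp only [e, Pi.zero_apply, mul_zero, Finset.sum_const_zero, add_zero] at this
    exact this
  · have e : ∀ i, pr (fun S x => ∑ j, x j * we j b S) (pd i η) = ∑ j, (∫ x, x j * pd i η x ∂(vB n)) • we j b := fun i => by
      ext S
      have := pr_p (z := fun S _ => b S) (fun S => integrable_const (b S)) S (hη.pd i).continuous
      refine this.trans ?_
      rw [Finset.sum_apply]
      refine Finset.sum_congr rfl fun j _ => ?_
      have : (pr (fun S _ => b S) fun x => x j * pd i η x) = (∫ x, x j * pd i η x ∂(vB n)) • b := by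
        ext S; simp only [pr, integral_const_mul, Pi.smul_apply, smul_eq_mul]; ring
      rw [this, map_smul]
    simp_rw [e, map_sum, map_smul]
    have X : ∑ i, ∑ j, (∫ x, x j * pd i η x ∂(vB n)) • we i (we j b) = -∑ i, ∑ j, (∫ x, x j * pd i η x ∂(vB n)) • we i (we j b) := by
      conv_lhs => rw [Finset.sum_comm]
      rw [← Finset.sum_neg_distrib]
      refine Finset.sum_congr rfl fun i _ => ?_
      rw [← Finset.sum_neg_distrib]
      refine Finset.sum_congr rfl fun j _ => ?_
      rw [sym_int hη j i, we_anti j i, smul_neg]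
    have X0 := self_eq_neg.1 X
    rw [X0, neg_zero]
    ext S; simp [pr]
  · refine .of_forall fun x => ?_
    have : ∀ i : Fin n, we i (we i b) = 0 := fun i => self_eq_neg.1 (we_anti i i b)
    have e : ∀ i, we i (fun T => we i b T) S = 0 := fun i => congrFun (this i) S
    simp [e]
  · refine .of_forall fun x => ?_
    exact congrArg _ (co_we_sum b S).symm

lemma Sys.lin {u' : Finset (Fin n) → En n → ℝ} {G' : Fin n → Finset (Fin n) → En n → ℝ} {f' g' : Finset (Fin n) → En n → ℝ} (h : Sys u G f g) (h' : Sys u' G' f' g') (c : ℝ) : 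
    Sys (fun S x => u S x + c * u' S x) (fun i S x => G i S x + c * G' i S x) (fun S x => f S x + c * f' S x) (fun S x => g S x + c * g' S x) := by
  refine ⟨fun S => (h.hu S).add ((h'.hu S).const_mul _), fun i S => (h.hG i S).add ((h'.hG i S).const_mul _), fun i S φ hφ => ?_, fun η hη => ?_, fun S => ?_, fun S => ?_⟩
  · have e1 := congrFun (pr_lin h.hu h'.hu c (hφ.gz.sm.pd i).continuous) S
    have e2 := congrFun (pr_lin (h.hG i) (h'.hG i) c hφ.gz.sm.continuous) S
    change pr (fun S x => u S x + c * u' S x) (pd i φ) S = -pr (fun S x => G i S x + c * G' i S x) φ S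
    rw [e1, e2, h.lb hφ.gz, h'.lb hφ.gz]
    simp only [Pi.add_apply, Pi.smul_apply, smul_eq_mul, Pi.neg_apply]; ring
  · rw [pr_lin h.fi h'.fi c hη.continuous, h.tz η hη, h'.tz η hη]
    have : ∀ i, we i (pr (fun S x => u S x + c * u' S x) (pd i η)) = we i (pr u (pd i η)) + c • we i (pr u' (pd i η)) := fun i => by
      rw [pr_lin h.hu h'.hu c (hη.pd i).continuous, map_add, map_smul]
    simp_rw [this]
    rw [Finset.sum_add_distrib, ← Finset.smul_sum, smul_neg]; abel
  · filter_upwards [h.hf S, h'.hf S] with x h1 h2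
    rw [h1, h2, Finset.mul_sum, ← Finset.sum_add_distrib]
    refine Finset.sum_congr rfl fun i _ => ?_
    have : (fun T => G i T x + c * G' i T x) = (fun T => G i T x) + c • fun T => G' i T x := rfl
    rw [this, map_add, map_smul]; rfl
  · filter_upwards [h.hg S, h'.hg S] with x h1 h2
    rw [h1, h2, mul_neg, ← neg_add, Finset.mul_sum, ← Finset.sum_add_distrib]
    refine congrArg _ (Finset.sum_congr rfl fun i _ => ?_)
    have : (fun T => G i T x + c * G' i T x) = (fun T => G i T x) + c • fun T => G' i T x := rfl
    rw [this, map_add, map_smul]; rfl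
end

lemma unit_l2 (n : ℕ) : ∃ C, 0 ≤ C ∧ ∀ (u : Finset (Fin n) → En n → ℝ) (G : Fin n → Finset (Fin n) → En n → ℝ) (f g : Finset (Fin n) → En n → ℝ) 
    (M : ℝ), 0 ≤ M → Sys u G f g → (∀ S, MemLp (f S) 2 (vB n)) → (∀ S, MemLp (g S) 2 (vB n)) → (∀ S, ∫ x, f S x ^ 2 ∂(vB n) ≤ M ^ 2) → (∀ S, ∫ x, g S x ^ 2 ∂(vB n) ≤ M ^ 2) → 
    ∀ i S, S.Nonempty → MemLp (G i S) 2 (vB n) ∧ ∫ x, G i S x ^ 2 ∂(vB n) ≤ (C * M) ^ 2 := by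
  obtain ⟨C, hC, hc⟩ : ∃ C, 0 ≤ C ∧ (2 ≤ n → ∀ (u : Finset (Fin n) → En n → ℝ) (G : Fin n → Finset (Fin n) → En n → ℝ) (f g : Finset (Fin n) → En n → ℝ) 
    (M : ℝ), 0 ≤ M → Sys u G f g → (∀ S, Cm 0 (f S) M) → (∀ S, Cm 0 (g S) M) → ∀ i S, S ≠ Finset.univ → Cm 0 (G i S) (C * M)) := by
    by_cases hn : 2 ≤ n
    · obtain ⟨C, hC, h⟩ := core n hn (lam := 0) le_rfl (by positivity)
      exact ⟨C, hC, fun _ => h⟩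
    · exact ⟨0, le_rfl, fun h => absurd h hn⟩
  refine ⟨C + 1, by positivity, fun u G f g M hM h hf hg hfM hgM i S hS => ?_⟩
  have key : Cm 0 (G i S) ((C + 1) * M) := by
    by_cases hu : S = Finset.univ
    · subst hu
      refine (((cm_zero hM (hg (Finset.univ.erase i)) (hgM _)).smul (-sgn i (Finset.univ.erase i))).congr (h.top i).symm).mono ?_
      rw [abs_neg, sgn_abs]; nlinarith
    · have h2 : 2 ≤ n := by
        have := Finset.card_lt_card (Finset.ssubset_univ_iff.2 hu)
        rw [Finset.card_univ, Fintype.card_fin] at this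
        have := hS.card_pos
        omega
      exact (hc h2 u G f g M hM h (fun S => cm_zero hM (hf S) (hfM S)) (fun S => cm_zero hM (hg S) (hgM S)) i S hu).mono (by nlinarith)
  exact ⟨key.l2, key.tot⟩

lemma unit_os (n : ℕ) {lam : ℝ} (h0 : 0 ≤ lam) (h1 : lam < n + 2) : ∃ C, 0 ≤ C ∧ ∀ (u : Finset (Fin n) → En n → ℝ) (G : Fin n → Finset (Fin n) → En n → ℝ) (f g : Finset (Fin n) → En n → ℝ) 
    (M : ℝ), 0 ≤ M → Sys u G f g → (∀ S, MemLp (f S) 2 (vB n)) → (∀ S, MemLp (g S) 2 (vB n)) → (∀ S, Os lam (f S) M) → (∀ S, Os lam (g S) M) → 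
    ∀ i S, S.Nonempty → Os lam (G i S) (C * M) := by
  obtain ⟨C, hC, hc⟩ : ∃ C, 0 ≤ C ∧ (2 ≤ n → ∀ (u : Finset (Fin n) → En n → ℝ) (G : Fin n → Finset (Fin n) → En n → ℝ) (f g : Finset (Fin n) → En n → ℝ) 
    (M : ℝ), 0 ≤ M → Sys u G f g → (∀ S, Cm lam (f S) M) → (∀ S, Cm lam (g S) M) → ∀ i S, S ≠ Finset.univ → Cm lam (G i S) (C * M)) := by
    by_cases hn : 2 ≤ n
    · obtain ⟨C, hC, h⟩ := core n hn h0 h1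
      exact ⟨C, hC, fun _ => h⟩
    · exact ⟨0, le_rfl, fun h => absurd h hn⟩
  refine ⟨C + 1, by positivity, fun u G f g M hM h hf hg hfM hgM i S hS => ?_⟩
  set b : Finset (Fin n) → ℝ := fun S => -(⨍ y, g S y ∂(vB n)) / ((n - S.card : ℕ) : ℝ) with hb
  have hs := h.lin (sys_b b) (-1)
  have cf : ∀ S, Cm lam (fun x => f S x + (-1) * 0) M := fun S => by
    have := (hfM S).cm hM (hf S)
    rw [h.mean] at this
    simpa using this
  have cg : ∀ S, Cm lam (fun x => g S x + (-1) * -(((n - S.card : ℕ) : ℝ) * b S)) M := fun S => by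
    refine ((hgM S).cm hM (hg S)).congr (.of_forall fun x => ?_)
    by_cases hn : n - S.card = 0
    · have : S = Finset.univ := by
        rw [← Finset.card_eq_iff_eq_univ, Fintype.card_fin]
        have := S.card_le_univ
        rw [Fintype.card_fin] at this
        omega
      subst this
      have e : ⨍ y, g Finset.univ y ∂(vB n) = 0 := by
        have : g Finset.univ =ᵐ[vB n] 0 := by
          filter_upwards [h.hg Finset.univ] with x hx
          rw [hx]; simp [co_apply]
        rw [average_congr this]; simp
      simp [e, hb]
    · have : ((n - S.card : ℕ) : ℝ) ≠ 0 := Nat.cast_ne_zero.2 hn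
      simp only [hb]
      field_simp
      ring
  have cs : ∀ {S}, Cm lam (fun x => G i S x + (-1) * we i b S) ((C + 1) * M) → Os lam (G i S) ((C + 1) * M) := fun {S} hh x1 hx1 ρ hρ => by
    obtain ⟨c, hc⟩ := hh.osc x1 hx1 ρ hρ
    refine ⟨c + we i b S, le_of_eq_of_le ?_ hc⟩
    congr 1; ext x; ring
  refine cs ?_
  by_cases hu : S = Finset.univ
  · subst hu
    refine (((cg (Finset.univ.erase i)).smul (-sgn i (Finset.univ.erase i))).congr (hs.top i).symm).mono ?_
    rw [abs_neg, sgn_abs]; nlinarith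
  · have h2 : 2 ≤ n := by
      have := Finset.card_lt_card (Finset.ssubset_univ_iff.2 hu)
      rw [Finset.card_univ, Fintype.card_fin] at this
      have := hS.card_pos
      omega
    exact (hc h2 _ _ _ _ M hM hs cf cg i S hu).mono (by nlinarith)

/-! ### Components of forms -/

def cp (v : Form n N k) (c : Fin N) (S : Finset (Fin n)) : ℝ := if h : S.card = k then v (⟨S, h⟩, c) else 0

lemma cp_of (v : Form n N k) (q : FormIdx n k × Fin N) : cp v q.2 q.1.1 = v q := by
  unfold cp; rw [dif_pos q.1.2]

lemma extD_cp (G : Fin n → Form n N k) (c : Fin N) (S : Finset (Fin n)) : cp (extD G) c S = ∑ i, we i (cp (G i) c) S := by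
  by_cases h : S.card = k + 1
  · have := cp_of (extD G) (⟨S, h⟩, c)
    refine this.trans ?_
    unfold extD
    refine Finset.sum_congr rfl fun i _ => ?_
    rw [we_apply]
    by_cases hi : i ∈ S
    · have hc : (S.erase i).card = k := by rw [Finset.card_erase_of_mem hi, h]; rfl
      simp only [hi, dif_pos, if_true, cp, hc, sgn]
    · simp [hi]
  · rw [cp, dif_neg h]
    refine (Finset.sum_eq_zero fun i _ => ?_).symm
    rw [we_apply]
    split_ifs with hi
    · have := Finset.card_erase_add_one hi
      rw [cp, dif_neg (by omega), mul_zero]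
    · rfl

lemma codiff_cp (G : Fin n → Form n N (k + 1)) (c : Fin N) (S : Finset (Fin n)) : cp (codiff G) c S = -∑ i, co i (cp (G i) c) S := by
  by_cases h : S.card = k
  · have := cp_of (codiff G) (⟨S, h⟩, c)
    refine this.trans ?_
    unfold codiff
    refine congrArg _ (Finset.sum_congr rfl fun i _ => ?_)
    rw [co_apply]
    by_cases hi : i ∈ S
    · simp [hi]
    · have hc : (insert i S).card = k + 1 := by rw [Finset.card_insert_of_notMem hi, h]
      simp only [hi, cp, hc, sgn, dif_neg, dif_pos, if_false, not_false_eq_true]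
  · rw [cp, dif_neg h, eq_comm, neg_eq_zero]
    refine Finset.sum_eq_zero fun i _ => ?_
    rw [co_apply]
    split_ifs with hi
    · rfl
    · rw [cp, dif_neg (by rw [Finset.card_insert_of_notMem hi]; omega), mul_zero]

lemma finner_codiff (v : Form n N k) (q0 : FormIdx n (k + 1) × Fin N) (w : Fin n → ℝ) : 
    finner v (codiff (fun i q => if q = q0 then w i else 0)) = -∑ i, we i (cp v q0.2) q0.1.1 * w i := by
  unfold finner codiff
  simp_rw [mul_neg]
  rw [Finset.sum_neg_distrib]
  simp_rw [Finset.mul_sum]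
  rw [Finset.sum_comm]
  refine congrArg _ (Finset.sum_congr rfl fun i _ => ?_)
  rw [we_apply]
  by_cases hi : i ∈ q0.1.1
  · rw [if_pos hi]
    have hc : (q0.1.1.erase i).card = k := by rw [Finset.card_erase_of_mem hi, q0.1.2]; rfl
    have hfi : (q0.1.1.erase i).filter (fun j => j < i) = q0.1.1.filter (fun j => j < i) := by
      ext j; simp only [Finset.mem_filter, Finset.mem_erase]
      exact ⟨fun h => ⟨h.1.2, h.2⟩, fun h => ⟨⟨h.2.ne, h.1⟩, h.2⟩⟩
    rw [Finset.sum_eq_single (⟨q0.1.1.erase i, hc⟩, q0.2)]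
    · have hni : i ∉ q0.1.1.erase i := Finset.notMem_erase i _
      have hq : ∀ h, ((⟨insert i (q0.1.1.erase i), h⟩, q0.2) : FormIdx n (k + 1) × Fin N) = q0 := fun h => by
        ext1
        · exact Subtype.ext (Finset.insert_erase hi)
        · rfl
      simp only [hni, dif_neg, not_false_eq_true, hq, if_true, cp, hc, dif_pos, hfi, sgn]
      ring
    · intro q _ hq
      split_ifs with h1 h2
      · ring
      · exfalso; apply hq
        ext1
        · refine Subtype.ext ?_
          have := congrArg (fun q => q.1.1) h2
          simp only at this
          change q.1.1 = q0.1.1.erase i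
          rw [← this, Finset.erase_insert h1]
        · have h3 := congrArg Prod.snd h2
          exact h3
      · ring
    · simp
  · rw [if_neg hi, zero_mul]
    refine Finset.sum_eq_zero fun q _ => ?_
    split_ifs with h1 h2
    · ring
    · exact absurd (by rw [← h2]; exact Finset.mem_insert_self i _) hi
    · ring

/-! ### Scaling -/

def Tm (x₀ : En n) (R : ℝ) (y : En n) : En n := x₀ + R • y
def Ti (x₀ : En n) (R : ℝ) (x : En n) : En n := R⁻¹ • (x - x₀)

section
variable {x₀ : En n} {R : ℝ}

lemma Ti_Tm (hR : 0 < R) (y : En n) : Ti x₀ R (Tm x₀ R y) = y := by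
  unfold Ti Tm; rw [add_sub_cancel_left, smul_smul, inv_mul_cancel₀ hR.ne', one_smul]

lemma Tm_Ti (hR : 0 < R) (x : En n) : Tm x₀ R (Ti x₀ R x) = x := by
  unfold Ti Tm; rw [smul_smul, mul_inv_cancel₀ hR.ne', one_smul, add_sub_cancel]

def Te (x₀ : En n) (R : ℝ) (hR : 0 < R) : En n ≃ₜ En n where
  toFun := Tm x₀ R
  invFun := Ti x₀ R
  left_inv := Ti_Tm hR
  right_inv := Tm_Ti hR
  continuous_toFun := by unfold Tm; fun_prop
  continuous_invFun := by unfold Ti; fun_prop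

lemma Tm_emb (hR : 0 < R) : MeasurableEmbedding (Tm x₀ R) := (Te x₀ R hR).measurableEmbedding

lemma Tm_ball (hR : 0 < R) (x1 : En n) (ρ : ℝ) : Tm x₀ R ⁻¹' ball (Tm x₀ R x1) (R * ρ) = ball x1 ρ := by
  ext y
  rw [Set.mem_preimage, mem_ball, mem_ball, dist_eq_norm, dist_eq_norm]
  unfold Tm
  rw [add_sub_add_left_eq_sub, ← smul_sub, norm_smul, Real.norm_of_nonneg hR.le, mul_lt_mul_iff_right₀ hR]

lemma Tm_ball0 (hR : 0 < R) : Tm x₀ R ⁻¹' ball x₀ R = ball 0 1 := by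
  have := Tm_ball (x₀ := x₀) hR 0 1
  rwa [mul_one, Tm, smul_zero, add_zero] at this

lemma Tm_map (hR : 0 < R) : (vB n).map (Tm x₀ R) = ENNReal.ofReal ((R ^ n)⁻¹) • volume.restrict (ball x₀ R) := by
  ext s hs
  rw [(Tm_emb hR).map_apply, Measure.smul_apply, Measure.restrict_apply hs, smul_eq_mul]
  unfold vB
  rw [Measure.restrict_apply ((Tm_emb hR).measurable hs), ← Tm_ball0 (x₀ := x₀) hR, ← Set.preimage_inter]
  have : Tm x₀ R ⁻¹' (s ∩ ball x₀ R) = (R • ·) ⁻¹' ((x₀ + ·) ⁻¹' (s ∩ ball x₀ R)) := rfl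
  rw [this, Measure.addHaar_preimage_smul _ hR.ne', measure_preimage_add, finrank_euclideanSpace, Fintype.card_fin, abs_of_pos (by positivity)]

lemma sc_ne (hR : 0 < R) : ENNReal.ofReal ((R ^ n)⁻¹) ≠ 0 := (ENNReal.ofReal_pos.2 (by positivity)).ne'

lemma sc_int (hR : 0 < R) (z : En n → ℝ) (s : Set (En n)) (hs : MeasurableSet s) : ∫ y in Tm x₀ R ⁻¹' s, z (Tm x₀ R y) ∂(vB n) = (R ^ n)⁻¹ * ∫ x in s ∩ ball x₀ R, z x := by
  rw [← (Tm_emb hR).setIntegral_map, Tm_map hR, Measure.restrict_smul, integral_smul_measure, Measure.restrict_restrict hs, ENNReal.toReal_ofReal (by positivity), smul_eq_mul]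

lemma sc_int' (hR : 0 < R) (z : En n → ℝ) : ∫ y, z (Tm x₀ R y) ∂(vB n) = (R ^ n)⁻¹ * ∫ x in ball x₀ R, z x := by
  have := sc_int (x₀ := x₀) hR z Set.univ MeasurableSet.univ
  rwa [Set.preimage_univ, Measure.restrict_univ, Set.univ_inter] at this

lemma sc_intble (hR : 0 < R) {z : En n → ℝ} : Integrable (fun y => z (Tm x₀ R y)) (vB n) ↔ IntegrableOn z (ball x₀ R) := by
  have := (Tm_emb (x₀ := x₀) hR).integrable_map_iff (μ := vB n) (g := z)
  rw [Tm_map hR, integrable_smul_measure (sc_ne hR) ENNReal.ofReal_ne_top] at this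
  exact this.symm

lemma sc_ae (hR : 0 < R) {P : En n → Prop} (h : ∀ᵐ x ∂volume.restrict (ball x₀ R), P x) : ∀ᵐ y ∂(vB n), P (Tm x₀ R y) := by
  rw [← (Tm_emb (x₀ := x₀) hR).ae_map_iff, Tm_map hR]
  exact Measure.ae_smul_measure h _

lemma sc_asm (hR : 0 < R) {z : En n → ℝ} (h : AEStronglyMeasurable z (volume.restrict (ball x₀ R))) : AEStronglyMeasurable (fun y => z (Tm x₀ R y)) (vB n) := by
  have : AEStronglyMeasurable z ((vB n).map (Tm x₀ R)) := by rw [Tm_map hR]; exact h.smul_measure _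
  exact this.comp_measurable (Tm_emb hR).measurable

lemma Ti_sm {η : En n → ℝ} (h : SM η) : SM (fun x => η (Ti x₀ R x)) := by
  have : ContDiff ℝ (⊤ : ℕ∞) (Ti x₀ R) := by unfold Ti; fun_prop
  exact ContDiff.comp h this

lemma Ti_fd {η : En n → ℝ} (h : SM η) (i : Fin n) (x : En n) : fderiv ℝ (fun x => η (Ti x₀ R x)) x (basisVec i) = R⁻¹ * pd i η (Ti x₀ R x) := by
  have h1 : HasFDerivAt (Ti x₀ R) (R⁻¹ • ContinuousLinearMap.id ℝ (En n)) x := ((hasFDerivAt_id x).sub_const x₀).const_smul R⁻¹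
  have h2 := (h.diff (Ti x₀ R x)).hasFDerivAt.comp x h1
  have : fderiv ℝ (fun x => η (Ti x₀ R x)) x = _ := h2.fderiv
  rw [this]
  simp [pd]

lemma Ti_test (hR : 0 < R) {φ : En n → ℝ} (h : IsTestFun (ball 0 1) φ) : IsTestFun (ball x₀ R) (fun x => φ (Ti x₀ R x)) := by
  refine ⟨Ti_sm h.1, h.2.1.comp_homeomorph (Te x₀ R hR).symm, ?_⟩
  have := tsupport_comp_eq_preimage φ (Te x₀ R hR).symm
  intro x hx
  have hx' : x ∈ tsupport (φ ∘ (Te x₀ R hR).symm) := hx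
  rw [this] at hx'
  have h3 : Ti x₀ R x ∈ ball 0 1 := h.2.2 hx'
  rw [← Tm_ball0 (x₀ := x₀) hR, Set.mem_preimage, Tm_Ti hR] at h3
  exact h3

lemma sc_mul (hR : 0 < R) (z η : En n → ℝ) : ∫ y, z (Tm x₀ R y) * η y ∂(vB n) = (R ^ n)⁻¹ * ∫ x in ball x₀ R, z x * η (Ti x₀ R x) := by
  rw [← sc_int' hR]; simp_rw [Ti_Tm hR]
end

lemma fnorm_ge (v : Form n N k) (q) : |v q| ≤ fnorm v := by
  unfold fnorm
  refine Real.abs_le_sqrt ?_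
  exact Finset.single_le_sum (f := fun q => v q ^ 2) (fun q _ => sq_nonneg _) (Finset.mem_univ q)

lemma gnorm_ge (H : Fin n → Form n N k) (i q) : |H i q| ≤ gnorm H := by
  unfold gnorm
  refine Real.abs_le_sqrt ?_
  refine (Finset.single_le_sum (f := fun q => H i q ^ 2) (fun q _ => sq_nonneg _) (Finset.mem_univ q)).trans ?_
  exact Finset.single_le_sum (f := fun i => ∑ q, H i q ^ 2) (fun i _ => Finset.sum_nonneg fun q _ => sq_nonneg _) (Finset.mem_univ i)

lemma comp_int {x₀ : En n} {R s : ℝ} (hs : 1 < s) {z t : En n → ℝ} (hz : AEStronglyMeasurable z (volume.restrict (ball x₀ R))) (h : ∀ x, |z x| ≤ t x) 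
    (ht : IntegrableOn (fun x => t x ^ s) (ball x₀ R)) : IntegrableOn z (ball x₀ R) := by
  have hc : IntegrableOn (fun _ => (1:ℝ)) (ball x₀ R) := integrableOn_const (measure_ball_lt_top.ne)
  refine Integrable.mono' (hc.add ht) hz (.of_forall fun x => ?_)
  have h0 : 0 ≤ t x := (abs_nonneg _).trans (h x)
  refine (h x).trans ?_
  change t x ≤ 1 + t x ^ s
  rcases le_total (t x) 1 with h1 | h1
  · have := Real.rpow_nonneg h0 s; linarith
  · have := Real.rpow_le_rpow_of_exponent_le h1 hs.le
    rw [Real.rpow_one] at this; linarith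

lemma cp_int {x₀ : En n} {R : ℝ} (hR : 0 < R) {v : En n → Form n N k} (h : ∀ q, IntegrableOn (fun x => v x q) (ball x₀ R)) (c : Fin N) (S : Finset (Fin n)) : 
    Integrable (fun y => cp (v (Tm x₀ R y)) c S) (vB n) := by
  by_cases hS : S.card = k
  · simp only [cp, hS, dif_pos]
    exact (sc_intble hR).2 (h (⟨S, hS⟩, c))
  · simp only [cp, hS, dif_neg, not_false_eq_true]; exact integrable_zero _ _ _

lemma sys_of {m : ℕ} {s R : ℝ} {x₀ : En n} (hs : 1 < s) (hR : 0 < R) {u : En n → Form n N (m + 1)} {G : En n → Fin n → Form n N (m + 1)}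
    {f : En n → Form n N (m + 2)} {g : En n → Form n N m} (hW : MemW1p (ball x₀ R) s u G) (hT : TangentialZero (ball x₀ R) u G) 
    (hf : ∀ᵐ x ∂volume.restrict (ball x₀ R), extD (G x) = f x) (hg : ∀ᵐ x ∂volume.restrict (ball x₀ R), codiff (G x) = g x) (c : Fin N) : 
    Sys (fun S y => cp (u (Tm x₀ R y)) c S) (fun i S y => R * cp (G (Tm x₀ R y) i) c S) (fun S y => R * cp (f (Tm x₀ R y)) c S) (fun S y => R * cp (g (Tm x₀ R y)) c S) := by
  obtain ⟨w1, w2, w3, w4, w5⟩ := hW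
  have iu : ∀ q, IntegrableOn (fun x => u x q) (ball x₀ R) := fun q => comp_int hs (w2 q) (fun x => fnorm_ge _ q) w4
  have iG : ∀ i q, IntegrableOn (fun x => G x i q) (ball x₀ R) := fun i q => comp_int hs (w3 i q) (fun x => gnorm_ge _ i q) w5
  have iU := fun S => cp_int hR iu c S
  have hsm : ∀ (a : ℝ) (i : Fin n) (v : Finset (Fin n) → ℝ) S, we i (fun T => a * v T) S = a * we i v S := fun a i v S => by
    have : (fun T => a * v T) = a • v := rfl
    rw [this, map_smul]; rfl
  have hsm' : ∀ (a : ℝ) (i : Fin n) (v : Finset (Fin n) → ℝ) S, co i (fun T => a * v T) S = a * co i v S := fun a i v S => by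
    have : (fun T => a * v T) = a • v := rfl
    rw [this, map_smul]; rfl
  refine ⟨iU, fun i S => (cp_int hR (iG i) c S).const_mul R, fun i S φ hφ => ?_, fun η hη => ?_, fun S => ?_, fun S => ?_⟩
  · by_cases hS : S.card = m + 1
    · simp only [cp, hS, dif_pos]
      have e1 := sc_mul (x₀ := x₀) hR (fun x => u x (⟨S, hS⟩, c)) (pd i φ)
      have e2 := sc_mul (x₀ := x₀) hR (fun x => R * G x i (⟨S, hS⟩, c)) φ
      refine e1.trans ((congrArg _ ?_).trans ((mul_neg _ _).trans (congrArg Neg.neg e2.symm)))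
      have := w1 i (⟨S, hS⟩, c) _ (Ti_test hR hφ)
      simp only [Ti_fd hφ.1] at this
      simp_rw [mul_left_comm _ R⁻¹] at this
      simp_rw [mul_assoc R]
      rw [integral_const_mul] at this ⊢
      rw [inv_mul_eq_iff_eq_mul₀ hR.ne'] at this
      rw [this]; ring
    · simp [cp, hS]
  · ext T
    by_cases hS : T.card = m + 2
    · have t := hT (fun x q => if q = (⟨T, hS⟩, c) then η (Ti x₀ R x) else 0) (fun q => by
        by_cases hq : q = (⟨T, hS⟩, c)
        · simp only [hq, if_true]; exact Ti_sm hη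
        · simp only [hq, if_false]; exact contDiff_const)
      have s1 : ∀ x, smoothGrad (fun x q => if q = ((⟨T, hS⟩, c) : FormIdx n (m + 2) × Fin N) then η (Ti x₀ R x) else 0) x = fun i q => if q = (⟨T, hS⟩, c) then R⁻¹ * pd i η (Ti x₀ R x) else 0 := fun x => by
        ext i q
        unfold smoothGrad
        by_cases hq : q = (⟨T, hS⟩, c)
        · simp only [hq, if_true]; exact Ti_fd hη i x
        · simp [hq]
      simp_rw [s1, finner_codiff] at t
      have s2 : ∫ x in ball x₀ R, finner (extD (G x)) (fun q => if q = (⟨T, hS⟩, c) then η (Ti x₀ R x) else 0) = ∫ x in ball x₀ R, f x (⟨T, hS⟩, c) * η (Ti x₀ R x) := by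
        refine integral_congr_ae ?_
        filter_upwards [hf] with x hx
        rw [hx]; simp [finner]
      rw [s2, integral_neg] at t
      have e1 := sc_mul (x₀ := x₀) hR (fun x => R * f x (⟨T, hS⟩, c)) η
      have e2 := sc_int' (x₀ := x₀) hR (fun x => ∑ i, we i (cp (u x) c) T * (R⁻¹ * pd i η (Ti x₀ R x)))
      simp_rw [Ti_Tm hR, mul_left_comm _ R⁻¹] at e2
      rw [integral_finsetSum _ fun i _ => (int_mul_cont (we_int iU T) (hη.pd i).continuous).const_mul R⁻¹] at e2
      simp_rw [integral_const_mul, mul_left_comm _ R⁻¹] at t e2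
      simp only [Pi.neg_apply, Finset.sum_apply]
      have e3 : ∀ i, we i (pr (fun S y => cp (u (Tm x₀ R y)) c S) (pd i η)) T = ∫ y, we i (cp (u (Tm x₀ R y)) c) T * pd i η y ∂(vB n) := fun i => by
        rw [← pr_we]; rfl
      simp_rw [e3]
      simp only [pr, cp, hS, dif_pos]
      refine e1.trans ?_
      simp_rw [mul_assoc R]
      rw [integral_const_mul, t]
      rw [← Finset.mul_sum] at e2
      have hRn : R ^ n ≠ 0 := by positivity
      have e4 := (inv_mul_eq_iff_eq_mul₀ hR.ne').1 e2
      refine Eq.trans ?_ (congrArg Neg.neg e4.symm)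
      ring
    · have e : ∀ i (v : Finset (Fin n) → ℝ), (∀ S, S.card ≠ m + 1 → v S = 0) → we i v T = 0 := fun i v hv => by
        rw [we_apply]
        split_ifs with hi
        · have := Finset.card_erase_add_one hi
          rw [hv _ (by omega), mul_zero]
        · rfl
      simp only [Pi.neg_apply, Finset.sum_apply]
      rw [Finset.sum_eq_zero fun i _ => e i _ fun S hS => by simp [pr, cp, hS]]
      simp [pr, cp, hS]
  · filter_upwards [sc_ae hR hf] with y hy
    rw [← hy, extD_cp, Finset.mul_sum]
    exact Finset.sum_congr rfl fun i _ => (hsm R i _ S).symm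
  · filter_upwards [sc_ae hR hg] with y hy
    rw [← hy, codiff_cp, mul_neg, Finset.mul_sum]
    exact congrArg _ (Finset.sum_congr rfl fun i _ => (hsm' R i _ S).symm)

lemma pisq {ι V : Type*} [Fintype ι] [NormedAddCommGroup V] (v : ι → V) : ‖v‖ ^ 2 ≤ ∑ i, ‖v i‖ ^ 2 := by
  have h0 : 0 ≤ ∑ i, ‖v i‖ ^ 2 := Finset.sum_nonneg fun i _ => sq_nonneg _
  have : ‖v‖ ≤ √(∑ i, ‖v i‖ ^ 2) := (pi_norm_le_iff_of_nonneg (Real.sqrt_nonneg _)).2 fun i => 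
    Real.le_sqrt_of_sq_le (Finset.single_le_sum (f := fun i => ‖v i‖ ^ 2) (fun i _ => sq_nonneg _) (Finset.mem_univ i))
  calc ‖v‖ ^ 2 ≤ (√(∑ i, ‖v i‖ ^ 2)) ^ 2 := by gcongr
    _ = _ := Real.sq_sqrt h0

lemma camp_osc {V : Type*} [NormedAddCommGroup V] [NormedSpace ℝ V] {lam : ℝ} {s : Set (En n)} {f : En n → V} (h : campanatoSemi 2 lam s f ≠ ⊤) {x1 : En n} (hx : x1 ∈ closure s) 
    {ρ : ℝ} (hρ : 0 < ρ) : ∫ y in ball x1 ρ ∩ s, ‖f y - ⨍ z in ball x1 ρ ∩ s, f z‖ ^ 2 ≤ (campanatoSemi 2 lam s f).toReal * ρ ^ lam := by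
  have h1 : ENNReal.ofReal (ρ ^ (-lam) * ∫ y in ball x1 ρ ∩ s, ‖f y - ⨍ z in ball x1 ρ ∩ s, f z‖ ^ (2:ℝ)) ≤ campanatoSemi 2 lam s f := by
    unfold campanatoSemi
    exact le_iSup₂_of_le x1 hx (le_iSup₂_of_le ρ hρ le_rfl)
  rw [ENNReal.ofReal_le_iff_le_toReal h, Real.rpow_neg hρ.le, inv_mul_le_iff₀ (by positivity), mul_comm] at h1
  simpa only [Real.rpow_two] using h1

lemma Tm_closure {x₀ : En n} {R : ℝ} (hR : 0 < R) (x1 : En n) : Tm x₀ R x1 ∈ closure (ball x₀ R) ↔ ‖x1‖ ≤ 1 := by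
  rw [closure_ball _ hR.ne', mem_closedBall, dist_eq_norm, Tm, add_sub_cancel_left, norm_smul, Real.norm_of_nonneg hR.le]
  exact mul_le_iff_le_one_right hR

lemma camp_in {lam R A L : ℝ} {x₀ : En n} (hR : 0 < R) {f : En n → Form n N k} (hf : MemCampanatoOn 2 lam (ball x₀ R) f) (hL : ∫ x in ball x₀ R, ‖f x‖ ^ 2 ≤ L)
    (hA : (campanatoSemi 2 lam (ball x₀ R) f).toReal ≤ A) (c : Fin N) (S : Finset (Fin n)) : 
    MemLp (fun y => R * cp (f (Tm x₀ R y)) c S) 2 (vB n) ∧ ∫ y, (R * cp (f (Tm x₀ R y)) c S) ^ 2 ∂(vB n) ≤ (√(R ^ 2 * (R ^ n)⁻¹ * L)) ^ 2 ∧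
      Os lam (fun y => R * cp (f (Tm x₀ R y)) c S) (√(R ^ 2 * (R ^ n)⁻¹ * R ^ lam * A)) := by
  obtain ⟨h1, h2, h3⟩ := hf
  have hL0 : 0 ≤ L := (integral_nonneg fun x => sq_nonneg _).trans hL
  have hA0 : 0 ≤ A := ENNReal.toReal_nonneg.trans hA
  simp only [Real.rpow_two] at h2
  rw [Real.sq_sqrt (by positivity)]
  by_cases hS : S.card = k
  · simp only [cp, hS, dif_pos]
    set q : FormIdx n k × Fin N := (⟨S, hS⟩, c)
    have m1 : AEStronglyMeasurable (fun x => f x q) (volume.restrict (ball x₀ R)) := (continuous_apply q).comp_aestronglyMeasurable h1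
    have hle : ∀ v : Form n N k, v q ^ 2 ≤ ‖v‖ ^ 2 := fun v => by
      rw [← sq_abs]; gcongr; exact norm_le_pi_norm v q
    have i1 : IntegrableOn (fun x => f x q ^ 2) (ball x₀ R) := Integrable.mono' h2 (m1.pow 2) (.of_forall fun x => by
      rw [Real.norm_of_nonneg (sq_nonneg _)]; exact hle _)
    have l2 : MemLp (fun y => f (Tm x₀ R y) q) 2 (vB n) := (memLp_two_iff_integrable_sq (sc_asm hR m1)).2 ((sc_intble hR).2 i1)
    have l2f : MemLp f 2 (volume.restrict (ball x₀ R)) := (memLp_two_iff_integrable_sq_norm h1).2 h2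
    refine ⟨l2.const_mul R, ?_, fun x1 hx1 ρ hρ => ?_⟩
    · have e := sc_int' (x₀ := x₀) hR (fun x => (R * f x q) ^ 2)
      simp_rw [mul_pow] at e ⊢
      rw [e, integral_const_mul]
      have := (setIntegral_mono i1 h2 fun x => hle (f x)).trans hL
      calc _ = R ^ 2 * (R ^ n)⁻¹ * ∫ x in ball x₀ R, f x q ^ 2 := by ring
        _ ≤ _ := by apply mul_le_mul_of_nonneg_left this; positivity
    · have hcl := (Tm_closure (x₀ := x₀) hR x1).2 hx1
      have o := camp_osc h3 hcl (mul_pos hR hρ)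
      set a := ⨍ z in ball (Tm x₀ R x1) (R * ρ) ∩ ball x₀ R, f z with ha
      refine ⟨R * a q, ?_⟩
      have e := sc_int (x₀ := x₀) hR (fun x => (R * f x q - R * a q) ^ 2) (ball (Tm x₀ R x1) (R * ρ)) measurableSet_ball
      rw [Tm_ball hR] at e
      rw [e]
      simp_rw [← mul_sub, mul_pow]
      rw [integral_const_mul, Real.sq_sqrt (by positivity)]
      haveI : IsFiniteMeasure (volume.restrict (ball (Tm x₀ R x1) (R * ρ) ∩ ball x₀ R)) := 
        ⟨by rw [Measure.restrict_apply_univ]; exact (measure_mono Set.inter_subset_left).trans_lt measure_ball_lt_top⟩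
      have l3 : MemLp (fun x => f x - a) 2 (volume.restrict (ball (Tm x₀ R x1) (R * ρ) ∩ ball x₀ R)) := 
        (l2f.mono_measure (Measure.restrict_mono Set.inter_subset_right le_rfl)).sub (memLp_const a)
      have i3 : Integrable (fun x => ‖f x - a‖ ^ 2) (volume.restrict (ball (Tm x₀ R x1) (R * ρ) ∩ ball x₀ R)) :=
        (memLp_two_iff_integrable_sq_norm l3.1).1 l3
      have i4 : Integrable (fun x => (f x q - a q) ^ 2) (volume.restrict (ball (Tm x₀ R x1) (R * ρ) ∩ ball x₀ R)) := 
        Integrable.mono' i3 (((continuous_apply q).comp_aestronglyMeasurable l3.1).pow 2) (.of_forall fun x => by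
          rw [Real.norm_of_nonneg (sq_nonneg _)]; exact hle (f x - a))
      have := (integral_mono i4 i3 fun x => hle (f x - a)).trans o
      rw [Real.mul_rpow hR.le hρ.le] at this
      calc _ = R ^ 2 * (R ^ n)⁻¹ * ∫ x in ball (Tm x₀ R x1) (R * ρ) ∩ ball x₀ R, (f x q - a q) ^ 2 := by ring
        _ ≤ R ^ 2 * (R ^ n)⁻¹ * (A * (R ^ lam * ρ ^ lam)) := by
            apply mul_le_mul_of_nonneg_left _ (by positivity)
            exact this.trans (mul_le_mul_of_nonneg_right hA (by positivity))
        _ = _ := by ring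
  · have e : ∀ y, cp (f (Tm x₀ R y)) c S = 0 := fun y => by simp [cp, hS]
    simp only [e, mul_zero]
    refine ⟨MemLp.zero', by simp; positivity, fun x1 _ ρ hρ => ⟨0, ?_⟩⟩
    simp only [sub_zero, ne_eq, OfNat.ofNat_ne_zero, not_false_eq_true, zero_pow, integral_zero]
    positivity

lemma comp_bd {m : ℕ} {s R L A lam C1 C2 : ℝ} {x₀ : En n} (hs : 1 < s) (hR : 0 < R) {u : En n → Form n N (m + 1)} {G : En n → Fin n → Form n N (m + 1)}
    (hC1 : 0 ≤ C1) (hC2 : 0 ≤ C2) (hL : 0 ≤ L) (hA : 0 ≤ A) (hW : MemW1p (ball x₀ R) s u G) 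
    (h1 : ∀ c i S, S.Nonempty → MemLp (fun y => R * cp (G (Tm x₀ R y) i) c S) 2 (vB n) ∧ ∫ y, (R * cp (G (Tm x₀ R y) i) c S) ^ 2 ∂(vB n) ≤ (C1 * √(R ^ 2 * (R ^ n)⁻¹ * L)) ^ 2)
    (h2 : ∀ c i S, S.Nonempty → Os lam (fun y => R * cp (G (Tm x₀ R y) i) c S) (C2 * √(R ^ 2 * (R ^ n)⁻¹ * R ^ lam * A))) (i : Fin n) (q : FormIdx n (m + 1) × Fin N) : 
    MemLp (fun x => G x i q) 2 (volume.restrict (ball x₀ R)) ∧ ∫ x in ball x₀ R, G x i q ^ 2 ≤ C1 ^ 2 * L ∧ 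
      ∀ x1 ∈ closure (ball x₀ R), ∀ ρ > 0, ∃ a, ∫ x in ball x1 ρ ∩ ball x₀ R, (G x i q - a) ^ 2 ≤ C2 ^ 2 * A * ρ ^ lam := by
  have hne : q.1.1.Nonempty := by rw [← Finset.card_pos, q.1.2]; omega
  obtain ⟨a1, a2⟩ := h1 q.2 i q.1.1 hne
  have a3 := h2 q.2 i q.1.1 hne
  simp only [cp_of] at a1 a2 a3
  have hK : 0 < R ^ 2 * (R ^ n)⁻¹ := by positivity
  refine ⟨?_, ?_, fun x1 hx1 ρ hρ => ?_⟩
  · refine (memLp_two_iff_integrable_sq (hW.2.2.1 i q)).2 ((sc_intble hR).1 ?_)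
    have := (a1.const_mul R⁻¹).integrable_sq
    simpa only [inv_mul_cancel_left₀ hR.ne'] using this
  · have e := sc_int' (x₀ := x₀) hR (fun x => (R * G x i q) ^ 2)
    rw [e, mul_pow, Real.sq_sqrt (by positivity)] at a2
    simp_rw [mul_pow] at a2
    rw [integral_const_mul] at a2
    refine le_of_mul_le_mul_left ?_ hK
    calc _ = (R ^ n)⁻¹ * (R ^ 2 * ∫ x in ball x₀ R, G x i q ^ 2) := by ring
      _ ≤ _ := a2
      _ = _ := by ring
  · have hT := Tm_Ti (x₀ := x₀) hR x1
    obtain ⟨a, ha⟩ := a3 (Ti x₀ R x1) ((Tm_closure (x₀ := x₀) hR _).1 (by rw [hT]; exact hx1)) (R⁻¹ * ρ) (by positivity)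
    refine ⟨R⁻¹ * a, ?_⟩
    have e := sc_int (x₀ := x₀) hR (fun x => (R * G x i q - a) ^ 2) (ball (Tm x₀ R (Ti x₀ R x1)) (R * (R⁻¹ * ρ))) measurableSet_ball
    rw [Tm_ball hR, hT, mul_inv_cancel_left₀ hR.ne'] at e
    rw [e, mul_pow, Real.sq_sqrt (by positivity), Real.mul_rpow (by positivity) hρ.le, Real.inv_rpow hR.le] at ha
    have e2 : ∀ x, (R * G x i q - a) ^ 2 = R ^ 2 * (G x i q - R⁻¹ * a) ^ 2 := fun x => by field_simp
    simp_rw [e2] at ha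
    rw [integral_const_mul] at ha
    refine le_of_mul_le_mul_left ?_ hK
    have hRl : R ^ lam ≠ 0 := (Real.rpow_pos_of_pos hR lam).ne'
    calc _ = (R ^ n)⁻¹ * (R ^ 2 * ∫ x in ball x1 ρ ∩ ball x₀ R, (G x i q - R⁻¹ * a) ^ 2) := by ring
      _ ≤ _ := ha
      _ = _ := by field_simp

lemma pisq2 {V : Fin n → Form n N k} : ‖V‖ ^ 2 ≤ ∑ i, ∑ q, V i q ^ 2 := by
  refine (pisq V).trans (Finset.sum_le_sum fun i _ => (pisq (V i)).trans (le_of_eq ?_))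
  simp only [Real.norm_eq_abs, sq_abs]

lemma G_bd {B : Set (En n)} (hB : volume B < ⊤) {lam K1 K2 : ℝ} {G : En n → Fin n → Form n N k}
    (h : ∀ i q, MemLp (fun x => G x i q) 2 (volume.restrict B) ∧ ∫ x in B, G x i q ^ 2 ≤ K1 ∧ 
      ∀ x1 ∈ closure B, ∀ ρ > 0, ∃ a, ∫ x in ball x1 ρ ∩ B, (G x i q - a) ^ 2 ≤ K2 * ρ ^ lam) : 
    AEStronglyMeasurable G (volume.restrict B) ∧ IntegrableOn (fun y => ‖G y‖ ^ 2) B ∧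
    ∫ y in B, ‖G y‖ ^ 2 ≤ (Fintype.card (Fin n × (FormIdx n k × Fin N))) * K1 ∧
    campanatoSemi 2 lam B G ≤ ENNReal.ofReal ((Fintype.card (Fin n × (FormIdx n k × Fin N))) * K2) := by
  haveI : IsFiniteMeasure (volume.restrict B) := ⟨by rwa [Measure.restrict_apply_univ]⟩
  have hGi : Integrable G (volume.restrict B) := Integrable.of_eval fun i => Integrable.of_eval fun q => (h i q).1.integrable one_le_two
  have hsum : ∀ K : ℝ, (∑ _i : Fin n, ∑ _q : FormIdx n k × Fin N, K) = (Fintype.card (Fin n × (FormIdx n k × Fin N))) * K := fun K => by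
    simp only [Finset.sum_const, Finset.card_univ, nsmul_eq_mul, Fintype.card_prod (Fin n)]; push_cast; ring
  have key : ∀ (μ : Measure (En n)) [IsFiniteMeasure μ] (H : En n → Fin n → Form n N k), AEStronglyMeasurable H μ → 
      (∀ i q, MemLp (fun x => H x i q) 2 μ) → Integrable (fun x => ‖H x‖ ^ 2) μ ∧ ∫ x, ‖H x‖ ^ 2 ∂μ ≤ ∑ i, ∑ q, ∫ x, H x i q ^ 2 ∂μ := by
    intro μ _ H hH hm
    have i1 : Integrable (fun x => ∑ i, ∑ q, H x i q ^ 2) μ := integrable_finsetSum _ fun i _ => integrable_finsetSum _ fun q _ => (hm i q).integrable_sq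
    have i2 : Integrable (fun x => ‖H x‖ ^ 2) μ := i1.mono' (hH.norm.pow 2) (.of_forall fun x => by
      rw [Real.norm_of_nonneg (sq_nonneg _)]; exact pisq2)
    refine ⟨i2, (integral_mono i2 i1 fun x => pisq2).trans (le_of_eq ?_)⟩
    rw [integral_finsetSum _ fun i _ => integrable_finsetSum _ fun q _ => (hm i q).integrable_sq]
    refine Finset.sum_congr rfl fun i _ => ?_
    rw [integral_finsetSum _ fun q _ => (hm i q).integrable_sq]
  obtain ⟨k1, k2⟩ := key _ G hGi.1 fun i q => (h i q).1
  refine ⟨hGi.1, k1, k2.trans ?_, ?_⟩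
  · rw [← hsum]
    exact Finset.sum_le_sum fun i _ => Finset.sum_le_sum fun q _ => (h i q).2.1
  · unfold campanatoSemi
    refine iSup₂_le fun x1 hx1 => iSup₂_le fun ρ hρ => ENNReal.ofReal_le_ofReal ?_
    rw [Real.rpow_neg hρ.le, inv_mul_le_iff₀ (by positivity)]
    simp only [Real.rpow_two]
    have hmono : volume.restrict (ball x1 ρ ∩ B) ≤ volume.restrict B := Measure.restrict_mono Set.inter_subset_right le_rfl
    have hfin : IsFiniteMeasure (volume.restrict (ball x1 ρ ∩ B)) := isFiniteMeasure_of_le _ hmono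
    have hGi' : Integrable G (volume.restrict (ball x1 ρ ∩ B)) := hGi.mono_measure hmono
    have hm' : ∀ i q, MemLp (fun x => G x i q) 2 (volume.restrict (ball x1 ρ ∩ B)) := fun i q => (h i q).1.mono_measure hmono
    have hav : ∀ i q, (⨍ z in ball x1 ρ ∩ B, G z) i q = ⨍ z in ball x1 ρ ∩ B, G z i q := fun i q => by
      rw [average_eq, average_eq]
      simp only [Pi.smul_apply]
      rw [eval_integral fun i => Integrable.of_eval fun q => (hm' i q).integrable one_le_two, eval_integral fun q => (hm' i q).integrable one_le_two]
    set a := ⨍ z in ball x1 ρ ∩ B, G z with ha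
    have := (key _ (fun x => G x - a) (hGi'.1.sub aestronglyMeasurable_const) fun i q => (hm' i q).sub (memLp_const (a i q))).2
    refine this.trans ?_
    rw [mul_comm (ρ ^ lam), mul_assoc, ← hsum]
    refine Finset.sum_le_sum fun i _ => Finset.sum_le_sum fun q _ => ?_
    obtain ⟨b, hb⟩ := (h i q).2.2 x1 hx1 ρ hρ
    simp only [Pi.sub_apply, hav]
    exact (mean_min (hm' i q) b).trans hb

lemma half_le {a b c : ℝ≥0∞} {K C : ℝ} (hC : 0 ≤ C) (hK : K ≤ C ^ 2) (h : a ≤ ENNReal.ofReal K * (b + c)) : 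
    a ^ (1 / 2 : ℝ) ≤ ENNReal.ofReal C * (b ^ (1 / 2 : ℝ) + c ^ (1 / 2 : ℝ)) := by
  calc a ^ (1 / 2 : ℝ) ≤ (ENNReal.ofReal (C ^ 2) * (b + c)) ^ (1 / 2 : ℝ) := by
        apply ENNReal.rpow_le_rpow _ (by norm_num)
        exact h.trans (by gcongr)
    _ = ENNReal.ofReal C * (b + c) ^ (1 / 2 : ℝ) := by
        rw [ENNReal.mul_rpow_of_nonneg _ _ (by norm_num), ENNReal.ofReal_rpow_of_nonneg (by positivity) (by norm_num), ← Real.sqrt_eq_rpow, Real.sqrt_sq hC]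
    _ ≤ _ := by
        gcongr
        exact ENNReal.rpow_add_le_add_rpow _ _ (by norm_num) (by norm_num)

lemma lint_eq {V : Type*} [NormedAddCommGroup V] {B : Set (En n)} {f : En n → V} (h : IntegrableOn (fun y => ‖f y‖ ^ 2) B) : 
    ∫⁻ y in B, ENNReal.ofReal (‖f y‖ ^ (2:ℝ)) = ENNReal.ofReal (∫ y in B, ‖f y‖ ^ 2) := by
  simp only [Real.rpow_two]
  rw [ofReal_integral_eq_lintegral_ofReal h (.of_forall fun x => sq_nonneg _)]

/-- **Boundary Campanato estimates for the linear `d`–`δ` system.** Let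
`u ∈ W^{1,s}(B_R)` solve `du = f`, `δu = g` in `B_R` with vanishing tangential part
`ν ∧ u = 0` on `∂B_R` (here `u` has degree `m+1`, `f` degree `m+2` and `g` degree `m`).
If `f, g ∈ 𝓛^{2,λ}(B_R)` with `0 < λ < n+2`, then `∇u ∈ 𝓛^{2,λ}(B_R)` and
`‖∇u‖_{𝓛^{2,λ}(B_R)} ≤ c (‖f‖_{𝓛^{2,λ}(B_R)} + ‖g‖_{𝓛^{2,λ}(B_R)})` with
`c = c(n,N,k,λ)`. -/
theorem boundary_campanato_estimates_linear_system
    (n N m : ℕ) (s lam : ℝ) (hs : 1 < s) (hlam0 : 0 < lam) (hlam : lam < (n : ℝ) + 2) :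
    ∃ C : ℝ, 0 < C ∧
      ∀ (R : ℝ) (x₀ : En n), 0 < R →
        ∀ (u : En n → Form n N (m + 1)) (G : En n → Fin n → Form n N (m + 1))
          (f : En n → Form n N (m + 2)) (g : En n → Form n N m),
          MemW1p (ball x₀ R) s u G →
          TangentialZero (ball x₀ R) u G →
          (∀ᵐ x ∂volume.restrict (ball x₀ R), extD (G x) = f x) →
          (∀ᵐ x ∂volume.restrict (ball x₀ R), codiff (G x) = g x) →
          MemCampanatoOn 2 lam (ball x₀ R) f →
          MemCampanatoOn 2 lam (ball x₀ R) g →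
          MemCampanatoOn 2 lam (ball x₀ R) G ∧
            campanatoNorm 2 lam (ball x₀ R) G ≤
              ENNReal.ofReal C *
                (campanatoNorm 2 lam (ball x₀ R) f + campanatoNorm 2 lam (ball x₀ R) g) := by
  obtain ⟨C1, hC1, H1⟩ := unit_l2 n
  obtain ⟨C2, hC2, H2⟩ := unit_os n hlam0.le hlam
  set D : ℝ := (Fintype.card (Fin n × (FormIdx n (m + 1) × Fin N)) : ℝ) with hD
  have hD0 : 0 ≤ D := Nat.cast_nonneg _
  have hDs : √D ^ 2 = D := Real.sq_sqrt hD0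
  have hDn := Real.sqrt_nonneg D
  set C : ℝ := √D * (C1 + C2) + 1 with hC
  have hC0 : 0 < C := by positivity
  have e1 : D * C1 ^ 2 ≤ C ^ 2 := by
    rw [← hDs, ← mul_pow]; gcongr
    nlinarith [mul_nonneg hDn hC2]
  have e2 : D * C2 ^ 2 ≤ C ^ 2 := by
    rw [← hDs, ← mul_pow]; gcongr
    nlinarith [mul_nonneg hDn hC1]
  refine ⟨C, hC0, fun R x₀ hR u G f g hW hT hf hg cf cg => ?_⟩
  have nf : 0 ≤ ∫ x in ball x₀ R, ‖f x‖ ^ 2 := integral_nonneg fun x => sq_nonneg _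
  have ng : 0 ≤ ∫ x in ball x₀ R, ‖g x‖ ^ 2 := integral_nonneg fun x => sq_nonneg _
  obtain ⟨L, hL⟩ : ∃ L : ℝ, L = (∫ x in ball x₀ R, ‖f x‖ ^ 2) + ∫ x in ball x₀ R, ‖g x‖ ^ 2 := ⟨_, rfl⟩
  obtain ⟨A, hA⟩ : ∃ A : ℝ, A = (campanatoSemi 2 lam (ball x₀ R) f).toReal + (campanatoSemi 2 lam (ball x₀ R) g).toReal := ⟨_, rfl⟩
  have af : 0 ≤ (campanatoSemi 2 lam (ball x₀ R) f).toReal := ENNReal.toReal_nonneg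
  have ag : 0 ≤ (campanatoSemi 2 lam (ball x₀ R) g).toReal := ENNReal.toReal_nonneg
  have hL0 : 0 ≤ L := by linarith
  have hA0 : 0 ≤ A := by linarith
  have Pf := camp_in hR cf (L := L) (A := A) (by linarith) (by linarith)
  have Pg := camp_in hR cg (L := L) (A := A) (by linarith) (by linarith)
  have S0 := sys_of hs hR hW hT hf hg
  have Q := comp_bd (lam := lam) hs hR hC1 hC2 hL0 hA0 hW
    (fun c => H1 _ _ _ _ _ (Real.sqrt_nonneg _) (S0 c) (fun S => (Pf c S).1) (fun S => (Pg c S).1) (fun S => (Pf c S).2.1) (fun S => (Pg c S).2.1))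
    (fun c => H2 _ _ _ _ _ (Real.sqrt_nonneg _) (S0 c) (fun S => (Pf c S).1) (fun S => (Pg c S).1) (fun S => (Pf c S).2.2) (fun S => (Pg c S).2.2))
  obtain ⟨r1, r2, r3, r4⟩ := G_bd measure_ball_lt_top Q
  rw [← hD] at r3 r4
  refine ⟨⟨r1, by simpa only [Real.rpow_two] using r2, ne_top_of_le_ne_top ENNReal.ofReal_ne_top r4⟩, ?_⟩
  have If : IntegrableOn (fun y => ‖f y‖ ^ 2) (ball x₀ R) := by simpa only [Real.rpow_two] using cf.2.1
  have Ig : IntegrableOn (fun y => ‖g y‖ ^ 2) (ball x₀ R) := by simpa only [Real.rpow_two] using cg.2.1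
  have t1 : ENNReal.ofReal (∫ y in ball x₀ R, ‖G y‖ ^ 2) ≤ ENNReal.ofReal (D * C1 ^ 2) * (ENNReal.ofReal (∫ y in ball x₀ R, ‖f y‖ ^ 2) + ENNReal.ofReal (∫ y in ball x₀ R, ‖g y‖ ^ 2)) := by
    rw [← ENNReal.ofReal_add nf ng, ← hL, ← ENNReal.ofReal_mul (by positivity), mul_assoc]
    exact ENNReal.ofReal_le_ofReal r3
  have t2 : campanatoSemi 2 lam (ball x₀ R) G ≤ ENNReal.ofReal (D * C2 ^ 2) * (campanatoSemi 2 lam (ball x₀ R) f + campanatoSemi 2 lam (ball x₀ R) g) := by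
    rw [← ENNReal.ofReal_toReal cf.2.2, ← ENNReal.ofReal_toReal cg.2.2, ← ENNReal.ofReal_add af ag, ← hA, ← ENNReal.ofReal_mul (by positivity), mul_assoc]
    exact r4
  unfold campanatoNorm
  rw [lint_eq r2, lint_eq If, lint_eq Ig]
  refine (add_le_add (half_le hC0.le e1 t1) (half_le hC0.le e2 t2)).trans (le_of_eq ?_)
  ring
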